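/- Let c be a real number with 1 < c < 4109054/1999527 and c ≠ 2, let ε > 0 be fixed and sufficiently small, let P be sufficiently large, τ = P^{1-c-ε}, and let X satisfy P^{9449/10000} ≪ X ≪ P. Then for every real β, ∫_{τ}^{1-τ} |S(α)|^4 · |T(α-β, X)| dα ≪ X^{(c+4)/7 + ε}·(P^{4-c} + P^2)·P^{ε} + P^{2627349/666509 + ε}·X^{1-c}, with implied constant depending only on c and ε. -/

import Mathlib

open scoped Classical
open Finset Real MeasureTheory

/-- `eC x = e(x) = e^{2πix}`. -/
noncomputable def eC (x : ℝ) : ℂ := Complex.exp ((2 * Real.pi * x : ℝ) * Complex.I)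

/-- `SS c P α = S(α) = Σ_{p ≤ P} (log p) e([p^c]α)`, the sum over primes `p ≤ P`. -/
noncomputable def SS (c P α : ℝ) : ℂ :=
  ∑ p ∈ (Finset.range (⌊P⌋₊ + 1)).filter Nat.Prime,
    (Real.log p : ℂ) * eC ((⌊(p : ℝ) ^ c⌋ : ℝ) * α)

/-- `TT c X α = T(α, X) = Σ_{X < n ≤ 2X} e([n^c]α)`, the sum over integers `n`. -/
noncomputable def TT (c X α : ℝ) : ℂ :=
  ∑ n ∈ Finset.Ioc ⌊X⌋₊ ⌊2 * X⌋₊, eC ((⌊(n : ℝ) ^ c⌋ : ℝ) * α)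

lemma eC_add (x y : ℝ) : eC (x + y) = eC x * eC y := by
  unfold eC; rw [← Complex.exp_add]; congr 1; push_cast; ring

lemma eC_zero : eC 0 = 1 := by simp [eC]

lemma eC_int (n : ℤ) : eC n = 1 := by
  unfold eC
  rw [Complex.exp_eq_one_iff]
  exact ⟨n, by push_cast; ring⟩

lemma norm_eC (x : ℝ) : ‖eC x‖ = 1 := by
  unfold eC; exact Complex.norm_exp_ofReal_mul_I _

lemma conj_eC (x : ℝ) : (starRingEnd ℂ) (eC x) = eC (-x) := by
  unfold eC
  rw [← Complex.exp_conj]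
  congr 1
  rw [map_mul, Complex.conj_ofReal, Complex.conj_I]; push_cast; ring

lemma eC_sub (x y : ℝ) : eC (x - y) = eC x * (starRingEnd ℂ) (eC y) := by
  rw [conj_eC, ← eC_add, sub_eq_add_neg]

lemma eC_add_int (x : ℝ) (n : ℤ) : eC (x + n) = eC x := by
  rw [eC_add, eC_int, mul_one]

lemma eC_re (x : ℝ) : (eC x).re = Real.cos (2 * π * x) := by
  unfold eC; rw [Complex.exp_ofReal_mul_I_re]

lemma eC_im (x : ℝ) : (eC x).im = Real.sin (2 * π * x) := by
  unfold eC; rw [Complex.exp_ofReal_mul_I_im]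

lemma continuous_eC : Continuous eC := by unfold eC; fun_prop

lemma norm_sum_eC_neg {ι : Type*} (s : Finset ι) (f : ι → ℝ) :
    ‖∑ n ∈ s, eC (-f n)‖ = ‖∑ n ∈ s, eC (f n)‖ := by
  rw [← Complex.norm_conj (∑ n ∈ s, eC (f n)), map_sum]
  simp_rw [conj_eC]

lemma norm_sum_eC_le {ι : Type*} (s : Finset ι) (f : ι → ℝ) :
    ‖∑ n ∈ s, eC (f n)‖ ≤ #s := by
  refine (norm_sum_le _ _).trans ?_
  simp [norm_eC]

/-- Summation by parts bound for `∑ (aₙ - aₙ₊₁) wₙ`. -/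
lemma norm_sum_sub_mul_le (a w : ℕ → ℂ) (ha : ∀ n, ‖a n‖ ≤ 1) (N : ℕ) :
    ‖∑ n ∈ range (N + 1), (a n - a (n + 1)) * w n‖
      ≤ ‖w 0‖ + ‖w N‖ + ∑ n ∈ range N, ‖w (n + 1) - w n‖ := by
  have key : ∀ N : ℕ, ∑ n ∈ range (N + 1), (a n - a (n + 1)) * w n
      = a 0 * w 0 - a (N + 1) * w N + ∑ n ∈ range N, a (n + 1) * (w (n + 1) - w n) := by
    intro N
    induction N with
    | zero => simp; ring
    | succ k ih => rw [sum_range_succ, ih, sum_range_succ]; ring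
  rw [key]
  have hb : ∀ n x, ‖a n * x‖ ≤ ‖x‖ := fun n x => by
    rw [norm_mul]; exact mul_le_of_le_one_left (norm_nonneg _) (ha n)
  refine (norm_add_le _ _).trans (add_le_add ((norm_sub_le _ _).trans
    (add_le_add (hb _ _) (hb _ _))) ((norm_sum_le _ _).trans (sum_le_sum fun n _ => hb _ _)))

lemma one_sub_eC (x : ℝ) :
    1 - eC x = ((2 * Real.sin (π * x) : ℝ) : ℂ) *
      ((Real.sin (π * x) : ℂ) - (Real.cos (π * x) : ℂ) * Complex.I) := by
  apply Complex.ext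
  · have : Real.cos (2 * π * x) = 1 - 2 * Real.sin (π * x) ^ 2 := by
      rw [show 2 * π * x = 2 * (π * x) by ring, Real.cos_two_mul, Real.cos_sq']; ring
    simp [eC_re, this, -Complex.ofReal_sin, -Complex.ofReal_cos]
    ring
  · have : Real.sin (2 * π * x) = 2 * Real.sin (π * x) * Real.cos (π * x) := by
      rw [show 2 * π * x = 2 * (π * x) by ring, Real.sin_two_mul]
    simp [eC_im, this, -Complex.ofReal_sin, -Complex.ofReal_cos]

lemma inv_one_sub_eC (x : ℝ) (hx : Real.sin (π * x) ≠ 0) :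
    (1 - eC x)⁻¹ = 1 / 2 + ((Real.cos (π * x) / Real.sin (π * x) / 2 : ℝ) : ℂ) * Complex.I := by
  have h1 : 1 - eC x ≠ 0 := by
    rw [one_sub_eC]
    intro h
    rcases mul_eq_zero.1 h with h | h
    · norm_cast at h; simp_all
    · have := congrArg Complex.re h
      simp [-Complex.ofReal_sin, -Complex.ofReal_cos] at this; exact hx this
  refine inv_eq_of_mul_eq_one_right ?_
  rw [one_sub_eC]
  have h2 : (Real.sin (π * x) : ℂ) ≠ 0 := by exact_mod_cast hx
  push_cast [-Complex.ofReal_sin, -Complex.ofReal_cos]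
  field_simp
  have h3 : (Real.sin (π * x) : ℂ) ^ 2 + (Real.cos (π * x) : ℂ) ^ 2 = 1 := by
    exact_mod_cast Real.sin_sq_add_cos_sq (π * x)
  linear_combination h3 - (Real.cos (π * x) : ℂ) ^ 2 * Complex.I_sq

lemma two_mul_le_sin_pi {x δ : ℝ} (hδ : 0 < δ) (h1 : δ ≤ x) (h2 : x ≤ 1 - δ) :
    2 * δ ≤ Real.sin (π * x) := by
  have hpi := Real.pi_pos
  rcases le_total x (1 / 2) with h | h
  · have := Real.mul_le_sin (x := π * x) (by nlinarith) (by nlinarith)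
    have e : 2 / π * (π * x) = 2 * x := by field_simp
    linarith
  · have := Real.mul_le_sin (x := π * (1 - x)) (by apply mul_nonneg hpi.le; linarith) (by nlinarith)
    have e : 2 / π * (π * (1 - x)) = 2 * (1 - x) := by field_simp
    have e2 : Real.sin (π * (1 - x)) = Real.sin (π * x) := by
      rw [show π * (1 - x) = π - π * x by ring, Real.sin_pi_sub]
    linarith

lemma norm_one_sub_eC (x : ℝ) : ‖1 - eC x‖ = 2 * |Real.sin (π * x)| := by
  rw [one_sub_eC, norm_mul, Complex.norm_real]
  have : ‖(Real.sin (π * x) : ℂ) - (Real.cos (π * x) : ℂ) * Complex.I‖ = 1 := by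
    rw [← sq_eq_sq₀ (norm_nonneg _) zero_le_one, ← Complex.normSq_eq_norm_sq,
      Complex.normSq_apply]
    simp [-Complex.ofReal_sin, -Complex.ofReal_cos]
    nlinarith [Real.sin_sq_add_cos_sq (π * x)]
  rw [this, Real.norm_eq_abs, abs_mul]; simp

lemma cot_anti {x y : ℝ} (hx : 0 < x) (hxy : x ≤ y) (hy : y < 1) :
    Real.cos (π * y) / Real.sin (π * y) ≤ Real.cos (π * x) / Real.sin (π * x) := by
  have hpi := Real.pi_pos
  have s1 : 0 < Real.sin (π * x) := Real.sin_pos_of_pos_of_lt_pi (by positivity) (by nlinarith)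
  have s2 : 0 < Real.sin (π * y) := Real.sin_pos_of_pos_of_lt_pi (by nlinarith) (by nlinarith)
  rw [div_le_div_iff₀ s2 s1]
  have : 0 ≤ Real.sin (π * y - π * x) :=
    Real.sin_nonneg_of_nonneg_of_le_pi (by nlinarith) (by nlinarith)
  rw [Real.sin_sub] at this; linarith

/-- Kusmin–Landau inequality. -/
lemma kusmin_landau (f : ℕ → ℝ) (L : ℕ) (ν : ℤ) (δ : ℝ) (hδ : 0 < δ)
    (h1 : ∀ n < L, δ ≤ f (n + 1) - f n - ν) (h2 : ∀ n < L, f (n + 1) - f n - ν ≤ 1 - δ)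
    (hm : ∀ n, n + 1 < L → f (n + 1) - f n ≤ f (n + 2) - f (n + 1)) :
    ‖∑ n ∈ range L, eC (f n)‖ ≤ 1 / δ := by
  rcases L with _ | N
  · simp; positivity
  set g : ℕ → ℝ := fun n => f (n + 1) - f n - ν with hg
  have hs : ∀ n < N + 1, 2 * δ ≤ Real.sin (π * g n) := fun n hn =>
    two_mul_le_sin_pi hδ (h1 n hn) (h2 n hn)
  have hs0 : ∀ n < N + 1, 0 < Real.sin (π * g n) := fun n hn => by linarith [hs n hn]
  set w : ℕ → ℂ := fun n => (1 - eC (g n))⁻¹ with hw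
  have e1 : ∑ n ∈ range (N + 1), eC (f n)
      = ∑ n ∈ range (N + 1), (eC (f n) - eC (f (n + 1))) * w n := by
    refine sum_congr rfl fun n hn => ?_
    have hn' := mem_range.1 hn
    have : eC (f (n + 1)) = eC (f n) * eC (g n) := by
      rw [← eC_add, ← eC_add_int (f n + g n) ν]; congr 1; simp only [hg]; ring
    rw [this]
    have h0 : 1 - eC (g n) ≠ 0 := by
      rw [← norm_ne_zero_iff, norm_one_sub_eC]
      have := hs0 n hn'
      positivity
    rw [← mul_one_sub, mul_assoc, hw, mul_inv_cancel₀ h0, mul_one]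
  have hwn : ∀ n < N + 1, ‖w n‖ ≤ 1 / (4 * δ) := fun n hn => by
    rw [hw]; simp only
    rw [norm_inv, norm_one_sub_eC, inv_eq_one_div, abs_of_pos (hs0 n hn)]
    apply one_div_le_one_div_of_le (by positivity); linarith [hs n hn]
  have hcot : ∀ n < N + 1, |Real.cos (π * g n) / Real.sin (π * g n) / 2| ≤ 1 / (4 * δ) := by
    intro n hn
    rw [abs_div, abs_div, abs_of_pos (hs0 n hn), abs_of_pos (two_pos : (0:ℝ) < 2), div_div,
      div_le_div_iff₀ (by have := hs0 n hn; positivity) (by positivity)]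
    have := Real.abs_cos_le_one (π * g n)
    nlinarith [hs n hn]
  have hd : ∑ n ∈ range N, ‖w (n + 1) - w n‖ =
      ∑ n ∈ range N, (Real.cos (π * g n) / Real.sin (π * g n) / 2 -
        Real.cos (π * g (n + 1)) / Real.sin (π * g (n + 1)) / 2) := by
    refine sum_congr rfl fun n hn => ?_
    have hn' := mem_range.1 hn
    rw [hw]; simp only
    rw [inv_one_sub_eC _ (hs0 n (by omega)).ne', inv_one_sub_eC _ (hs0 (n + 1) (by omega)).ne',
      add_sub_add_left_eq_sub, ← sub_mul, ← Complex.ofReal_sub, norm_mul, Complex.norm_I, mul_one,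
      Complex.norm_real, Real.norm_eq_abs, abs_sub_comm, abs_of_nonneg]
    have := cot_anti (x := g n) (y := g (n + 1)) (by linarith [h1 n (by omega)])
      (by simp only [hg]; linarith [hm n (by omega)]) (by linarith [h2 (n + 1) (by omega)])
    linarith
  have hd2 : ∑ n ∈ range N, ‖w (n + 1) - w n‖ ≤ 1 / (4 * δ) + 1 / (4 * δ) := by
    rw [hd, sum_range_sub' (fun n => Real.cos (π * g n) / Real.sin (π * g n) / 2)]
    have := abs_le.1 (hcot 0 (by omega))
    have := abs_le.1 (hcot N (by omega))
    linarith
  rw [e1]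
  refine (norm_sum_sub_mul_le (fun n => eC (f n)) w (fun n => (norm_eC _).le) N).trans ?_
  have := hwn 0 (by omega)
  have := hwn N (by omega)
  have : 1 / δ = 1 / (4 * δ) + 1 / (4 * δ) + (1 / (4 * δ) + 1 / (4 * δ)) := by field_simp; norm_num
  linarith

lemma le_sub_of_diff_le {D : ℕ → ℝ} {L : ℕ} {l : ℝ} (hD : ∀ n, n + 1 < L → l ≤ D (n + 1) - D n)
    {m n : ℕ} (hmn : m ≤ n) (hn : n < L) : l * (n - m : ℝ) ≤ D n - D m := by
  induction n, hmn using Nat.le_induction with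
  | base => simp
  | succ k hk ih =>
    have := hD k hn
    have := ih (by omega)
    push_cast; linarith

lemma sub_le_of_diff_le {D : ℕ → ℝ} {L : ℕ} {l : ℝ} (hD : ∀ n, n + 1 < L → D (n + 1) - D n ≤ l)
    {m n : ℕ} (hmn : m ≤ n) (hn : n < L) : D n - D m ≤ l * (n - m : ℝ) := by
  induction n, hmn using Nat.le_induction with
  | base => simp
  | succ k hk ih =>
    have := hD k hn
    have := ih (by omega)
    push_cast; linarith

lemma exists_filter_eq_Ico {D : ℕ → ℝ} {L : ℕ} (hD : ∀ m n, m ≤ n → n < L → D m ≤ D n) (u v : ℝ) :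
    ∃ a b, (range L).filter (fun n => u ≤ D n ∧ D n ≤ v) = Ico a b := by
  set S := (range L).filter (fun n => u ≤ D n ∧ D n ≤ v) with hS
  rcases S.eq_empty_or_nonempty with h | h
  · exact ⟨0, 0, by rw [h]; simp⟩
  · refine ⟨S.min' h, S.max' h + 1, ?_⟩
    have h1 := S.min'_mem h
    have h2 := S.max'_mem h
    have g1 : ∀ n ∈ S, S.min' h ≤ n := fun n hn => S.min'_le n hn
    have g2 : ∀ n ∈ S, n ≤ S.max' h := fun n hn => S.le_max' n hn
    generalize S.min' h = a at *
    generalize S.max' h = b at *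
    ext n
    constructor
    · intro hn
      have := g1 n hn
      have := g2 n hn
      simp; omega
    · intro hn
      simp only [hS, mem_filter, mem_range, mem_Ico] at *
      refine ⟨by omega, h1.2.1.trans (hD _ _ hn.1 (by omega)), (hD _ _ (by omega) h2.1).trans h2.2.2⟩

lemma card_filter_diff_le {D : ℕ → ℝ} {L : ℕ} {l : ℝ} (hl : 0 < l)
    (hD : ∀ n, n + 1 < L → l ≤ D (n + 1) - D n) {u v : ℝ} (huv : u ≤ v) :
    (#((range L).filter (fun n => u ≤ D n ∧ D n ≤ v)) : ℝ) ≤ (v - u) / l + 1 := by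
  set S := (range L).filter (fun n => u ≤ D n ∧ D n ≤ v) with hS
  rcases S.eq_empty_or_nonempty with h | h
  · rw [h]; simp; have := sub_nonneg.2 huv; positivity
  · have h1 := S.min'_mem h
    have h2 := S.max'_mem h
    have g1 : ∀ n ∈ S, S.min' h ≤ n := fun n hn => S.min'_le n hn
    have g2 : ∀ n ∈ S, n ≤ S.max' h := fun n hn => S.le_max' n hn
    have hab : S.min' h ≤ S.max' h := g2 _ h1
    generalize S.min' h = a at *
    generalize S.max' h = b at *
    have hsub : S ⊆ Icc a b := fun n hn => mem_Icc.2 ⟨g1 n hn, g2 n hn⟩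
    have hc := card_le_card hsub
    rw [Nat.card_Icc] at hc
    simp only [hS, mem_filter, mem_range] at h1 h2
    have := le_sub_of_diff_le hD hab h2.1
    have e : ((#S : ℕ) : ℝ) ≤ b - a + 1 := by
      have : #S + a ≤ b + 1 := by omega
      have : ((#S + a : ℕ) : ℝ) ≤ ((b + 1 : ℕ) : ℝ) := by exact_mod_cast this
      push_cast at this; linarith
    have : (b - a : ℝ) ≤ (v - u) / l := by
      rw [le_div_iff₀ hl]; linarith
    linarith

/-- Second difference test (van der Corput). -/
lemma second_diff_test (f : ℕ → ℝ) (L : ℕ) (l h : ℝ) (hl : 0 < l) (hh : 1 ≤ h)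
    (h1 : ∀ n < L, l ≤ f (n + 2) - f (n + 1) - (f (n + 1) - f n))
    (h2 : ∀ n < L, f (n + 2) - f (n + 1) - (f (n + 1) - f n) ≤ h * l) :
    ‖∑ n ∈ range L, eC (f n)‖ ≤ 20 * h * (L * √l + 1 / √l) := by
  have hs : 0 < √l := Real.sqrt_pos.2 hl
  by_cases hbig : 1 / 2 < √l
  · refine (norm_sum_eC_le _ _).trans ?_
    rw [card_range]
    have : 0 < 1 / √l := by positivity
    have hL : (0 : ℝ) ≤ L := by positivity
    nlinarith [mul_nonneg hL hs.le, mul_nonneg (sub_nonneg.2 hh) (mul_nonneg hL hs.le), mul_nonneg hL (sub_nonneg.2 hbig.le), mul_nonneg (sub_nonneg.2 hh) this.le]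
  push Not at hbig
  rcases Nat.eq_zero_or_pos L with h0 | hLpos
  · subst h0; simp; positivity
  set δ := √l with hδ
  have hδl : δ ^ 2 = l := Real.sq_sqrt hl.le
  set D : ℕ → ℝ := fun n => f (n + 1) - f n with hDd
  have hD : ∀ n, n + 1 < L → l ≤ D (n + 1) - D n := fun n hn => h1 n (by omega)
  have hD2 : ∀ n, n + 1 < L → D (n + 1) - D n ≤ h * l := fun n hn => h2 n (by omega)
  have hmono : ∀ m n, m ≤ n → n < L → D m ≤ D n := fun m n hmn hn => by
    have := le_sub_of_diff_le hD hmn hn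
    have h' : (m : ℝ) ≤ n := by exact_mod_cast hmn
    nlinarith [mul_nonneg hl.le (sub_nonneg.2 h')]
  have piece : ∀ ν : ℤ, ‖∑ n ∈ range L with ⌊D n⌋ = ν, eC (f n)‖ ≤ 5 / δ := by
    intro ν
    set A := (range L).filter (fun n => ⌊D n⌋ = ν) with hA
    set S := (range L).filter (fun n => ν + δ ≤ D n ∧ D n ≤ ν + 1 - δ) with hS
    set B1 := (range L).filter (fun n => (ν : ℝ) ≤ D n ∧ D n ≤ ν + δ) with hB1
    set B2 := (range L).filter (fun n => ν + 1 - δ ≤ D n ∧ D n ≤ ν + 1) with hB2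
    have hSA : S ⊆ A := by
      intro n hn
      simp only [hS, hA, mem_filter] at *
      refine ⟨hn.1, ?_⟩
      rw [Int.floor_eq_iff]
      constructor <;> linarith
    have hAS : A \ S ⊆ B1 ∪ B2 := by
      intro n hn
      simp only [hS, hA, hB1, hB2, mem_filter, mem_sdiff, mem_union] at *
      obtain ⟨⟨hnL, hfl⟩, hns⟩ := hn
      rw [Int.floor_eq_iff] at hfl
      by_cases hc : D n ≤ ν + δ
      · left; exact ⟨hnL, hfl.1, hc⟩
      · right
        push Not at hc
        refine ⟨hnL, ?_, hfl.2.le⟩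
        by_contra hcon
        push Not at hcon
        exact hns ⟨hnL, hc.le, hcon.le⟩
    have c1 : (#B1 : ℝ) ≤ δ / l + 1 := by
      have := card_filter_diff_le hl hD (u := ν) (v := ν + δ) (by linarith)
      simpa using this
    have c2 : (#B2 : ℝ) ≤ δ / l + 1 := by
      have := card_filter_diff_le hl hD (u := ν + 1 - δ) (v := ν + 1) (by linarith)
      rwa [show (ν : ℝ) + 1 - (ν + 1 - δ) = δ by ring] at this
    have c3 : (#(A \ S) : ℝ) ≤ 2 * (δ / l + 1) := by
      have : #(A \ S) ≤ #B1 + #B2 := (card_le_card hAS).trans (card_union_le _ _)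
      have : (#(A \ S) : ℝ) ≤ #B1 + #B2 := by exact_mod_cast this
      linarith
    have hSb : ‖∑ n ∈ S, eC (f n)‖ ≤ 1 / δ := by
      obtain ⟨a, b, hab⟩ := exists_filter_eq_Ico hmono (ν + δ) (ν + 1 - δ)
      rw [← hS] at hab
      rw [hab, sum_Ico_eq_sum_range]
      have hm : ∀ n < b - a, a + n ∈ S := fun n hn => by rw [hab]; simp; omega
      have hm' : ∀ n < b - a, a + n < L ∧ ν + δ ≤ D (a + n) ∧ D (a + n) ≤ ν + 1 - δ := by
        intro n hn
        simpa [hS] using hm n hn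
      refine kusmin_landau (fun n => f (a + n)) (b - a) ν δ hs ?_ ?_ ?_
      · intro n hn
        have := (hm' n hn).2.1
        simp only [hDd] at this
        show δ ≤ f (a + n + 1) - f (a + n) - ν
        linarith
      · intro n hn
        have := (hm' n hn).2.2
        simp only [hDd] at this
        show f (a + n + 1) - f (a + n) - ν ≤ 1 - δ
        linarith
      · intro n hn
        exact hmono (a + n) (a + n + 1) (by omega) (hm' (n + 1) hn).1
    have e : δ / l = 1 / δ := by rw [← hδl]; field_simp
    have e2 : 1 ≤ 1 / δ := by rw [le_div_iff₀ hs]; linarith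
    rw [← sum_sdiff hSA]
    refine (norm_add_le _ _).trans ?_
    have := norm_sum_eC_le (A \ S) f
    rw [e] at c3
    have : 5 / δ = 5 * (1 / δ) := by ring
    linarith
  have hmap : ∀ n ∈ range L, ⌊D n⌋ ∈ Icc ⌊D 0⌋ ⌊D (L - 1)⌋ := by
    intro n hn
    have := mem_range.1 hn
    exact mem_Icc.2 ⟨Int.floor_mono (hmono 0 n (by omega) this),
      Int.floor_mono (hmono n (L - 1) (by omega) (by omega))⟩
  rw [← sum_fiberwise_of_maps_to hmap]
  refine (norm_sum_le _ _).trans ((sum_le_card_nsmul _ _ (5 / δ) fun ν _ => piece ν).trans ?_)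
  rw [Int.card_Icc, nsmul_eq_mul]
  have hcard : (((⌊D (L - 1)⌋ + 1 - ⌊D 0⌋).toNat : ℕ) : ℝ) ≤ h * l * L + 2 := by
    have h3 : ⌊D 0⌋ ≤ ⌊D (L - 1)⌋ := Int.floor_mono (hmono 0 (L - 1) (by omega) (by omega))
    have : (((⌊D (L - 1)⌋ + 1 - ⌊D 0⌋).toNat : ℤ) : ℝ) = ((⌊D (L - 1)⌋ + 1 - ⌊D 0⌋ : ℤ) : ℝ) := by
      congr 1; omega
    rw [Int.cast_natCast] at this
    rw [this]
    push_cast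
    have a1 := Int.floor_le (D (L - 1))
    have a2 := Int.lt_floor_add_one (D 0)
    have a3 := sub_le_of_diff_le hD2 (Nat.zero_le (L - 1)) (by omega)
    have a4 : (((L - 1 : ℕ) : ℝ) - (0 : ℕ)) ≤ L := by simp
    have : h * l * (((L - 1 : ℕ) : ℝ) - (0 : ℕ)) ≤ h * l * L := mul_le_mul_of_nonneg_left a4 (by positivity)
    linarith
  refine (mul_le_mul_of_nonneg_right hcard (by positivity)).trans ?_
  rw [← hδl]
  have : (h * δ ^ 2 * L + 2) * (5 / δ) = 5 * h * (L * δ) + 10 * (1 / δ) := by field_simp; ring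
  rw [this]
  have : 0 < 1 / δ := by positivity
  have : (0:ℝ) ≤ L * δ := by positivity
  nlinarith

lemma sum_Ico_shift (z : ℤ → ℂ) (L Q : ℕ) (hz : ∀ n : ℤ, n < 0 ∨ (L : ℤ) ≤ n → z n = 0) (j : ℕ)
    (hj : j < Q) : ∑ n ∈ Ico (-(Q : ℤ)) L, z (n + j) = ∑ n ∈ Ico (0 : ℤ) L, z n := by
  have e : ∑ n ∈ Ico (-(Q : ℤ)) L, z (n + j) = ∑ m ∈ Ico (-(Q : ℤ) + j) (L + j), z m := by
    rw [← Finset.image_add_right_Ico, sum_image (by intro a _ b _ h; simpa using h)]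
  rw [e]
  symm
  apply sum_subset
  · intro n hn; simp at *; omega
  · intro n _ hn
    apply hz
    simp at hn; omega

lemma sum_natAbs_sub_le (B : ℕ → ℝ) (hB : ∀ q, 0 ≤ B q) (Q j : ℕ) (hj : j < Q) :
    ∑ i ∈ range Q, B ((j : ℤ) - i).natAbs ≤ B 0 + 2 * ∑ q ∈ Ico 1 Q, B q := by
  have h1 : ∑ i ∈ range (j + 1), B ((j : ℤ) - i).natAbs = ∑ q ∈ range (j + 1), B q := by
    rw [← sum_range_reflect]
    refine sum_congr rfl fun i hi => ?_
    have := mem_range.1 hi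
    congr 1; omega
  have h2 : ∑ i ∈ Ico (j + 1) Q, B ((j : ℤ) - i).natAbs = ∑ q ∈ Ico 1 (Q - j), B q := by
    rw [sum_Ico_eq_sum_range, sum_Ico_eq_sum_range]
    have : Q - (j + 1) = Q - j - 1 := by omega
    rw [this]
    refine sum_congr rfl fun i hi => ?_
    congr 1; push_cast; omega
  have h3 : ∑ i ∈ range Q, B ((j : ℤ) - i).natAbs
      = ∑ q ∈ range (j + 1), B q + ∑ q ∈ Ico 1 (Q - j), B q := by
    rw [← h1, ← h2, sum_range_add_sum_Ico _ (by omega)]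
  rw [h3]
  have h4 : ∑ q ∈ range (j + 1), B q ≤ B 0 + ∑ q ∈ Ico 1 Q, B q := by
    have : ∑ q ∈ range Q, B q = B 0 + ∑ q ∈ Ico 1 Q, B q := by
      rw [range_eq_Ico, sum_eq_sum_Ico_succ_bot (by omega)]
    rw [← this]
    exact sum_le_sum_of_subset_of_nonneg (range_subset_range.2 (by omega)) fun _ _ _ => hB _
  have h5 : ∑ q ∈ Ico 1 (Q - j), B q ≤ ∑ q ∈ Ico 1 Q, B q :=
    sum_le_sum_of_subset_of_nonneg (Ico_subset_Ico le_rfl (by omega)) fun _ _ _ => hB _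
  linarith

/-- Weyl–van der Corput inequality for a family of sums. -/
lemma weyl_vdc {ι : Type*} (s : Finset ι) (z : ι → ℤ → ℂ) (L Q : ℕ) (hQ : 1 ≤ Q)
    (hz : ∀ i ∈ s, ∀ n : ℤ, n < 0 ∨ (L : ℤ) ≤ n → z i n = 0) (B : ℕ → ℝ)
    (hB : ∀ q < Q, ‖∑ i ∈ s, ∑ n ∈ Ico (0 : ℤ) L, z i (n + q) * (starRingEnd ℂ) (z i n)‖ ≤ B q) :
    Q * ∑ i ∈ s, ‖∑ n ∈ Ico (0 : ℤ) L, z i n‖ ^ 2 ≤ (L + Q) * (B 0 + 2 * ∑ q ∈ Ico 1 Q, B q) := by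
  have hcorr : ∀ j < Q, ∀ k < Q, (∑ i ∈ s, ∑ n ∈ Ico (-(Q : ℤ)) L,
      z i (n + j) * (starRingEnd ℂ) (z i (n + k))).re ≤ B ((j : ℤ) - k).natAbs := by
    have main : ∀ k < Q, ∀ q, k + q < Q → ∑ i ∈ s, ∑ n ∈ Ico (-(Q : ℤ)) L,
        z i (n + (k + q : ℕ)) * (starRingEnd ℂ) (z i (n + k)) =
        ∑ i ∈ s, ∑ n ∈ Ico (0 : ℤ) L, z i (n + q) * (starRingEnd ℂ) (z i n) := by
      intro k hk q hq
      refine sum_congr rfl fun i hi => ?_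
      rw [← sum_Ico_shift (fun n => z i (n + q) * (starRingEnd ℂ) (z i n)) L Q
        (fun n hn => by simp [hz i hi n hn]) k hk]
      refine sum_congr rfl fun n _ => ?_
      congr 2; push_cast; ring
    intro j hj k hk
    refine (Complex.re_le_norm _).trans ?_
    rcases le_total k j with h | h
    · obtain ⟨q, rfl⟩ := Nat.exists_eq_add_of_le h
      rw [main k hk q hj]
      have : ((((k + q : ℕ) : ℤ)) - k).natAbs = q := by omega
      rw [this]; exact hB q (by omega)
    · obtain ⟨q, rfl⟩ := Nat.exists_eq_add_of_le h
      have e : ((j : ℤ) - ((j + q : ℕ) : ℤ)).natAbs = q := by omega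
      rw [e, ← Complex.norm_conj, map_sum]
      simp_rw [map_sum, map_mul, Complex.conj_conj, mul_comm _ (z _ (_ + ((j + q : ℕ) : ℤ)))]
      rw [main j hj q hk]
      exact hB q (by omega)
  have hB0 : ∀ q < Q, 0 ≤ B q := fun q hq => (norm_nonneg _).trans (hB q hq)
  have step : ∀ i ∈ s, (Q : ℝ) ^ 2 * ‖∑ n ∈ Ico (0 : ℤ) L, z i n‖ ^ 2 ≤ (L + Q) *
      ∑ j ∈ range Q, ∑ k ∈ range Q, (∑ n ∈ Ico (-(Q : ℤ)) L,
        z i (n + j) * (starRingEnd ℂ) (z i (n + k))).re := by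
    intro i hi
    have e1 : (Q : ℂ) * ∑ n ∈ Ico (0 : ℤ) L, z i n
        = ∑ n ∈ Ico (-(Q : ℤ)) L, ∑ j ∈ range Q, z i (n + j) := by
      rw [sum_comm, sum_congr rfl fun j hj => sum_Ico_shift (z i) L Q (hz i hi) j (mem_range.1 hj)]
      simp
    have e2 : (Q : ℝ) * ‖∑ n ∈ Ico (0 : ℤ) L, z i n‖
        ≤ ∑ n ∈ Ico (-(Q : ℤ)) L, ‖∑ j ∈ range Q, z i (n + j)‖ := by
      have := congrArg norm e1
      rw [norm_mul, Complex.norm_natCast] at this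
      rw [this]; exact norm_sum_le _ _
    have e3 := sq_sum_le_card_mul_sum_sq (s := Ico (-(Q : ℤ)) L)
      (f := fun n => ‖∑ j ∈ range Q, z i (n + j)‖)
    have e4 : (#(Ico (-(Q : ℤ)) L) : ℝ) = L + Q := by
      rw [Int.card_Ico]
      have : ((L : ℤ) - -(Q : ℤ)).toNat = L + Q := by omega
      rw [this]; push_cast; ring
    rw [e4] at e3
    have e5 : ∑ n ∈ Ico (-(Q : ℤ)) L, ‖∑ j ∈ range Q, z i (n + j)‖ ^ 2 =
        ∑ j ∈ range Q, ∑ k ∈ range Q, (∑ n ∈ Ico (-(Q : ℤ)) L,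
        z i (n + j) * (starRingEnd ℂ) (z i (n + k))).re := by
      have : ∀ n, ‖∑ j ∈ range Q, z i (n + j)‖ ^ 2 = ∑ j ∈ range Q, ∑ k ∈ range Q,
          (z i (n + j) * (starRingEnd ℂ) (z i (n + k))).re := by
        intro n
        have h := Complex.mul_conj (∑ j ∈ range Q, z i (n + j))
        rw [Complex.normSq_eq_norm_sq, map_sum, sum_mul_sum] at h
        have h2 := congrArg Complex.re h
        rw [Complex.ofReal_re] at h2
        rw [← h2, Complex.re_sum]
        refine sum_congr rfl fun j _ => ?_
        rw [Complex.re_sum]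
      simp_rw [this]
      rw [sum_comm]
      refine sum_congr rfl fun j _ => ?_
      rw [sum_comm]
      refine sum_congr rfl fun k _ => ?_
      rw [Complex.re_sum]
    rw [← e5]
    calc (Q : ℝ) ^ 2 * ‖∑ n ∈ Ico (0 : ℤ) L, z i n‖ ^ 2
        = ((Q : ℝ) * ‖∑ n ∈ Ico (0 : ℤ) L, z i n‖) ^ 2 := by ring
      _ ≤ _ := pow_le_pow_left₀ (by positivity) e2 2
      _ ≤ _ := e3
  have hQ' : (0 : ℝ) < Q := by exact_mod_cast hQ
  refine le_of_mul_le_mul_left ?_ hQ'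
  calc (Q : ℝ) * (Q * ∑ i ∈ s, ‖∑ n ∈ Ico (0 : ℤ) L, z i n‖ ^ 2)
      = ∑ i ∈ s, (Q : ℝ) ^ 2 * ‖∑ n ∈ Ico (0 : ℤ) L, z i n‖ ^ 2 := by rw [← mul_sum]; ring
    _ ≤ ∑ i ∈ s, (L + Q) * ∑ j ∈ range Q, ∑ k ∈ range Q, (∑ n ∈ Ico (-(Q : ℤ)) L,
        z i (n + j) * (starRingEnd ℂ) (z i (n + k))).re := sum_le_sum step
    _ = (L + Q) * ∑ j ∈ range Q, ∑ k ∈ range Q, (∑ i ∈ s, ∑ n ∈ Ico (-(Q : ℤ)) L,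
        z i (n + j) * (starRingEnd ℂ) (z i (n + k))).re := by
      rw [← mul_sum, sum_comm]
      congr 1
      refine sum_congr rfl fun j _ => ?_
      rw [sum_comm]
      refine sum_congr rfl fun k _ => ?_
      rw [Complex.re_sum]
    _ ≤ (L + Q) * ∑ j ∈ range Q, (B 0 + 2 * ∑ q ∈ Ico 1 Q, B q) := by
      refine mul_le_mul_of_nonneg_left (sum_le_sum fun j hj => ?_) (by positivity)
      have hj' := mem_range.1 hj
      refine (sum_le_sum fun k hk => hcorr j hj' k (mem_range.1 hk)).trans ?_
      set B' : ℕ → ℝ := fun q => max (B q) 0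
      have hBB : ∀ q < Q, B' q = B q := fun q hq => max_eq_left (hB0 q hq)
      have := sum_natAbs_sub_le B' (fun q => le_max_right _ _) Q j hj'
      rw [hBB 0 (by omega), sum_congr rfl (fun q hq => hBB q (mem_Ico.1 hq).2)] at this
      refine le_trans (sum_le_sum fun k _ => le_max_left _ _) this
    _ = _ := by rw [sum_const, card_range, nsmul_eq_mul]; ring

/-- Forward difference of a sequence. -/
noncomputable def fdiff (f : ℕ → ℝ) : ℕ → ℝ := fun n => f (n + 1) - f n

lemma fdiff_iterate_shift_sub (k q : ℕ) (f : ℕ → ℝ) (n : ℕ) :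
    fdiff^[k] (fun m => f (m + q) - f m) n = ∑ j ∈ range q, fdiff^[k + 1] f (n + j) := by
  have h : ∀ k : ℕ, ∀ f : ℕ → ℝ, ∀ n, fdiff^[k] (fun m => f (m + q) - f m) n =
      fdiff^[k] f (n + q) - fdiff^[k] f n := by
    intro k
    induction k with
    | zero => intro f n; rfl
    | succ k ih =>
      intro f n
      rw [Function.iterate_succ_apply, Function.iterate_succ_apply, ← ih]
      refine congrFun (congrArg _ ?_) n
      funext m
      simp only [fdiff]
      rw [show m + 1 + q = m + q + 1 by ring]; ring
  rw [h, Function.iterate_succ_apply']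
  have : ∀ j ∈ range q, fdiff (fdiff^[k] f) (n + j)
      = (fun j => fdiff^[k] f (n + j)) (j + 1) - (fun j => fdiff^[k] f (n + j)) j := by
    intro j _; simp [fdiff, add_assoc]
  rw [sum_congr rfl this, sum_range_sub (fun j => fdiff^[k] f (n + j))]; simp

/-- The `k`-th difference test with exponents `κ, ρ`. -/
def VdCBound (k : ℕ) (κ ρ : ℝ) : Prop :=
  ∀ h : ℝ, 1 ≤ h → ∃ C > 0, ∀ (f : ℕ → ℝ) (L : ℕ) (l : ℝ), 0 < l →
    (∀ n < L, l ≤ fdiff^[k] f n ∧ fdiff^[k] f n ≤ h * l) →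
    ‖∑ n ∈ range L, eC (f n)‖ ≤ C * (L * l ^ κ + (L : ℝ) ^ (1 - ρ) * l ^ (-κ))

lemma vdCBound_two : VdCBound 2 (1 / 2) 1 := by
  intro h hh
  refine ⟨20 * h, by positivity, fun f L l hl hf => ?_⟩
  have := second_diff_test f L l h hl hh (fun n hn => (hf n hn).1) (fun n hn => (hf n hn).2)
  rw [Real.sqrt_eq_rpow] at this
  rw [sub_self, Real.rpow_zero, Real.rpow_neg hl.le, one_mul, ← one_div]
  exact this

lemma sum_rpow_neg_le {κ : ℝ} (h0 : 0 < κ) (h1 : κ ≤ 1 / 2) (Q : ℕ) :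
    ∑ q ∈ Ico 1 Q, (q : ℝ) ^ (-κ) ≤ 4 * (Q : ℝ) ^ (1 - κ) := by
  induction Q with
  | zero => simp; positivity
  | succ n ih =>
    rcases Nat.eq_zero_or_pos n with rfl | hn
    · simp
    rw [sum_Ico_succ_top hn]
    have hn' : (0 : ℝ) < n := by exact_mod_cast hn
    suffices h : 4 * (n : ℝ) ^ (1 - κ) + (n : ℝ) ^ (-κ) ≤ 4 * ((n + 1 : ℕ) : ℝ) ^ (1 - κ) by linarith
    push_cast
    have amgm := Real.geom_mean_le_arith_mean2_weighted h0.le (by linarith : 0 ≤ 1 - κ)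
      (by positivity : (0 : ℝ) ≤ n + 1) hn'.le (by ring)
    have p1 : (0 : ℝ) < (n + 1 : ℝ) ^ κ := by positivity
    have e1 : (n : ℝ) ^ (-κ) = (n : ℝ) ^ (1 - κ) / n := by
      rw [show -κ = (1 - κ) - 1 by ring, Real.rpow_sub_one hn'.ne']
    have e2 : (n + 1 : ℝ) ^ (1 - κ) = (n + 1) / (n + 1 : ℝ) ^ κ := by
      rw [Real.rpow_sub (by positivity), Real.rpow_one]
    rw [e1, e2, mul_div_assoc', le_div_iff₀ p1]
    set y := (n : ℝ) ^ (1 - κ)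
    set x := (n + 1 : ℝ) ^ κ
    have hxy : x * y ≤ n + κ := by linarith
    have : (4 * y + y / n) * x = (x * y) * (4 + 1 / n) := by field_simp
    rw [this]
    have h3 : (x * y) * (4 + 1 / n) ≤ (n + κ) * (4 + 1 / n) := by gcongr
    have h4 : (n + κ) * (4 + 1 / n) = 4 * n + 4 * κ + 1 + κ / n := by field_simp; ring
    have h5 : κ / n ≤ κ := div_le_self h0.le (by exact_mod_cast hn)
    linarith

lemma norm_sum_sq_le_of_shift (f : ℕ → ℝ) (L Q : ℕ) (hQ : 1 ≤ Q) (B : ℕ → ℝ)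
    (hB : ∀ q ∈ Ico 1 Q, ‖∑ n ∈ range (L - q), eC (f (n + q) - f n)‖ ≤ B q) :
    Q * ‖∑ n ∈ range L, eC (f n)‖ ^ 2 ≤ (L + Q) * (L + 2 * ∑ q ∈ Ico 1 Q, B q) := by
  set z : Unit → ℤ → ℂ := fun _ n => if 0 ≤ n ∧ n < L then eC (f n.toNat) else 0 with hz
  have conv : ∀ g : ℤ → ℂ, ∀ L : ℕ, ∑ n ∈ Ico (0 : ℤ) L, g n = ∑ n ∈ range L, g n := by
    intro g L
    refine (sum_nbij (fun n : ℕ => (n : ℤ)) ?_ ?_ ?_ ?_).symm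
    · intro a ha; simp at *; omega
    · intro a _ b _ h; simpa using h
    · intro a ha
      simp at ha
      exact ⟨a.toNat, by simp; omega, by simp; omega⟩
    · intro a _; rfl
  have e0 : ∀ n < L, z () (n : ℤ) = eC (f n) := by
    intro n hn; simp [hz, hn]
  have := weyl_vdc (univ : Finset Unit) z L Q hQ
    (by intro i _ n hn; simp only [hz]; rw [if_neg (by omega)]) (fun q => if q = 0 then L else B q) ?_
  · simp only [univ_unique, PUnit.default_eq_unit, sum_singleton, if_true] at this
    rw [conv, sum_congr rfl fun n hn => e0 n (mem_range.1 hn)] at this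
    refine this.trans_eq ?_
    congr 3
    refine sum_congr rfl fun q hq => ?_
    rw [if_neg]; have := mem_Ico.1 hq; omega
  · intro q hq
    simp only [univ_unique, PUnit.default_eq_unit, sum_singleton]
    have : ∑ n ∈ Ico (0 : ℤ) L, z () (n + q) * (starRingEnd ℂ) (z () n)
        = ∑ n ∈ range (L - q), eC (f (n + q) - f n) := by
      rw [conv]
      symm
      refine (sum_congr rfl fun n hn => ?_).trans (sum_subset (range_subset_range.2 (Nat.sub_le L q)) ?_)
      · have hn' := mem_range.1 hn
        rw [eC_sub, ← e0 n (by omega), ← e0 (n + q) (by omega)]; push_cast; rfl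
      · intro n hn hn2
        simp at hn hn2
        have : z () ((n : ℤ) + q) = 0 := by simp only [hz]; rw [if_neg]; omega
        rw [this, zero_mul]
    rw [this]
    split_ifs with h
    · subst h
      refine (norm_sum_eC_le _ _).trans ?_; simp
    · exact hB q (mem_Ico.2 ⟨by omega, hq⟩)

set_option maxHeartbeats 1000000 in
lemma vdCBound_succ {k : ℕ} {κ ρ : ℝ} (h0 : 0 < κ) (h1 : κ ≤ 1 / 2) (_ : 0 < ρ) (hρ1 : ρ ≤ 1)
    (H : VdCBound k κ ρ) : VdCBound (k + 1) (κ / (2 * (1 + κ))) (ρ / 2) := by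
  intro h hh
  obtain ⟨C, hC, H⟩ := H h hh
  refine ⟨2 + 32 * C, by positivity, fun f L l hl hf => ?_⟩
  set κ' := κ / (2 * (1 + κ)) with hκ'
  have hk0 : 0 < κ' := by positivity
  have hk1 : κ * (1 - 2 * κ') = 2 * κ' := by rw [hκ']; field_simp; ring
  rcases Nat.eq_zero_or_pos L with rfl | hL
  · simp; positivity
  have hL1 : (1 : ℝ) ≤ L := by exact_mod_cast hL
  have hLp : (0 : ℝ) < L := by linarith
  set y := (L : ℝ) ^ (1 - ρ / 2) with hy
  have hyp : 0 < y := by positivity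
  have hu : 0 < l ^ κ' := by positivity
  have huv : l ^ (-κ') = (l ^ κ')⁻¹ := Real.rpow_neg hl.le _
  rw [huv]
  have htriv := norm_sum_eC_le (range L) f
  rw [card_range] at htriv
  rcases le_or_gt 1 l with hl1 | hl1
  · have : 1 ≤ l ^ κ' := Real.one_le_rpow hl1 hk0.le
    have h2 : (L : ℝ) ≤ L * l ^ κ' := le_mul_of_one_le_right hLp.le this
    have h3 : 0 ≤ y * (l ^ κ')⁻¹ := by positivity
    nlinarith [mul_pos hC (mul_pos hLp hu), mul_nonneg hC.le h3]
  set u := l ^ κ' with hud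
  have hu1 : u < 1 := Real.rpow_lt_one hl.le hl1 hk0
  have hu2 : l ^ (2 * κ') = u ^ 2 := by
    rw [hud, ← Real.rpow_natCast, ← Real.rpow_mul hl.le]; congr 1; push_cast; ring
  set Q := ⌈(u ^ 2)⁻¹⌉₊ with hQ
  have hui : 1 ≤ (u ^ 2)⁻¹ := by
    rw [one_le_inv₀ (by positivity)]; nlinarith
  have hQ1 : 1 ≤ Q := Nat.one_le_ceil_iff.2 (by positivity)
  have hQge : (u ^ 2)⁻¹ ≤ Q := Nat.le_ceil _
  have hQle : (Q : ℝ) ≤ 2 * (u ^ 2)⁻¹ := by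
    have := (Nat.ceil_lt_add_one (by positivity : 0 ≤ (u ^ 2)⁻¹)).le
    linarith
  have hQp : (0 : ℝ) < Q := by exact_mod_cast hQ1
  rcases lt_or_ge L Q with hLQ | hLQ
  · have h2 : (L : ℝ) ≤ (u ^ 2)⁻¹ := (Nat.lt_ceil.1 hLQ).le
    have h3 : (L : ℝ) = y * (L : ℝ) ^ (ρ / 2) := by
      rw [hy, ← Real.rpow_add hLp]; simp
    have h4 : (L : ℝ) ^ (ρ / 2) ≤ u⁻¹ := by
      calc (L : ℝ) ^ (ρ / 2) ≤ (L : ℝ) ^ (1 / 2 : ℝ) :=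
            Real.rpow_le_rpow_of_exponent_le hL1 (by linarith)
        _ ≤ ((u ^ 2)⁻¹) ^ (1 / 2 : ℝ) := Real.rpow_le_rpow hLp.le h2 (by norm_num)
        _ = u⁻¹ := by
          rw [← inv_pow, ← Real.sqrt_eq_rpow, Real.sqrt_sq (by positivity)]
    have h5 : (L : ℝ) ≤ y * u⁻¹ := by
      calc (L : ℝ) = y * (L : ℝ) ^ (ρ / 2) := h3
        _ ≤ _ := by gcongr
    have h6 : 0 ≤ L * u := by positivity
    have h7 : 0 ≤ y * u⁻¹ := by positivity
    nlinarith [mul_nonneg hC.le h6, mul_nonneg hC.le h7]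
  · obtain ⟨W, hWd⟩ : ∃ W, W = C * (L * (Q * l) ^ κ) := ⟨_, rfl⟩
    obtain ⟨V, hVd⟩ : ∃ V, V = C * ((L : ℝ) ^ (1 - ρ) * l ^ (-κ)) := ⟨_, rfl⟩
    have hLQr : (Q : ℝ) ≤ L := by exact_mod_cast hLQ
    have key := norm_sum_sq_le_of_shift f L Q hQ1 (fun q => W + V * (q : ℝ) ^ (-κ)) ?_
    · have hs := sum_rpow_neg_le h0 h1 Q
      have hV : 0 ≤ V := by rw [hVd]; positivity
      have hW : 0 ≤ W := by rw [hWd]; positivity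
      have hs2 : ∑ q ∈ Ico 1 Q, (W + V * (q : ℝ) ^ (-κ)) ≤ Q * W + V * (4 * (Q : ℝ) ^ (1 - κ)) := by
        rw [sum_add_distrib, ← mul_sum]
        refine add_le_add ?_ (mul_le_mul_of_nonneg_left hs hV)
        rw [sum_const, Nat.card_Ico, nsmul_eq_mul]
        refine mul_le_mul_of_nonneg_right ?_ hW
        exact_mod_cast Nat.sub_le _ _
      have hWu : W ≤ 2 * C * L * u ^ 2 := by
        have : (Q * l) ^ κ ≤ 2 * u ^ 2 := by
          calc (Q * l) ^ κ ≤ (2 * (u ^ 2)⁻¹ * l) ^ κ := by gcongr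
            _ = 2 ^ κ * u ^ 2 := by
              rw [mul_assoc, Real.mul_rpow (by norm_num) (by positivity)]
              congr 1
              rw [← hu2, ← hk1, ← Real.rpow_neg hl.le, ← Real.rpow_add_one hl.ne',
                ← Real.rpow_mul hl.le]
              congr 1
              rw [hk1]; linarith
            _ ≤ 2 * u ^ 2 := by
              gcongr
              calc (2 : ℝ) ^ κ ≤ 2 ^ (1 : ℝ) :=
                    Real.rpow_le_rpow_of_exponent_le (by norm_num) (by linarith)
                _ = 2 := Real.rpow_one _
        calc W ≤ C * (L * (2 * u ^ 2)) := by rw [hWd]; gcongr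
          _ = _ := by ring
      have hVu : L * (V * (Q : ℝ) ^ (1 - κ)) ≤ Q * (C * (y * u⁻¹) ^ 2) := by
        have e1 : (L : ℝ) * (L : ℝ) ^ (1 - ρ) = y ^ 2 := by
          rw [hy, ← Real.rpow_natCast, ← Real.rpow_mul hLp.le, mul_comm, ← Real.rpow_add_one hLp.ne']
          congr 1; push_cast; ring
        have e2 : (Q : ℝ) ^ (1 - κ) = Q * (Q : ℝ) ^ (-κ) := by
          rw [mul_comm, ← Real.rpow_add_one hQp.ne']; congr 1; ring
        have e3 : l ^ (-κ) * (Q : ℝ) ^ (-κ) ≤ (u⁻¹) ^ 2 := by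
          calc l ^ (-κ) * (Q : ℝ) ^ (-κ) ≤ l ^ (-κ) * ((u ^ 2)⁻¹) ^ (-κ) := by
                refine mul_le_mul_of_nonneg_left ?_ (by positivity)
                exact Real.rpow_le_rpow_of_nonpos (by positivity) hQge (by linarith)
            _ = _ := by
              rw [inv_pow, ← hu2, ← Real.rpow_neg hl.le, ← Real.rpow_mul hl.le,
                ← Real.rpow_add hl]
              congr 1; linarith
        calc L * (V * (Q : ℝ) ^ (1 - κ))
            = Q * (C * (L * (L : ℝ) ^ (1 - ρ)) * (l ^ (-κ) * (Q : ℝ) ^ (-κ))) := by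
              rw [hVd, e2]; ring
          _ ≤ Q * (C * (y ^ 2) * (u⁻¹) ^ 2) := by rw [e1]; gcongr
          _ = _ := by ring
      have hLL : (L : ℝ) ≤ Q * (L * u ^ 2) := by
        have : (1 : ℝ) ≤ Q * u ^ 2 := by
          calc (1 : ℝ) = (u ^ 2)⁻¹ * u ^ 2 := by field_simp
            _ ≤ _ := by gcongr
        nlinarith
      have fin : Q * ‖∑ n ∈ range L, eC (f n)‖ ^ 2
          ≤ Q * ((2 + 32 * C) * ((L * u) ^ 2 + (y * u⁻¹) ^ 2)) := by
        calc _ ≤ _ := key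
          _ ≤ (L + L) * (L + 2 * (Q * W + V * (4 * (Q : ℝ) ^ (1 - κ)))) := by
            gcongr
          _ = 2 * L * L + 4 * L * Q * W + 16 * (L * (V * (Q : ℝ) ^ (1 - κ))) := by ring
          _ ≤ 2 * L * (Q * (L * u ^ 2)) + 4 * L * Q * (2 * C * L * u ^ 2)
              + 16 * (Q * (C * (y * u⁻¹) ^ 2)) := by gcongr
          _ = Q * ((2 + 8 * C) * (L * u) ^ 2 + 16 * C * (y * u⁻¹) ^ 2) := by ring
          _ ≤ _ := by
            refine mul_le_mul_of_nonneg_left ?_ hQp.le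
            have a1 : 0 ≤ (L * u) ^ 2 := by positivity
            have a2 : 0 ≤ (y * u⁻¹) ^ 2 := by positivity
            nlinarith [mul_nonneg hC.le a1, mul_nonneg hC.le a2]
      have fin2 := le_of_mul_le_mul_left fin hQp
      refine abs_le_of_sq_le_sq' ?_ (by positivity) |>.2
      have a1 : 0 ≤ L * u := by positivity
      have a2 : 0 ≤ y * u⁻¹ := by positivity
      calc _ ≤ _ := fin2
        _ ≤ (2 + 32 * C) ^ 2 * (L * u + y * u⁻¹) ^ 2 := by
          refine mul_le_mul ?_ ?_ (by positivity) (by positivity)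
          · nlinarith
          · nlinarith [mul_nonneg a1 a2]
        _ = _ := by ring
    · intro q hq
      have hq' := mem_Ico.1 hq
      have hqp : (0 : ℝ) < q := by exact_mod_cast hq'.1
      have := H (fun m => f (m + q) - f m) (L - q) (q * l) (by positivity) ?_
      · refine this.trans ?_
        have hLq : ((L - q : ℕ) : ℝ) ≤ L := by exact_mod_cast Nat.sub_le _ _
        have hqQ : (q : ℝ) ≤ Q := by exact_mod_cast hq'.2.le
        calc _ ≤ C * (L * (Q * l) ^ κ + (L : ℝ) ^ (1 - ρ) * (q * l) ^ (-κ)) := by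
              have : 0 ≤ 1 - ρ := by linarith
              gcongr
          _ = _ := by
            rw [Real.mul_rpow hqp.le hl.le]; rw [hWd, hVd]; ring
      · intro n hn
        rw [fdiff_iterate_shift_sub]
        have hf' : ∀ j ∈ range q, l ≤ fdiff^[k + 1] f (n + j) ∧ fdiff^[k + 1] f (n + j) ≤ h * l :=
          fun j hj => hf _ (by have := mem_range.1 hj; omega)
        constructor
        · have := card_nsmul_le_sum (range q) _ l (fun j hj => (hf' j hj).1)
          simpa using this
        · have := sum_le_card_nsmul (range q) _ (h * l) (fun j hj => (hf' j hj).2)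
          refine this.trans_eq ?_
          simp; ring

lemma vdCBound_three : VdCBound 3 (1 / 6) (1 / 2) := by
  have := vdCBound_succ (by norm_num) (by norm_num) (by norm_num) (by norm_num) vdCBound_two
  norm_num at this ⊢; exact this

lemma vdCBound_four : VdCBound 4 (1 / 14) (1 / 4) := by
  have := vdCBound_succ (by norm_num) (by norm_num) (by norm_num) (by norm_num) vdCBound_three
  norm_num at this ⊢; exact this

lemma vdCBound_five : VdCBound 5 (1 / 30) (1 / 8) := by
  have := vdCBound_succ (by norm_num) (by norm_num) (by norm_num) (by norm_num) vdCBound_four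
  norm_num at this ⊢; exact this

lemma fdiff_bounds (x0 lo hi : ℝ) (hx0 : 0 < x0) (k : ℕ) : ∀ (F : ℕ → ℝ → ℝ),
    (∀ j < k, ∀ x > 0, HasDerivAt (F j) (F (j + 1) x) x) → ∀ n : ℕ,
    (∀ x ∈ Set.Icc (x0 + n) (x0 + n + k), lo ≤ F k x ∧ F k x ≤ hi) →
    lo ≤ fdiff^[k] (fun m : ℕ => F 0 (x0 + m)) n ∧ fdiff^[k] (fun m : ℕ => F 0 (x0 + m)) n ≤ hi := by
  induction k with
  | zero => intro F _ n h; exact h _ (by simp)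
  | succ k ih =>
    intro F hF n h
    rw [Function.iterate_succ_apply]
    have e : fdiff (fun m : ℕ => F 0 (x0 + m)) = fun m : ℕ => (fun j x => F j (x + 1) - F j x) 0 (x0 + m) := by
      funext m; simp only [fdiff]; push_cast; rw [add_assoc]
    rw [e]
    refine ih (fun j x => F j (x + 1) - F j x) ?_ n ?_
    · intro j hj x hx
      exact ((hF j (by omega) (x + 1) (by linarith)).comp_add_const x 1).sub (hF j (by omega) x hx)
    · intro x hx
      have hxp : 0 < x := by have := hx.1; have : (0 : ℝ) ≤ n := by positivity
                             linarith
      obtain ⟨ξ, hξ, hξe⟩ := exists_hasDerivAt_eq_slope (F k) (F (k + 1)) (by linarith : x < x + 1)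
        (fun y hy => (hF k (by omega) y (by have := hy.1; linarith)).continuousAt.continuousWithinAt)
        (fun y hy => hF k (by omega) y (by have := hy.1; linarith))
      have : F k (x + 1) - F k x = F (k + 1) ξ := by rw [hξe]; field_simp; ring
      simp only [this]
      refine h ξ ⟨by linarith [hx.1, hξ.1], ?_⟩
      push_cast; linarith [hx.2, hξ.2]

/-- `c (c-1) ⋯ (c-j+1)`. -/
noncomputable def fallingCoeff (c : ℝ) (j : ℕ) : ℝ := ∏ i ∈ range j, (c - i)

lemma hasDerivAt_pow_chain (c t : ℝ) (j : ℕ) (x : ℝ) (hx : 0 < x) :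
    HasDerivAt (fun x : ℝ => t * fallingCoeff c j * x ^ (c - j))
      (t * fallingCoeff c (j + 1) * x ^ (c - (j + 1 : ℕ))) x := by
  have := (Real.hasDerivAt_rpow_const (x := x) (p := c - j) (Or.inl hx.ne')).const_mul
    (t * fallingCoeff c j)
  refine this.congr_deriv ?_
  have e : fallingCoeff c (j + 1) = fallingCoeff c j * (c - j) := by
    simp only [fallingCoeff]; rw [prod_range_succ]
  rw [e]
  push_cast
  rw [show c - (j + 1 : ℝ) = c - j - 1 by ring]
  ring

lemma sum_Ioc_eq_sum_range_shift (g : ℕ → ℂ) (a b : ℕ) :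
    ∑ n ∈ Ioc a b, g n = ∑ n ∈ range (b - a), g (a + 1 + n) := by
  have : Ioc a b = Ico (a + 1) (b + 1) := by ext n; simp only [mem_Ioc, mem_Ico]; omega
  rw [this, sum_Ico_eq_sum_range, Nat.add_sub_add_right]

lemma vdC_pow {k : ℕ} {κ ρ c : ℝ} (_ : 0 < κ) (hρ : ρ ≤ 1) (H : VdCBound k κ ρ) (hck : c < k)
    (hc : fallingCoeff c k ≠ 0) :
    ∃ C > 0, ∀ (t M : ℝ) (a b : ℕ), t ≠ 0 → 1 ≤ M → M ≤ a + 1 → (b : ℝ) ≤ 4 * M →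
      ‖∑ n ∈ Ioc a b, eC (t * (n : ℝ) ^ c)‖
        ≤ C * (M * (|t| * M ^ (c - k)) ^ κ + M ^ (1 - ρ) * (|t| * M ^ (c - k)) ^ (-κ)) := by
  set A := |fallingCoeff c k| with hA
  have hAp : 0 < A := abs_pos.2 hc
  set d : ℝ := 4 + k with hd
  have hd1 : 1 ≤ d := by have : (0:ℝ) ≤ k := by positivity
                         linarith
  have hdp : 0 < d := by linarith
  set B := A * d ^ (c - k) with hB
  have hBp : 0 < B := by positivity
  obtain ⟨C, hC, H⟩ := H (d ^ (k - c)) (Real.one_le_rpow hd1 (by linarith))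
  refine ⟨C * (4 * B ^ κ + 4 ^ (1 - ρ) * B ^ (-κ)), by positivity, ?_⟩
  intro t M a b ht hM hMa hbM
  have hMp : 0 < M := by linarith
  set l := |t| * M ^ (c - k) with hl
  have htp : 0 < |t| := abs_pos.2 ht
  have hlp : 0 < l := by positivity
  have x0p : (0 : ℝ) < (a + 1 : ℕ) := by positivity
  have main : ∀ s : ℝ, |s| = |t| → s * fallingCoeff c k = |t| * A →
      ‖∑ n ∈ Ioc a b, eC (s * (n : ℝ) ^ c)‖ ≤ C * (((b - a : ℕ) : ℝ) * (B * l) ^ κ +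
        ((b - a : ℕ) : ℝ) ^ (1 - ρ) * (B * l) ^ (-κ)) := by
    intro s hs hsA
    rw [sum_Ioc_eq_sum_range_shift]
    have := H (fun m : ℕ => s * fallingCoeff c 0 * (((a + 1 : ℕ) : ℝ) + m) ^ (c - (0 : ℕ))) (b - a)
      (B * l) (by positivity) ?_
    · refine (le_of_eq ?_).trans this
      congr 1
      refine sum_congr rfl fun n _ => ?_
      simp [fallingCoeff]
    · intro n hn
      refine fdiff_bounds ((a + 1 : ℕ) : ℝ) _ _ x0p k (fun j x => s * fallingCoeff c j * x ^ (c - j))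
        (fun j _ x hx => hasDerivAt_pow_chain c s j x hx) n ?_
      intro x hx
      have hx1 : M ≤ x := by
        have := hx.1
        have h0 : (0 : ℝ) ≤ n := by positivity
        push_cast at this; linarith
      have hx2 : x ≤ d * M := by
        have h1 := hx.2
        have h2 : ((a + 1 + n : ℕ) : ℝ) ≤ b := by exact_mod_cast (by omega)
        push_cast at h1 h2
        have : (k : ℝ) ≤ k * M := le_mul_of_one_le_right (by positivity) hM
        rw [hd]; nlinarith
      have hxp : 0 < x := by linarith
      have u1 : x ^ (c - k) ≤ M ^ (c - k) :=
        Real.rpow_le_rpow_of_nonpos hMp hx1 (by linarith)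
      have u2 : (d * M) ^ (c - k) ≤ x ^ (c - k) :=
        Real.rpow_le_rpow_of_nonpos hxp hx2 (by linarith)
      rw [Real.mul_rpow hdp.le hMp.le] at u2
      simp only [hsA]
      constructor
      · calc B * l = |t| * A * (d ^ (c - k) * M ^ (c - k)) := by rw [hB, hl]; ring
          _ ≤ _ := by gcongr
      · calc |t| * A * x ^ (c - k) ≤ |t| * A * M ^ (c - k) := by gcongr
          _ = d ^ (k - c) * (B * l) := by
            rw [hB, hl, show (k : ℝ) - c = -(c - k) by ring, Real.rpow_neg hdp.le]; field_simp
  have main2 : ‖∑ n ∈ Ioc a b, eC (t * (n : ℝ) ^ c)‖ ≤ C * (((b - a : ℕ) : ℝ) * (B * l) ^ κ +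
        ((b - a : ℕ) : ℝ) ^ (1 - ρ) * (B * l) ^ (-κ)) := by
    by_cases hsg : 0 ≤ t * fallingCoeff c k
    · exact main t rfl (by rw [hA, ← abs_mul, abs_of_nonneg hsg])
    · push Not at hsg
      have := main (-t) (abs_neg t) (by rw [hA, ← abs_mul, abs_of_neg hsg]; ring)
      rw [← norm_sum_eC_neg]
      simpa using this
  refine main2.trans ?_
  have hLM : ((b - a : ℕ) : ℝ) ≤ 4 * M := by
    refine le_trans ?_ hbM
    exact_mod_cast Nat.sub_le _ _
  rw [Real.mul_rpow hBp.le hlp.le, Real.mul_rpow hBp.le hlp.le]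
  have h1ρ : 0 ≤ 1 - ρ := by linarith
  calc _ ≤ C * (4 * M * (B ^ κ * l ^ κ) + (4 * M) ^ (1 - ρ) * (B ^ (-κ) * l ^ (-κ))) := by gcongr
    _ = C * (4 * B ^ κ * (M * l ^ κ) + 4 ^ (1 - ρ) * B ^ (-κ) * (M ^ (1 - ρ) * l ^ (-κ))) := by
      rw [Real.mul_rpow (by norm_num) hMp.le]; ring
    _ ≤ _ := by
      rw [mul_assoc C]
      refine mul_le_mul_of_nonneg_left ?_ hC.le
      have p1 : 0 ≤ M * l ^ κ := by positivity
      have p2 : 0 ≤ M ^ (1 - ρ) * l ^ (-κ) := by positivity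
      have p3 : 0 ≤ B ^ κ := by positivity
      have p4 : 0 ≤ (4 : ℝ) ^ (1 - ρ) * B ^ (-κ) := by positivity
      nlinarith [mul_nonneg p3 p2, mul_nonneg p4 p1]

lemma fallingCoeff_ne_zero {c : ℝ} (hc1 : 1 < c) (hc3 : c < 3) (hc2 : c ≠ 2) (k : ℕ) :
    fallingCoeff c k ≠ 0 := by
  rw [fallingCoeff, prod_ne_zero_iff]
  intro i _ h
  have hci : c = i := by linarith
  have h1 : (1 : ℝ) < (i : ℝ) := by linarith
  have h2 : (i : ℝ) < 3 := by linarith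
  have h1' : 1 < i := by exact_mod_cast h1
  have h2' : i < 3 := by exact_mod_cast h2
  have : i = 2 := by omega
  subst this
  exact hc2 (by simpa using hci)

/-- Kusmin–Landau for `θ n ^ c`. -/
lemma kusmin_landau_pow {c θ M : ℝ} {a b : ℕ} (hc : 1 < c) (hθ : θ ≠ 0) (hM : 1 ≤ M)
    (hMa : M ≤ a + 1) (hbM : (b : ℝ) ≤ 4 * M) (hsmall : |θ| * (c * (5 * M) ^ (c - 1)) ≤ 1 / 2) :
    ‖∑ n ∈ Ioc a b, eC (θ * (n : ℝ) ^ c)‖ ≤ M ^ (1 - c) / |θ| := by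
  have hMp : 0 < M := by linarith
  have main : ∀ θ : ℝ, 0 < θ → θ * (c * (5 * M) ^ (c - 1)) ≤ 1 / 2 →
      ‖∑ n ∈ Ioc a b, eC (θ * (n : ℝ) ^ c)‖ ≤ M ^ (1 - c) / θ := by
    intro θ hθ hsmall
    rw [sum_Ioc_eq_sum_range_shift]
    have x0p : (0 : ℝ) < (a + 1 : ℕ) := by positivity
    set f : ℕ → ℝ := fun m => θ * (((a + 1 : ℕ) : ℝ) + m) ^ c with hf
    have hfb : ∀ n < b - a, θ * M ^ (c - 1) ≤ f (n + 1) - f n ∧ f (n + 1) - f n ≤ 1 / 2 := by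
      intro n hn
      have h := fdiff_bounds ((a + 1 : ℕ) : ℝ) (θ * M ^ (c - 1)) (1 / 2) x0p 1
        (fun j x => θ * fallingCoeff c j * x ^ (c - j))
        (fun j _ x hx => hasDerivAt_pow_chain c θ j x hx) n ?_
      · simpa [fdiff, fallingCoeff, hf] using h
      · intro x hx
        have hx1 : M ≤ x := by
          have := hx.1
          have h0 : (0 : ℝ) ≤ n := by positivity
          push_cast at this; linarith
        have hx2 : x ≤ 5 * M := by
          have h1 := hx.2
          have h2 : ((a + 1 + n : ℕ) : ℝ) ≤ b := by exact_mod_cast (by omega)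
          push_cast at h1 h2; linarith
        have u1 : M ^ (c - 1) ≤ x ^ (c - 1) := Real.rpow_le_rpow hMp.le hx1 (by linarith)
        have u2 : x ^ (c - 1) ≤ (5 * M) ^ (c - 1) :=
          Real.rpow_le_rpow (by linarith) hx2 (by linarith)
        simp only [fallingCoeff, prod_range_one, Nat.cast_zero, sub_zero, Nat.cast_one]
        constructor
        · have : θ * M ^ (c - 1) ≤ θ * x ^ (c - 1) := by gcongr
          have h3 : 0 ≤ θ * x ^ (c - 1) := mul_nonneg hθ.le (Real.rpow_nonneg (by linarith) _)
          nlinarith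
        · refine le_trans ?_ hsmall
          rw [mul_assoc]; gcongr
    have hmono : ∀ n, f (n + 1) - f n ≤ f (n + 2) - f (n + 1) := by
      intro n
      have h := fdiff_bounds ((a + 1 : ℕ) : ℝ) 0 (θ * (c * (c - 1)) * (((a + 1 : ℕ) : ℝ) + n) ^ (c - 2) + θ * (c * (c - 1)) * (((a + 1 : ℕ) : ℝ) + n + 2) ^ (c - 2)) x0p 2
        (fun j x => θ * fallingCoeff c j * x ^ (c - j))
        (fun j _ x hx => hasDerivAt_pow_chain c θ j x hx) n ?_
      · have := h.1
        simp only [Function.iterate_succ, Function.iterate_zero, Function.comp, id, fdiff,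
          fallingCoeff, prod_range_zero, Nat.cast_zero, sub_zero, mul_one] at this
        simp only [hf]
        have e : n + 1 + 1 = n + 2 := rfl
        rw [e] at this
        linarith
      · intro x hx
        have hcc : 0 ≤ θ * (c * (c - 1)) := by
          have : 0 < c - 1 := by linarith
          have : 0 < c := by linarith
          positivity
        have hxn : (0 : ℝ) < ((a + 1 : ℕ) : ℝ) + n := add_pos_of_pos_of_nonneg x0p (Nat.cast_nonneg n)
        have hxp : 0 < x := lt_of_lt_of_le hxn hx.1
        have e : fallingCoeff c 2 = c * (c - 1) := by simp [fallingCoeff, prod_range_succ]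
        simp only [e, Nat.cast_ofNat]
        refine ⟨mul_nonneg hcc (by positivity), ?_⟩
        rw [← mul_add]
        refine mul_le_mul_of_nonneg_left ?_ hcc
        have hx2 : x ≤ ((a + 1 : ℕ) : ℝ) + n + 2 := by simpa using hx.2
        rcases le_total 0 (c - 2) with h2 | h2
        · have := Real.rpow_le_rpow hxp.le hx2 h2
          have : 0 ≤ (((a + 1 : ℕ) : ℝ) + n) ^ (c - 2) := by positivity
          linarith
        · have := Real.rpow_le_rpow_of_nonpos hxn hx.1 h2
          have : 0 ≤ (((a + 1 : ℕ) : ℝ) + n + 2) ^ (c - 2) := by positivity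
          linarith
    rcases Nat.eq_zero_or_pos (b - a) with h0 | h0
    · rw [h0]; simp; positivity
    have hd1 := (hfb 0 h0)
    have hk := kusmin_landau f (b - a) 0 (θ * M ^ (c - 1)) (by positivity)
      (fun n hn => by simpa using (hfb n hn).1)
      (fun n hn => by have := (hfb n hn).2; simp; linarith) (fun n _ => hmono n)
    refine (le_of_eq ?_).trans (hk.trans (le_of_eq ?_))
    · congr 1
      refine sum_congr rfl fun n _ => ?_
      simp [hf]
    · rw [show 1 - c = -(c - 1) by ring, Real.rpow_neg hMp.le]; field_simp
  rcases lt_or_gt_of_ne hθ with h | h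
  · rw [abs_of_neg h] at hsmall ⊢
    rw [← norm_sum_eC_neg]
    simpa using main (-θ) (by linarith) hsmall
  · rw [abs_of_pos h] at hsmall ⊢
    exact main θ h hsmall

/-- The Fejér kernel. -/
noncomputable def fejer (J : ℕ) (t : ℝ) : ℝ := ‖∑ j ∈ range J, eC (j * t)‖ ^ 2 / J

lemma fejer_nonneg (J : ℕ) (t : ℝ) : 0 ≤ fejer J t := by unfold fejer; positivity

lemma continuous_fejer (J : ℕ) : Continuous (fejer J) := by
  unfold fejer
  refine Continuous.div_const (Continuous.pow (Continuous.norm ?_) 2) _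
  exact continuous_finsetSum _ fun j _ => continuous_eC.comp (by fun_prop)

lemma fejer_eq_sum (J : ℕ) (t : ℝ) :
    (fejer J t : ℂ) = (1 / J : ℂ) * ∑ j ∈ range J, ∑ k ∈ range J, eC (((j : ℤ) - k : ℤ) * t) := by
  unfold fejer
  have h := Complex.mul_conj (∑ j ∈ range J, eC (j * t))
  rw [Complex.normSq_eq_norm_sq, map_sum, sum_mul_sum] at h
  rw [Complex.ofReal_div, ← h, Complex.ofReal_natCast, div_eq_mul_one_div, mul_comm]
  congr 1
  refine sum_congr rfl fun j _ => sum_congr rfl fun k _ => ?_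
  rw [← eC_sub]; congr 1; push_cast; ring

lemma eC_geom (J : ℕ) (t : ℝ) : (∑ j ∈ range J, eC (j * t)) * (1 - eC t) = 1 - eC (J * t) := by
  induction J with
  | zero => simp [eC_zero]
  | succ n ih =>
    rw [sum_range_succ, add_mul, ih, mul_sub, mul_one, ← eC_add]
    push_cast
    rw [show (n : ℝ) * t + t = (n + 1) * t by ring]; ring

lemma fejer_le (J : ℕ) (t : ℝ) : fejer J t ≤ J := by
  unfold fejer
  rcases Nat.eq_zero_or_pos J with rfl | h
  · simp
  have hJ : (0 : ℝ) < J := by exact_mod_cast h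
  rw [div_le_iff₀ hJ, ← sq]
  refine pow_le_pow_left₀ (norm_nonneg _) ?_ 2
  simpa using norm_sum_eC_le (range J) (fun j => (j : ℝ) * t)

lemma abs_sin_pi_ge {t : ℝ} (ht : |t| ≤ 1 / 2) : 2 * |t| ≤ |Real.sin (π * t)| := by
  have hpi := Real.pi_pos
  have main : ∀ t : ℝ, 0 ≤ t → t ≤ 1 / 2 → 2 * t ≤ Real.sin (π * t) := by
    intro t h0 h1
    have := Real.mul_le_sin (x := π * t) (by positivity) (by nlinarith)
    have e : 2 / π * (π * t) = 2 * t := by field_simp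
    linarith
  rcases le_total 0 t with h | h
  · rw [abs_of_nonneg h] at *
    exact (main t h ht).trans (le_abs_self _)
  · rw [abs_of_nonpos h] at *
    refine (main (-t) (by linarith) ht).trans ?_
    rw [show π * -t = -(π * t) by ring, Real.sin_neg]; exact neg_le_abs _

lemma fejer_le_inv (J : ℕ) (hJ : 1 ≤ J) {t : ℝ} (ht : |t| ≤ 1 / 2) :
    J * t ^ 2 * fejer J t ≤ 1 / 4 := by
  have hJ' : (0 : ℝ) < J := by exact_mod_cast hJ
  have h := congrArg norm (eC_geom J t)
  rw [norm_mul, norm_one_sub_eC] at h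
  have h1 : ‖1 - eC (J * t)‖ ≤ 2 := by
    refine (norm_sub_le _ _).trans ?_; rw [norm_eC]; norm_num
  have h2 := abs_sin_pi_ge ht
  unfold fejer
  set A := ‖∑ j ∈ range J, eC (j * t)‖
  have hA : 0 ≤ A := norm_nonneg _
  have h3 : A * (4 * |t|) ≤ 2 := by
    calc A * (4 * |t|) ≤ A * (2 * |Real.sin (π * t)|) := mul_le_mul_of_nonneg_left (by linarith) hA
      _ ≤ 2 := by rw [h]; exact h1
  have : J * t ^ 2 * (A ^ 2 / J) = (A * (4 * |t|)) ^ 2 / 16 := by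
    rw [mul_pow, mul_pow, sq_abs]; field_simp; norm_num
  rw [this]
  have : 0 ≤ A * (4 * |t|) := by positivity
  nlinarith

lemma fejer_ge (J : ℕ) (hJ : 1 ≤ J) {t : ℝ} (ht : J * |t| ≤ 1 / 2) :
    (J : ℝ) ≤ 5 / 2 * fejer J t := by
  have hJ' : (0 : ℝ) < J := by exact_mod_cast hJ
  unfold fejer
  rcases eq_or_ne t 0 with rfl | h0
  · simp only [mul_zero, eC_zero]
    simp
    field_simp
    nlinarith
  have h := congrArg norm (eC_geom J t)
  rw [norm_mul, norm_one_sub_eC, norm_one_sub_eC] at h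
  have h2 := abs_sin_pi_ge (t := J * t) (by rw [abs_mul, Nat.abs_cast]; exact ht)
  rw [abs_mul, Nat.abs_cast] at h2
  have h3 : |Real.sin (π * t)| ≤ π * |t| := by
    refine Real.abs_sin_le_abs.trans ?_
    rw [abs_mul, abs_of_pos Real.pi_pos]
  set A := ‖∑ j ∈ range J, eC (j * t)‖
  have hA : 0 ≤ A := norm_nonneg _
  have ht' : 0 < |t| := abs_pos.2 h0
  have h4 : 2 * J ≤ A * π := by
    have : A * (2 * |Real.sin (π * t)|) ≤ A * (2 * (π * |t|)) := by gcongr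
    have h5 : (2 * J) * (2 * |t|) ≤ (A * π) * (2 * |t|) := by nlinarith
    exact le_of_mul_le_mul_right h5 (by positivity)
  have hpi : π ^ 2 ≤ 10 := by nlinarith [Real.pi_lt_d2, Real.pi_pos]
  rw [mul_div_assoc', le_div_iff₀ hJ']
  have h6 : (2 * J : ℝ) ^ 2 ≤ (A * π) ^ 2 := pow_le_pow_left₀ (by positivity) h4 2
  nlinarith [sq_nonneg A]

lemma abs_mul_fejer_le (J : ℕ) (hJ : 1 ≤ J) {t : ℝ} (ht : |t| ≤ 1 / 2) :
    |t| * fejer J t ≤ 2 / (1 + J * |t|) := by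
  have hJ' : (0 : ℝ) < J := by exact_mod_cast hJ
  have h1 := fejer_le J t
  have h2 := fejer_le_inv J hJ ht
  have h0 := fejer_nonneg J t
  rw [le_div_iff₀ (by positivity)]
  rw [← sq_abs] at h2
  have ht0 := abs_nonneg t
  have e : |t| * fejer J t * (1 + J * |t|) = |t| * fejer J t + J * |t| ^ 2 * fejer J t := by ring
  rw [e]
  have : |t| * fejer J t ≤ 1 := by
    rcases le_total (J * |t|) 1 with h | h
    · nlinarith
    · nlinarith [mul_nonneg ht0 h0]
  linarith

lemma integral_eC_mul_int (h : ℤ) : ∫ t in (-(1 / 2) : ℝ)..(1 / 2), eC (h * t) = if h = 0 then 1 else 0 := by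
  split_ifs with h0
  · subst h0; simp [eC_zero]; norm_num
  · have hne : (2 * π * h : ℂ) * Complex.I ≠ 0 := by
      simp [Real.pi_ne_zero, h0]
    have e : ∀ t : ℝ, eC (h * t) = Complex.exp ((2 * π * h : ℂ) * Complex.I * t) := by
      intro t; unfold eC; congr 1; push_cast; ring
    simp_rw [e]
    rw [integral_exp_mul_complex hne]
    have : Complex.exp ((2 * π * h : ℂ) * Complex.I * ((1 / 2 : ℝ) : ℂ))
        = Complex.exp ((2 * π * h : ℂ) * Complex.I * ((-(1 / 2) : ℝ) : ℂ)) := by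
      rw [Complex.exp_eq_exp_iff_exists_int]
      exact ⟨h, by push_cast; ring⟩
    rw [this, sub_self, zero_div]

lemma integral_fejer (J : ℕ) (hJ : 1 ≤ J) : ∫ t in (-(1 / 2) : ℝ)..(1 / 2), fejer J t = 1 := by
  have hJ' : (J : ℂ) ≠ 0 := by exact_mod_cast (by omega : J ≠ 0)
  have : ((∫ t in (-(1 / 2) : ℝ)..(1 / 2), fejer J t : ℝ) : ℂ) = 1 := by
    rw [← intervalIntegral.integral_ofReal]
    simp_rw [fejer_eq_sum]
    rw [intervalIntegral.integral_const_mul, intervalIntegral.integral_finsetSum]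
    · have : ∀ j ∈ range J, ∫ t in (-(1 / 2) : ℝ)..(1 / 2), ∑ k ∈ range J, eC (((j : ℤ) - k : ℤ) * t)
          = 1 := by
        intro j hj
        rw [intervalIntegral.integral_finsetSum]
        · simp_rw [integral_eC_mul_int, sub_eq_zero, Nat.cast_inj]
          rw [sum_ite_eq, if_pos hj]
        · intro k _; exact (continuous_eC.comp (by fun_prop)).intervalIntegrable _ _
      rw [sum_congr rfl this]; simp [hJ']
    · intro j _
      exact (continuous_finsetSum _ fun k _ => continuous_eC.comp (by fun_prop)).intervalIntegrable _ _
  exact_mod_cast this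

lemma integral_abs_mul_fejer_le (J : ℕ) (hJ : 2 ≤ J) :
    ∫ t in (-(1 / 2) : ℝ)..(1 / 2), |t| * fejer J t ≤ 4 * Real.log J / J := by
  have hJ' : (0 : ℝ) < J := by exact_mod_cast (by omega : 0 < J)
  have hcont : Continuous fun t : ℝ => 2 / (1 + J * |t|) := by
    refine continuous_const.div (by fun_prop) fun t => ?_
    positivity
  have hc2 : Continuous fun t : ℝ => |t| * fejer J t := continuous_abs.mul (continuous_fejer J)
  have h1 : ∫ t in (-(1 / 2) : ℝ)..(1 / 2), |t| * fejer J t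
      ≤ ∫ t in (-(1 / 2) : ℝ)..(1 / 2), 2 / (1 + J * |t|) := by
    apply intervalIntegral.integral_mono_on (by norm_num) (hc2.intervalIntegrable _ _)
      (hcont.intervalIntegrable _ _)
    intro t ht
    exact abs_mul_fejer_le J (by omega) (abs_le.2 ⟨by linarith [ht.1], ht.2⟩)
  have h2 : ∫ t in (0 : ℝ)..(1 / 2), 2 / (1 + J * |t|) = 2 / J * Real.log (1 + J / 2) := by
    have : ∀ t ∈ Set.uIcc (0 : ℝ) (1 / 2), HasDerivAt (fun t : ℝ => 2 / J * Real.log (1 + J * t))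
        (2 / (1 + J * |t|)) t := by
      intro t ht
      rw [Set.uIcc_of_le (by norm_num)] at ht
      have hp : 0 < 1 + J * t := by have := mul_nonneg hJ'.le ht.1; linarith
      have hd : HasDerivAt (fun t : ℝ => 1 + J * t) J t := by
        simpa using ((hasDerivAt_id t).const_mul (J : ℝ)).const_add 1
      have := (hd.log hp.ne').const_mul (2 / (J : ℝ))
      refine this.congr_deriv ?_
      rw [abs_of_nonneg ht.1]; field_simp
    rw [intervalIntegral.integral_eq_sub_of_hasDerivAt this (hcont.intervalIntegrable _ _)]
    simp
    left; congr 1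
  have h3 : ∫ t in (-(1 / 2) : ℝ)..0, 2 / (1 + J * |t|) = 2 / J * Real.log (1 + J / 2) := by
    rw [← h2]
    have := intervalIntegral.integral_comp_neg (a := 0) (b := 1 / 2) (fun t : ℝ => 2 / (1 + J * |t|))
    simp only [abs_neg, neg_zero] at this
    exact this.symm
  rw [← intervalIntegral.integral_add_adjacent_intervals (hcont.intervalIntegrable _ 0)
    (hcont.intervalIntegrable _ _), h2, h3] at h1
  have h4 : Real.log (1 + J / 2) ≤ Real.log J := by
    apply Real.log_le_log (by positivity)
    have : (2 : ℝ) ≤ J := by exact_mod_cast hJ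
    linarith
  calc _ ≤ _ := h1
    _ = 4 / J * Real.log (1 + J / 2) := by ring
    _ ≤ 4 / J * Real.log J := by gcongr
    _ = _ := by ring

lemma sum_re_eC_le {ι : Type*} (s : Finset ι) (y : ι → ℝ) (E : ℝ) (J : ℕ) (hJ : 1 ≤ J) (hE0 : 0 ≤ E)
    (hE : ∀ h ∈ Ico 1 J, ‖∑ i ∈ s, eC (h * y i)‖ ≤ E) :
    ∑ i ∈ s, fejer J (y i) ≤ #s + J * E := by
  have hJ' : (0 : ℝ) < J := by exact_mod_cast hJ
  have hb : ∀ j ∈ range J, ∀ k ∈ range J, ‖∑ i ∈ s, eC (((j : ℤ) - k : ℤ) * y i)‖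
      ≤ if j = k then (#s : ℝ) else E := by
    intro j hj k hk
    have hj' := mem_range.1 hj
    have hk' := mem_range.1 hk
    split_ifs with h
    · exact norm_sum_eC_le _ _
    · rcases lt_or_gt_of_ne h with h | h
      · have := hE (k - j) (mem_Ico.2 ⟨by omega, by omega⟩)
        rw [← norm_sum_eC_neg] at this
        convert this using 5
        push_cast [h.le]; ring
      · have := hE (j - k) (mem_Ico.2 ⟨by omega, by omega⟩)
        convert this using 5
        push_cast [h.le]; ring
  have e : ((∑ i ∈ s, fejer J (y i) : ℝ) : ℂ) = (1 / J : ℂ) * ∑ j ∈ range J, ∑ k ∈ range J,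
      ∑ i ∈ s, eC (((j : ℤ) - k : ℤ) * y i) := by
    rw [Complex.ofReal_sum]
    simp_rw [fejer_eq_sum]
    rw [← mul_sum, sum_comm]
    congr 1
    exact sum_congr rfl fun j _ => sum_comm
  have h0 : 0 ≤ ∑ i ∈ s, fejer J (y i) := sum_nonneg fun i _ => fejer_nonneg _ _
  have h1 := congrArg norm e
  rw [Complex.norm_real, Real.norm_of_nonneg h0, norm_mul] at h1
  rw [h1]
  have h2 : ‖∑ j ∈ range J, ∑ k ∈ range J, ∑ i ∈ s, eC (((j : ℤ) - k : ℤ) * y i)‖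
      ≤ ∑ j ∈ range J, ∑ k ∈ range J, ((if j = k then (#s : ℝ) else 0) + E) := by
    refine (norm_sum_le _ _).trans (sum_le_sum fun j hj => (norm_sum_le _ _).trans
      (sum_le_sum fun k hk => (hb j hj k hk).trans ?_))
    split_ifs <;> linarith
  have h3 : ∑ j ∈ range J, ∑ k ∈ range J, ((if j = k then (#s : ℝ) else 0) + E)
      = J * (#s + J * E) := by
    have : ∀ j ∈ range J, ∑ k ∈ range J, ((if j = k then (#s : ℝ) else 0) + E) = #s + J * E := by
      intro j hj
      rw [sum_add_distrib, sum_ite_eq, if_pos hj]; simp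
    rw [sum_congr rfl this]; simp; ring
  rw [h3] at h2
  have : ‖(1 / J : ℂ)‖ = 1 / J := by simp
  rw [this]
  calc (1 / J : ℝ) * _ ≤ 1 / J * (J * (#s + J * E)) := by gcongr
    _ = _ := by field_simp

lemma fejer_add_int (J : ℕ) (t : ℝ) (m : ℤ) : fejer J (t + m) = fejer J t := by
  unfold fejer
  congr 3
  refine sum_congr rfl fun j _ => ?_
  rw [← eC_add_int (j * t) (j * m)]; congr 1; push_cast; ring

/-- Number of points close to an integer. -/
lemma card_near_int_le {ι : Type*} (s : Finset ι) (y : ι → ℝ) (E : ℝ) (J : ℕ) (hJ : 1 ≤ J)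
    (hE0 : 0 ≤ E) (hE : ∀ h ∈ Ico 1 J, ‖∑ i ∈ s, eC (h * y i)‖ ≤ E) (t : ℝ) (ht0 : 0 ≤ t)
    (ht : t ≤ 1 / 2) :
    (#(s.filter fun i => |y i - round (y i)| ≤ t) : ℝ) ≤ 10 * #s * t + 5 / 2 * #s / J + 5 / 2 * E := by
  have main : ∀ K : ℕ, 1 ≤ K → K ≤ J → K * t ≤ 1 / 2 →
      (#(s.filter fun i => |y i - round (y i)| ≤ t) : ℝ) ≤ 5 / 2 * #s / K + 5 / 2 * E := by
    intro K hK hKJ hKt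
    have hK' : (0 : ℝ) < K := by exact_mod_cast hK
    have h1 := sum_re_eC_le s y E K hK hE0 fun h hh => hE h (Ico_subset_Ico le_rfl hKJ hh)
    have h2 : (#(s.filter fun i => |y i - round (y i)| ≤ t) : ℝ) * (K / (5 / 2))
        ≤ ∑ i ∈ s, fejer K (y i) := by
      rw [← nsmul_eq_mul]
      refine (card_nsmul_le_sum _ (fun i => fejer K (y i)) _ fun i hi => ?_).trans
        (sum_le_sum_of_subset_of_nonneg (filter_subset _ _) fun _ _ _ => fejer_nonneg _ _)
      have hi' := (mem_filter.1 hi).2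
      have := fejer_ge K hK (t := y i - round (y i)) (by nlinarith)
      rw [← fejer_add_int K _ (round (y i)), sub_add_cancel] at this
      rw [div_le_iff₀ (by norm_num)]; linarith
    have h3 := h2.trans h1
    have : (#(s.filter fun i => |y i - round (y i)| ≤ t) : ℝ) * (K / (5 / 2)) ≤
      (5 / 2 * #s / K + 5 / 2 * E) * (K / (5 / 2)) := by
      refine h3.trans (le_of_eq ?_); field_simp
    exact le_of_mul_le_mul_right this (by positivity)
  have hJ' : (0 : ℝ) < J := by exact_mod_cast hJ
  have hs : (0 : ℝ) ≤ #s := by positivity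
  by_cases h : J * t ≤ 1 / 2
  · have := main J hJ le_rfl h
    have : 0 ≤ 10 * #s * t := by positivity
    linarith
  · push Not at h
    have htp : 0 < t := by by_contra hcon; push Not at hcon; nlinarith
    set K := ⌊1 / (2 * t)⌋₊ with hKd
    have hx1 : 1 ≤ 1 / (2 * t) := by rw [le_div_iff₀ (by positivity)]; linarith
    have hK1 : 1 ≤ K := Nat.one_le_floor_iff _ |>.2 hx1
    have hKle : (K : ℝ) ≤ 1 / (2 * t) := Nat.floor_le (by positivity)
    have hKJ : K ≤ J := by
      have : (K : ℝ) ≤ J := hKle.trans (by rw [div_le_iff₀ (by positivity)]; linarith)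
      exact_mod_cast this
    have hKt : K * t ≤ 1 / 2 := by
      calc K * t ≤ 1 / (2 * t) * t := by gcongr
        _ = 1 / 2 := by field_simp
    have hge : 1 / (4 * t) ≤ K := by
      have h1 := Nat.lt_floor_add_one (1 / (2 * t))
      have h2 : (1 : ℝ) ≤ K := by exact_mod_cast hK1
      have h3 : 1 / (2 * t) = 2 * (1 / (4 * t)) := by field_simp; norm_num
      rw [← hKd] at h1; linarith
    have h4 : (1 : ℝ) / K ≤ 4 * t := by
      rw [div_le_iff₀ (by positivity)] at *
      nlinarith
    have := main K hK1 hKJ hKt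
    have h5 : 5 / 2 * #s / K ≤ 10 * #s * t := by
      calc 5 / 2 * (#s : ℝ) / K = 5 / 2 * #s * (1 / K) := by ring
        _ ≤ 5 / 2 * #s * (4 * t) := by gcongr
        _ = _ := by ring
    have : 0 ≤ 5 / 2 * (#s : ℝ) / J := by positivity
    linarith

/-- `e(-α{y})`. -/
noncomputable def eFract (α y : ℝ) : ℂ := eC (-(α * Int.fract y))

lemma norm_eFract (α y : ℝ) : ‖eFract α y‖ = 1 := norm_eC _

lemma measurable_eFract (α : ℝ) : Measurable (eFract α) :=
  continuous_eC.measurable.comp ((measurable_fract.const_mul α).neg)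

lemma eC_floor_mul (α y : ℝ) : eC (⌊y⌋ * α) = eC (α * y) * eFract α y := by
  unfold eFract; rw [← eC_add]; congr 1
  have := Int.floor_add_fract y
  linear_combination α * this

lemma intervalIntegrable_of_bdd {f : ℝ → ℂ} (hf : Measurable f) (C : ℝ) (hC : ∀ x, ‖f x‖ ≤ C) (a b : ℝ) :
    IntervalIntegrable f volume a b := by
  refine (intervalIntegrable_const (c := C)).mono_fun hf.aestronglyMeasurable ?_
  filter_upwards with x
  exact (hC x).trans (le_abs_self C)

lemma integral_eC_mul (β : ℝ) : ‖∫ s in (0 : ℝ)..1, eC (β * s)‖ ≤ 1 ∧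
    π * |β| * ‖∫ s in (0 : ℝ)..1, eC (β * s)‖ ≤ 1 := by
  constructor
  · have := intervalIntegral.norm_integral_le_of_norm_le_const (a := 0) (b := 1) (C := 1)
      (f := fun s => eC (β * s)) (fun s _ => (norm_eC _).le)
    simpa using this
  · rcases eq_or_ne β 0 with rfl | h0
    · simp
    have hne : (2 * π * β : ℂ) * Complex.I ≠ 0 := by
      simp [Real.pi_ne_zero, h0]
    have e : ∀ t : ℝ, eC (β * t) = Complex.exp ((2 * π * β : ℂ) * Complex.I * t) := by
      intro t; unfold eC; congr 1; push_cast; ring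
    have h1 : ∫ s in (0 : ℝ)..1, eC (β * s) = (eC (β * 1) - eC (β * 0)) / ((2 * π * β : ℂ) * Complex.I) := by
      simp_rw [e]; rw [integral_exp_mul_complex hne]
    rw [h1, norm_div, norm_mul, Complex.norm_I, mul_one]
    have h2 : ‖(2 * π * β : ℂ)‖ = 2 * π * |β| := by
      simp [Real.pi_pos.le]
    rw [h2]
    have h3 : ‖eC (β * 1) - eC (β * 0)‖ ≤ 2 := by
      refine (norm_sub_le _ _).trans ?_; rw [norm_eC, norm_eC]; norm_num
    have hp : 0 < π * |β| := mul_pos Real.pi_pos (abs_pos.2 h0)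
    rw [mul_div_assoc', div_le_one (by linarith)]
    have := mul_le_mul_of_nonneg_left h3 hp.le
    simp only [mul_one] at this ⊢
    linarith

lemma integral_eFract_coeff {α : ℝ} (h0 : 0 ≤ α) (h1 : α ≤ 1) (h : ℤ) :
    ‖∫ s in (0 : ℝ)..1, eC (-(α + h) * s)‖ ≤ 2 / (1 + |(h : ℝ)|) := by
  obtain ⟨a1, a2⟩ := integral_eC_mul (-(α + h))
  set I := ‖∫ s in (0 : ℝ)..1, eC (-(α + h) * s)‖
  rw [abs_neg] at a2
  rw [le_div_iff₀ (by positivity)]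
  have hI : 0 ≤ I := norm_nonneg _
  by_cases hs : |(h : ℝ)| ≤ 1
  · nlinarith
  · push Not at hs
    have h2 : (2 : ℝ) ≤ |(h : ℝ)| := by
      have : 1 < |h| := by exact_mod_cast hs
      exact_mod_cast (by omega : 2 ≤ |h|)
    have h3 : |(h : ℝ)| - 1 ≤ |α + h| := by
      have := abs_sub_abs_le_abs_sub (h : ℝ) (-α)
      rw [sub_neg_eq_add, abs_neg, abs_of_nonneg h0] at this
      rw [add_comm]; linarith
    have hpi := Real.pi_gt_three
    have h5 : 3 * (|(h : ℝ)| - 1) * I ≤ 1 := by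
      refine le_trans ?_ a2
      gcongr
    nlinarith

lemma eFract_sub_sub {α y t : ℝ} (h0 : 0 ≤ α) (h1 : α ≤ 1) :
    ‖eFract α (y - t) - eFract α y‖ ≤ 2 * π * |t| + (if |y - round y| ≤ |t| then 2 else 0) := by
  split_ifs with h
  · have : ‖eFract α (y - t) - eFract α y‖ ≤ 2 := by
      refine (norm_sub_le _ _).trans ?_; rw [norm_eFract, norm_eFract]; norm_num
    have : 0 ≤ 2 * π * |t| := by positivity
    linarith
  · push Not at h
    rw [abs_sub_round_eq_min, lt_min_iff] at h
    have hf : ⌊y - t⌋ = ⌊y⌋ := by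
      rw [Int.floor_eq_iff]
      have := Int.floor_add_fract y
      have := le_abs_self t
      have := neg_abs_le t
      constructor <;> linarith
    have hfr : Int.fract (y - t) = Int.fract y - t := by
      simp only [Int.fract, hf]; ring
    have e : eFract α (y - t) - eFract α y = eFract α y * (eC (α * t) - 1) := by
      unfold eFract
      rw [hfr, mul_sub (eC _), mul_one, ← eC_add]; congr 2; ring
    rw [e, norm_mul, norm_eFract, one_mul, norm_sub_rev, norm_one_sub_eC, add_zero]
    have := Real.abs_sin_le_abs (x := π * (α * t))
    rw [abs_mul, abs_mul, abs_of_pos Real.pi_pos, abs_of_nonneg h0] at this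
    have h3 : α * |t| ≤ |t| := mul_le_of_le_one_left (abs_nonneg t) h1
    have := mul_le_mul_of_nonneg_left h3 Real.pi_pos.le
    linarith

lemma eFract_periodic (α : ℝ) : Function.Periodic (eFract α) 1 := by
  intro x; simp [eFract]

lemma eFract_integral (α y : ℝ) (m : ℤ) :
    ∫ t in (-(1 / 2) : ℝ)..(1 / 2), eFract α (y - t) * eC (m * t)
      = eC (m * y) * ∫ s in (0 : ℝ)..1, eC (-(α + m) * s) := by
  have h1 : ∀ t : ℝ, eFract α (y - t) * eC (m * t)
      = (fun u => eC (m * y) * (eFract α u * eC (-(m * u)))) (y - t) := by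
    intro t
    have : eC (m * t) = eC (m * y) * eC (-(m * (y - t))) := by rw [← eC_add]; congr 1; ring
    simp only [this]; ring
  simp_rw [h1]
  rw [intervalIntegral.integral_comp_sub_left (fun u => eC (m * y) * (eFract α u * eC (-(m * u)))),
    intervalIntegral.integral_const_mul]
  congr 1
  have hp : Function.Periodic (fun u => eFract α u * eC (-(m * u))) 1 := by
    intro u
    simp only [eFract_periodic α u]
    congr 1
    rw [← eC_add_int (-(m * u)) (-m)]; congr 1; push_cast; ring
  have := hp.intervalIntegral_add_eq (y - 1 / 2) 0
  rw [zero_add] at this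
  rw [show y - -(1 / 2) = y - 1 / 2 + 1 by ring, this]
  refine intervalIntegral.integral_congr_ae ?_
  have h2 : ∀ᵐ u : ℝ, u ≠ 1 := by simp [ae_iff, measure_singleton]
  filter_upwards [h2] with u hu1 hu
  rw [Set.uIoc_of_le zero_le_one] at hu
  have : Int.fract u = u := Int.fract_eq_self.2 ⟨hu.1.le, lt_of_le_of_ne hu.2 hu1⟩
  unfold eFract
  rw [this, ← eC_add]; congr 1; ring

lemma sum_range_sub_le (J : ℕ) (f : ℤ → ℝ) (hf : ∀ h, 0 ≤ f h) :
    ∑ j ∈ range J, ∑ k ∈ range J, f ((j : ℤ) - k) ≤ J * ∑ h ∈ Ioo (-(J : ℤ)) J, f h := by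
  calc _ ≤ ∑ j ∈ range J, ∑ h ∈ Ioo (-(J : ℤ)) J, f h := by
        refine sum_le_sum fun j hj => ?_
        have hj := mem_range.1 hj
        rw [← sum_image (f := f) (g := fun k : ℕ => (j : ℤ) - k) (by intro a _ b _ hab; simp at hab; exact hab)]
        refine sum_le_sum_of_subset_of_nonneg ?_ fun h _ _ => hf h
        intro h hh
        obtain ⟨k, hk, rfl⟩ := mem_image.1 hh
        have hk := mem_range.1 hk
        rw [mem_Ioo]; omega
    _ = _ := by simp

/-- Removing the integer part from an exponential sum. -/
lemma floor_sum_le {ι : Type*} (s : Finset ι) (y : ι → ℝ) (z : ι → ℂ) (W : ℝ) (hz : ∀ i ∈ s, ‖z i‖ ≤ W)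
    (hW : 0 ≤ W) {α : ℝ} (h0 : 0 ≤ α) (h1 : α ≤ 1) (E : ℝ) (J : ℕ) (hJ : 2 ≤ J)
    (hE0 : 0 ≤ E) (hE : ∀ h ∈ Ico 1 J, ‖∑ i ∈ s, eC (h * y i)‖ ≤ E) :
    ‖∑ i ∈ s, z i * eC (⌊y i⌋ * α)‖ ≤
      2 * ∑ h ∈ Ioo (-(J : ℤ)) J, 1 / (1 + |(h : ℝ)|) * ‖∑ i ∈ s, z i * eC ((h + α) * y i)‖
      + W * (120 * #s * (log J / J) + 5 * E) := by
  have hJ' : (0 : ℝ) < J := by positivity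
  set G : ℝ → ℂ := fun x => ∫ t in (-(1 / 2) : ℝ)..(1 / 2), eFract α (x - t) * (fejer J t : ℂ) with hG
  have hint : ∀ x : ℝ, IntervalIntegrable (fun t => eFract α (x - t)) volume (-(1 / 2)) (1 / 2) :=
    fun x => intervalIntegrable_of_bdd ((measurable_eFract α).comp (measurable_const.sub measurable_id)) 1
      (fun t => (norm_eFract _ _).le) _ _
  have hcf : Continuous fun t => (fejer J t : ℂ) :=
    Complex.continuous_ofReal.comp (continuous_fejer J)
  have hint2 : ∀ x : ℝ, IntervalIntegrable (fun t => eFract α (x - t) * (fejer J t : ℂ)) volume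
      (-(1 / 2)) (1 / 2) := fun x => (hint x).mul_continuousOn hcf.continuousOn
  have hGe : ∀ x, G x = (1 / J : ℂ) * ∑ j ∈ range J, ∑ k ∈ range J,
      eC (((j : ℤ) - k : ℤ) * x) * ∫ s in (0 : ℝ)..1, eC (-(α + ((j : ℤ) - k : ℤ)) * s) := by
    intro x
    simp only [hG, fejer_eq_sum, mul_sum, mul_left_comm _ (1 / J : ℂ)]
    have hii : ∀ j k : ℕ, IntervalIntegrable (fun t => (1 / J : ℂ) * (eFract α (x - t) *
      eC (((j : ℤ) - k : ℤ) * t))) volume (-(1 / 2)) (1 / 2) := fun j k =>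
      ((hint x).mul_continuousOn
        ((continuous_eC.comp (continuous_const.mul continuous_id)).continuousOn)).const_mul _
    have hs : ∀ j ∈ range J, IntervalIntegrable (fun t => ∑ k ∈ range J, (1 / J : ℂ) * (eFract α (x - t) *
      eC (((j : ℤ) - k : ℤ) * t))) volume (-(1 / 2)) (1 / 2) := fun j _ => by
      simpa only [Finset.sum_fn] using IntervalIntegrable.sum (range J) (fun k _ => hii j k)
    rw [intervalIntegral.integral_finsetSum hs]
    refine sum_congr rfl fun j _ => ?_
    rw [intervalIntegral.integral_finsetSum fun k _ => hii j k]
    refine sum_congr rfl fun k _ => ?_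
    rw [intervalIntegral.integral_const_mul, eFract_integral]
  have hmain : ‖∑ i ∈ s, z i * eC (α * y i) * G (y i)‖ ≤
      2 * ∑ h ∈ Ioo (-(J : ℤ)) J, 1 / (1 + |(h : ℝ)|) * ‖∑ i ∈ s, z i * eC ((h + α) * y i)‖ := by
    have e : ∑ i ∈ s, z i * eC (α * y i) * G (y i) = (1 / J : ℂ) * ∑ j ∈ range J, ∑ k ∈ range J,
        (∫ s in (0 : ℝ)..1, eC (-(α + ((j : ℤ) - k : ℤ)) * s)) *
          ∑ i ∈ s, z i * eC ((((j : ℤ) - k : ℤ) + α) * y i) := by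
      simp_rw [hGe, mul_sum]
      rw [sum_comm]
      refine sum_congr rfl fun j _ => ?_
      rw [sum_comm]
      refine sum_congr rfl fun k _ => sum_congr rfl fun i _ => ?_
      rw [add_mul, eC_add]; ring
    rw [e, norm_mul]
    have h3 := sum_range_sub_le J (fun h => 2 * (1 / (1 + |(h : ℝ)|) * ‖∑ i ∈ s, z i * eC ((h + α) * y i)‖))
      (fun h => by positivity)
    have h4 : ‖(1 / J : ℂ)‖ = 1 / J := by simp
    rw [h4]
    calc (1 / J : ℝ) * _ ≤ 1 / J * (J * ∑ h ∈ Ioo (-(J : ℤ)) J,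
          2 * (1 / (1 + |(h : ℝ)|) * ‖∑ i ∈ s, z i * eC ((h + α) * y i)‖)) := by
          gcongr
          refine le_trans ?_ h3
          refine (norm_sum_le _ _).trans (sum_le_sum fun j _ => (norm_sum_le _ _).trans
            (sum_le_sum fun k _ => ?_))
          rw [norm_mul]
          refine (mul_le_mul_of_nonneg_right (integral_eFract_coeff h0 h1 _) (norm_nonneg _)).trans
            (le_of_eq ?_)
          ring
      _ = _ := by rw [← mul_sum]; field_simp
  have herr : ‖∑ i ∈ s, z i * eC (α * y i) * (eFract α (y i) - G (y i))‖ ≤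
      W * (120 * #s * (log J / J) + 5 * E) := by
    have e1 : ∀ x, eFract α x - G x = ∫ t in (-(1 / 2) : ℝ)..(1 / 2),
        (eFract α x - eFract α (x - t)) * (fejer J t : ℂ) := by
      intro x
      have hc : ∫ t in (-(1 / 2) : ℝ)..(1 / 2), eFract α x * (fejer J t : ℂ) = eFract α x := by
        rw [intervalIntegral.integral_const_mul, intervalIntegral.integral_ofReal, integral_fejer J (by omega)]
        simp
      simp_rw [sub_mul]
      rw [intervalIntegral.integral_sub ((hcf.intervalIntegrable _ _).const_mul _) (hint2 x), hc]
    have hii : ∀ i, IntervalIntegrable (fun t => z i * eC (α * y i) * ((eFract α (y i) - eFract α (y i - t)) *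
        (fejer J t : ℂ))) volume (-(1 / 2)) (1 / 2) := fun i =>
      (((intervalIntegrable_const).sub (hint (y i))).mul_continuousOn hcf.continuousOn).const_mul _
    have e2 : ∑ i ∈ s, z i * eC (α * y i) * (eFract α (y i) - G (y i)) =
        ∫ t in (-(1 / 2) : ℝ)..(1 / 2), ∑ i ∈ s, z i * eC (α * y i) *
          ((eFract α (y i) - eFract α (y i - t)) * (fejer J t : ℂ)) := by
      rw [intervalIntegral.integral_finsetSum fun i _ => hii i]
      refine sum_congr rfl fun i _ => ?_
      rw [intervalIntegral.integral_const_mul, e1]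
    rw [e2]
    have hb : ∀ t ∈ Set.Ioc (-(1 / 2) : ℝ) (1 / 2), ‖∑ i ∈ s, z i * eC (α * y i) *
          ((eFract α (y i) - eFract α (y i - t)) * (fejer J t : ℂ))‖ ≤
          W * (27 * #s) * (|t| * fejer J t) + W * (5 * #s / J + 5 * E) * fejer J t := by
      intro t ht
      have habs : |t| ≤ 1 / 2 := abs_le.2 ⟨ht.1.le, ht.2⟩
      have hfn := fejer_nonneg J t
      have hcard := card_near_int_le s y E J (by omega) hE0 hE |t| (abs_nonneg _) habs
      calc _ ≤ ∑ i ∈ s, W * (2 * π * |t| + (if |y i - round (y i)| ≤ |t| then 2 else 0)) * fejer J t := by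
            refine (norm_sum_le _ _).trans (sum_le_sum fun i hi => ?_)
            rw [norm_mul, norm_mul, norm_mul, norm_eC, mul_one, Complex.norm_real, norm_sub_rev,
              Real.norm_of_nonneg hfn, mul_assoc]
            gcongr
            · exact hz i hi
            · exact eFract_sub_sub h0 h1
        _ = W * (2 * π * #s * |t| + 2 * #(s.filter fun i => |y i - round (y i)| ≤ |t|)) * fejer J t := by
            rw [← sum_mul, ← mul_sum, sum_add_distrib, ← sum_filter, sum_const, sum_const]
            simp only [nsmul_eq_mul]; ring
        _ ≤ W * (2 * 3.5 * #s * |t| + 2 * (10 * #s * |t| + 5 / 2 * #s / J + 5 / 2 * E)) * fejer J t := by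
            have := Real.pi_lt_d2
            gcongr
            linarith
        _ = _ := by ring
    have hci : Continuous fun t : ℝ => |t| * fejer J t := continuous_abs.mul (continuous_fejer J)
    have hi5 : IntervalIntegrable (fun t => W * (27 * #s) * (|t| * fejer J t) +
        W * (5 * #s / J + 5 * E) * fejer J t) volume (-(1 / 2)) (1 / 2) :=
      ((continuous_const.mul hci).add (continuous_const.mul (continuous_fejer J))).intervalIntegrable _ _
    have h5 := intervalIntegral.norm_integral_le_of_norm_le (by norm_num : (-(1 / 2) : ℝ) ≤ 1 / 2)
      (Filter.Eventually.of_forall hb) hi5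
    refine h5.trans ?_
    rw [intervalIntegral.integral_add ((hci.intervalIntegrable _ _).const_mul _)
      (((continuous_fejer J).intervalIntegrable _ _).const_mul _),
      intervalIntegral.integral_const_mul, intervalIntegral.integral_const_mul,
      integral_fejer J (by omega), mul_one]
    have h6 := integral_abs_mul_fejer_le J hJ
    have hlog : 1 / 2 ≤ log J := by
      have := Real.log_two_gt_d9
      have : log 2 ≤ log J := Real.log_le_log (by norm_num) (by exact_mod_cast hJ)
      linarith
    have h7 : 5 * (#s : ℝ) / J ≤ 10 * #s * (log J / J) := by
      rw [div_eq_mul_inv, div_eq_mul_inv (log (J : ℝ))]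
      have : 0 ≤ 10 * (#s : ℝ) * (J : ℝ)⁻¹ := by positivity
      nlinarith
    have h8 : 0 ≤ (#s : ℝ) * (log J / J) := by positivity
    calc _ ≤ W * (27 * #s) * (4 * log J / J) + W * (10 * #s * (log J / J) + 5 * E) := by gcongr
      _ = W * (118 * (#s * (log J / J)) + 5 * E) := by ring
      _ ≤ _ := by gcongr ?_ * ?_; linarith
  have e : ∑ i ∈ s, z i * eC (⌊y i⌋ * α) = ∑ i ∈ s, z i * eC (α * y i) * G (y i) +
      ∑ i ∈ s, z i * eC (α * y i) * (eFract α (y i) - G (y i)) := by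
    rw [← sum_add_distrib]
    refine sum_congr rfl fun i _ => ?_
    rw [eC_floor_mul]; ring
  rw [e]
  exact (norm_add_le _ _).trans (add_le_add hmain herr)

/-- Third derivative test together with Kusmin--Landau, for monomials. -/
lemma sum_pow_bound {c : ℝ} (hc1 : 1 < c) (hc2 : c < 3) (hc3 : c ≠ 2) :
    ∃ C > 0, ∀ (θ M : ℝ) (a b : ℕ), θ ≠ 0 → 1 ≤ M → M ≤ a + 1 → (b : ℝ) ≤ 4 * M →
      ‖∑ n ∈ Ioc a b, eC (θ * (n : ℝ) ^ c)‖ ≤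
        C * (|θ| ^ (1 / 6 : ℝ) * M ^ (1 / 2 + c / 6) + M ^ (5 / 6 : ℝ)) + M ^ (1 - c) / |θ| := by
  obtain ⟨C, hC, H⟩ := vdC_pow (by norm_num) (by norm_num) vdCBound_three (by push_cast; linarith)
    (fallingCoeff_ne_zero hc1 hc2 hc3 3)
  refine ⟨C * (2 * (c * 5 ^ (c - 1)) + 1), by positivity, fun θ M a b hθ hM hMa hbM => ?_⟩
  have hM0 : 0 < M := by linarith
  have hθ' : 0 < |θ| := abs_pos.2 hθ
  set D := 2 * (c * (5 : ℝ) ^ (c - 1)) with hD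
  have hD1 : 0 < D := by positivity
  by_cases hs : |θ| * (c * (5 * M) ^ (c - 1)) ≤ 1 / 2
  · have h1 := kusmin_landau_pow hc1 hθ hM hMa hbM hs
    have : 0 ≤ C * (D + 1) * (|θ| ^ (1 / 6 : ℝ) * M ^ (1 / 2 + c / 6) + M ^ (5 / 6 : ℝ)) := by positivity
    linarith
  · push Not at hs
    have h1 := H θ M a b hθ hM hMa hbM
    have e1 : M * (|θ| * M ^ (c - (3 : ℕ))) ^ (1 / 6 : ℝ) = |θ| ^ (1 / 6 : ℝ) * M ^ (1 / 2 + c / 6) := by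
      rw [mul_rpow hθ'.le (by positivity), ← rpow_mul hM0.le]
      rw [show (1 / 2 + c / 6 : ℝ) = 1 + (c - (3 : ℕ)) * (1 / 6) by push_cast; ring, rpow_add hM0, rpow_one]
      ring
    have e2 : M ^ (1 - 1 / 2 : ℝ) * (|θ| * M ^ (c - (3 : ℕ))) ^ (-(1 / 6) : ℝ) ≤ (D + 1) * M ^ (5 / 6 : ℝ) := by
      rw [mul_rpow (by norm_num) hM0.le] at hs
      have h3 : D⁻¹ * M ^ (-2 : ℝ) ≤ |θ| * M ^ (c - (3 : ℕ)) := by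
        have e : M ^ (c - (3 : ℕ)) = M ^ (c - 1) * M ^ (-2 : ℝ) := by
          rw [← rpow_add hM0]; congr 1; push_cast; ring
        rw [e, ← mul_assoc]
        gcongr
        rw [inv_le_iff_one_le_mul₀ hD1]
        calc (1 : ℝ) ≤ 2 * (|θ| * (c * (5 ^ (c - 1) * M ^ (c - 1)))) := by linarith
          _ = _ := by rw [hD]; ring
      have h4 : (|θ| * M ^ (c - (3 : ℕ))) ^ (-(1 / 6) : ℝ) ≤ (D⁻¹ * M ^ (-2 : ℝ)) ^ (-(1 / 6) : ℝ) :=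
        rpow_le_rpow_of_nonpos (by positivity) h3 (by norm_num)
      have h5 : (D⁻¹ * M ^ (-2 : ℝ)) ^ (-(1 / 6) : ℝ) = D ^ (1 / 6 : ℝ) * M ^ (1 / 3 : ℝ) := by
        rw [mul_rpow (by positivity) (by positivity), inv_rpow hD1.le, ← rpow_neg hD1.le, ← rpow_mul hM0.le]
        norm_num
      have h6 : D ^ (1 / 6 : ℝ) ≤ D + 1 := by
        rcases le_total D 1 with h | h
        · have := rpow_le_one hD1.le h (by norm_num : (0 : ℝ) ≤ 1 / 6); linarith
        · have := rpow_le_rpow_of_exponent_le h (by norm_num : (1 / 6 : ℝ) ≤ 1)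
          rw [rpow_one] at this; linarith
      calc _ ≤ M ^ (1 - 1 / 2 : ℝ) * (D ^ (1 / 6 : ℝ) * M ^ (1 / 3 : ℝ)) := by rw [← h5]; gcongr
        _ = D ^ (1 / 6 : ℝ) * M ^ (5 / 6 : ℝ) := by
          rw [mul_left_comm, ← rpow_add hM0]; norm_num
        _ ≤ _ := by gcongr
    have h7 : 0 ≤ M ^ (1 - c) / |θ| := by positivity
    rw [e1] at h1
    have h8 : 0 ≤ |θ| ^ (1 / 6 : ℝ) * M ^ (1 / 2 + c / 6) := by positivity
    calc _ ≤ _ := h1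
      _ ≤ C * ((D + 1) * (|θ| ^ (1 / 6 : ℝ) * M ^ (1 / 2 + c / 6)) + (D + 1) * M ^ (5 / 6 : ℝ)) := by
        refine mul_le_mul_of_nonneg_left (add_le_add ?_ e2) hC.le
        nlinarith
      _ ≤ _ := by linarith

lemma sum_inv_one_add_le (J : ℕ) (hJ : 2 ≤ J) :
    ∑ h ∈ Ioo (-(J : ℤ)) J, 1 / (1 + |(h : ℝ)|) ≤ 8 * log J := by
  have h1 : Ioo (-(J : ℤ)) J ⊆ (range J).image (fun n : ℕ => (n : ℤ)) ∪ (range J).image (fun n : ℕ => -(n : ℤ)) := by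
    intro h hh
    rw [mem_Ioo] at hh
    rw [mem_union, mem_image, mem_image]
    rcases le_total 0 h with h0 | h0
    · left; exact ⟨h.toNat, by rw [mem_range]; omega, by omega⟩
    · right; exact ⟨(-h).toNat, by rw [mem_range]; omega, by omega⟩
  have hh : ∑ n ∈ range J, 1 / (1 + (n : ℝ)) ≤ 1 + log J := by
    have := harmonic_le_one_add_log J
    refine le_trans (le_of_eq ?_) this
    unfold harmonic; push_cast
    exact sum_congr rfl fun n _ => by rw [one_div, add_comm]
  have hlog : 1 / 2 ≤ log J := by
    have := Real.log_two_gt_d9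
    have : log 2 ≤ log J := Real.log_le_log (by norm_num) (by exact_mod_cast hJ)
    linarith
  calc _ ≤ ∑ h ∈ (range J).image (fun n : ℕ => (n : ℤ)) ∪ (range J).image (fun n : ℕ => -(n : ℤ)), 1 / (1 + |(h : ℝ)|) :=
        sum_le_sum_of_subset_of_nonneg h1 fun _ _ _ => by positivity
    _ ≤ ∑ h ∈ (range J).image (fun n : ℕ => (n : ℤ)), 1 / (1 + |(h : ℝ)|) +
        ∑ h ∈ (range J).image (fun n : ℕ => -(n : ℤ)), 1 / (1 + |(h : ℝ)|) := by
        rw [← sum_union_inter]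
        exact le_add_of_nonneg_right (sum_nonneg fun _ _ => by positivity)
    _ = 2 * ∑ n ∈ range J, 1 / (1 + (n : ℝ)) := by
        rw [sum_image (by intro a _ b _ h; simpa using h), sum_image (by intro a _ b _ h; simpa using h), two_mul]
        congr 1 <;> exact sum_congr rfl fun n _ => by simp
    _ ≤ _ := by linarith

lemma TT_fract (c X γ : ℝ) : TT c X γ = TT c X (Int.fract γ) := by
  unfold TT
  refine sum_congr rfl fun n _ => ?_
  rw [← eC_add_int _ (-(⌊(n : ℝ) ^ c⌋ * ⌊γ⌋))]
  congr 1
  push_cast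
  have := Int.floor_add_fract γ
  linear_combination -(⌊(n : ℝ) ^ c⌋ : ℝ) * this

lemma exists_log_le_rpow {δ : ℝ} (hδ : 0 < δ) : ∀ x : ℝ, 1 ≤ x → log x ≤ (1 / δ) * x ^ δ := by
  intro x hx
  have := Real.log_le_rpow_div (by linarith : 0 ≤ x) hδ
  linarith [this, (by ring : (1 / δ) * x ^ δ = x ^ δ / δ)]

lemma TT_bound {c : ℝ} (hc1 : 1 < c) (hc2 : c < 2.0551) (hc3 : c ≠ 2) :
    ∃ C > 0, ∀ X : ℝ, 1 ≤ X → ∀ γ : ℝ, 0 < γ → γ < 1 →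
      ‖TT c X γ‖ ≤ C * (X ^ (0.866 : ℝ) + X ^ (1 - c) / γ + X ^ (1 - c) / (1 - γ)) := by
  obtain ⟨C, hC, H⟩ := sum_pow_bound hc1 (by linarith) hc3
  refine ⟨1000000 * (1 + C), by positivity, fun X hX γ h0 h1 => ?_⟩
  have hX0 : 0 < X := by linarith
  set a := ⌊X⌋₊
  set b := ⌊2 * X⌋₊
  have hMa : X ≤ a + 1 := (Nat.lt_floor_add_one X).le
  have hbM : (b : ℝ) ≤ 2 * X := Nat.floor_le (by positivity)
  set J := ⌈X ^ (0.1345 : ℝ)⌉₊ + 1 with hJd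
  have hp1 : 1 ≤ X ^ (0.1345 : ℝ) := one_le_rpow hX (by norm_num)
  have hJ2 : 2 ≤ J := by
    have : 0 < ⌈X ^ (0.1345 : ℝ)⌉₊ := Nat.ceil_pos.2 (by linarith)
    omega
  have hJge : X ^ (0.1345 : ℝ) ≤ J := by
    have := Nat.le_ceil (X ^ (0.1345 : ℝ))
    rw [hJd]; push_cast; linarith
  have hJle : (J : ℝ) ≤ 3 * X ^ (0.1345 : ℝ) := by
    have := Nat.ceil_lt_add_one (by linarith : 0 ≤ X ^ (0.1345 : ℝ))
    rw [hJd]; push_cast; linarith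
  have hJ0 : (0 : ℝ) < J := by linarith
  have hlogJ : log J ≤ 1500 * X ^ (0.0005 : ℝ) := by
    have h2 := exists_log_le_rpow (by norm_num : (0 : ℝ) < 0.002) J (by linarith)
    have h3 : (J : ℝ) ^ (0.002 : ℝ) ≤ 3 * X ^ (0.0005 : ℝ) := by
      calc (J : ℝ) ^ (0.002 : ℝ) ≤ (3 * X ^ (0.1345 : ℝ)) ^ (0.002 : ℝ) := rpow_le_rpow hJ0.le hJle (by norm_num)
        _ = 3 ^ (0.002 : ℝ) * X ^ (0.1345 * 0.002 : ℝ) := by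
          rw [mul_rpow (by norm_num) (by positivity), ← rpow_mul hX0.le]
        _ ≤ 3 ^ (1 : ℝ) * X ^ (0.0005 : ℝ) := by
          gcongr <;> norm_num
        _ = _ := by rw [rpow_one]
    linarith
  have hlogJ0 : 0 ≤ log J := Real.log_natCast_nonneg J
  have key : ∀ θ : ℝ, θ ≠ 0 → |θ| ≤ J → ‖∑ n ∈ Ioc a b, eC (θ * (n : ℝ) ^ c)‖ ≤
      4 * C * X ^ (0.8655 : ℝ) + X ^ (1 - c) / |θ| := by
    intro θ hθ hθJ
    refine (H θ X a b hθ hX hMa (by linarith)).trans ?_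
    have h2 : |θ| ^ (1 / 6 : ℝ) ≤ 3 * X ^ (0.0225 : ℝ) := by
      calc |θ| ^ (1 / 6 : ℝ) ≤ (3 * X ^ (0.1345 : ℝ)) ^ (1 / 6 : ℝ) :=
            rpow_le_rpow (abs_nonneg _) (hθJ.trans hJle) (by norm_num)
        _ = 3 ^ (1 / 6 : ℝ) * X ^ (0.1345 * (1 / 6) : ℝ) := by
          rw [mul_rpow (by norm_num) (by positivity), ← rpow_mul hX0.le]
        _ ≤ 3 ^ (1 : ℝ) * X ^ (0.0225 : ℝ) := by
          gcongr <;> norm_num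
        _ = _ := by rw [rpow_one]
    have h3 : X ^ (0.0225 : ℝ) * X ^ (1 / 2 + c / 6) ≤ X ^ (0.8655 : ℝ) := by
      rw [← rpow_add hX0]
      exact rpow_le_rpow_of_exponent_le hX (by linarith)
    have h4 : X ^ (5 / 6 : ℝ) ≤ X ^ (0.8655 : ℝ) := rpow_le_rpow_of_exponent_le hX (by norm_num)
    have h5 : |θ| ^ (1 / 6 : ℝ) * X ^ (1 / 2 + c / 6) ≤ 3 * X ^ (0.8655 : ℝ) := by
      calc _ ≤ 3 * X ^ (0.0225 : ℝ) * X ^ (1 / 2 + c / 6) := by gcongr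
        _ = 3 * (X ^ (0.0225 : ℝ) * X ^ (1 / 2 + c / 6)) := by ring
        _ ≤ _ := by gcongr
    have := mul_le_mul_of_nonneg_left (add_le_add h5 h4) hC.le
    linarith
  set R := X ^ (0.8655 : ℝ) with hR
  have hR1 : 1 ≤ R := one_le_rpow hX (by norm_num)
  have hXc : X ^ (1 - c) ≤ 1 := rpow_le_one_of_one_le_of_nonpos hX (by linarith)
  have hXc0 : 0 < X ^ (1 - c) := by positivity
  have key1 : ∀ θ : ℝ, 1 ≤ |θ| → |θ| ≤ J → ‖∑ n ∈ Ioc a b, eC (θ * (n : ℝ) ^ c)‖ ≤ 4 * C * R + 1 := by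
    intro θ hθ hθJ
    refine (key θ (by intro h; subst h; norm_num at hθ) hθJ).trans ?_
    have : X ^ (1 - c) / |θ| ≤ 1 := by rw [div_le_one (by linarith)]; linarith
    linarith
  have hF := floor_sum_le (Ioc a b) (fun n : ℕ => (n : ℝ) ^ c) (fun _ => 1) 1 (by simp) (by norm_num) h0.le h1.le
    (4 * C * R + 1) J hJ2 (by positivity) (by
      intro h hh
      obtain ⟨hh1, hh2⟩ := mem_Ico.1 hh
      have hh1' : (1 : ℝ) ≤ h := by exact_mod_cast hh1
      have hh2' : (h : ℝ) ≤ J := by exact_mod_cast hh2.le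
      refine key1 h ?_ ?_ <;> rw [abs_of_nonneg (by linarith)] <;> assumption)
  simp only [one_mul] at hF
  have hS : ∑ h ∈ Ioo (-(J : ℤ)) J, 1 / (1 + |(h : ℝ)|) * ‖∑ n ∈ Ioc a b, eC ((h + γ) * (n : ℝ) ^ c)‖ ≤
      (4 * C * R + 1) * (8 * log J) + X ^ (1 - c) / γ + X ^ (1 - c) / (1 - γ) := by
    calc _ ≤ ∑ h ∈ Ioo (-(J : ℤ)) J, ((4 * C * R + 1) * (1 / (1 + |(h : ℝ)|)) +
          (if h = 0 then X ^ (1 - c) / γ else 0) + (if h = -1 then X ^ (1 - c) / (1 - γ) else 0)) := by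
          refine sum_le_sum fun h hh => ?_
          obtain ⟨hh1, hh2⟩ := mem_Ioo.1 hh
          have hh1' : -(J : ℝ) + 1 ≤ h := by exact_mod_cast (by omega : -(J : ℤ) + 1 ≤ h)
          have hh2' : (h : ℝ) ≤ J - 1 := by exact_mod_cast (by omega : h ≤ (J : ℤ) - 1)
          have hJa : |(h : ℝ) + γ| ≤ J := abs_le.2 ⟨by linarith, by linarith⟩
          rcases eq_or_ne h 0 with rfl | hn0
          · have := key γ h0.ne' (by simpa using hJa)
            rw [abs_of_pos h0] at this
            simp; linarith
          · rcases eq_or_ne h (-1) with rfl | hn1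
            · have := key (-1 + γ) (by linarith) (by simpa using hJa)
              rw [abs_of_neg (by linarith), show -(-1 + γ) = 1 - γ by ring] at this
              have h5 : 0 < X ^ (1 - c) / (1 - γ) := by have : 0 < 1 - γ := by linarith
                                                        positivity
              simp only [Int.reduceNeg, Int.cast_neg, Int.cast_one, abs_neg, abs_one, if_true]
              norm_num
              have : 0 ≤ C * R := by positivity
              linarith
            · have hb : 1 ≤ |(h : ℝ) + γ| := by
                rcases lt_or_gt_of_ne hn0 with h6 | h6
                · have : (h : ℝ) ≤ -2 := by exact_mod_cast (by omega : h ≤ -2)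
                  rw [abs_of_neg (by linarith)]; linarith
                · have : (1 : ℝ) ≤ h := by exact_mod_cast (by omega : 1 ≤ h)
                  rw [abs_of_pos (by linarith)]; linarith
              have := key1 _ hb hJa
              rw [if_neg hn0, if_neg hn1, add_zero, add_zero, mul_comm]
              gcongr
      _ ≤ _ := by
          rw [sum_add_distrib, sum_add_distrib, ← mul_sum, sum_ite_eq', sum_ite_eq']
          have := sum_inv_one_add_le J hJ2
          have h5 : 0 < X ^ (1 - c) / γ := by positivity
          have h6 : 0 < X ^ (1 - c) / (1 - γ) := by have : 0 < 1 - γ := by linarith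
                                                    positivity
          refine add_le_add (add_le_add (by gcongr) ?_) ?_ <;> split_ifs <;> linarith
  have hcard : (#(Ioc a b) : ℝ) ≤ 2 * X := by
    rw [Nat.card_Ioc]
    exact le_trans (by exact_mod_cast Nat.sub_le _ _) hbM
  have hfl : (#(Ioc a b) : ℝ) * (log J / J) ≤ 2 * R * log J := by
    have : X / J ≤ R := by
      rw [div_le_iff₀ hJ0]
      calc X = R * X ^ (0.1345 : ℝ) := by rw [hR, ← rpow_add hX0]; norm_num
        _ ≤ _ := by gcongr
    calc _ ≤ 2 * X * (log J / J) := by gcongr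
      _ = 2 * (X / J) * log J := by ring
      _ ≤ _ := by gcongr
  have hRl : R * log J ≤ 1500 * X ^ (0.866 : ℝ) := by
    have : R * X ^ (0.0005 : ℝ) = X ^ (0.866 : ℝ) := by rw [hR, ← rpow_add hX0]; norm_num
    calc _ ≤ R * (1500 * X ^ (0.0005 : ℝ)) := by gcongr
      _ = _ := by rw [← this]; ring
  have hRX : R ≤ X ^ (0.866 : ℝ) := rpow_le_rpow_of_exponent_le hX (by norm_num)
  have hTT : TT c X γ = ∑ n ∈ Ioc a b, eC (⌊(n : ℝ) ^ c⌋ * γ) := rfl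
  rw [hTT]
  set V := X ^ (0.866 : ℝ)
  have g1 : 0 < X ^ (1 - c) / γ := by positivity
  have g2 : 0 < X ^ (1 - c) / (1 - γ) := by have : 0 < 1 - γ := by linarith
                                            positivity
  have hl2 : log J ≤ R * log J := by nlinarith
  calc _ ≤ _ := hF
    _ ≤ 2 * ((4 * C * R + 1) * (8 * log J) + X ^ (1 - c) / γ + X ^ (1 - c) / (1 - γ)) +
        (120 * (2 * R * log J) + 5 * (4 * C * R + 1)) := by
        have := mul_le_mul_of_nonneg_left hfl (by norm_num : (0 : ℝ) ≤ 120)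
        linarith
    _ = 64 * C * (R * log J) + 16 * log J + 240 * (R * log J) + 20 * C * R + 5 +
        2 * (X ^ (1 - c) / γ) + 2 * (X ^ (1 - c) / (1 - γ)) := by ring
    _ ≤ 64 * C * (1500 * V) + 16 * (1500 * V) + 240 * (1500 * V) + 20 * C * V + 5 * V +
        2 * (X ^ (1 - c) / γ) + 2 * (X ^ (1 - c) / (1 - γ)) := by
        gcongr <;> linarith
    _ ≤ _ := by
        have hV : 0 < V := by linarith
        have : 0 < C * V := by positivity
        have : 0 < C * (X ^ (1 - c) / γ) := by positivity
        have : 0 < C * (X ^ (1 - c) / (1 - γ)) := by positivity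
        linarith

lemma vdC_pow_log {c κ ρ C : ℝ} {k : ℕ}
    (H : ∀ (t M : ℝ) (a b : ℕ), t ≠ 0 → 1 ≤ M → M ≤ a + 1 → (b : ℝ) ≤ 4 * M →
      ‖∑ n ∈ Ioc a b, eC (t * (n : ℝ) ^ c)‖ ≤
        C * (M * (|t| * M ^ (c - k)) ^ κ + M ^ (1 - ρ) * (|t| * M ^ (c - k)) ^ (-κ)))
    (hC : 0 < C) (t M : ℝ) (a b : ℕ) (ht : t ≠ 0) (hM : 1 ≤ M) (hMa : M ≤ a + 1) (hb : (b : ℝ) ≤ 4 * M)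
    (g n δ D : ℝ) (hg : g = log |t| + c * log M) (h1 : κ * (g - k * log M) ≤ D - δ * n)
    (h2 : -ρ * log M - κ * (g - k * log M) ≤ D - δ * n) :
    ‖∑ n ∈ Ioc a b, eC (t * (n : ℝ) ^ c)‖ ≤ 2 * C * exp D * (M * exp (-(δ * n))) := by
  have hM0 : 0 < M := by linarith
  have ht0 : 0 < |t| := abs_pos.2 ht
  have e : |t| * M ^ (c - k) = exp (g - k * log M) := by
    rw [rpow_def_of_pos hM0]
    nth_rewrite 1 [← exp_log ht0]
    rw [← exp_add, hg]; congr 1; ring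
  refine (H t M a b ht hM hMa hb).trans ?_
  rw [e, ← exp_mul, ← exp_mul]
  have e3 : M ^ (1 - ρ) = M * exp (-ρ * log M) := by
    rw [rpow_sub hM0, rpow_one, rpow_def_of_pos hM0, div_eq_mul_inv, ← exp_neg]; congr 2; ring
  rw [e3, mul_assoc M, ← exp_add]
  have i1 : exp ((g - k * log M) * κ) ≤ exp D * exp (-(δ * n)) := by
    rw [← exp_add]; exact exp_le_exp.2 (by linarith)
  have i2 : exp (-ρ * log M + (g - k * log M) * -κ) ≤ exp D * exp (-(δ * n)) := by
    rw [← exp_add]; exact exp_le_exp.2 (by linarith)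
  calc _ ≤ C * (M * (exp D * exp (-(δ * n))) + M * (exp D * exp (-(δ * n)))) := by gcongr
    _ = _ := by ring

/-- Cancellation in the sums over the long variable after Weyl differencing. -/
lemma shifted_sum_bound {c : ℝ} (hc1 : 1 < c) (hc2 : c < 2.0551) (hc3 : c ≠ 2) :
    ∃ C > 0, ∀ (N M K q θ t : ℝ) (a b : ℕ), 1 ≤ N → 1 ≤ K → K ≤ M → N ≤ 4 * (M * K) → M * K ≤ 3 * N →
      N ^ (-(c - 1) - 0.02) ≤ |θ| → |θ| ≤ 2 * N ^ (0.0155 : ℝ) → 1 ≤ q → q ≤ 2 * N ^ (0.0294 : ℝ) →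
      |θ| * q * K ^ (c - 1) ≤ |t| → |t| ≤ 100 * (|θ| * q * K ^ (c - 1)) →
      M ≤ a + 1 → (b : ℝ) ≤ 4 * M →
      ‖∑ n ∈ Ioc a b, eC (t * (n : ℝ) ^ c)‖ ≤ C * (M * N ^ (-0.0294 : ℝ)) := by
  have hf := fun k => fallingCoeff_ne_zero hc1 (by linarith) hc3 k
  obtain ⟨C3, hC3, H3⟩ := vdC_pow (by norm_num) (by norm_num) vdCBound_three (by push_cast; linarith) (hf 3)
  obtain ⟨C4, hC4, H4⟩ := vdC_pow (by norm_num) (by norm_num) vdCBound_four (by push_cast; linarith) (hf 4)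
  obtain ⟨C5, hC5, H5⟩ := vdC_pow (by norm_num) (by norm_num) vdCBound_five (by push_cast; linarith) (hf 5)
  set D := 10 + 10 * log 100 with hD
  refine ⟨2 * C3 * exp D + 2 * C4 * exp D + 2 * C5 * exp D, by positivity, ?_⟩
  intro N M K q θ t a b hN hK hKM hN4 hMK hθ1 hθ2 hq1 hq2 ht1 ht2 hMa hbM
  have hN0 : 0 < N := by linarith
  have hK0 : 0 < K := by linarith
  have hM1 : 1 ≤ M := by linarith
  have hM0 : 0 < M := by linarith
  have hq0 : 0 < q := by linarith
  have hθ0 : 0 < |θ| := lt_of_lt_of_le (by positivity) hθ1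
  have ht0 : 0 < |t| := lt_of_lt_of_le (by positivity) ht1
  have ht : t ≠ 0 := abs_pos.1 ht0
  have lN := Real.log_nonneg hN
  have lK := Real.log_nonneg hK
  have lq := Real.log_nonneg hq1
  have l1 := Real.log_le_log hK0 hKM
  have l2 := Real.log_le_log hN0 hN4
  have l3 := Real.log_le_log (by positivity) hMK
  have l4 := Real.log_le_log (by positivity) hθ1
  have l5 := Real.log_le_log hθ0 hθ2
  have l6 := Real.log_le_log hq0 hq2
  have l7 := Real.log_le_log (by positivity) ht1
  have l8 := Real.log_le_log ht0 ht2
  rw [log_mul (by norm_num) (by positivity), log_mul hM0.ne' hK0.ne'] at l2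
  rw [log_mul hM0.ne' hK0.ne', log_mul (by norm_num) (by positivity)] at l3
  rw [log_rpow hN0] at l4
  rw [log_mul (by norm_num) (by positivity), log_rpow hN0] at l5 l6
  rw [log_mul (by positivity) (by positivity), log_mul hθ0.ne' hq0.ne', log_rpow hK0] at l7
  rw [log_mul (by positivity) (by positivity), log_mul (by positivity) (by positivity), log_mul hθ0.ne' hq0.ne',
    log_rpow hK0] at l8
  have hl0 : 0 ≤ log 100 := Real.log_nonneg (by norm_num)
  have m4 : log 4 ≤ log 100 := Real.log_le_log (by norm_num) (by norm_num)
  have m3 : log 3 ≤ log 100 := Real.log_le_log (by norm_num) (by norm_num)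
  have m2 : log 2 ≤ log 100 := Real.log_le_log (by norm_num) (by norm_num)
  set n := log N
  set m := log M
  set k := log K
  set v := log |θ|
  set w := log q
  set T := log |t|
  set l := log 100
  have eN : N ^ (-0.0294 : ℝ) = exp (-(0.0294 * n)) := by
    rw [rpow_def_of_pos hN0]; congr 1; ring
  rw [eN]
  have hY : 0 < M * exp (-(0.0294 * n)) := by positivity
  obtain ⟨g, hg⟩ : ∃ g, g = T + c * m := ⟨_, rfl⟩
  have p1 : c * n ≤ c * (l + m + k) := mul_le_mul_of_nonneg_left (by linarith) (by linarith)
  have p2 : c * (m + k) ≤ c * (l + n) := mul_le_mul_of_nonneg_left (by linarith) (by linarith)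
  have p3 : c * l ≤ 2.0551 * l := mul_le_mul_of_nonneg_right hc2.le hl0
  have p4 : c * n ≤ 2.0551 * n := mul_le_mul_of_nonneg_right hc2.le lN
  have glo : 0.98 * n - k - 3 * l ≤ g := by rw [hg]; linarith
  have ghi : g ≤ 2.1 * n - k + 6 * l := by rw [hg]; linarith
  have wide : ∀ A B E : ℝ, 0 ≤ A → 0 ≤ B → 0 ≤ E → ∀ x, (x ≤ 2 * A * exp D * (M * exp (-(0.0294 * n))) ∨
      x ≤ 2 * B * exp D * (M * exp (-(0.0294 * n))) ∨ x ≤ 2 * E * exp D * (M * exp (-(0.0294 * n)))) →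
      x ≤ (2 * A * exp D + 2 * B * exp D + 2 * E * exp D) * (M * exp (-(0.0294 * n))) := by
    intro A B E hA hB hE x hx
    have : 0 ≤ 2 * A * exp D * (M * exp (-(0.0294 * n))) := by positivity
    have : 0 ≤ 2 * B * exp D * (M * exp (-(0.0294 * n))) := by positivity
    have : 0 ≤ 2 * E * exp D * (M * exp (-(0.0294 * n))) := by positivity
    rcases hx with h | h | h <;> linarith
  refine wide C3 C4 C5 hC3.le hC4.le hC5.le _ ?_
  rcases le_total g (3 * m - 6 * 0.0294 * n) with c3 | c3
  · left
    refine vdC_pow_log H3 hC3 t M a b ht hM1 hMa hbM g n 0.0294 D hg ?_ ?_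
    · push_cast; linarith
    · push_cast; linarith
  · right
    rcases le_total g (4 * m - 14 * 0.0294 * n) with c4 | c4
    · left
      refine vdC_pow_log H4 hC4 t M a b ht hM1 hMa hbM g n 0.0294 D hg ?_ ?_
      · push_cast; linarith
      · push_cast; linarith
    · right
      have ghi' : g ≤ (2.0551 + 0.0155 + 0.0294) * n - k + 6 * l := by rw [hg]; linarith
      refine vdC_pow_log H5 hC5 t M a b ht hM1 hMa hbM g n 0.0294 D hg ?_ ?_
      · push_cast; linarith
      · push_cast; linarith

lemma sum_Ico_zero_int {E : Type*} [AddCommMonoid E] (L : ℕ) (F : ℤ → E) :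
    ∑ n ∈ Ico (0 : ℤ) L, F n = ∑ n ∈ range L, F n := by
  have : Ico (0 : ℤ) L = (range L).image (fun n : ℕ => (n : ℤ)) := by
    ext h
    rw [mem_Ico, mem_image]
    constructor
    · rintro ⟨h0, h1⟩; exact ⟨h.toNat, by rw [mem_range]; omega, by omega⟩
    · rintro ⟨n, hn, rfl⟩; rw [mem_range] at hn; omega
  rw [this, sum_image (by intro a _ b _ h; simpa using h)]

lemma rpow_diff_bounds {c x q : ℝ} (hc1 : 1 < c) (hx : 0 < x) (hq : 0 < q) :
    q * x ^ (c - 1) ≤ (x + q) ^ c - x ^ c ∧ (x + q) ^ c - x ^ c ≤ c * q * (x + q) ^ (c - 1) := by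
  obtain ⟨ξ, hξ, he⟩ := exists_deriv_eq_slope (fun y : ℝ => y ^ c) (by linarith : x < x + q)
    (continuousOn_id.rpow_const fun y _ => Or.inr (by linarith))
    (fun y hy => (Real.hasDerivAt_rpow_const (Or.inr hc1.le)).differentiableAt.differentiableWithinAt)
  rw [(Real.hasDerivAt_rpow_const (Or.inr hc1.le)).deriv, add_sub_cancel_left, eq_div_iff hq.ne'] at he
  rw [← he]
  have h1 : x ^ (c - 1) ≤ ξ ^ (c - 1) := rpow_le_rpow hx.le hξ.1.le (by linarith)
  have h2 : ξ ^ (c - 1) ≤ (x + q) ^ (c - 1) := rpow_le_rpow (by linarith [hξ.1]) hξ.2.le (by linarith)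
  have h3 : 0 < x ^ (c - 1) := by positivity
  constructor
  · nlinarith [mul_pos hq h3, mul_le_mul_of_nonneg_left h1 hq.le]
  · have : c * ξ ^ (c - 1) * q = c * q * ξ ^ (c - 1) := by ring
    rw [this]; gcongr

lemma bilinear_block {c : ℝ} (hc1 : 1 < c) (hc2 : c < 2.0551) (hc3 : c ≠ 2) :
    ∃ C > 0, ∀ (N N' M K : ℕ) (θ : ℝ) (β : ℕ → ℂ), 1 ≤ N → N' ≤ 3 * N → 1 ≤ K → K ≤ M → N ≤ 4 * (M * K) →
      M * K ≤ 3 * N → (N : ℝ) ^ (0.0294 : ℝ) ≤ 2 * K →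
      (N : ℝ) ^ (-(c - 1) - 0.02) ≤ |θ| → |θ| ≤ 2 * (N : ℝ) ^ (0.0155 : ℝ) → (∀ n, K ≤ n → β n = 0) →
      ∑ m ∈ Ioc M (2 * M), ‖∑ n ∈ range K, (if N < m * (K + 1 + n) ∧ m * (K + 1 + n) ≤ N' then
        β n * eC (θ * ((m * (K + 1 + n) : ℕ) : ℝ) ^ c) else 0)‖ ^ 2 ≤
        C * ((N : ℝ) ^ (1 - 0.0294 : ℝ) * ∑ n ∈ range K, ‖β n‖ ^ 2) := by
  obtain ⟨C, hC, H⟩ := shifted_sum_bound hc1 hc2 hc3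
  refine ⟨15 * (1 + 4 * C), by positivity, ?_⟩
  intro N N' M K θ β hN hN' hK hKM hN4 hMK hNK hθ1 hθ2 hβ
  have hNr : (1 : ℝ) ≤ N := by exact_mod_cast hN
  have hKr : (1 : ℝ) ≤ K := by exact_mod_cast hK
  have hKMr : (K : ℝ) ≤ M := by exact_mod_cast hKM
  have hN4r : (N : ℝ) ≤ 4 * (M * K) := by exact_mod_cast hN4
  have hMKr : (M : ℝ) * K ≤ 3 * N := by exact_mod_cast hMK
  have hN0 : (0 : ℝ) < N := by linarith
  have hθ0 : 0 < |θ| := lt_of_lt_of_le (by positivity) hθ1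
  set δN := (N : ℝ) ^ (0.0294 : ℝ) with hδN
  have hδ1 : 1 ≤ δN := one_le_rpow hNr (by norm_num)
  set Q := ⌈δN⌉₊ with hQd
  have hQ1 : 1 ≤ Q := Nat.one_le_ceil_iff.2 (by linarith)
  have hQge : δN ≤ Q := Nat.le_ceil _
  have hQle : (Q : ℝ) ≤ 2 * δN := by
    have := Nat.ceil_lt_add_one (by linarith : 0 ≤ δN); linarith
  set S := ∑ n ∈ range K, ‖β n‖ ^ 2 with hS
  have hS0 : 0 ≤ S := sum_nonneg fun _ _ => by positivity
  set g : ℕ → ℕ → ℂ := fun m n => if N < m * (K + 1 + n) ∧ m * (K + 1 + n) ≤ N' then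
        β n * eC (θ * ((m * (K + 1 + n) : ℕ) : ℝ) ^ c) else 0 with hg
  set z : ℕ → ℤ → ℂ := fun m j => if 0 ≤ j then g m j.toNat else 0 with hz
  have hzn : ∀ m (n : ℕ), z m n = g m n := by intro m n; simp [hz]
  have hshift : ∀ q : ℕ, ∑ n ∈ range K, ‖β (n + q)‖ ^ 2 ≤ S := by
    intro q
    have e1 : ∑ n ∈ range K, ‖β (n + q)‖ ^ 2 ≤ ∑ n ∈ range (K + q), ‖β n‖ ^ 2 := by
      rw [add_comm K q, sum_range_add]
      have : 0 ≤ ∑ n ∈ range q, ‖β n‖ ^ 2 := sum_nonneg fun _ _ => by positivity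
      simp_rw [add_comm _ q]; linarith
    refine e1.trans (le_of_eq ?_)
    rw [sum_range_add, sum_eq_zero (s := range q) (fun n _ => by rw [hβ _ (by omega)]; simp), add_zero]
  set Y := (N : ℝ) ^ (-0.0294 : ℝ) with hY
  have hY0 : 0 < Y := by positivity
  have hδY : δN * Y = 1 := by rw [hδN, hY, ← rpow_add hN0]; norm_num
  set B : ℕ → ℝ := fun q => if q = 0 then M * S else C * (M * Y) * S with hB
  have hgz : ∀ m n, ‖g m n‖ ≤ ‖β n‖ := by
    intro m n
    simp only [hg]; split_ifs
    · rw [norm_mul, norm_eC, mul_one]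
    · simp
  have hBq : ∀ q < Q, ‖∑ m ∈ Ioc M (2 * M), ∑ n ∈ Ico (0 : ℤ) K, z m (n + q) * (starRingEnd ℂ) (z m n)‖ ≤ B q := by
    intro q hq
    simp_rw [sum_Ico_zero_int]
    have e0 : ∀ m (n : ℕ), z m ((n : ℤ) + q) * (starRingEnd ℂ) (z m n) = g m (n + q) * (starRingEnd ℂ) (g m n) := by
      intro m n
      rw [hzn, ← hzn m (n + q)]; push_cast; rfl
    simp_rw [e0]
    rcases eq_or_ne q 0 with rfl | hq0
    · simp only [hB, if_true, add_zero]
      refine (norm_sum_le _ _).trans ?_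
      calc _ ≤ ∑ m ∈ Ioc M (2 * M), S := by
            refine sum_le_sum fun m _ => (norm_sum_le _ _).trans (sum_le_sum fun n _ => ?_)
            rw [norm_mul, RCLike.norm_conj, ← sq]
            exact pow_le_pow_left₀ (norm_nonneg _) (hgz m n) 2
        _ = _ := by simp [two_mul]
    · simp only [hB, if_neg hq0]
      have hq1 : (1 : ℝ) ≤ q := by exact_mod_cast Nat.one_le_iff_ne_zero.2 hq0
      have hq2 : (q : ℝ) ≤ 2 * δN := le_trans (by exact_mod_cast hq.le) hQle
      rw [sum_comm]
      have hin : ∀ n ∈ range K, ‖∑ m ∈ Ioc M (2 * M), g m (n + q) * (starRingEnd ℂ) (g m n)‖ ≤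
          C * (M * Y) * ((‖β (n + q)‖ ^ 2 + ‖β n‖ ^ 2) / 2) := by
        intro n hn
        rw [mem_range] at hn
        have hCM : 0 ≤ C * (M * Y) := by positivity
        by_cases hnq : K ≤ n + q
        · rw [sum_eq_zero (fun m _ => by simp [hg, hβ _ hnq]), norm_zero]; positivity
        push Not at hnq
        set k := K + 1 + n with hk
        have hk0 : 0 < k := by omega
        have e1 : ∀ m ∈ Ioc M (2 * M), g m (n + q) * (starRingEnd ℂ) (g m n) =
            if m ∈ Ioc (max M (N / k)) (min (2 * M) (N' / (k + q))) then
              β (n + q) * (starRingEnd ℂ) (β n) * eC (θ * (((k + q : ℕ) : ℝ) ^ c - (k : ℝ) ^ c) * (m : ℝ) ^ c) else 0 := by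
          intro m hm
          rw [mem_Ioc] at hm
          have i1 : max M (N / k) < m ↔ N < m * k := by
            rw [max_lt_iff, Nat.div_lt_iff_lt_mul hk0]; tauto
          have i2 : m ≤ min (2 * M) (N' / (k + q)) ↔ m * (k + q) ≤ N' := by
            rw [le_min_iff, Nat.le_div_iff_mul_le (by omega)]; tauto
          simp only [mem_Ioc, i1, i2, hg]
          rw [show K + 1 + (n + q) = k + q by omega, ← hk]
          have i3 : m * k ≤ m * (k + q) := Nat.mul_le_mul_left _ (by omega)
          by_cases h : N < m * k ∧ m * (k + q) ≤ N'
          · rw [if_pos h, if_pos ⟨by omega, h.2⟩, if_pos ⟨h.1, by omega⟩, map_mul, conj_eC, mul_mul_mul_comm, ← eC_add]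
            congr 2
            push_cast
            rw [mul_rpow (by positivity) (by positivity), mul_rpow (by positivity) (by positivity)]
            ring
          · rw [if_neg h]
            by_cases h1 : N < m * k
            · rw [if_neg (c := N < m * (k + q) ∧ _) (fun h2 => h ⟨h1, h2.2⟩), zero_mul]
            · rw [if_neg (c := N < m * k ∧ _) (fun h2 => h1 h2.1), map_zero, mul_zero]
        rw [sum_congr rfl e1, ← sum_filter, filter_mem_eq_inter, inter_eq_right.2, ← mul_sum, norm_mul, norm_mul,
          RCLike.norm_conj]
        swap
        · intro m hm
          rw [mem_Ioc] at hm ⊢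
          exact ⟨lt_of_le_of_lt (le_max_left _ _) hm.1, hm.2.trans (min_le_left _ _)⟩
        have hkr : (K : ℝ) ≤ k := by exact_mod_cast (by omega : K ≤ k)
        have hkq : (k : ℝ) + q ≤ 2 * K := by exact_mod_cast (by omega : k + q ≤ 2 * K)
        obtain ⟨d1, d2⟩ := rpow_diff_bounds (x := k) (q := q) hc1 (by linarith) (by linarith)
        have hd0 : 0 < ((k : ℝ) + q) ^ c - (k : ℝ) ^ c := lt_of_lt_of_le (by have : (0 : ℝ) < k := by linarith
                                                                             positivity) d1
        have habs : |θ * (((k + q : ℕ) : ℝ) ^ c - (k : ℝ) ^ c)| = |θ| * (((k : ℝ) + q) ^ c - (k : ℝ) ^ c) := by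
          push_cast; rw [abs_mul, abs_of_pos hd0]
        have hb := H N M K q θ (θ * (((k + q : ℕ) : ℝ) ^ c - (k : ℝ) ^ c)) (max M (N / k)) (min (2 * M) (N' / (k + q)))
          hNr hKr hKMr hN4r hMKr hθ1 hθ2 hq1 hq2 (by
            rw [habs, mul_assoc]
            refine mul_le_mul_of_nonneg_left (le_trans ?_ d1) hθ0.le
            gcongr) (by
            rw [habs, mul_assoc |θ|, mul_left_comm]
            refine mul_le_mul_of_nonneg_left (d2.trans ?_) hθ0.le
            have j1 : ((k : ℝ) + q) ^ (c - 1) ≤ 4 * K ^ (c - 1) := by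
              calc _ ≤ (2 * (K : ℝ)) ^ (c - 1) := rpow_le_rpow (by positivity) hkq (by linarith)
                _ = 2 ^ (c - 1) * (K : ℝ) ^ (c - 1) := mul_rpow (by norm_num) (by positivity)
                _ ≤ 2 ^ (2 : ℝ) * (K : ℝ) ^ (c - 1) := by
                  gcongr
                  · norm_num
                  · linarith
                _ = _ := by norm_num
            calc c * q * ((k : ℝ) + q) ^ (c - 1) ≤ 3 * q * (4 * K ^ (c - 1)) := by gcongr; linarith
              _ ≤ _ := by
                have : 0 ≤ q * (K : ℝ) ^ (c - 1) := by positivity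
                linarith) (by
            have : M ≤ max M (N / k) := le_max_left _ _
            have : (M : ℝ) ≤ (max M (N / k) : ℕ) := by exact_mod_cast this
            linarith) (by
            have : min (2 * M) (N' / (k + q)) ≤ 2 * M := min_le_left _ _
            have : ((min (2 * M) (N' / (k + q)) : ℕ) : ℝ) ≤ 2 * M := by exact_mod_cast this
            have : (0 : ℝ) ≤ M := by positivity
            linarith)
        have am : ‖β (n + q)‖ * ‖β n‖ ≤ (‖β (n + q)‖ ^ 2 + ‖β n‖ ^ 2) / 2 := by
          nlinarith [sq_nonneg (‖β (n + q)‖ - ‖β n‖)]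
        calc _ ≤ ((‖β (n + q)‖ ^ 2 + ‖β n‖ ^ 2) / 2) * (C * (M * Y)) := by gcongr
          _ = _ := by ring
      refine (norm_sum_le _ _).trans ((sum_le_sum hin).trans ?_)
      rw [← mul_sum, ← sum_div, sum_add_distrib]
      have := hshift q
      gcongr
      linarith
  have hW := weyl_vdc (Ioc M (2 * M)) z K Q hQ1 (by
    intro m _ j hj
    simp only [hz]
    split_ifs with h0
    · have : K ≤ j.toNat := by omega
      simp [hg, hβ _ this]
    · rfl) B hBq
  simp_rw [sum_Ico_zero_int, hzn] at hW
  have hBs : B 0 + 2 * ∑ q ∈ Ico 1 Q, B q ≤ (1 + 4 * C) * (M * S) := by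
    have e1 : ∑ q ∈ Ico 1 Q, B q = (Q - 1 : ℕ) * (C * (M * Y) * S) := by
      rw [sum_congr rfl (g := fun _ => C * (M * Y) * S)]
      · simp
      · intro q hq
        rw [mem_Ico] at hq
        simp only [hB]; rw [if_neg (by omega)]
    rw [e1]
    have h2 : ((Q - 1 : ℕ) : ℝ) ≤ 2 * δN := le_trans (by exact_mod_cast Nat.sub_le _ _) hQle
    have h3 : ((Q - 1 : ℕ) : ℝ) * (C * (M * Y) * S) ≤ 2 * δN * (C * (M * Y) * S) := by gcongr
    have h4 : 2 * δN * (C * (M * Y) * S) = 2 * C * (M * S) * (δN * Y) := by ring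
    rw [h4, hδY] at h3
    have : B 0 = M * S := by simp [hB]
    rw [this]; linarith
  set Z0 := ∑ m ∈ Ioc M (2 * M), ‖∑ n ∈ range K, g m n‖ ^ 2
  have hZ0 : 0 ≤ Z0 := sum_nonneg fun _ _ => by positivity
  have f1 : δN * Z0 ≤ 5 * K * ((1 + 4 * C) * (M * S)) := by
    calc δN * Z0 ≤ Q * Z0 := by gcongr
      _ ≤ _ := hW
      _ ≤ 5 * K * ((1 + 4 * C) * (M * S)) := by gcongr; linarith
  have f2 : Z0 = Y * (δN * Z0) := by rw [← mul_assoc, mul_comm Y, hδY, one_mul]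
  have f3 : (N : ℝ) ^ (1 - 0.0294 : ℝ) = N * Y := by
    rw [hY, sub_eq_add_neg, rpow_add hN0, rpow_one]
  rw [f3, f2]
  calc Y * (δN * Z0) ≤ Y * (5 * K * ((1 + 4 * C) * (M * S))) := by gcongr
    _ = 5 * (1 + 4 * C) * Y * S * (M * K) := by ring
    _ ≤ 5 * (1 + 4 * C) * Y * S * (3 * N) := by gcongr
    _ = _ := by ring

lemma sum_antidiagonal_eq {R : Type*} [AddCommMonoid R] (x : ℕ) (F : ℕ → ℕ → R) :
    ∑ m ∈ Ioc 0 x, ∑ p ∈ m.divisorsAntidiagonal, F p.1 p.2 =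
      ∑ a ∈ Ioc 0 x, ∑ b ∈ Ioc 0 x, if a * b ≤ x then F a b else 0 := by
  have e : ∀ m ∈ Ioc 0 x, ∑ p ∈ m.divisorsAntidiagonal, F p.1 p.2 =
      ∑ p ∈ Ioc 0 x ×ˢ Ioc 0 x, if p.1 * p.2 = m then F p.1 p.2 else 0 := by
    intro m hm
    rw [mem_Ioc] at hm
    rw [← sum_filter]
    refine sum_congr ?_ fun _ _ => rfl
    ext ⟨a, b⟩
    simp only [Nat.mem_divisorsAntidiagonal, mem_filter, mem_product, mem_Ioc]
    constructor
    · rintro ⟨h1, h2⟩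
      have ha : 0 < a := Nat.pos_of_ne_zero fun h => by simp [h] at h1; omega
      have hb : 0 < b := Nat.pos_of_ne_zero fun h => by simp [h] at h1; omega
      exact ⟨⟨⟨ha, by nlinarith⟩, hb, by nlinarith⟩, h1⟩
    · rintro ⟨_, h1⟩
      exact ⟨h1, by omega⟩
  rw [sum_congr rfl e, sum_comm, sum_product]
  refine sum_congr rfl fun a ha => sum_congr rfl fun b hb => ?_
  rw [mem_Ioc] at ha hb
  rw [sum_ite_eq]
  have : 0 < a * b := Nat.mul_pos ha.1 hb.1
  simp [this]

lemma sum_antidiagonal_le (x : ℕ) (f g : ℕ → ℝ) (hf : ∀ n, 0 ≤ f n) (hg : ∀ n, 0 ≤ g n) :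
    ∑ m ∈ Ioc 0 x, ∑ p ∈ m.divisorsAntidiagonal, f p.1 * g p.2 ≤ (∑ a ∈ Ioc 0 x, f a) * ∑ b ∈ Ioc 0 x, g b := by
  rw [sum_antidiagonal_eq x (fun a b => f a * g b), sum_mul_sum]
  refine sum_le_sum fun a _ => sum_le_sum fun b _ => ?_
  split_ifs
  · rfl
  · exact mul_nonneg (hf a) (hg b)

lemma card_divisorsAntidiagonal_eq (n : ℕ) : #n.divisorsAntidiagonal = #n.divisors := by
  rw [card_eq_sum_ones, card_eq_sum_ones, Nat.sum_divisorsAntidiagonal (fun _ _ => 1)]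

lemma sum_card_divisors_div_le (x : ℕ) :
    ∑ a ∈ Ioc 0 x, (#a.divisors : ℝ) / a ≤ (1 + log x) ^ 2 := by
  have hH : ∑ a ∈ Ioc 0 x, (1 : ℝ) / a ≤ 1 + log x := by
    have := harmonic_le_one_add_log x
    rw [harmonic_eq_sum_Icc] at this
    push_cast at this
    simpa [← Finset.Icc_add_one_left_eq_Ioc] using this
  have h0 : 0 ≤ ∑ a ∈ Ioc 0 x, (1 : ℝ) / a := sum_nonneg fun _ _ => by positivity
  refine le_trans ?_ ((sum_antidiagonal_le x (fun a => 1 / a) (fun a => 1 / a) (fun _ => by positivity) (fun _ => by positivity)).trans ?_)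
  · refine sum_le_sum fun m _ => le_of_eq ?_
    rw [sum_congr rfl (g := fun _ => 1 / (m : ℝ))]
    · rw [sum_const, card_divisorsAntidiagonal_eq, nsmul_eq_mul]; ring
    · intro p hp
      rw [Nat.mem_divisorsAntidiagonal] at hp
      rw [← hp.1]; push_cast; ring
  · rw [sq]; gcongr

lemma card_divisors_mul_le (a b : ℕ) : #(a * b).divisors ≤ #a.divisors * #b.divisors := by
  rw [Nat.divisors_mul]; exact card_mul_le

lemma sum_card_divisors_sq_div_le (x : ℕ) :
    ∑ a ∈ Ioc 0 x, (#a.divisors : ℝ) ^ 2 / a ≤ (1 + log x) ^ 4 := by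
  have hH := sum_card_divisors_div_le x
  have h0 : 0 ≤ ∑ a ∈ Ioc 0 x, (#a.divisors : ℝ) / a := sum_nonneg fun _ _ => by positivity
  refine le_trans ?_ ((sum_antidiagonal_le x (fun a => #a.divisors / a) (fun a => #a.divisors / a) (fun _ => by positivity) (fun _ => by positivity)).trans ?_)
  · refine sum_le_sum fun m _ => ?_
    have : (#m.divisors : ℝ) ^ 2 / m = ∑ p ∈ m.divisorsAntidiagonal, (#m.divisors : ℝ) / m := by
      rw [sum_const, card_divisorsAntidiagonal_eq, nsmul_eq_mul]; ring
    rw [this]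
    refine sum_le_sum fun p hp => ?_
    rw [Nat.mem_divisorsAntidiagonal] at hp
    rw [← hp.1, div_mul_div_comm]
    push_cast
    gcongr
    exact_mod_cast card_divisors_mul_le _ _
  · calc _ ≤ (1 + log x) ^ 2 * (1 + log x) ^ 2 := by gcongr
      _ = _ := by ring

lemma sum_card_divisors_sq_le (M : ℕ) :
    ∑ a ∈ Ioc M (2 * M), (#a.divisors : ℝ) ^ 2 ≤ 2 * M * (1 + log (2 * M)) ^ 4 := by
  have h := sum_card_divisors_sq_div_le (2 * M)
  push_cast at h
  calc _ ≤ ∑ a ∈ Ioc M (2 * M), 2 * M * ((#a.divisors : ℝ) ^ 2 / a) := by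
        refine sum_le_sum fun a ha => ?_
        rw [mem_Ioc] at ha
        have ha0 : (0 : ℝ) < a := by exact_mod_cast (by omega : 0 < a)
        have : (a : ℝ) ≤ 2 * M := by exact_mod_cast ha.2
        rw [mul_div_assoc', le_div_iff₀ ha0, mul_comm]
        gcongr
    _ = 2 * M * ∑ a ∈ Ioc M (2 * M), ((#a.divisors : ℝ) ^ 2 / a) := by rw [mul_sum]
    _ ≤ 2 * M * ∑ a ∈ Ioc 0 (2 * M), ((#a.divisors : ℝ) ^ 2 / a) := by
        gcongr
        omega
    _ ≤ _ := by gcongr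

lemma bilinear_half (c : ℝ) (hc1 : 1 < c) (hc2 : c < 2.0551) (hc3 : c ≠ 2) : ∃ C > 0, ∀ (N N' M K : ℕ) (θ : ℝ) (f g : ℕ → ℂ),
    1 ≤ N → N' ≤ 3 * N → 1 ≤ K → K ≤ M → N ≤ 4 * (M * K) → M * K ≤ 3 * N → (N : ℝ) ^ (0.0294 : ℝ) ≤ 2 * K →
    (N : ℝ) ^ (-(c - 1) - 0.02) ≤ |θ| → |θ| ≤ 2 * (N : ℝ) ^ (0.0155 : ℝ) →
    ‖∑ m ∈ Ioc M (2 * M), ∑ k ∈ Ioc K (2 * K), (if N < m * k ∧ m * k ≤ N' then f m * g k * eC (θ * ((m * k : ℕ) : ℝ) ^ c) else 0)‖ ^ 2 ≤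
      C * (N : ℝ) ^ (1 - 0.0294 : ℝ) * ((∑ m ∈ Ioc M (2 * M), ‖f m‖ ^ 2) * ∑ k ∈ Ioc K (2 * K), ‖g k‖ ^ 2) := by
  obtain ⟨C, hC, H⟩ := bilinear_block hc1 hc2 hc3
  refine ⟨C, hC, fun N N' M K θ f g hN hN' hK hKM h4 h3 hδ hθ1 hθ2 => ?_⟩
  have hshift : ∀ {R : Type} [AddCommMonoid R] (F : ℕ → R), ∑ k ∈ Ioc K (2 * K), F k = ∑ n ∈ range K, F (K + 1 + n) := by
    intro R _ F
    rw [← Finset.Ico_add_one_add_one_eq_Ioc, sum_Ico_eq_sum_range]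
    congr 2; omega
  have hb := H N N' M K θ (fun n => if n < K then g (K + 1 + n) else 0) hN hN' hK hKM h4 h3 hδ hθ1 hθ2
    (fun n hn => if_neg (by omega))
  have e1 : ∑ m ∈ Ioc M (2 * M), ∑ k ∈ Ioc K (2 * K), (if N < m * k ∧ m * k ≤ N' then f m * g k * eC (θ * ((m * k : ℕ) : ℝ) ^ c) else 0)
      = ∑ m ∈ Ioc M (2 * M), f m * ∑ n ∈ range K, (if N < m * (K + 1 + n) ∧ m * (K + 1 + n) ≤ N' then
        (if n < K then g (K + 1 + n) else 0) * eC (θ * ((m * (K + 1 + n) : ℕ) : ℝ) ^ c) else 0) := by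
    refine sum_congr rfl fun m _ => ?_
    rw [hshift, mul_sum]
    refine sum_congr rfl fun n hn => ?_
    rw [if_pos (mem_range.1 hn)]
    split_ifs
    · ring
    · simp
  have e2 : ∑ n ∈ range K, ‖(if n < K then g (K + 1 + n) else 0)‖ ^ 2 = ∑ k ∈ Ioc K (2 * K), ‖g k‖ ^ 2 := by
    rw [hshift]
    exact sum_congr rfl fun n hn => by rw [if_pos (mem_range.1 hn)]
  rw [e2] at hb
  rw [e1]
  refine (pow_le_pow_left₀ (norm_nonneg _) (norm_sum_le _ _) 2).trans ?_
  simp_rw [norm_mul]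
  refine (sum_mul_sq_le_sq_mul_sq _ _ _).trans ?_
  calc _ ≤ (∑ m ∈ Ioc M (2 * M), ‖f m‖ ^ 2) * _ := mul_le_mul_of_nonneg_left hb (sum_nonneg fun _ _ => by positivity)
    _ = _ := by ring

lemma bilinear_full (c : ℝ) (hc1 : 1 < c) (hc2 : c < 2.0551) (hc3 : c ≠ 2) : ∃ C > 0, ∀ (N N' M K : ℕ) (θ : ℝ) (f g : ℕ → ℂ),
    1 ≤ N → N' ≤ 3 * N → 1 ≤ K → 1 ≤ M → N ≤ 4 * (M * K) → M * K ≤ 3 * N → (N : ℝ) ^ (0.0294 : ℝ) ≤ 2 * K →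
    (N : ℝ) ^ (0.0294 : ℝ) ≤ 2 * M →
    (N : ℝ) ^ (-(c - 1) - 0.02) ≤ |θ| → |θ| ≤ 2 * (N : ℝ) ^ (0.0155 : ℝ) →
    ‖∑ m ∈ Ioc M (2 * M), ∑ k ∈ Ioc K (2 * K), (if N < m * k ∧ m * k ≤ N' then f m * g k * eC (θ * ((m * k : ℕ) : ℝ) ^ c) else 0)‖ ^ 2 ≤
      C * (N : ℝ) ^ (1 - 0.0294 : ℝ) * ((∑ m ∈ Ioc M (2 * M), ‖f m‖ ^ 2) * ∑ k ∈ Ioc K (2 * K), ‖g k‖ ^ 2) := by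
  obtain ⟨C, hC, H⟩ := bilinear_half c hc1 hc2 hc3
  refine ⟨C, hC, fun N N' M K θ f g hN hN' hK hM h4 h3 hδ hδ' hθ1 hθ2 => ?_⟩
  rcases le_total K M with h | h
  · exact H N N' M K θ f g hN hN' hK h h4 h3 hδ hθ1 hθ2
  · have := H N N' K M θ g f hN hN' hM h (by rwa [mul_comm K]) (by rwa [mul_comm K]) hδ' hθ1 hθ2
    rw [sum_comm, mul_comm (∑ m ∈ Ioc M (2 * M), _)]
    refine le_trans (le_of_eq ?_) this
    congr 2
    refine sum_congr rfl fun k _ => sum_congr rfl fun m _ => ?_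
    simp only [mul_comm m k, mul_comm (f m)]

lemma sum_dyadic (G : ℕ → ℂ) {x L : ℕ} (hL : x ≤ 2 ^ L) (h1 : G 1 = 0) (hx : ∀ a, x < a → G a = 0) :
    ∑ a ∈ Ioc 0 x, G a = ∑ i ∈ range L, ∑ a ∈ Ioc (2 ^ i) (2 * 2 ^ i), G a := by
  have e1 : ∑ a ∈ Ioc 0 x, G a = ∑ a ∈ Ioc 0 (2 ^ L), G a :=
    sum_subset (Ioc_subset_Ioc_right hL) fun a ha hn => hx a (by simp only [mem_Ioc] at ha hn; omega)
  rw [e1]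
  clear e1 hL hx
  induction L with
  | zero =>
    rw [show Ioc 0 (2 ^ 0) = {1} from rfl]
    simpa using h1
  | succ L ih => rw [sum_range_succ, ← ih, pow_succ', sum_Ioc_consecutive _ (Nat.zero_le _) (by omega)]

lemma typeII (c : ℝ) (hc1 : 1 < c) (hc2 : c < 2.0551) (hc3 : c ≠ 2) : ∃ C > 0, ∀ (N N' : ℕ) (θ : ℝ) (f g : ℕ → ℂ),
    1 ≤ N → N' ≤ 3 * N → (∀ m, ‖f m‖ ≤ #m.divisors) → (∀ k, ‖g k‖ ≤ log k) →
    (∀ m : ℕ, (m : ℝ) ≤ (N : ℝ) ^ (0.05 : ℝ) → f m = 0) → (∀ m : ℕ, (m : ℝ) ≤ (N : ℝ) ^ (0.05 : ℝ) → g m = 0) →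
    (N : ℝ) ^ (-(c - 1) - 0.02) ≤ |θ| → |θ| ≤ 2 * (N : ℝ) ^ (0.0155 : ℝ) →
    ‖∑ m ∈ Ioc 0 N', ∑ k ∈ Ioc 0 N', (if N < m * k ∧ m * k ≤ N' then f m * g k * eC (θ * ((m * k : ℕ) : ℝ) ^ c) else 0)‖ ≤
      C * (N : ℝ) ^ (1 - 0.01465 : ℝ) := by
  obtain ⟨C, hC, H⟩ := bilinear_full c hc1 hc2 hc3
  obtain ⟨D, hD, HD⟩ : ∃ D > 0, ∀ x : ℝ, 1 ≤ x → (1 + log (6 * x)) ^ 5 ≤ D * x ^ (0.00005 : ℝ) := by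
    have h := exists_log_le_rpow (δ := 0.00001) (by norm_num)
    refine ⟨(1 + 100000 * 6 ^ (0.00001 : ℝ)) ^ 5, by positivity, fun x hx => ?_⟩
    have h1 := h (6 * x) (by linarith)
    rw [mul_rpow (by norm_num) (by linarith)] at h1
    have h2 : 1 ≤ x ^ (0.00001 : ℝ) := one_le_rpow hx (by norm_num)
    have h3 : x ^ (0.00005 : ℝ) = (x ^ (0.00001 : ℝ)) ^ 5 := by
      rw [← rpow_natCast, ← rpow_mul (by linarith)]; norm_num
    have h4 : 0 ≤ log (6 * x) := log_nonneg (by linarith)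
    rw [h3, ← mul_pow]
    gcongr
    norm_num at h1 ⊢
    nlinarith
  refine ⟨4 * (√(6 * C) + 1) * D, by positivity, fun N N' θ f g hN hN' hf hg hf0 hg0 hθ1 hθ2 => ?_⟩
  have hNr : (1 : ℝ) ≤ N := by exact_mod_cast hN
  have hN0 : (0 : ℝ) < N := by linarith
  have hl1 : 0 ≤ log (6 * N) := log_nonneg (by linarith)
  set ℓ := 1 + log (6 * (N : ℝ)) with hℓ
  have hℓ1 : 1 ≤ ℓ := by linarith
  have hU1 : (1 : ℝ) ≤ (N : ℝ) ^ (0.05 : ℝ) := one_le_rpow hNr (by norm_num)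
  have hUδ : (N : ℝ) ^ (0.0294 : ℝ) ≤ (N : ℝ) ^ (0.05 : ℝ) := rpow_le_rpow_of_exponent_le hNr (by norm_num)
  obtain ⟨L, hL⟩ : ∃ L, L = Nat.log 2 (3 * N) + 1 := ⟨_, rfl⟩
  have hL1 : N' ≤ 2 ^ L := hN'.trans (by rw [hL]; exact (Nat.lt_pow_succ_log_self (by norm_num) _).le)
  have hL2 : (L : ℝ) ≤ 2 * ℓ := by
    have h := Nat.pow_log_le_self 2 (x := 3 * N) (by omega)
    have h' : (2 : ℝ) ^ (Nat.log 2 (3 * N)) ≤ 3 * N := by exact_mod_cast h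
    have h2 := log_le_log (by positivity) (h'.trans (by linarith : 3 * (N : ℝ) ≤ 6 * N))
    rw [log_pow] at h2
    have := log_two_gt_d9
    have : (0 : ℝ) ≤ (Nat.log 2 (3 * N) : ℝ) := by positivity
    rw [hL]; push_cast
    nlinarith
  set F : ℕ → ℕ → ℂ := fun m k => if N < m * k ∧ m * k ≤ N' then f m * g k * eC (θ * ((m * k : ℕ) : ℝ) ^ c) else 0 with hF
  have hf1 : f 1 = 0 := hf0 1 (by simpa using hU1)
  have hg1 : g 1 = 0 := hg0 1 (by simpa using hU1)
  have hsplit : ∑ m ∈ Ioc 0 N', ∑ k ∈ Ioc 0 N', F m k =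
      ∑ i ∈ range L, ∑ j ∈ range L, ∑ m ∈ Ioc (2 ^ i) (2 * 2 ^ i), ∑ k ∈ Ioc (2 ^ j) (2 * 2 ^ j), F m k := by
    rw [sum_dyadic _ hL1]
    · refine sum_congr rfl fun i _ => ?_
      rw [sum_comm]
      rw [sum_dyadic _ hL1]
      · exact sum_congr rfl fun j _ => by rw [sum_comm]
      · exact sum_eq_zero fun m _ => by simp [hF, hg1]
      · intro k hk
        refine sum_eq_zero fun m hm => ?_
        rw [mem_Ioc] at hm
        simp only [hF]; rw [if_neg]
        rintro ⟨_, h⟩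
        have : 0 < m := by omega
        nlinarith
    · exact sum_eq_zero fun m _ => by simp [hF, hf1]
    · intro k hk
      refine sum_eq_zero fun m hm => ?_
      rw [mem_Ioc] at hm
      simp only [hF]; rw [if_neg]
      rintro ⟨_, h⟩
      have : 0 < m := by omega
      nlinarith
  have hblock : ∀ i j, ‖∑ m ∈ Ioc (2 ^ i) (2 * 2 ^ i), ∑ k ∈ Ioc (2 ^ j) (2 * 2 ^ j), F m k‖ ≤
      √(6 * C) * ((N : ℝ) ^ (1 - 0.0147 : ℝ) * ℓ ^ 3) := by
    intro i j
    by_cases hz : ∀ m ∈ Ioc (2 ^ i) (2 * 2 ^ i), ∀ k ∈ Ioc (2 ^ j) (2 * 2 ^ j), F m k = 0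
    · rw [sum_eq_zero fun m hm => sum_eq_zero fun k hk => hz m hm k hk, norm_zero]; positivity
    push Not at hz
    obtain ⟨m, hm, k, hk, hmk⟩ := hz
    rw [mem_Ioc] at hm hk
    simp only [hF] at hmk
    split_ifs at hmk with hc
    · have hfm : f m ≠ 0 := by rintro h; simp [h] at hmk
      have hgk : g k ≠ 0 := by rintro h; simp [h] at hmk
      have hmU : (N : ℝ) ^ (0.05 : ℝ) < m := by by_contra h; exact hfm (hf0 m (not_lt.1 h))
      have hkU : (N : ℝ) ^ (0.05 : ℝ) < k := by by_contra h; exact hgk (hg0 k (not_lt.1 h))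
      obtain ⟨M, hM⟩ : ∃ M, M = 2 ^ i := ⟨_, rfl⟩
      obtain ⟨K, hK⟩ : ∃ K, K = 2 ^ j := ⟨_, rfl⟩
      have hM1 : 1 ≤ M := hM ▸ Nat.one_le_two_pow
      have hK1 : 1 ≤ K := hK ▸ Nat.one_le_two_pow
      simp only [← hM] at hm ⊢
      simp only [← hK] at hk ⊢
      have hMK3 : M * K ≤ 3 * N := by
        have : M * K ≤ m * k := Nat.mul_le_mul hm.1.le hk.1.le
        omega
      have hMK4 : N ≤ 4 * (M * K) := by
        have : m * k ≤ (2 * M) * (2 * K) := Nat.mul_le_mul hm.2 hk.2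
        nlinarith
      have hm2 : (m : ℝ) ≤ 2 * M := by exact_mod_cast hm.2
      have hk2 : (k : ℝ) ≤ 2 * K := by exact_mod_cast hk.2
      have hb := H N N' M K θ f g hN hN' hK1 hM1 hMK4 hMK3 (by linarith) (by linarith) hθ1 hθ2
      have hM1r : (1 : ℝ) ≤ M := by exact_mod_cast hM1
      have hK1r : (1 : ℝ) ≤ K := by exact_mod_cast hK1
      have hMN : 2 * (M : ℝ) ≤ 6 * N := by
        have : M ≤ 3 * N := le_trans (Nat.le_mul_of_pos_right _ hK1) hMK3
        have : (M : ℝ) ≤ 3 * N := by exact_mod_cast this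
        linarith
      have hKN : 2 * (K : ℝ) ≤ 6 * N := by
        have : K ≤ 3 * N := le_trans (Nat.le_mul_of_pos_left _ hM1) hMK3
        have : (K : ℝ) ≤ 3 * N := by exact_mod_cast this
        linarith
      have hMKr : (M : ℝ) * K ≤ 3 * N := by exact_mod_cast hMK3
      have b1 : ∑ m ∈ Ioc M (2 * M), ‖f m‖ ^ 2 ≤ 2 * M * ℓ ^ 4 := by
        refine le_trans (sum_le_sum fun m _ => pow_le_pow_left₀ (norm_nonneg _) (hf m) 2)
          ((sum_card_divisors_sq_le M).trans ?_)
        have : 0 ≤ log (2 * (M : ℝ)) := log_nonneg (by linarith)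
        have := log_le_log (by positivity) hMN
        gcongr
        linarith
      have b2 : ∑ m ∈ Ioc K (2 * K), ‖g m‖ ^ 2 ≤ K * ℓ ^ 2 := by
        calc _ ≤ ∑ m ∈ Ioc K (2 * K), ℓ ^ 2 := by
              refine sum_le_sum fun k hk => pow_le_pow_left₀ (norm_nonneg _) ((hg k).trans ?_) 2
              rw [mem_Ioc] at hk
              have h1 : (0 : ℝ) < k := by exact_mod_cast (by omega : 0 < k)
              have h2 : (k : ℝ) ≤ 2 * K := by exact_mod_cast hk.2
              have := log_le_log h1 (h2.trans hKN)
              linarith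
          _ = _ := by simp [two_mul]
      have hsq : ‖∑ m ∈ Ioc M (2 * M), ∑ k ∈ Ioc K (2 * K), F m k‖ ^ 2 ≤ (√(6 * C) * ((N : ℝ) ^ (1 - 0.0147 : ℝ) * ℓ ^ 3)) ^ 2 := by
        refine hb.trans ?_
        have e1 : (N : ℝ) ^ (1 - 0.0147 : ℝ) * (N : ℝ) ^ (1 - 0.0147 : ℝ) = (N : ℝ) ^ (1 - 0.0294 : ℝ) * N := by
          nth_rw 4 [← rpow_one (N : ℝ)]
          rw [← rpow_add hN0, ← rpow_add hN0]; norm_num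
        calc _ ≤ C * (N : ℝ) ^ (1 - 0.0294 : ℝ) * ((2 * M * ℓ ^ 4) * (K * ℓ ^ 2)) := by gcongr
          _ = 2 * C * (N : ℝ) ^ (1 - 0.0294 : ℝ) * ℓ ^ 6 * (M * K) := by ring
          _ ≤ 2 * C * (N : ℝ) ^ (1 - 0.0294 : ℝ) * ℓ ^ 6 * (3 * N) := by gcongr
          _ = 6 * C * ((N : ℝ) ^ (1 - 0.0294 : ℝ) * N) * ℓ ^ 6 := by ring
          _ = _ := by rw [← e1, mul_pow, sq_sqrt (by positivity)]; ring
      exact (pow_le_pow_iff_left₀ (norm_nonneg _) (by positivity) two_ne_zero).1 hsq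
    · exact absurd rfl hmk
  rw [hsplit]
  have hD' := HD N hNr
  calc _ ≤ ∑ i ∈ range L, ∑ j ∈ range L, √(6 * C) * ((N : ℝ) ^ (1 - 0.0147 : ℝ) * ℓ ^ 3) :=
        (norm_sum_le _ _).trans (sum_le_sum fun i _ => (norm_sum_le _ _).trans (sum_le_sum fun j _ => hblock i j))
    _ = L * L * (√(6 * C) * ((N : ℝ) ^ (1 - 0.0147 : ℝ) * ℓ ^ 3)) := by simp; ring
    _ ≤ (2 * ℓ) * (2 * ℓ) * ((√(6 * C) + 1) * ((N : ℝ) ^ (1 - 0.0147 : ℝ) * ℓ ^ 3)) := by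
        gcongr; linarith
    _ = 4 * (√(6 * C) + 1) * (N : ℝ) ^ (1 - 0.0147 : ℝ) * ℓ ^ 5 := by ring
    _ ≤ 4 * (√(6 * C) + 1) * (N : ℝ) ^ (1 - 0.0147 : ℝ) * (D * (N : ℝ) ^ (0.00005 : ℝ)) := by gcongr
    _ = 4 * (√(6 * C) + 1) * D * ((N : ℝ) ^ (1 - 0.0147 : ℝ) * (N : ℝ) ^ (0.00005 : ℝ)) := by ring
    _ = _ := by rw [← rpow_add hN0]; norm_num

lemma norm_sum_mono_mul_le (w : ℕ → ℝ) (z : ℕ → ℂ) {a b : ℕ} (hab : a ≤ b) (hw0 : 0 ≤ w a)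
    (hw : ∀ k, a ≤ k → w k ≤ w (k + 1)) {E : ℝ} (hE : ∀ j, a ≤ j → j ≤ b → ‖∑ k ∈ Ioc a j, z k‖ ≤ E) :
    ‖∑ k ∈ Ioc a b, (w k : ℂ) * z k‖ ≤ 2 * w b * E := by
  have key : ∀ j, a ≤ j → j ≤ b → w a ≤ w j ∧
      ‖∑ k ∈ Ioc a j, (w k : ℂ) * z k - w j * ∑ k ∈ Ioc a j, z k‖ ≤ (w j - w a) * E := by
    intro j hj
    induction j, hj using Nat.le_induction with
    | base => intro _; simp
    | succ j hj ih =>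
      intro hjb
      obtain ⟨i1, i2⟩ := ih (by omega)
      have hs := hw j hj
      refine ⟨by linarith, ?_⟩
      rw [sum_Ioc_succ_top (by omega), sum_Ioc_succ_top (by omega)]
      have e : ∑ k ∈ Ioc a j, (w k : ℂ) * z k + w (j + 1) * z (j + 1) - w (j + 1) * (∑ k ∈ Ioc a j, z k + z (j + 1)) =
        (∑ k ∈ Ioc a j, (w k : ℂ) * z k - w j * ∑ k ∈ Ioc a j, z k) - ((w (j + 1) - w j : ℝ) : ℂ) * ∑ k ∈ Ioc a j, z k := by
        push_cast; ring
      rw [e]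
      refine (norm_sub_le _ _).trans ?_
      rw [norm_mul, Complex.norm_real, Real.norm_of_nonneg (by linarith)]
      have := mul_le_mul_of_nonneg_left (hE j hj (by omega)) (by linarith : 0 ≤ w (j + 1) - w j)
      linarith
  obtain ⟨k1, k2⟩ := key b hab le_rfl
  have h1 := hE b hab le_rfl
  have hE0 : 0 ≤ E := (norm_nonneg _).trans h1
  have h2 := norm_le_norm_add_norm_sub' (∑ k ∈ Ioc a b, (w k : ℂ) * z k) (w b * ∑ k ∈ Ioc a b, z k)
  rw [norm_mul (w b : ℂ), Complex.norm_real, Real.norm_of_nonneg (by linarith)] at h2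
  have := mul_le_mul_of_nonneg_left h1 (by linarith : 0 ≤ w b)
  nlinarith

lemma typeI_inner (c : ℝ) (hc1 : 1 < c) (hc2 : c < 2.0551) (hc3 : c ≠ 2) : ∃ C > 0, ∀ (N b m : ℕ) (θ : ℝ),
    1 ≤ N → 1 ≤ m → m ≤ N → m * b ≤ 3 * N →
    (N : ℝ) ^ (-(c - 1) - 0.02) ≤ |θ| → |θ| ≤ 2 * (N : ℝ) ^ (0.0155 : ℝ) →
    ‖∑ k ∈ Ioc (N / m) b, eC (θ * ((m * k : ℕ) : ℝ) ^ c)‖ ≤ C * (N : ℝ) ^ (0.8452 : ℝ) := by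
  obtain ⟨C, hC, H⟩ := sum_pow_bound hc1 (by linarith) hc3
  refine ⟨3 * C + 1, by positivity, fun N b m θ hN hm hmN hmb hθ1 hθ2 => ?_⟩
  have hNr : (1 : ℝ) ≤ N := by exact_mod_cast hN
  have hN0 : (0 : ℝ) < N := by linarith
  have hmr : (1 : ℝ) ≤ m := by exact_mod_cast hm
  have hm0 : (0 : ℝ) < m := by linarith
  have hθ0 : 0 < |θ| := lt_of_lt_of_le (by positivity) hθ1
  have hθ : θ ≠ 0 := abs_pos.1 hθ0
  have h := H (θ * (m : ℝ) ^ c) ((N : ℝ) / m) (N / m) b (mul_ne_zero hθ (by positivity))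
    ((one_le_div hm0).2 (by exact_mod_cast hmN)) (by
      rw [div_le_iff₀ hm0]
      have := Nat.lt_mul_div_succ N hm
      have : N ≤ (N / m + 1) * m := by rw [mul_comm]; exact this.le
      exact_mod_cast this) (by
      rw [mul_div_assoc', le_div_iff₀ hm0]
      have : (m : ℝ) * b ≤ 3 * N := by exact_mod_cast hmb
      linarith)
  have e1 : ∀ k : ℕ, θ * (m : ℝ) ^ c * (k : ℝ) ^ c = θ * ((m * k : ℕ) : ℝ) ^ c := by
    intro k; push_cast; rw [mul_rpow (by positivity) (by positivity)]; ring
  simp_rw [e1] at h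
  refine h.trans ?_
  have hab : |θ * (m : ℝ) ^ c| = |θ| * (m : ℝ) ^ c := by rw [abs_mul, abs_of_pos (a := (m : ℝ) ^ c) (by positivity)]
  rw [hab]
  have t1 : (|θ| * (m : ℝ) ^ c) ^ (1 / 6 : ℝ) * ((N : ℝ) / m) ^ (1 / 2 + c / 6) ≤ 2 * (N : ℝ) ^ (0.8452 : ℝ) := by
    rw [← log_le_log_iff (by positivity) (by positivity), log_mul (by positivity) (by positivity), log_mul (by positivity) (by positivity),
      log_rpow (by positivity), log_mul (by positivity) (by positivity), log_rpow (by positivity), log_rpow (by positivity), log_rpow (by positivity),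
      log_div (by positivity) (by positivity)]
    have hlθ := log_le_log hθ0 hθ2
    rw [log_mul (by positivity) (by positivity), log_rpow (by positivity)] at hlθ
    have l1 : 0 ≤ log (N : ℝ) := log_nonneg hNr
    have l2 : 0 ≤ log (m : ℝ) := log_nonneg hmr
    have l3 : 0 ≤ log (2 : ℝ) := log_nonneg (by norm_num)
    nlinarith
  have t2 : ((N : ℝ) / m) ^ (5 / 6 : ℝ) ≤ (N : ℝ) ^ (0.8452 : ℝ) := by
    calc _ ≤ (N : ℝ) ^ (5 / 6 : ℝ) := rpow_le_rpow (by positivity) (div_le_self hN0.le hmr) (by norm_num)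
      _ ≤ _ := rpow_le_rpow_of_exponent_le hNr (by norm_num)
  have t3 : ((N : ℝ) / m) ^ (1 - c) / (|θ| * (m : ℝ) ^ c) ≤ (N : ℝ) ^ (0.8452 : ℝ) := by
    rw [← log_le_log_iff (by positivity) (by positivity), log_div (by positivity) (by positivity), log_mul (by positivity) (by positivity),
      log_rpow (by positivity), log_rpow (by positivity), log_rpow (by positivity),
      log_div (by positivity) (by positivity)]
    have hlθ := log_le_log (by positivity) hθ1
    rw [log_rpow (by positivity)] at hlθ
    have l1 : 0 ≤ log (N : ℝ) := log_nonneg hNr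
    have l2 : 0 ≤ log (m : ℝ) := log_nonneg hmr
    nlinarith
  have : C * ((|θ| * (m : ℝ) ^ c) ^ (1 / 6 : ℝ) * ((N : ℝ) / m) ^ (1 / 2 + c / 6) + ((N : ℝ) / m) ^ (5 / 6 : ℝ)) ≤
    C * (2 * (N : ℝ) ^ (0.8452 : ℝ) + (N : ℝ) ^ (0.8452 : ℝ)) := by gcongr
  linarith

lemma typeI (c : ℝ) (hc1 : 1 < c) (hc2 : c < 2.0551) (hc3 : c ≠ 2) : ∃ C > 0, ∀ (N N' : ℕ) (θ : ℝ) (f : ℕ → ℂ) (w : ℕ → ℝ),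
    1 ≤ N → N ≤ N' → N' ≤ 3 * N → (∀ m, ‖f m‖ ≤ 1 + log m) → (∀ k, 1 ≤ k → 0 ≤ w k) → (∀ k, 1 ≤ k → w k ≤ w (k + 1)) →
    (∀ k, 1 ≤ k → w k ≤ 1 + log k) →
    (∀ m : ℕ, (N : ℝ) ^ (0.1 : ℝ) < (m : ℝ) → f m = 0) →
    (N : ℝ) ^ (-(c - 1) - 0.02) ≤ |θ| → |θ| ≤ 2 * (N : ℝ) ^ (0.0155 : ℝ) →
    ‖∑ m ∈ Ioc 0 N', ∑ k ∈ Ioc 0 N', (if N < m * k ∧ m * k ≤ N' then f m * w k * eC (θ * ((m * k : ℕ) : ℝ) ^ c) else 0)‖ ≤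
      C * (N : ℝ) ^ (1 - 0.01465 : ℝ) := by
  obtain ⟨C, hC, H⟩ := typeI_inner c hc1 hc2 hc3
  obtain ⟨D, hD, HD⟩ : ∃ D > 0, ∀ x : ℝ, 1 ≤ x → (1 + log (6 * x)) ^ 2 ≤ D * x ^ (0.02 : ℝ) := by
    have h := exists_log_le_rpow (δ := 0.01) (by norm_num)
    refine ⟨(1 + 100 * 6 ^ (0.01 : ℝ)) ^ 2, by positivity, fun x hx => ?_⟩
    have h1 := h (6 * x) (by linarith)
    rw [mul_rpow (by norm_num) (by linarith)] at h1
    have h2 : 1 ≤ x ^ (0.01 : ℝ) := one_le_rpow hx (by norm_num)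
    have h3 : x ^ (0.02 : ℝ) = (x ^ (0.01 : ℝ)) ^ 2 := by
      rw [← rpow_natCast, ← rpow_mul (by linarith)]; norm_num
    have h4 : 0 ≤ log (6 * x) := log_nonneg (by linarith)
    rw [h3, ← mul_pow]
    gcongr
    norm_num at h1 ⊢
    nlinarith
  refine ⟨2 * C * D, by positivity, fun N N' θ f w hN hNN hN' hf hw0 hw1 hw2 hf0 hθ1 hθ2 => ?_⟩
  have hNr : (1 : ℝ) ≤ N := by exact_mod_cast hN
  have hN0 : (0 : ℝ) < N := by linarith
  have hl1 : 0 ≤ log (6 * N) := log_nonneg (by linarith)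
  obtain ⟨ℓ, hℓ⟩ : ∃ ℓ, ℓ = 1 + log (6 * (N : ℝ)) := ⟨_, rfl⟩
  have hℓ1 : 1 ≤ ℓ := by linarith
  have hlog : ∀ k : ℕ, 1 ≤ k → k ≤ 3 * N → 1 + log (k : ℝ) ≤ ℓ := by
    intro k hk1 hk
    have h1 : (0 : ℝ) < k := by exact_mod_cast hk1
    have h2 : (k : ℝ) ≤ 3 * N := by exact_mod_cast hk
    have := log_le_log h1 (by linarith : (k : ℝ) ≤ 6 * N)
    linarith
  have hm : ∀ m ∈ Ioc 0 N', ‖∑ k ∈ Ioc 0 N', (if N < m * k ∧ m * k ≤ N' then f m * w k * eC (θ * ((m * k : ℕ) : ℝ) ^ c) else 0)‖ ≤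
      if m ∈ Ioc 0 ⌊(N : ℝ) ^ (0.1 : ℝ)⌋₊ then ℓ * (2 * ℓ * (C * (N : ℝ) ^ (0.8452 : ℝ))) else 0 := by
    intro m hm
    rw [mem_Ioc] at hm
    by_cases hmU : (N : ℝ) ^ (0.1 : ℝ) < m
    · rw [hf0 m hmU]
      simp only [zero_mul, ite_self, sum_const_zero, norm_zero]
      split_ifs <;> positivity
    · rw [not_lt] at hmU
      rw [if_pos (by rw [mem_Ioc]; exact ⟨hm.1, Nat.le_floor hmU⟩)]
      have hmN : m ≤ N := by
        have : (m : ℝ) ≤ N := hmU.trans (by nth_rw 2 [← rpow_one (N : ℝ)]; exact rpow_le_rpow_of_exponent_le hNr (by norm_num))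
        exact_mod_cast this
      have e1 : ∑ k ∈ Ioc 0 N', (if N < m * k ∧ m * k ≤ N' then f m * w k * eC (θ * ((m * k : ℕ) : ℝ) ^ c) else 0)
          = f m * ∑ k ∈ Ioc (N / m) (N' / m), (w k : ℂ) * eC (θ * ((m * k : ℕ) : ℝ) ^ c) := by
        rw [← sum_filter, mul_sum]
        refine sum_congr ?_ fun _ _ => by ring
        ext k
        rw [mem_filter, mem_Ioc, mem_Ioc, Nat.div_lt_iff_lt_mul hm.1, Nat.le_div_iff_mul_le hm.1, mul_comm k m]
        constructor
        · rintro ⟨_, h⟩; exact h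
        · rintro ⟨h1, h2⟩
          have : 0 < k := Nat.pos_of_ne_zero fun h => by simp [h] at h1
          exact ⟨⟨this, by nlinarith⟩, h1, h2⟩
      have hNm : 1 ≤ N / m := (Nat.one_le_div_iff hm.1).2 hmN
      have hb := norm_sum_mono_mul_le w (fun k => eC (θ * ((m * k : ℕ) : ℝ) ^ c)) (a := N / m) (b := N' / m)
        (Nat.div_le_div_right hNN) (hw0 _ hNm) (fun k hk => hw1 k (by omega)) (E := C * (N : ℝ) ^ (0.8452 : ℝ)) (by
          intro j _ hj
          refine H N j m θ hN hm.1 hmN ?_ hθ1 hθ2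
          calc m * j ≤ m * (N' / m) := Nat.mul_le_mul_left _ hj
            _ ≤ N' := Nat.mul_div_le _ _
            _ ≤ _ := hN')
      have hNm' : 1 ≤ N' / m := hNm.trans (Nat.div_le_div_right hNN)
      have hwb : w (N' / m) ≤ ℓ := (hw2 _ hNm').trans (hlog _ hNm' ((Nat.div_le_self _ _).trans hN'))
      rw [e1, norm_mul]
      refine mul_le_mul ((hf m).trans (hlog m hm.1 (by omega))) (hb.trans ?_) (norm_nonneg _) (by linarith)
      gcongr
  refine (norm_sum_le _ _).trans ((sum_le_sum hm).trans ?_)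
  rw [← sum_filter, filter_mem_eq_inter]
  have hD' := HD N hNr
  rw [← hℓ] at hD'
  calc _ ≤ ∑ m ∈ Ioc 0 ⌊(N : ℝ) ^ (0.1 : ℝ)⌋₊, ℓ * (2 * ℓ * (C * (N : ℝ) ^ (0.8452 : ℝ))) :=
        sum_le_sum_of_subset_of_nonneg inter_subset_right fun _ _ _ => by positivity
    _ = ⌊(N : ℝ) ^ (0.1 : ℝ)⌋₊ * (ℓ * (2 * ℓ * (C * (N : ℝ) ^ (0.8452 : ℝ)))) := by simp
    _ ≤ (N : ℝ) ^ (0.1 : ℝ) * (ℓ * (2 * ℓ * (C * (N : ℝ) ^ (0.8452 : ℝ)))) := by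
        gcongr; exact Nat.floor_le (by positivity)
    _ = 2 * C * ((N : ℝ) ^ (0.1 : ℝ) * (N : ℝ) ^ (0.8452 : ℝ)) * ℓ ^ 2 := by ring
    _ ≤ 2 * C * ((N : ℝ) ^ (0.1 : ℝ) * (N : ℝ) ^ (0.8452 : ℝ)) * (D * (N : ℝ) ^ (0.02 : ℝ)) := by gcongr
    _ = 2 * C * D * ((N : ℝ) ^ (0.1 : ℝ) * (N : ℝ) ^ (0.8452 : ℝ) * (N : ℝ) ^ (0.02 : ℝ)) := by ring
    _ ≤ _ := by
      rw [← rpow_add hN0, ← rpow_add hN0]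
      have := rpow_le_rpow_of_exponent_le hNr (by norm_num : (0.1 : ℝ) + 0.8452 + 0.02 ≤ 1 - 0.01465)
      gcongr

section
open ArithmeticFunction

/-- The restriction of an arithmetic function to arguments at most `U`. -/
noncomputable def truncAF (U : ℕ) (f : ArithmeticFunction ℝ) : ArithmeticFunction ℝ :=
  ⟨fun n => if n ≤ U then f n else 0, by simp⟩

lemma truncAF_apply (U : ℕ) (f : ArithmeticFunction ℝ) (n : ℕ) : truncAF U f n = if n ≤ U then f n else 0 := rfl

lemma arith_sub_apply (f g : ArithmeticFunction ℝ) (n : ℕ) : (f - g) n = f n - g n := by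
  have h := ArithmeticFunction.add_apply (f := f - g) (g := g) (n := n)
  rw [sub_add_cancel] at h
  rw [h, add_sub_cancel_right]

lemma vaughan_identity (U : ℕ) : vonMangoldt = truncAF U vonMangoldt + truncAF U (moebius : ArithmeticFunction ℝ) * ArithmeticFunction.log
    - (truncAF U (moebius : ArithmeticFunction ℝ) * truncAF U vonMangoldt) * (zeta : ArithmeticFunction ℝ)
    + (((moebius : ArithmeticFunction ℝ) - truncAF U (moebius : ArithmeticFunction ℝ)) * (zeta : ArithmeticFunction ℝ)) *
      (vonMangoldt - truncAF U vonMangoldt) := by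
  have h := coe_moebius_mul_coe_zeta (R := ℝ)
  rw [← vonMangoldt_mul_zeta]
  linear_combination (-(vonMangoldt - truncAF U vonMangoldt)) * h

lemma sum_convolution (f g : ArithmeticFunction ℝ) (F : ℕ → ℂ) (N N' : ℕ) :
    ∑ n ∈ Ioc N N', ((f * g) n : ℂ) * F n = ∑ m ∈ Ioc 0 N', ∑ k ∈ Ioc 0 N',
      if N < m * k ∧ m * k ≤ N' then (f m : ℂ) * g k * F (m * k) else 0 := by
  have h := sum_antidiagonal_eq N' (fun a b => if N < a * b then (f a : ℂ) * g b * F (a * b) else 0)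
  have e1 : ∑ n ∈ Ioc N N', ((f * g) n : ℂ) * F n = ∑ n ∈ Ioc 0 N', if N < n then ((f * g) n : ℂ) * F n else 0 := by
    rw [← sum_filter]
    refine sum_congr ?_ fun _ _ => rfl
    ext n; simp only [mem_Ioc, mem_filter]; omega
  rw [e1]
  refine Eq.trans (sum_congr rfl fun n hn => ?_) (h.trans (sum_congr rfl fun m _ => sum_congr rfl fun k _ => ?_))
  · rw [ArithmeticFunction.mul_apply]
    push_cast
    rw [sum_mul]
    have e2 : ∀ p ∈ n.divisorsAntidiagonal, (if N < p.1 * p.2 then (f p.1 : ℂ) * g p.2 * F (p.1 * p.2) else 0) =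
        if N < n then (f p.1 : ℂ) * g p.2 * F n else 0 := by
      intro p hp
      rw [(Nat.mem_divisorsAntidiagonal.1 hp).1]
    rw [sum_congr rfl e2]
    split_ifs
    · rfl
    · simp
  · rw [← ite_and]
    simp only [and_comm]

lemma abs_coe_moebius_le (n : ℕ) : |(moebius : ArithmeticFunction ℝ) n| ≤ 1 := by
  rw [intCoe_apply]
  exact_mod_cast abs_moebius_le_one

lemma vonMangoldt_sum_bound (c : ℝ) (hc1 : 1 < c) (hc2 : c < 2.0551) (hc3 : c ≠ 2) : ∃ C > 0, ∀ (N N' : ℕ) (θ : ℝ),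
    1 ≤ N → N ≤ N' → N' ≤ 3 * N →
    (N : ℝ) ^ (-(c - 1) - 0.02) ≤ |θ| → |θ| ≤ 2 * (N : ℝ) ^ (0.0155 : ℝ) →
    ‖∑ n ∈ Ioc N N', (vonMangoldt n : ℂ) * eC (θ * (n : ℝ) ^ c)‖ ≤ C * (N : ℝ) ^ (1 - 0.01465 : ℝ) := by
  obtain ⟨C1, hC1, H1⟩ := typeI c hc1 hc2 hc3
  obtain ⟨C2, hC2, H2⟩ := typeII c hc1 hc2 hc3
  refine ⟨2 * C1 + C2, by positivity, fun N N' θ hN hNN hN' hθ1 hθ2 => ?_⟩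
  have hNr : (1 : ℝ) ≤ N := by exact_mod_cast hN
  obtain ⟨U, hU⟩ : ∃ U, U = ⌊(N : ℝ) ^ (0.05 : ℝ)⌋₊ := ⟨_, rfl⟩
  have hU1 : (U : ℝ) ≤ (N : ℝ) ^ (0.05 : ℝ) := hU ▸ Nat.floor_le (by positivity)
  have hU2 : ∀ m : ℕ, (m : ℝ) ≤ (N : ℝ) ^ (0.05 : ℝ) → m ≤ U := fun m hm => hU ▸ Nat.le_floor hm
  have hUN : U ≤ N := by
    have : (U : ℝ) ≤ N := hU1.trans (by nth_rw 2 [← rpow_one (N : ℝ)]; exact rpow_le_rpow_of_exponent_le hNr (by norm_num))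
    exact_mod_cast this
  have hUU : (U : ℝ) * U ≤ (N : ℝ) ^ (0.1 : ℝ) := by
    calc _ ≤ (N : ℝ) ^ (0.05 : ℝ) * (N : ℝ) ^ (0.05 : ℝ) := by gcongr
      _ = _ := by rw [← rpow_add (by linarith)]; norm_num
  have hlog0 : ∀ m : ℕ, 0 ≤ log (m : ℝ) := fun m => log_natCast_nonneg m
  have hmt : ∀ m, |truncAF U (moebius : ArithmeticFunction ℝ) m| ≤ 1 := by
    intro m
    rw [truncAF_apply]
    split_ifs
    · exact abs_coe_moebius_le m
    · simp
  have hΛt : ∀ m, 0 ≤ truncAF U vonMangoldt m ∧ truncAF U vonMangoldt m ≤ vonMangoldt m := by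
    intro m
    rw [truncAF_apply]
    split_ifs
    · exact ⟨vonMangoldt_nonneg, le_rfl⟩
    · exact ⟨le_rfl, vonMangoldt_nonneg⟩
  have hv : ∀ n ∈ Ioc N N', (vonMangoldt n : ℂ) * eC (θ * (n : ℝ) ^ c) =
      ((truncAF U (moebius : ArithmeticFunction ℝ) * ArithmeticFunction.log) n : ℂ) * eC (θ * (n : ℝ) ^ c)
      - (((truncAF U (moebius : ArithmeticFunction ℝ) * truncAF U vonMangoldt) * (zeta : ArithmeticFunction ℝ)) n : ℂ) * eC (θ * (n : ℝ) ^ c)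
      + (((((moebius : ArithmeticFunction ℝ) - truncAF U (moebius : ArithmeticFunction ℝ)) * (zeta : ArithmeticFunction ℝ)) *
        (vonMangoldt - truncAF U vonMangoldt)) n : ℂ) * eC (θ * (n : ℝ) ^ c) := by
    intro n hn
    rw [mem_Ioc] at hn
    have h := congrArg (fun f : ArithmeticFunction ℝ => f n) (vaughan_identity U)
    simp only [ArithmeticFunction.add_apply, arith_sub_apply] at h
    rw [truncAF_apply U vonMangoldt n, if_neg (by omega), zero_add] at h
    rw [← sub_mul, ← add_mul]
    congr 1
    exact_mod_cast h
  rw [sum_congr rfl hv, sum_add_distrib, sum_sub_distrib,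
    sum_convolution _ _ (fun n => eC (θ * (n : ℝ) ^ c)), sum_convolution _ _ (fun n => eC (θ * (n : ℝ) ^ c)),
    sum_convolution _ _ (fun n => eC (θ * (n : ℝ) ^ c))]
  have b1 := H1 N N' θ (fun m => (truncAF U (moebius : ArithmeticFunction ℝ) m : ℂ)) (fun k => ArithmeticFunction.log k) hN hNN hN'
    (fun m => by
      rw [Complex.norm_real, Real.norm_eq_abs]; linarith [hmt m, hlog0 m]) (fun k _ => by rw [log_apply]; exact hlog0 k)
    (fun k hk => by
      rw [log_apply, log_apply]
      exact log_le_log (by exact_mod_cast hk) (by push_cast; linarith))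
    (fun k _ => by rw [log_apply]; linarith)
    (fun m hm => by
      rw [truncAF_apply, if_neg, Complex.ofReal_zero]
      intro hmU
      have : (m : ℝ) ≤ U := by exact_mod_cast hmU
      have := rpow_le_rpow_of_exponent_le hNr (by norm_num : (0.05 : ℝ) ≤ 0.1)
      linarith) hθ1 hθ2
  have b2 := H1 N N' θ (fun m => ((truncAF U (moebius : ArithmeticFunction ℝ) * truncAF U vonMangoldt) m : ℂ))
    (fun k => (zeta : ArithmeticFunction ℝ) k) hN hNN hN'
    (fun m => by
      rw [Complex.norm_real, Real.norm_eq_abs, ArithmeticFunction.mul_apply]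
      refine (abs_sum_le_sum_abs _ _).trans ?_
      have h1 : ∑ p ∈ m.divisorsAntidiagonal, |truncAF U (moebius : ArithmeticFunction ℝ) p.1 * truncAF U vonMangoldt p.2| ≤
          ∑ p ∈ m.divisorsAntidiagonal, vonMangoldt p.2 := by
        refine sum_le_sum fun p _ => ?_
        rw [abs_mul, abs_of_nonneg (hΛt p.2).1]
        calc _ ≤ 1 * vonMangoldt p.2 := mul_le_mul (hmt _) (hΛt _).2 (hΛt _).1 (by norm_num)
          _ = _ := one_mul _
      have h2 : ∑ p ∈ m.divisorsAntidiagonal, vonMangoldt p.2 = Real.log m := by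
        rw [Nat.sum_divisorsAntidiagonal' (fun _ b => vonMangoldt b), vonMangoldt_sum]
      linarith) (fun k hk => by rw [natCoe_apply, zeta_apply]; positivity)
    (fun k hk => by rw [natCoe_apply, natCoe_apply, zeta_apply, zeta_apply, if_neg (by omega), if_neg (by omega)])
    (fun k hk => by
      rw [natCoe_apply, zeta_apply, if_neg (by omega)]
      have := hlog0 k
      push_cast; linarith)
    (fun m hm => by
      rw [ArithmeticFunction.mul_apply, sum_eq_zero, Complex.ofReal_zero]
      intro p hp
      rw [Nat.mem_divisorsAntidiagonal] at hp
      by_contra hne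
      have h1 : p.1 ≤ U := by
        by_contra h; rw [truncAF_apply, if_neg h, zero_mul] at hne; exact hne rfl
      have h2 : p.2 ≤ U := by
        by_contra h; rw [truncAF_apply U vonMangoldt, if_neg h, mul_zero] at hne; exact hne rfl
      have h3 : m ≤ U * U := hp.1 ▸ Nat.mul_le_mul h1 h2
      have : (m : ℝ) ≤ U * U := by exact_mod_cast h3
      linarith) hθ1 hθ2
  have b3 := H2 N N' θ (fun m => ((((moebius : ArithmeticFunction ℝ) - truncAF U (moebius : ArithmeticFunction ℝ)) * (zeta : ArithmeticFunction ℝ)) m : ℂ))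
    (fun k => ((vonMangoldt - truncAF U vonMangoldt) k : ℂ)) hN hN'
    (fun m => by
      rw [Complex.norm_real, Real.norm_eq_abs, ArithmeticFunction.mul_apply]
      refine (abs_sum_le_sum_abs _ _).trans ?_
      rw [← card_divisorsAntidiagonal_eq, card_eq_sum_ones]
      push_cast
      refine sum_le_sum fun p _ => ?_
      rw [abs_mul, natCoe_apply, zeta_apply, arith_sub_apply, truncAF_apply]
      have := abs_coe_moebius_le p.1
      split_ifs
      · simp
      · simp
      · simp
      · rw [sub_zero]; push_cast; rw [abs_one, mul_one]; exact this)
    (fun k => by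
      rw [Complex.norm_real, Real.norm_eq_abs, arith_sub_apply, abs_of_nonneg (by linarith [(hΛt k).2])]
      linarith [(hΛt k).1, vonMangoldt_le_log (n := k)])
    (fun m hm => by
      rw [ArithmeticFunction.mul_apply, sum_eq_zero, Complex.ofReal_zero]
      intro p hp
      rw [Nat.mem_divisorsAntidiagonal] at hp
      have : p.1 ≤ U := (Nat.le_of_dvd (Nat.pos_of_ne_zero hp.2) ⟨_, hp.1.symm⟩).trans (hU2 m hm)
      rw [arith_sub_apply, truncAF_apply, if_pos this, sub_self, zero_mul])
    (fun m hm => by rw [arith_sub_apply, truncAF_apply, if_pos (hU2 m hm), sub_self, Complex.ofReal_zero]) hθ1 hθ2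
  calc _ ≤ _ := (norm_add_le _ _).trans (add_le_add_left (norm_sub_le _ _) _)
    _ ≤ C1 * (N : ℝ) ^ (1 - 0.01465 : ℝ) + C1 * (N : ℝ) ^ (1 - 0.01465 : ℝ) + C2 * (N : ℝ) ^ (1 - 0.01465 : ℝ) :=
      add_le_add (add_le_add b1 b2) b3
    _ = _ := by ring

end

section

open scoped ArithmeticFunction.vonMangoldt

set_option maxHeartbeats 1000000 in
lemma floor_block (c : ℝ) (hc1 : 1 < c) (hc2 : c < 2.0551) (hc3 : c ≠ 2) : ∃ C > 0, ∀ (P α : ℝ) (N N' : ℕ),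
    2 ^ 200 ≤ P → P ^ (1 - c - 0.003) ≤ α → α ≤ 1 - P ^ (1 - c - 0.003) →
    P ^ (0.985 : ℝ) ≤ N → N ≤ P → N ≤ N' → N' ≤ 3 * N →
    ‖∑ n ∈ Ioc N N', (Λ n : ℂ) * eC (⌊(n : ℝ) ^ c⌋ * α)‖ ≤ C * P ^ (1 - 0.01463 : ℝ) := by
  obtain ⟨C1, hC1, H1⟩ := vonMangoldt_sum_bound c hc1 hc2 hc3
  obtain ⟨C2, hC2, H2⟩ := typeI_inner c hc1 hc2 hc3
  obtain ⟨D, hD, HD⟩ : ∃ D > 0, ∀ x : ℝ, 1 ≤ x → (2 + log x) ^ 2 ≤ D * x ^ (0.00002 : ℝ) := by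
    have h := exists_log_le_rpow (δ := 0.00001) (by norm_num)
    refine ⟨(2 + 100000) ^ 2, by positivity, fun x hx => ?_⟩
    have h1 := h x (by linarith)
    have h2 : 1 ≤ x ^ (0.00001 : ℝ) := one_le_rpow hx (by norm_num)
    have h3 : x ^ (0.00002 : ℝ) = (x ^ (0.00001 : ℝ)) ^ 2 := by
      rw [← rpow_natCast, ← rpow_mul (by linarith)]; norm_num
    have h4 : 0 ≤ log x := log_nonneg (by linarith)
    rw [h3, ← mul_pow]
    gcongr
    norm_num at h1 ⊢
    nlinarith
  refine ⟨(16 * C1 + 720 + 5 * C2) * D, by positivity, fun P α N N' hP hα1 hα2 hPN hNP hNN hN' => ?_⟩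
  have hP1 : (1 : ℝ) ≤ P := le_trans (by norm_num) hP
  have hP0 : 0 < P := by linarith
  have hNr : (1 : ℝ) ≤ N := (one_le_rpow hP1 (by norm_num)).trans hPN
  have hN : 1 ≤ N := by exact_mod_cast hNr
  have hlP : 0 ≤ log P := log_nonneg hP1
  obtain ⟨ℓ, hℓ⟩ : ∃ ℓ, ℓ = 2 + log P := ⟨_, rfl⟩
  have hℓ1 : 1 ≤ ℓ := by linarith
  have h8 : (8 : ℝ) ≤ P ^ (0.015 : ℝ) := by
    calc (8 : ℝ) = (2 ^ (200 : ℝ)) ^ (0.015 : ℝ) := by rw [← rpow_mul (by norm_num)]; norm_num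
      _ ≤ _ := rpow_le_rpow (by positivity) (by exact_mod_cast hP) (by norm_num)
  obtain ⟨J, hJ⟩ : ∃ J, J = ⌊P ^ (0.015 : ℝ)⌋₊ := ⟨_, rfl⟩
  have hJ1 : (J : ℝ) ≤ P ^ (0.015 : ℝ) := hJ ▸ Nat.floor_le (by positivity)
  have hJ2 : P ^ (0.015 : ℝ) < J + 1 := hJ ▸ Nat.lt_floor_add_one _
  have hJ3 : 2 ≤ J := by
    have : (2 : ℝ) < J + 1 := by linarith
    have : 2 < J + 1 := by exact_mod_cast this
    omega
  have hJ0 : (0 : ℝ) < J := by positivity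
  have hα0 : 0 < α := lt_of_lt_of_le (by positivity) hα1
  have hα01 : α < 1 := lt_of_le_of_lt hα2 (by have : 0 < P ^ (1 - c - 0.003) := by positivity
                                              linarith)
  have hJN : P ^ (0.015 : ℝ) ≤ (N : ℝ) ^ (0.0155 : ℝ) := by
    calc P ^ (0.015 : ℝ) ≤ P ^ (0.985 * 0.0155 : ℝ) := rpow_le_rpow_of_exponent_le hP1 (by norm_num)
      _ = (P ^ (0.985 : ℝ)) ^ (0.0155 : ℝ) := rpow_mul hP0.le _ _
      _ ≤ _ := rpow_le_rpow (by positivity) hPN (by norm_num)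
  have hNm : (N : ℝ) ^ (-(c - 1) - 0.02) ≤ P ^ (1 - c - 0.003) := by
    calc (N : ℝ) ^ (-(c - 1) - 0.02) ≤ (P ^ (0.985 : ℝ)) ^ (-(c - 1) - 0.02) :=
          rpow_le_rpow_of_nonpos (by positivity) hPN (by linarith)
      _ = P ^ (0.985 * (-(c - 1) - 0.02)) := (rpow_mul hP0.le _ _).symm
      _ ≤ _ := rpow_le_rpow_of_exponent_le hP1 (by linarith)
  have hNY : (N : ℝ) ^ (1 - 0.01465 : ℝ) ≤ P ^ (1 - 0.01465 : ℝ) := rpow_le_rpow (by linarith) hNP (by norm_num)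
  have hcard : (#(Ioc N N') : ℝ) ≤ 3 * P := by
    rw [Nat.card_Ioc]
    calc ((N' - N : ℕ) : ℝ) ≤ (3 * N : ℕ) := by exact_mod_cast (by omega)
      _ ≤ _ := by push_cast; linarith
  have hz : ∀ n ∈ Ioc N N', ‖(Λ n : ℂ)‖ ≤ ℓ := by
    intro n hn
    rw [mem_Ioc] at hn
    rw [Complex.norm_real, Real.norm_of_nonneg ArithmeticFunction.vonMangoldt_nonneg]
    refine ArithmeticFunction.vonMangoldt_le_log.trans ?_
    have h1 : (0 : ℝ) < n := by exact_mod_cast (by omega : 0 < n)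
    have h2 : (n : ℝ) ≤ 3 * N := by exact_mod_cast (by omega : n ≤ 3 * N)
    have h3 := log_le_log h1 (h2.trans (by linarith : 3 * (N : ℝ) ≤ 3 * P))
    rw [log_mul (by norm_num) (by positivity)] at h3
    have := log_le_sub_one_of_pos (by norm_num : (0 : ℝ) < 3)
    linarith
  have hE : ∀ h ∈ Ico 1 J, ‖∑ n ∈ Ioc N N', eC (h * (n : ℝ) ^ c)‖ ≤ C2 * P ^ (1 - 0.01465 : ℝ) := by
    intro h hh
    rw [mem_Ico] at hh
    have hh1 : (1 : ℝ) ≤ h := by exact_mod_cast hh.1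
    have hhJ : (h : ℝ) ≤ J := by exact_mod_cast hh.2.le
    have := H2 N N' 1 h hN le_rfl hN (by omega) (by
      rw [abs_of_pos (by linarith)]
      exact le_trans (rpow_le_one_of_one_le_of_nonpos hNr (by linarith)) hh1) (by
      rw [abs_of_pos (by linarith)]
      have : 0 < (N : ℝ) ^ (0.0155 : ℝ) := by positivity
      linarith)
    simp only [Nat.div_one, one_mul] at this
    refine this.trans ?_
    gcongr
    exact (rpow_le_rpow_of_exponent_le hNr (by norm_num)).trans hNY
  have hF : ∀ h ∈ Ioo (-(J : ℤ)) J, ‖∑ n ∈ Ioc N N', (Λ n : ℂ) * eC ((h + α) * (n : ℝ) ^ c)‖ ≤ C1 * P ^ (1 - 0.01465 : ℝ) := by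
    intro h hh
    rw [mem_Ioo] at hh
    have g1 : (h : ℝ) ≤ J - 1 := by exact_mod_cast (by omega : h ≤ (J : ℤ) - 1)
    have g2 : -(J : ℝ) + 1 ≤ h := by exact_mod_cast (by omega : -(J : ℤ) + 1 ≤ h)
    refine (H1 N N' (h + α) hN hNN hN' (hNm.trans ?_) ?_).trans (by gcongr)
    · rcases lt_or_ge h 0 with h0 | h0
      · have : (h : ℝ) ≤ -1 := by exact_mod_cast (by omega : h ≤ -1)
        rw [abs_of_neg (by linarith)]; linarith
      · have : (0 : ℝ) ≤ h := by exact_mod_cast h0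
        rw [abs_of_pos (by linarith)]; linarith
    · have : 0 < (N : ℝ) ^ (0.0155 : ℝ) := by positivity
      rw [abs_le]; constructor <;> linarith
  have hfl := floor_sum_le (Ioc N N') (fun n => (n : ℝ) ^ c) (fun n => (Λ n : ℂ)) ℓ hz (by linarith) hα0.le hα01.le _ J hJ3
    (by positivity) hE
  refine hfl.trans ?_
  have hlJ : log J ≤ ℓ := by
    have : (J : ℝ) ≤ P := hJ1.trans (by nth_rw 2 [← rpow_one P]; exact rpow_le_rpow_of_exponent_le hP1 (by norm_num))
    have := log_le_log hJ0 this
    linarith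
  have hlJ0 : 0 ≤ log (J : ℝ) := log_natCast_nonneg J
  have s1 : ∑ h ∈ Ioo (-(J : ℤ)) J, 1 / (1 + |(h : ℝ)|) * ‖∑ n ∈ Ioc N N', (Λ n : ℂ) * eC ((h + α) * (n : ℝ) ^ c)‖ ≤
      8 * ℓ * (C1 * P ^ (1 - 0.01465 : ℝ)) := by
    calc _ ≤ ∑ h ∈ Ioo (-(J : ℤ)) J, 1 / (1 + |(h : ℝ)|) * (C1 * P ^ (1 - 0.01465 : ℝ)) :=
          sum_le_sum fun h hh => mul_le_mul_of_nonneg_left (hF h hh) (by positivity)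
      _ ≤ 8 * ℓ * (C1 * P ^ (1 - 0.01465 : ℝ)) := by
        rw [← sum_mul]
        gcongr
        exact (sum_inv_one_add_le J hJ3).trans (by linarith)
  have s2 : log J / J ≤ 2 * ℓ * P ^ (-0.015 : ℝ) := by
    rw [div_le_iff₀ hJ0]
    have e : P ^ (-0.015 : ℝ) * P ^ (0.015 : ℝ) = 1 := by rw [← rpow_add hP0]; norm_num
    have : P ^ (0.015 : ℝ) ≤ 2 * J := by linarith
    have h3 : 1 ≤ P ^ (-0.015 : ℝ) * (2 * J) := by rw [← e]; gcongr
    nlinarith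
  have e3 : P * P ^ (-0.015 : ℝ) ≤ P ^ (1 - 0.01465 : ℝ) := by
    nth_rw 1 [← rpow_one P]
    rw [← rpow_add hP0]
    exact rpow_le_rpow_of_exponent_le hP1 (by norm_num)
  have hD' := HD P hP1
  rw [← hℓ] at hD'
  obtain ⟨Y, hY⟩ : ∃ Y, Y = P ^ (1 - 0.01465 : ℝ) := ⟨_, rfl⟩
  rw [← hY] at s1 e3 ⊢
  have hY0 : 0 < Y := by rw [hY]; positivity
  calc _ ≤ 2 * (8 * ℓ * (C1 * Y)) + ℓ * (120 * (3 * P) * (2 * ℓ * P ^ (-0.015 : ℝ)) + 5 * (C2 * Y)) := by gcongr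
    _ = 16 * C1 * (ℓ * Y) + 720 * ℓ ^ 2 * (P * P ^ (-0.015 : ℝ)) + 5 * C2 * (ℓ * Y) := by ring
    _ ≤ 16 * C1 * (ℓ ^ 2 * Y) + 720 * ℓ ^ 2 * Y + 5 * C2 * (ℓ ^ 2 * Y) := by
      gcongr <;> nlinarith
    _ = (16 * C1 + 720 + 5 * C2) * Y * ℓ ^ 2 := by ring
    _ ≤ (16 * C1 + 720 + 5 * C2) * Y * (D * P ^ (0.00002 : ℝ)) := by gcongr
    _ = (16 * C1 + 720 + 5 * C2) * D * (Y * P ^ (0.00002 : ℝ)) := by ring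
    _ = _ := by rw [hY, ← rpow_add hP0]; norm_num

lemma SS_sup_bound (c : ℝ) (hc1 : 1 < c) (hc2 : c < 2.0551) (hc3 : c ≠ 2) : ∃ C > 0, ∀ P α : ℝ,
    2 ^ 200 ≤ P → P ^ (1 - c - 0.003) ≤ α → α ≤ 1 - P ^ (1 - c - 0.003) →
    ‖SS c P α‖ ≤ C * P ^ (1 - 0.0146 : ℝ) := by
  obtain ⟨C, hC, H⟩ := floor_block c hc1 hc2 hc3
  have hl := exists_log_le_rpow (δ := 0.00003) (by norm_num)
  have hl2 := exists_log_le_rpow (δ := 0.1) (by norm_num)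
  refine ⟨20 * (log 4 + 4) + 100000 * C + 20, by positivity, fun P α hP hα1 hα2 => ?_⟩
  have hP1 : (1 : ℝ) ≤ P := le_trans (by norm_num) hP
  have hP0 : 0 < P := by linarith
  set F : ℕ → ℂ := fun n => (Λ n : ℂ) * eC (⌊(n : ℝ) ^ c⌋ * α) with hF
  have hFn : ∀ n, ‖F n‖ ≤ Λ n := by
    intro n
    rw [hF]; simp only
    rw [norm_mul, norm_eC, mul_one, Complex.norm_real, Real.norm_of_nonneg ArithmeticFunction.vonMangoldt_nonneg]
  obtain ⟨B, hB⟩ : ∃ B, B = C * P ^ (1 - 0.01463 : ℝ) := ⟨_, rfl⟩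
  have hB0 : 0 ≤ B := by rw [hB]; positivity
  obtain ⟨A, hA⟩ : ∃ A, A = (log 4 + 4) * (4 * P ^ (0.985 : ℝ)) := ⟨_, rfl⟩
  have hPp : 1 ≤ P ^ (0.985 : ℝ) := one_le_rpow hP1 (by norm_num)
  have hind : ∀ n : ℕ, (n : ℝ) ≤ P → ‖∑ k ∈ Ioc 0 n, F k‖ ≤ A + B * Nat.log 2 n := by
    intro n
    induction n using Nat.strong_induction_on with
    | _ n ih =>
      intro hn
      by_cases hbig : P ^ (0.985 : ℝ) ≤ (n / 2 : ℕ)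
      · have h1 : (1 : ℝ) ≤ (n / 2 : ℕ) := hPp.trans hbig
        have h2 : 1 ≤ n / 2 := by exact_mod_cast h1
        have h3 : ((n / 2 : ℕ) : ℝ) ≤ P := le_trans (by exact_mod_cast Nat.div_le_self _ _) hn
        have i1 := ih (n / 2) (by omega) h3
        have i2 := H P α (n / 2) n hP hα1 hα2 hbig h3 (by omega) (by omega)
        rw [← sum_Ioc_consecutive F (Nat.zero_le (n / 2)) (by omega)]
        rw [Nat.log_of_one_lt_of_le (by norm_num) (by omega : 2 ≤ n)]
        refine (norm_add_le _ _).trans ?_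
        push_cast
        rw [← hB] at i2
        linarith
      · rw [not_le] at hbig
        have h1 : (n : ℝ) ≤ 2 * (n / 2 : ℕ) + 1 := by exact_mod_cast (by omega : n ≤ 2 * (n / 2) + 1)
        have h2 : (n : ℝ) ≤ 4 * P ^ (0.985 : ℝ) := by linarith
        have h3 : ‖∑ k ∈ Ioc 0 n, F k‖ ≤ Chebyshev.psi n := by
          rw [Chebyshev.psi, Nat.floor_natCast]
          exact (norm_sum_le _ _).trans (sum_le_sum fun k _ => hFn k)
        have h4 := Chebyshev.psi_le_const_mul_self (Nat.cast_nonneg n : (0 : ℝ) ≤ n)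
        have : 0 ≤ B * Nat.log 2 n := by positivity
        have : (log 4 + 4) * (n : ℝ) ≤ A := by rw [hA]; gcongr
        linarith
  have hfl : (⌊P⌋₊ : ℝ) ≤ P := Nat.floor_le hP0.le
  have h1 := hind ⌊P⌋₊ hfl
  have hfl1 : 1 ≤ ⌊P⌋₊ := Nat.one_le_floor_iff _ |>.2 hP1
  have hlog : (Nat.log 2 ⌊P⌋₊ : ℝ) ≤ 2 * log P := by
    have h := Nat.pow_log_le_self 2 (x := ⌊P⌋₊) (by omega)
    have h' : (2 : ℝ) ^ (Nat.log 2 ⌊P⌋₊) ≤ P := le_trans (by exact_mod_cast h) hfl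
    have h2 := log_le_log (by positivity) h'
    rw [log_pow] at h2
    have := log_two_gt_d9
    have : (0 : ℝ) ≤ (Nat.log 2 ⌊P⌋₊ : ℝ) := by positivity
    nlinarith
  have hdiff : ‖∑ k ∈ Ioc 0 ⌊P⌋₊, F k - SS c P α‖ ≤ 2 * √P * log P := by
    refine le_trans ?_ (Chebyshev.psi_sub_theta_le hP1)
    have e1 : SS c P α = ∑ k ∈ Ioc 0 ⌊P⌋₊, if k.Prime then F k else 0 := by
      rw [SS, ← sum_filter]
      refine sum_congr ?_ ?_
      · ext k
        simp only [mem_filter, mem_range, mem_Ioc]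
        constructor
        · rintro ⟨a, b⟩; exact ⟨⟨b.pos, by omega⟩, b⟩
        · rintro ⟨a, b⟩; exact ⟨by omega, b⟩
      · intro k hk
        rw [mem_filter] at hk
        simp only [hF]
        rw [ArithmeticFunction.vonMangoldt_apply_prime hk.2]
    rw [e1, ← sum_sub_distrib, Chebyshev.psi, Chebyshev.theta, sum_filter, ← sum_sub_distrib]
    refine (norm_sum_le _ _).trans (sum_le_sum fun k _ => ?_)
    by_cases hk : k.Prime
    · rw [if_pos hk, if_pos hk, ArithmeticFunction.vonMangoldt_apply_prime hk]; simp
    · rw [if_neg hk, if_neg hk, sub_zero, sub_zero]; exact hFn k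
  have hS : ‖SS c P α‖ ≤ ‖∑ k ∈ Ioc 0 ⌊P⌋₊, F k‖ + ‖∑ k ∈ Ioc 0 ⌊P⌋₊, F k - SS c P α‖ := by
    have := norm_sub_norm_le (SS c P α) (∑ k ∈ Ioc 0 ⌊P⌋₊, F k)
    rw [norm_sub_rev] at this
    linarith
  have hlP := hl P hP1
  have hlP2 := hl2 P hP1
  have hlP0 : 0 ≤ log P := log_nonneg hP1
  obtain ⟨Y, hY⟩ : ∃ Y, Y = P ^ (1 - 0.0146 : ℝ) := ⟨_, rfl⟩

  have t2 : B * log P ≤ 1 / 0.00003 * C * Y := by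
    calc B * log P ≤ B * (1 / 0.00003 * P ^ (0.00003 : ℝ)) := by gcongr
      _ = 1 / 0.00003 * C * (P ^ (1 - 0.01463 : ℝ) * P ^ (0.00003 : ℝ)) := by rw [hB]; ring
      _ = _ := by rw [← rpow_add hP0, hY]; norm_num
  have t3 : √P * log P ≤ 10 * Y := by
    calc √P * log P ≤ √P * (1 / 0.1 * P ^ (0.1 : ℝ)) := by gcongr
      _ = 10 * (P ^ (1 / 2 : ℝ) * P ^ (0.1 : ℝ)) := by rw [sqrt_eq_rpow]; ring
      _ ≤ _ := by
        rw [← rpow_add hP0, hY]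
        have := rpow_le_rpow_of_exponent_le hP1 (by norm_num : (1 / 2 + 0.1 : ℝ) ≤ 1 - 0.0146)
        gcongr
  have t4 : P ^ (0.985 : ℝ) ≤ Y := hY ▸ rpow_le_rpow_of_exponent_le hP1 (by norm_num)
  have t5 : A ≤ (log 4 + 4) * (4 * Y) := by rw [hA]; gcongr
  have t6 : B * (Nat.log 2 ⌊P⌋₊ : ℝ) ≤ B * (2 * log P) := by gcongr
  have hY0 : 0 < Y := by rw [hY]; positivity
  have hl4 : 0 ≤ log 4 * Y := mul_nonneg (log_nonneg (by norm_num)) hY0.le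
  have : 0 ≤ C * Y := by positivity
  rw [← hY]
  norm_num at t2
  nlinarith

end

/-- The additive quadruple difference of `y`. -/
def quadDiff (y : ℕ → ℝ) (p : (ℕ × ℕ) × (ℕ × ℕ)) : ℝ := y p.1.1 + y p.1.2 - (y p.2.1 + y p.2.2)

/-- The number of quadruples from `s` whose additive difference under `y` is at most `δ`. -/
noncomputable def quadEnergy (s : Finset ℕ) (y : ℕ → ℝ) (δ : ℝ) : ℕ :=
  #{p ∈ (s ×ˢ s) ×ˢ (s ×ˢ s) | |quadDiff y p| ≤ δ}

lemma norm_sum_eC_pow_four (s : Finset ℕ) (w : ℕ → ℝ) (y : ℕ → ℝ) (x : ℝ) :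
    ‖∑ n ∈ s, (w n : ℂ) * eC (x * y n)‖ ^ 4 =
      ∑ p ∈ (s ×ˢ s) ×ˢ (s ×ˢ s), w p.1.1 * w p.1.2 * (w p.2.1 * w p.2.2) * cos (2 * π * x * quadDiff y p) := by
  set Z := ∑ n ∈ s, (w n : ℂ) * eC (x * y n) with hZ
  have h1 : ((‖Z‖ ^ 4 : ℝ) : ℂ) = (Z * Z) * ((starRingEnd ℂ) Z * (starRingEnd ℂ) Z) := by
    rw [mul_mul_mul_comm, Complex.mul_conj']; push_cast; ring
  have h2 : (starRingEnd ℂ) Z = ∑ n ∈ s, (w n : ℂ) * eC (-(x * y n)) := by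
    rw [hZ, map_sum]; simp [conj_eC]
  have h3 : (Z * Z) * ((starRingEnd ℂ) Z * (starRingEnd ℂ) Z) =
      ∑ p ∈ (s ×ˢ s) ×ˢ (s ×ˢ s), ((w p.1.1 * w p.1.2 * (w p.2.1 * w p.2.2) : ℝ) : ℂ) * eC (x * quadDiff y p) := by
    rw [h2, hZ, sum_mul_sum, sum_mul_sum, ← sum_product', ← sum_product', sum_mul_sum, ← sum_product']
    refine sum_congr rfl fun p _ => ?_
    have : x * quadDiff y p = (x * y p.1.1 + x * y p.1.2) + (-(x * y p.2.1) + -(x * y p.2.2)) := by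
      rw [quadDiff]; ring
    rw [this, eC_add, eC_add, eC_add]
    push_cast; ring
  have h4 := congrArg Complex.re (h1.trans h3)
  rw [Complex.ofReal_re, Complex.re_sum] at h4
  rw [h4]
  refine sum_congr rfl fun p _ => ?_
  rw [Complex.re_ofReal_mul, eC_re]
  ring_nf

lemma integral_triangle_cos {T μ : ℝ} (hT : 0 < T) (hμ : μ ≠ 0) :
    ∫ x in (0 : ℝ)..T, (1 - x / T) * cos (2 * π * x * μ) = (1 - cos (2 * π * μ * T)) / (T * (2 * π * μ) ^ 2) := by
  have hk : 2 * π * μ ≠ 0 := by positivity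
  have hd : ∀ x ∈ Set.uIcc 0 T, HasDerivAt (fun x => (1 - x / T) * (sin (2 * π * μ * x) / (2 * π * μ)) - cos (2 * π * μ * x) / (T * (2 * π * μ) ^ 2))
      ((1 - x / T) * cos (2 * π * x * μ)) x := by
    intro x _
    have h1 : HasDerivAt (fun x => 2 * π * μ * x) (2 * π * μ) x := by simpa using (hasDerivAt_id x).const_mul (2 * π * μ)
    have h2 : HasDerivAt (fun x => 1 - x / T) (-(1 / T)) x := by
      simpa using ((hasDerivAt_id x).div_const T).const_sub 1
    refine ((h2.mul (h1.sin.div_const (2 * π * μ))).sub (h1.cos.div_const (T * (2 * π * μ) ^ 2))).congr_deriv ?_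
    rw [show 2 * π * x * μ = 2 * π * μ * x by ring]
    field_simp
    ring
  rw [intervalIntegral.integral_eq_sub_of_hasDerivAt hd (by apply Continuous.intervalIntegrable; fun_prop)]
  simp only [mul_zero, sin_zero, cos_zero, div_self hT.ne']
  field_simp
  ring

lemma integral_triangle_cos_nonneg {T : ℝ} (hT : 0 < T) (μ : ℝ) :
    0 ≤ ∫ x in (0 : ℝ)..T, (1 - x / T) * cos (2 * π * x * μ) := by
  rcases eq_or_ne μ 0 with rfl | hμ
  · refine intervalIntegral.integral_nonneg hT.le fun x hx => ?_
    have : x / T ≤ 1 := (div_le_one hT).2 hx.2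
    simp only [mul_zero, cos_zero, mul_one]; linarith
  · rw [integral_triangle_cos hT hμ]
    have := cos_le_one (2 * π * μ * T)
    apply div_nonneg <;> [linarith; positivity]

lemma integral_triangle {T : ℝ} (hT : 0 < T) : ∫ x in (0 : ℝ)..T, (1 - x / T) = T / 2 := by
  have hd : ∀ x ∈ Set.uIcc 0 T, HasDerivAt (fun x => x - x ^ 2 / (2 * T)) (1 - x / T) x := by
    intro x _
    refine ((hasDerivAt_id x).sub ((hasDerivAt_pow 2 x).div_const (2 * T))).congr_deriv ?_
    field_simp
    norm_num
    ring
  rw [intervalIntegral.integral_eq_sub_of_hasDerivAt hd (by apply Continuous.intervalIntegrable; fun_prop)]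
  field_simp
  ring

lemma integral_triangle_cos_ge {T μ : ℝ} (hT : 0 < T) (hμ : |μ| ≤ 1 / (2 * T)) :
    2 * T / π ^ 2 ≤ ∫ x in (0 : ℝ)..T, (1 - x / T) * cos (2 * π * x * μ) := by
  rcases eq_or_ne μ 0 with rfl | h0
  · simp only [mul_zero, cos_zero, mul_one, integral_triangle hT]
    have := pi_gt_three
    rw [div_le_div_iff₀ (by positivity) (by norm_num)]
    have : 4 ≤ π ^ 2 := by nlinarith
    nlinarith
  · rw [integral_triangle_cos hT h0]
    have h1 : |2 * π * μ * T| ≤ π := by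
      rw [abs_mul, abs_mul, abs_of_pos (by positivity : 0 < 2 * π), abs_of_pos hT]
      rw [le_div_iff₀ (by positivity)] at hμ
      nlinarith [pi_pos]
    have h2 := cos_le_one_sub_mul_cos_sq h1
    have : 2 * T / π ^ 2 = (2 / π ^ 2 * (2 * π * μ * T) ^ 2) / (T * (2 * π * μ) ^ 2) := by field_simp
    rw [this]
    gcongr
    linarith

lemma integral_triangle_cos_le {T : ℝ} (hT : 0 < T) (μ : ℝ) :
    ∫ x in (0 : ℝ)..T, (1 - x / T) * cos (2 * π * x * μ) ≤ 2 * T / (1 + (T * μ) ^ 2) := by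
  rw [le_div_iff₀ (by positivity)]
  have h1 : ∫ x in (0 : ℝ)..T, (1 - x / T) * cos (2 * π * x * μ) ≤ T / 2 := by
    rw [← integral_triangle hT]
    refine intervalIntegral.integral_mono_on hT.le (by apply Continuous.intervalIntegrable; fun_prop)
      (by apply Continuous.intervalIntegrable; fun_prop) fun x hx => ?_
    have : x / T ≤ 1 := (div_le_one hT).2 hx.2
    nlinarith [cos_le_one (2 * π * x * μ)]
  rcases eq_or_ne μ 0 with rfl | h0
  · linarith
  · have h2 : (∫ x in (0 : ℝ)..T, (1 - x / T) * cos (2 * π * x * μ)) * (T * μ) ^ 2 ≤ T := by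
      rw [integral_triangle_cos hT h0]
      have hp := pi_gt_three
      have := neg_one_le_cos (2 * π * μ * T)
      have e : (1 - cos (2 * π * μ * T)) / (T * (2 * π * μ) ^ 2) * (T * μ) ^ 2 = T * ((1 - cos (2 * π * μ * T)) / (2 * π) ^ 2) := by
        field_simp
      rw [e]
      have : (1 - cos (2 * π * μ * T)) / (2 * π) ^ 2 ≤ 1 := by
        rw [div_le_one (by positivity)]; nlinarith
      nlinarith
    linarith

lemma quadEnergy_le_integral (s : Finset ℕ) (w y : ℕ → ℝ) (hw0 : ∀ n, 0 ≤ w n) (s' : Finset ℕ) (hs : s' ⊆ s)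
    (hw1 : ∀ n ∈ s', w n = 1) {T : ℝ} (hT : 0 < T) :
    (quadEnergy s' y (1 / (2 * T)) : ℝ) * (2 * T / π ^ 2) ≤ ∫ x in (0 : ℝ)..T, ‖∑ n ∈ s, (w n : ℂ) * eC (x * y n)‖ ^ 4 := by
  have hcont : Continuous fun x : ℝ => ‖∑ n ∈ s, (w n : ℂ) * eC (x * y n)‖ ^ 4 := by
    have := continuous_eC
    fun_prop
  calc (quadEnergy s' y (1 / (2 * T)) : ℝ) * (2 * T / π ^ 2)
      = ∑ p ∈ (s' ×ˢ s') ×ˢ (s' ×ˢ s') with |quadDiff y p| ≤ 1 / (2 * T), 2 * T / π ^ 2 := by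
        rw [sum_const, nsmul_eq_mul, quadEnergy]
    _ ≤ ∑ p ∈ (s' ×ˢ s') ×ˢ (s' ×ˢ s') with |quadDiff y p| ≤ 1 / (2 * T),
        w p.1.1 * w p.1.2 * (w p.2.1 * w p.2.2) * ∫ x in (0 : ℝ)..T, (1 - x / T) * cos (2 * π * x * quadDiff y p) := by
        refine sum_le_sum fun p hp => ?_
        simp only [mem_filter, mem_product] at hp
        rw [hw1 _ hp.1.1.1, hw1 _ hp.1.1.2, hw1 _ hp.1.2.1, hw1 _ hp.1.2.2, mul_one, mul_one, one_mul]
        exact integral_triangle_cos_ge hT hp.2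
    _ ≤ ∑ p ∈ (s ×ˢ s) ×ˢ (s ×ˢ s),
        w p.1.1 * w p.1.2 * (w p.2.1 * w p.2.2) * ∫ x in (0 : ℝ)..T, (1 - x / T) * cos (2 * π * x * quadDiff y p) := by
        refine sum_le_sum_of_subset_of_nonneg ((filter_subset _ _).trans (product_subset_product (product_subset_product hs hs) (product_subset_product hs hs))) fun p _ _ => ?_
        exact mul_nonneg (mul_nonneg (mul_nonneg (hw0 _) (hw0 _)) (mul_nonneg (hw0 _) (hw0 _))) (integral_triangle_cos_nonneg hT _)
    _ = ∫ x in (0 : ℝ)..T, (1 - x / T) * ‖∑ n ∈ s, (w n : ℂ) * eC (x * y n)‖ ^ 4 := by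
        simp_rw [norm_sum_eC_pow_four, mul_sum]
        rw [intervalIntegral.integral_finsetSum]
        · refine sum_congr rfl fun p _ => ?_
          rw [← intervalIntegral.integral_const_mul]
          congr 1; ext x; ring
        · intro p _
          apply Continuous.intervalIntegrable; fun_prop
    _ ≤ _ := by
        refine intervalIntegral.integral_mono_on hT.le (by apply Continuous.intervalIntegrable; fun_prop)
          (hcont.intervalIntegrable _ _) fun x hx => ?_
        have : 0 ≤ x / T := div_nonneg hx.1 hT.le
        have : 0 ≤ ‖∑ n ∈ s, (w n : ℂ) * eC (x * y n)‖ ^ 4 := by positivity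
        nlinarith

lemma integral_le_sum_kernel (s : Finset ℕ) (y : ℕ → ℝ) {T : ℝ} (hT : 0 < T) :
    ∫ x in (0 : ℝ)..T, ‖∑ n ∈ s, eC (x * y n)‖ ^ 4 ≤
      ∑ p ∈ (s ×ˢ s) ×ˢ (s ×ˢ s), 8 * T / (1 + (2 * T * quadDiff y p) ^ 2) := by
  have hcont : Continuous fun x : ℝ => ‖∑ n ∈ s, eC (x * y n)‖ ^ 4 := by
    have := continuous_eC
    fun_prop
  have hsub : Continuous fun x : ℝ => 2 * (1 - x / (2 * T)) * ‖∑ n ∈ s, eC (x * y n)‖ ^ 4 := by fun_prop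
  calc ∫ x in (0 : ℝ)..T, ‖∑ n ∈ s, eC (x * y n)‖ ^ 4
      ≤ ∫ x in (0 : ℝ)..T, 2 * (1 - x / (2 * T)) * ‖∑ n ∈ s, eC (x * y n)‖ ^ 4 := by
        refine intervalIntegral.integral_mono_on hT.le (hcont.intervalIntegrable _ _) (hsub.intervalIntegrable _ _) fun x hx => ?_
        have : x / (2 * T) ≤ 1 / 2 := by rw [div_le_iff₀ (by positivity)]; linarith [hx.2]
        have : 0 ≤ ‖∑ n ∈ s, eC (x * y n)‖ ^ 4 := by positivity
        nlinarith
    _ ≤ ∫ x in (0 : ℝ)..(2 * T), 2 * (1 - x / (2 * T)) * ‖∑ n ∈ s, eC (x * y n)‖ ^ 4 := by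
        rw [← intervalIntegral.integral_add_adjacent_intervals (b := T) (c := 2 * T) (hsub.intervalIntegrable _ _) (hsub.intervalIntegrable _ _)]
        refine le_add_of_nonneg_right (intervalIntegral.integral_nonneg (by linarith) fun x hx => ?_)
        have : x / (2 * T) ≤ 1 := by rw [div_le_iff₀ (by positivity)]; linarith [hx.2]
        have : 0 ≤ 1 - x / (2 * T) := by linarith
        positivity
    _ = ∑ p ∈ (s ×ˢ s) ×ˢ (s ×ˢ s), 2 * ∫ x in (0 : ℝ)..(2 * T), (1 - x / (2 * T)) * cos (2 * π * x * quadDiff y p) := by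
        have h := fun x => norm_sum_eC_pow_four s (fun _ => 1) y x
        simp only [Complex.ofReal_one, one_mul] at h
        simp_rw [h, mul_sum]
        rw [intervalIntegral.integral_finsetSum]
        · refine sum_congr rfl fun p _ => ?_
          rw [← intervalIntegral.integral_const_mul]
          congr 1; ext x; ring
        · intro p _
          apply Continuous.intervalIntegrable; fun_prop
    _ ≤ _ := by
        refine sum_le_sum fun p _ => ?_
        have := integral_triangle_cos_le (by linarith : 0 < 2 * T) (quadDiff y p)
        calc _ ≤ 2 * (2 * (2 * T) / (1 + (2 * T * quadDiff y p) ^ 2)) := by linarith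
          _ = _ := by ring

lemma exists_sum_int_kernel_le : ∃ C > 0, ∀ (J : Finset ℤ) (a : ℤ), ∑ b ∈ J, 1 / (1 + ((a : ℝ) - b) ^ 2) ≤ C := by
  have hs : Summable fun k : ℤ => 1 / (1 + (k : ℝ) ^ 2) := by
    have h := ((Real.summable_one_div_int_add_rpow (1 / 2) 2).2 (by norm_num)).mul_left 2
    refine Summable.of_nonneg_of_le (fun k => by positivity) (fun k => ?_) h
    have h0 : (k : ℝ) + 1 / 2 ≠ 0 := by
      intro h
      have : ((2 * k + 1 : ℤ) : ℝ) = 0 := by push_cast; linarith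
      have := Int.cast_eq_zero.1 this
      omega
    rw [Real.rpow_two, sq_abs, ← mul_div_assoc, div_le_div_iff₀ (by positivity) (by positivity)]
    nlinarith [sq_nonneg ((k : ℝ) - 1)]
  refine ⟨∑' k : ℤ, 1 / (1 + (k : ℝ) ^ 2), hs.tsum_pos (fun k => by positivity) 0 (by simp), fun J a => ?_⟩
  have : ∑ b ∈ J, 1 / (1 + ((a : ℝ) - b) ^ 2) = ∑ k ∈ J.map (Equiv.subLeft a).toEmbedding, 1 / (1 + (k : ℝ) ^ 2) := by
    rw [sum_map]
    refine sum_congr rfl fun b _ => ?_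
    simp
  rw [this]
  exact hs.sum_le_tsum _ (fun k _ => by positivity)

/-- A positive decaying kernel summed over pairs is controlled by the near-diagonal pairs. -/
lemma exists_sum_kernel_le {ι : Type} : ∃ C : ℝ, C > 0 ∧ ∀ (s : Finset ι) (v : ι → ℝ),
    ∑ p ∈ s, ∑ q ∈ s, 1 / (1 + (v p - v q) ^ 2) ≤ C * (#{r ∈ s ×ˢ s | |v r.1 - v r.2| ≤ 1} : ℕ) := by
  obtain ⟨C, hC, hK⟩ := exists_sum_int_kernel_le
  refine ⟨3 * C, by positivity, fun s v => ?_⟩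
  set j : ι → ℤ := fun p => ⌊v p⌋
  set J := s.image j
  set r : ℤ → ℝ := fun a => #{p ∈ s | j p = a}
  have hmaps : ∀ p ∈ s, j p ∈ J := fun p hp => mem_image_of_mem _ hp
  have h1 : ∀ p q, 1 / (1 + (v p - v q) ^ 2) ≤ 3 * (1 / (1 + ((j p : ℝ) - j q) ^ 2)) := by
    intro p q
    rw [← mul_div_assoc, mul_one, div_le_div_iff₀ (by positivity) (by positivity)]
    have a1 := Int.floor_le (v p)
    have a2 := Int.lt_floor_add_one (v p)
    have b1 := Int.floor_le (v q)
    have b2 := Int.lt_floor_add_one (v q)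
    simp only [j]
    obtain ⟨d, hd⟩ : ∃ d, d = ((⌊v p⌋ : ℝ) - ⌊v q⌋) - (v p - v q) := ⟨_, rfl⟩
    have e : (⌊v p⌋ : ℝ) - ⌊v q⌋ = (v p - v q) + d := by linarith
    have : d ^ 2 ≤ 1 := by rw [sq_le_one_iff_abs_le_one, abs_le]; constructor <;> linarith
    rw [e]
    nlinarith [sq_nonneg ((v p - v q) - d)]
  have h2 : ∑ p ∈ s, ∑ q ∈ s, 1 / (1 + ((j p : ℝ) - j q) ^ 2) = ∑ a ∈ J, ∑ b ∈ J, r a * r b * (1 / (1 + ((a : ℝ) - b) ^ 2)) := by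
    rw [← sum_fiberwise_of_maps_to hmaps]
    refine sum_congr rfl fun a _ => ?_
    have : ∀ p ∈ s.filter (fun p => j p = a), ∑ q ∈ s, 1 / (1 + ((j p : ℝ) - j q) ^ 2) = ∑ b ∈ J, r b * (1 / (1 + ((a : ℝ) - b) ^ 2)) := by
      intro p hp
      rw [(mem_filter.1 hp).2, ← sum_fiberwise_of_maps_to hmaps]
      refine sum_congr rfl fun b _ => ?_
      rw [sum_congr rfl (g := fun _ => 1 / (1 + ((a : ℝ) - b) ^ 2)) (fun q hq => by rw [(mem_filter.1 hq).2]), sum_const, nsmul_eq_mul]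
    rw [sum_congr rfl this, sum_const, nsmul_eq_mul, mul_sum]
    exact sum_congr rfl fun b _ => by ring
  have h3 : ∑ a ∈ J, ∑ b ∈ J, r a * r b * (1 / (1 + ((a : ℝ) - b) ^ 2)) ≤ ∑ a ∈ J, r a ^ 2 * C := by
    have e1 : ∑ a ∈ J, ∑ b ∈ J, r a * r b * (1 / (1 + ((a : ℝ) - b) ^ 2)) ≤
        ∑ a ∈ J, ∑ b ∈ J, (r a ^ 2 / 2 * (1 / (1 + ((a : ℝ) - b) ^ 2)) + r b ^ 2 / 2 * (1 / (1 + ((a : ℝ) - b) ^ 2))) := by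
      refine sum_le_sum fun a _ => sum_le_sum fun b _ => ?_
      rw [← add_mul]
      gcongr
      nlinarith [sq_nonneg (r a - r b)]
    have e2 : ∑ a ∈ J, ∑ b ∈ J, r b ^ 2 / 2 * (1 / (1 + ((a : ℝ) - b) ^ 2)) = ∑ a ∈ J, ∑ b ∈ J, r a ^ 2 / 2 * (1 / (1 + ((a : ℝ) - b) ^ 2)) := by
      rw [sum_comm]
      refine sum_congr rfl fun a _ => sum_congr rfl fun b _ => ?_
      rw [← neg_sub, neg_sq]
    simp_rw [sum_add_distrib] at e1
    rw [e2, ← sum_add_distrib] at e1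
    refine e1.trans (sum_le_sum fun a _ => ?_)
    rw [← mul_sum, ← add_mul, add_halves]
    exact mul_le_mul_of_nonneg_left (hK J a) (by positivity)
  have h4 : ∑ a ∈ J, r a ^ 2 ≤ #{r ∈ s ×ˢ s | |v r.1 - v r.2| ≤ 1} := by
    have e : ∑ a ∈ J, r a ^ 2 = #{r ∈ s ×ˢ s | j r.1 = j r.2} := by
      have : #{r ∈ s ×ˢ s | j r.1 = j r.2} = ∑ a ∈ J, #{p ∈ s | j p = a} ^ 2 := by
        rw [card_eq_sum_card_fiberwise (f := fun r : ι × ι => j r.1) (t := J)]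
        · refine sum_congr rfl fun a _ => ?_
          rw [sq, ← card_product]
          congr 1
          ext ⟨p, q⟩
          simp only [mem_filter, mem_product]
          constructor
          · rintro ⟨⟨⟨a1, a2⟩, a3⟩, a4⟩; exact ⟨⟨a1, a4⟩, a2, by rw [← a3, a4]⟩
          · rintro ⟨⟨a1, a2⟩, a3, a4⟩; exact ⟨⟨⟨a1, a3⟩, by rw [a2, a4]⟩, a2⟩
        · intro x hx
          simp only [coe_filter, mem_product, Set.mem_ofPred_eq] at hx
          exact hmaps _ hx.1.1
      rw [this]; push_cast; rfl
    rw [e]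
    norm_cast
    refine card_le_card fun x hx => ?_
    simp only [mem_filter] at hx ⊢
    refine ⟨hx.1, ?_⟩
    exact (Int.abs_sub_lt_one_of_floor_eq_floor hx.2).le
  calc ∑ p ∈ s, ∑ q ∈ s, 1 / (1 + (v p - v q) ^ 2) ≤ ∑ p ∈ s, ∑ q ∈ s, 3 * (1 / (1 + ((j p : ℝ) - j q) ^ 2)) :=
        sum_le_sum fun p _ => sum_le_sum fun q _ => h1 p q
    _ = 3 * ∑ p ∈ s, ∑ q ∈ s, 1 / (1 + ((j p : ℝ) - j q) ^ 2) := by simp_rw [mul_sum]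
    _ ≤ 3 * (C * ∑ a ∈ J, r a ^ 2) := by rw [h2, mul_comm C, sum_mul]; exact mul_le_mul_of_nonneg_left h3 (by norm_num)
    _ ≤ 3 * (C * (#{r ∈ s ×ˢ s | |v r.1 - v r.2| ≤ 1} : ℕ)) := by gcongr
    _ = _ := by ring

lemma exists_integral_le_energy : ∃ C : ℝ, C > 0 ∧ ∀ (s : Finset ℕ) (y : ℕ → ℝ) (T : ℝ), 0 < T →
    ∫ x in (0 : ℝ)..T, ‖∑ n ∈ s, eC (x * y n)‖ ^ 4 ≤ C * T * quadEnergy s y (1 / (2 * T)) := by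
  obtain ⟨C, hC, hK⟩ := exists_sum_kernel_le (ι := ℕ × ℕ)
  refine ⟨8 * C, by positivity, fun s y T hT => (integral_le_sum_kernel s y hT).trans ?_⟩
  have h := hK (s ×ˢ s) (fun p => 2 * T * (y p.1 + y p.2))
  have e : ∀ p : (ℕ × ℕ) × (ℕ × ℕ), 2 * T * (y p.1.1 + y p.1.2) - 2 * T * (y p.2.1 + y p.2.2) = 2 * T * quadDiff y p := by
    intro p; rw [quadDiff]; ring
  rw [← sum_product'] at h
  simp only [e] at h
  have e2 : #{r ∈ (s ×ˢ s) ×ˢ (s ×ˢ s) | |2 * T * quadDiff y r| ≤ 1} = quadEnergy s y (1 / (2 * T)) := by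
    rw [quadEnergy]
    congr 1
    refine filter_congr fun p _ => ?_
    rw [abs_mul, abs_of_pos (by positivity : 0 < 2 * T), le_div_iff₀ (by positivity), mul_comm]
  rw [e2] at h
  calc _ = 8 * T * ∑ p ∈ (s ×ˢ s) ×ˢ (s ×ˢ s), 1 / (1 + (2 * T * quadDiff y p) ^ 2) := by
        rw [mul_sum]; exact sum_congr rfl fun p _ => by ring
    _ ≤ 8 * T * (C * quadEnergy s y (1 / (2 * T))) := by gcongr
    _ = _ := by ring

/-- `w0` is a bump function on `(1/2, b)` with derivatives `w1`, `w2`, everything bounded and Lipschitz with constant `B`. -/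
structure IsBump (w0 w1 w2 : ℝ → ℝ) (b B : ℝ) : Prop where
  d0 : ∀ u, HasDerivAt w0 (w1 u) u
  d1 : ∀ u, HasDerivAt w1 (w2 u) u
  c2 : Continuous w2
  b0 : ∀ u, |w0 u| ≤ B
  b1 : ∀ u, |w1 u| ≤ B
  b2 : ∀ u, |w2 u| ≤ B
  l0 : ∀ u v, |w0 u - w0 v| ≤ B * |u - v|
  l1 : ∀ u v, |w1 u - w1 v| ≤ B * |u - v|
  l2 : ∀ u v, |w2 u - w2 v| ≤ B * |u - v|
  z0 : ∀ u, u ≤ 1 / 2 ∨ b ≤ u → w0 u = 0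
  z1 : ∀ u, u ≤ 1 / 2 ∨ b ≤ u → w1 u = 0
  z2 : ∀ u, u ≤ 1 / 2 ∨ b ≤ u → w2 u = 0

lemma exists_isBump {R : ℝ} (hR : 1 ≤ R) : ∃ w0 w1 w2 : ℝ → ℝ, ∃ B, 0 < B ∧ IsBump w0 w1 w2 (R + 1) B ∧
    (∀ u, 0 ≤ w0 u) ∧ ∀ u, 1 ≤ u → u ≤ R → w0 u = 1 := by
  let f : ContDiffBump ((1 + R) / 2 : ℝ) := ⟨(R - 1) / 2 + 1 / 8, (R - 1) / 2 + 1 / 4, by linarith, by linarith⟩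
  have hf : ContDiff ℝ 3 f := f.contDiff
  have h0 : HasCompactSupport f := f.hasCompactSupport
  have h1 : HasCompactSupport (deriv f) := h0.deriv
  have h2 : HasCompactSupport (deriv (deriv f)) := h1.deriv
  have h3 : HasCompactSupport (deriv (deriv (deriv f))) := h2.deriv
  have g1 : ContDiff ℝ 2 (deriv f) := by
    rw [show (3 : WithTop ℕ∞) = 2 + 1 by norm_num] at hf
    exact (contDiff_succ_iff_deriv.1 hf).2.2
  have g2 : ContDiff ℝ 1 (deriv (deriv f)) := by
    rw [show (2 : WithTop ℕ∞) = 1 + 1 by norm_num] at g1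
    exact (contDiff_succ_iff_deriv.1 g1).2.2
  have g3 : Continuous (deriv (deriv (deriv f))) := g2.continuous_deriv le_rfl
  obtain ⟨B0, hB0⟩ := h0.exists_bound_of_continuous hf.continuous
  obtain ⟨B1, hB1⟩ := h1.exists_bound_of_continuous g1.continuous
  obtain ⟨B2, hB2⟩ := h2.exists_bound_of_continuous g2.continuous
  obtain ⟨B3, hB3⟩ := h3.exists_bound_of_continuous g3
  have lip : ∀ (h : ℝ → ℝ) (K : ℝ), Differentiable ℝ h → (∀ u, ‖deriv h u‖ ≤ K) → ∀ u v, |h u - h v| ≤ K * |u - v| := by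
    intro h K hd hK u v
    have := Convex.norm_image_sub_le_of_norm_deriv_le (s := Set.univ) (f := h) (C := K) (x := v) (y := u)
      (fun x _ => hd x) (fun x _ => hK x) convex_univ (Set.mem_univ _) (Set.mem_univ _)
    simpa using this
  have ht : ∀ u : ℝ, u ≤ 1 / 2 ∨ R + 1 ≤ u → u ∉ tsupport f := by
    intro u hu
    rw [f.tsupport_eq, Metric.mem_closedBall, Real.dist_eq, not_le]
    change (R - 1) / 2 + 1 / 4 < _
    rcases hu with hu | hu
    · rw [abs_of_neg (by linarith)]; linarith
    · rw [abs_of_pos (by linarith)]; linarith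
  have s1 := support_deriv_subset (𝕜 := ℝ) (f := f)
  have s2 := (support_deriv_subset (𝕜 := ℝ) (f := deriv f)).trans (closure_minimal s1 isClosed_closure)
  obtain ⟨B, hB⟩ : ∃ B, B = max 1 (max (max B0 B1) (max B2 B3)) := ⟨_, rfl⟩
  have p0 : B0 ≤ B := by rw [hB]; simp
  have p1 : B1 ≤ B := by rw [hB]; simp
  have p2 : B2 ≤ B := by rw [hB]; simp
  have p3 : B3 ≤ B := by rw [hB]; simp
  refine ⟨f, deriv f, deriv (deriv f), B, by rw [hB]; positivity, ⟨?_, ?_, g2.continuous, fun u => (hB0 u).trans p0, fun u => (hB1 u).trans p1, fun u => (hB2 u).trans p2, ?_, ?_, ?_, ?_, ?_, ?_⟩, fun u => f.nonneg, ?_⟩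
  · exact fun u => (hf.differentiable (by norm_num) u).hasDerivAt
  · exact fun u => (g1.differentiable (by norm_num) u).hasDerivAt
  · exact lip _ _ (hf.differentiable (by norm_num)) fun u => (hB1 u).trans p1
  · exact lip _ _ (g1.differentiable (by norm_num)) fun u => (hB2 u).trans p2
  · exact lip _ _ (g2.differentiable (by norm_num)) fun u => (hB3 u).trans p3
  · exact fun u hu => image_eq_zero_of_notMem_tsupport (ht u hu)
  · exact fun u hu => by_contra fun h => ht u hu (s1 h)
  · exact fun u hu => by_contra fun h => ht u hu (s2 h)
  · intro u h1 h2
    apply f.one_of_mem_closedBall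
    rw [Metric.mem_closedBall, Real.dist_eq, abs_le]
    change -((R - 1) / 2 + 1 / 8) ≤ _ ∧ _ ≤ (R - 1) / 2 + 1 / 8
    constructor <;> linarith

lemma HasDerivAt.eC_comp {f : ℝ → ℝ} {f' x : ℝ} (hf : HasDerivAt f f' x) :
    HasDerivAt (fun x => eC (f x)) (eC (f x) * (2 * π * Complex.I * f')) x := by
  have h := ((hf.const_mul (2 * π)).ofReal_comp.mul_const Complex.I).cexp
  refine h.congr_deriv ?_
  simp only [eC]
  push_cast; ring

/-- The boundary term in twice-iterated integration by parts. -/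
noncomputable def bdTerm (w0 w1 f f1 f2 : ℝ → ℝ) (v : ℝ) : ℂ :=
  eC (f v) * ((w0 v / f1 v : ℝ) / (2 * π * Complex.I) + ((w1 v / f1 v ^ 2 - w0 v * f2 v / f1 v ^ 3) / (4 * π ^ 2) : ℝ))

/-- The remainder weight in twice-iterated integration by parts. -/
noncomputable def remTerm (w0 w1 w2 f1 f2 f3 : ℝ → ℝ) (v : ℝ) : ℝ :=
  w2 v / f1 v ^ 2 - 3 * w1 v * f2 v / f1 v ^ 3 - w0 v * f3 v / f1 v ^ 3 + 3 * w0 v * f2 v ^ 2 / f1 v ^ 4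

lemma integral_by_parts_twice {p q : ℝ} {w0 w1 w2 f f1 f2 f3 : ℝ → ℝ}
    (hw0 : ∀ v ∈ Set.uIcc p q, HasDerivAt w0 (w1 v) v) (hw1 : ∀ v ∈ Set.uIcc p q, HasDerivAt w1 (w2 v) v)
    (hw2 : ContinuousOn w2 (Set.uIcc p q))
    (hf : ∀ v ∈ Set.uIcc p q, HasDerivAt f (f1 v) v) (hf1 : ∀ v ∈ Set.uIcc p q, HasDerivAt f1 (f2 v) v)
    (hf2 : ∀ v ∈ Set.uIcc p q, HasDerivAt f2 (f3 v) v) (hf3 : ContinuousOn f3 (Set.uIcc p q))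
    (hne : ∀ v ∈ Set.uIcc p q, f1 v ≠ 0) :
    ∫ v in p..q, (w0 v : ℂ) * eC (f v) = bdTerm w0 w1 f f1 f2 q - bdTerm w0 w1 f f1 f2 p
      - 1 / (4 * π ^ 2) * ∫ v in p..q, (remTerm w0 w1 w2 f1 f2 f3 v : ℂ) * eC (f v) := by
  have cw0 : ContinuousOn w0 (Set.uIcc p q) := fun v hv => (hw0 v hv).continuousAt.continuousWithinAt
  have cw1 : ContinuousOn w1 (Set.uIcc p q) := fun v hv => (hw1 v hv).continuousAt.continuousWithinAt
  have cf : ContinuousOn f (Set.uIcc p q) := fun v hv => (hf v hv).continuousAt.continuousWithinAt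
  have cf1 : ContinuousOn f1 (Set.uIcc p q) := fun v hv => (hf1 v hv).continuousAt.continuousWithinAt
  have cf2 : ContinuousOn f2 (Set.uIcc p q) := fun v hv => (hf2 v hv).continuousAt.continuousWithinAt
  have ce : ContinuousOn (fun v => eC (f v)) (Set.uIcc p q) := continuous_eC.comp_continuousOn cf
  have crem : ContinuousOn (remTerm w0 w1 w2 f1 f2 f3) (Set.uIcc p q) := by
    unfold remTerm
    refine ContinuousOn.add (ContinuousOn.sub (ContinuousOn.sub ?_ ?_) ?_) ?_
    · exact hw2.div (cf1.pow 2) fun v hv => pow_ne_zero _ (hne v hv)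
    · exact ((cw1.const_mul 3).mul cf2).div (cf1.pow 3) fun v hv => pow_ne_zero _ (hne v hv)
    · exact (cw0.mul hf3).div (cf1.pow 3) fun v hv => pow_ne_zero _ (hne v hv)
    · exact ((cw0.const_mul 3).mul (cf2.pow 2)).div (cf1.pow 4) fun v hv => pow_ne_zero _ (hne v hv)
  have i1 : IntervalIntegrable (fun v => (w0 v : ℂ) * eC (f v)) volume p q :=
    ((Complex.continuous_ofReal.comp_continuousOn cw0).mul ce).intervalIntegrable
  have i2 : IntervalIntegrable (fun v => (remTerm w0 w1 w2 f1 f2 f3 v : ℂ) * eC (f v)) volume p q :=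
    ((Complex.continuous_ofReal.comp_continuousOn crem).mul ce).intervalIntegrable
  have hd : ∀ v ∈ Set.uIcc p q, HasDerivAt (bdTerm w0 w1 f f1 f2)
      ((w0 v : ℂ) * eC (f v) + 1 / (4 * π ^ 2) * ((remTerm w0 w1 w2 f1 f2 f3 v : ℂ) * eC (f v))) v := by
    intro v hv
    have h1 := hne v hv
    have a1 := ((hw0 v hv).fun_div (hf1 v hv) h1).ofReal_comp.div_const (2 * π * Complex.I)
    have a2 := ((hw1 v hv).fun_div ((hf1 v hv).fun_pow 2) (pow_ne_zero 2 h1)).fun_sub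
      (((hw0 v hv).fun_mul (hf2 v hv)).fun_div ((hf1 v hv).fun_pow 3) (pow_ne_zero 3 h1))
    have a3 := (a2.div_const (4 * π ^ 2)).ofReal_comp
    refine ((hf v hv).eC_comp.mul (a1.add a3)).congr_deriv ?_
    have h1' : (f1 v : ℂ) ≠ 0 := by exact_mod_cast h1
    have hpi : (π : ℂ) ≠ 0 := by exact_mod_cast pi_ne_zero
    have hI : Complex.I ^ 2 = -1 := Complex.I_sq
    simp only [remTerm, Pi.add_apply]
    push_cast
    field_simp
    linear_combination (eC (f v) * π * (4 * f1 v ^ 3 * w1 v - 4 * f1 v ^ 2 * w0 v * f2 v)) * hI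
  have := intervalIntegral.integral_eq_sub_of_hasDerivAt hd (i1.add (i2.const_mul _))
  rw [intervalIntegral.integral_add i1 (i2.const_mul _), intervalIntegral.integral_const_mul] at this
  rw [← this]; ring

/-- `F` is bounded and Lipschitz on `S`, both with constant `K`. -/
def IsGood (S : Set ℝ) (K : ℝ) (F : ℝ → ℂ) : Prop :=
  (∀ s ∈ S, ‖F s‖ ≤ K) ∧ ∀ s ∈ S, ∀ t ∈ S, ‖F s - F t‖ ≤ K * |s - t|

namespace IsGood

variable {S : Set ℝ} {K L : ℝ} {F G : ℝ → ℂ}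

lemma congr (h : IsGood S K F) (he : ∀ s ∈ S, G s = F s) : IsGood S K G :=
  ⟨fun s hs => by rw [he s hs]; exact h.1 s hs, fun s hs t ht => by rw [he s hs, he t ht]; exact h.2 s hs t ht⟩

lemma mono (h : IsGood S K F) (hKL : K ≤ L) : IsGood S L F :=
  ⟨fun s hs => (h.1 s hs).trans hKL, fun s hs t ht => (h.2 s hs t ht).trans (by gcongr)⟩

lemma add (hF : IsGood S K F) (hG : IsGood S L G) : IsGood S (K + L) (fun s => F s + G s) :=
  ⟨fun s hs => (norm_add_le _ _).trans (add_le_add (hF.1 s hs) (hG.1 s hs)), fun s hs t ht => by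
    rw [add_sub_add_comm, add_mul]
    exact (norm_add_le _ _).trans (add_le_add (hF.2 s hs t ht) (hG.2 s hs t ht))⟩

lemma const_mul (hF : IsGood S K F) (a : ℂ) : IsGood S (‖a‖ * K) (fun s => a * F s) :=
  ⟨fun s hs => by rw [norm_mul]; gcongr; exact hF.1 s hs, fun s hs t ht => by
    rw [← mul_sub, norm_mul, mul_assoc]; gcongr; exact hF.2 s hs t ht⟩

lemma const_mul_le (hF : IsGood S K F) {a : ℂ} {k : ℝ} (hK : 0 ≤ K) (ha : ‖a‖ ≤ k) :
    IsGood S (k * K) (fun s => a * F s) := (hF.const_mul a).mono (by gcongr)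

lemma neg (hF : IsGood S K F) : IsGood S K (fun s => -F s) := by
  have := hF.const_mul (-1)
  simpa using this

lemma sub (hF : IsGood S K F) (hG : IsGood S L G) : IsGood S (K + L) (fun s => F s - G s) := by
  simpa only [sub_eq_add_neg] using hF.add hG.neg

lemma mul (hF : IsGood S K F) (hG : IsGood S L G) (hK : 0 ≤ K) (hL : 0 ≤ L) : IsGood S (2 * K * L) (fun s => F s * G s) :=
  ⟨fun s hs => by
    rw [norm_mul]
    calc _ ≤ K * L := by gcongr; exacts [hF.1 s hs, hG.1 s hs]
      _ ≤ _ := by nlinarith [mul_nonneg hK hL], fun s hs t ht => by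
    have e : F s * G s - F t * G t = F s * (G s - G t) + (F s - F t) * G t := by ring
    rw [e]
    calc _ ≤ ‖F s‖ * ‖G s - G t‖ + ‖F s - F t‖ * ‖G t‖ := by
            rw [← norm_mul, ← norm_mul]; exact norm_add_le _ _
      _ ≤ K * (L * |s - t|) + (K * |s - t|) * L := by
            gcongr
            exacts [hF.1 s hs, hG.2 s hs t ht, hF.2 s hs t ht, hG.1 t ht]
      _ = _ := by ring⟩

lemma integral {F : ℝ → ℝ → ℂ} {K : ℝ → ℝ} {p q : ℝ} (hpq : p ≤ q)
    (hF : ∀ s ∈ S, IntervalIntegrable (fun v => F v s) volume p q) (hK : IntervalIntegrable K volume p q)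
    (h : ∀ v ∈ Set.Icc p q, IsGood S (K v) (F v)) : IsGood S (∫ v in p..q, K v) (fun s => ∫ v in p..q, F v s) := by
  refine ⟨fun s hs => ?_, fun s hs t ht => ?_⟩
  · exact intervalIntegral.norm_integral_le_of_norm_le hpq (by filter_upwards with v hv using (h v (Set.Ioc_subset_Icc_self hv)).1 s hs) hK
  · rw [← intervalIntegral.integral_sub (hF s hs) (hF t ht), ← intervalIntegral.integral_mul_const]
    exact intervalIntegral.norm_integral_le_of_norm_le hpq (by filter_upwards with v hv using (h v (Set.Ioc_subset_Icc_self hv)).2 s hs t ht) (hK.mul_const _)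

end IsGood

lemma exists_mvt {f f' : ℝ → ℝ} {lo hi : ℝ} (hf : ∀ z ∈ Set.Icc lo hi, HasDerivAt f (f' z) z) {u v : ℝ}
    (hu : u ∈ Set.Icc lo hi) (hv : v ∈ Set.Icc lo hi) : ∃ z ∈ Set.uIcc u v, f v - f u = f' z * (v - u) := by
  wlog huv : u ≤ v generalizing u v
  · obtain ⟨z, hz, h⟩ := this hv hu (le_of_not_ge huv)
    exact ⟨z, by rwa [Set.uIcc_comm], by linarith⟩
  rcases huv.eq_or_lt with rfl | huv
  · exact ⟨u, by simp, by simp⟩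
  have hsub : Set.Icc u v ⊆ Set.Icc lo hi := Set.Icc_subset_Icc hu.1 hv.2
  obtain ⟨z, hz, h⟩ := exists_hasDerivAt_eq_slope f f' huv (fun z hz => (hf z (hsub hz)).continuousAt.continuousWithinAt)
    (fun z hz => hf z (hsub (Set.Ioo_subset_Icc_self hz)))
  refine ⟨z, by rw [Set.uIcc_of_le huv.le]; exact Set.Ioo_subset_Icc_self hz, ?_⟩
  rw [h]; field_simp [(sub_pos.2 huv).ne']

lemma exists_rpow_lipschitz {lo : ℝ} (hlo : 0 < lo) (hi p : ℝ) : ∃ C > 0, ∀ s ∈ Set.Icc lo hi,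
    |s ^ p| ≤ C ∧ ∀ t ∈ Set.Icc lo hi, |s ^ p - t ^ p| ≤ C * |s - t| := by
  have hc : ∀ q : ℝ, ContinuousOn (fun s : ℝ => s ^ q) (Set.Icc lo hi) := fun q s hs =>
    (continuousAt_rpow_const _ _ (Or.inl (hlo.trans_le hs.1).ne')).continuousWithinAt
  obtain ⟨C1, h1⟩ := isCompact_Icc.exists_bound_of_continuousOn (hc p)
  obtain ⟨C2, h2⟩ := isCompact_Icc.exists_bound_of_continuousOn ((hc (p - 1)).const_mul p)
  refine ⟨max 1 (max C1 C2), by positivity, fun s hs => ⟨(h1 s hs).trans (by simp), fun t ht => ?_⟩⟩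
  obtain ⟨z, hz, h⟩ := exists_mvt (f := fun s => s ^ p) (f' := fun s => p * s ^ (p - 1))
    (fun z hz => hasDerivAt_rpow_const (Or.inl (hlo.trans_le hz.1).ne')) ht hs
  rw [h, abs_mul]
  gcongr
  exact (h2 z ((Set.uIcc_subset_Icc ht hs) hz)).trans (by simp)

lemma norm_eC_sub_le (a b : ℝ) : ‖eC a - eC b‖ ≤ 2 * π * |a - b| := by
  have h : ∀ x ∈ (Set.univ : Set ℝ), HasDerivWithinAt eC (eC x * (2 * π * Complex.I)) Set.univ x := by
    intro x _
    have : HasDerivAt eC (eC x * (2 * π * Complex.I)) x := by simpa using (hasDerivAt_id x).eC_comp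
    exact this.hasDerivWithinAt
  have := convex_univ.norm_image_sub_le_of_norm_hasDerivWithin_le (C := 2 * π) h (fun x _ => by
    rw [norm_mul, norm_eC]; simp [abs_of_pos pi_pos]) (Set.mem_univ b) (Set.mem_univ a)
  simpa using this

/-- The elementary oscillating block `s ↦ s^k / s^{αl} · ω(sv) e(x s^α g)`. -/
noncomputable def oscBlock (α : ℝ) (k l : ℕ) (ω : ℝ → ℝ) (x v g s : ℝ) : ℂ :=
  ((s ^ k / (s ^ α) ^ l * ω (s * v) : ℝ) : ℂ) * eC (x * s ^ α * g)

lemma exists_oscBlock_isGood {lo : ℝ} (hlo : 0 < lo) (hi vhi α : ℝ) {ω : ℝ → ℝ} {B : ℝ} (hB : 0 < B)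
    (hb : ∀ u, |ω u| ≤ B) (hl : ∀ u v, |ω u - ω v| ≤ B * |u - v|) (k l : ℕ) : ∃ C > 0, ∀ x v g : ℝ, 0 ≤ x → 0 ≤ v → v ≤ vhi → 0 ≤ g →
      IsGood (Set.Icc lo hi) (C * (1 + x * g)) (oscBlock α k l ω x v g) := by
  obtain ⟨C1, hC1, h1⟩ := exists_rpow_lipschitz hlo hi (k - α * l)
  obtain ⟨C2, hC2, h2⟩ := exists_rpow_lipschitz hlo hi α
  obtain ⟨D, hD⟩ : ∃ D, D = max 1 vhi := ⟨_, rfl⟩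
  have hD1 : 1 ≤ D := by rw [hD]; simp
  obtain ⟨E, hE⟩ : ∃ E, E = max 1 (2 * π * C2) := ⟨_, rfl⟩
  have hE1 : 1 ≤ E := by rw [hE]; simp
  have hE2 : 2 * π * C2 ≤ E := by rw [hE]; simp
  refine ⟨2 * (2 * C1 * (B * D)) * E, by positivity, fun x v g hx hv0 hv hg => ?_⟩
  have hxg := mul_nonneg hx hg
  have g1 : IsGood (Set.Icc lo hi) C1 (fun s => ((s ^ k / (s ^ α) ^ l : ℝ) : ℂ)) := by
    have e : ∀ s ∈ Set.Icc lo hi, s ^ k / (s ^ α) ^ l = s ^ ((k : ℝ) - α * l) := fun s hs => by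
      rw [rpow_sub (hlo.trans_le hs.1), rpow_natCast, rpow_mul_natCast (hlo.trans_le hs.1).le]
    refine ⟨fun s hs => ?_, fun s hs t ht => ?_⟩
    · rw [Complex.norm_real, e s hs]; exact (h1 s hs).1
    · rw [← Complex.ofReal_sub, Complex.norm_real, e s hs, e t ht]; exact (h1 s hs).2 t ht
  have g2 : IsGood (Set.Icc lo hi) (B * D) (fun s => ((ω (s * v) : ℝ) : ℂ)) := by
    refine ⟨fun s hs => ?_, fun s hs t ht => ?_⟩
    · rw [Complex.norm_real]; exact (hb _).trans (le_mul_of_one_le_right hB.le hD1)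
    · rw [← Complex.ofReal_sub, Complex.norm_real]
      refine (hl _ _).trans ?_
      rw [← sub_mul, abs_mul, abs_of_nonneg hv0, mul_assoc, mul_comm |s - t|]
      have : v ≤ D := hv.trans (by rw [hD]; simp)
      gcongr
  have g3 : IsGood (Set.Icc lo hi) (E * (1 + x * g)) (fun s => eC (x * s ^ α * g)) := by
    refine ⟨fun s hs => ?_, fun s hs t ht => ?_⟩
    · rw [norm_eC]; nlinarith
    · refine (norm_eC_sub_le _ _).trans ?_
      have e : x * s ^ α * g - x * t ^ α * g = x * g * (s ^ α - t ^ α) := by ring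
      rw [e, abs_mul, abs_of_nonneg hxg]
      calc 2 * π * (x * g * |s ^ α - t ^ α|) ≤ 2 * π * (x * g * (C2 * |s - t|)) := by gcongr; exact (h2 s hs).2 t ht
        _ = (2 * π * C2) * (x * g) * |s - t| := by ring
        _ ≤ E * (1 + x * g) * |s - t| := by gcongr; linarith
  have := (g1.mul g2 hC1.le (by positivity)).mul g3 (by positivity) (by positivity)
  refine (this.mono (le_of_eq (by ring))).congr fun s _ => ?_
  rw [oscBlock]; push_cast; ring

/-- The normalized phase `v^α - αv + α - 1` with its derivatives. -/
noncomputable def gPh (α v : ℝ) : ℝ := v ^ α - α * v + (α - 1)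
noncomputable def gPh1 (α v : ℝ) : ℝ := α * v ^ (α - 1) - α
noncomputable def gPh2 (α v : ℝ) : ℝ := α * (α - 1) * v ^ (α - 2)
noncomputable def gPh3 (α v : ℝ) : ℝ := α * (α - 1) * (α - 2) * v ^ (α - 3)

lemma hasDerivAt_gPh (α : ℝ) {v : ℝ} (hv : 0 < v) : HasDerivAt (gPh α) (gPh1 α v) v := by
  have := ((hasDerivAt_rpow_const (p := α) (Or.inl hv.ne')).fun_sub ((hasDerivAt_id' v).const_mul α)).add_const (α - 1)
  exact this.congr_deriv (by rw [gPh1]; ring)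

lemma hasDerivAt_gPh1 (α : ℝ) {v : ℝ} (hv : 0 < v) : HasDerivAt (gPh1 α) (gPh2 α v) v := by
  have := ((hasDerivAt_rpow_const (p := α - 1) (Or.inl hv.ne')).const_mul α).sub_const α
  exact this.congr_deriv (by rw [gPh2, show α - 1 - 1 = α - 2 by ring]; ring)

lemma hasDerivAt_gPh2 (α : ℝ) {v : ℝ} (hv : 0 < v) : HasDerivAt (gPh2 α) (gPh3 α v) v := by
  have := (hasDerivAt_rpow_const (p := α - 2) (Or.inl hv.ne')).const_mul (α * (α - 1))
  exact this.congr_deriv (by rw [gPh3, show α - 2 - 1 = α - 3 by ring]; ring)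

lemma gPh_one (α : ℝ) : gPh α 1 = 0 := by rw [gPh, one_rpow]; ring
lemma gPh1_one (α : ℝ) : gPh1 α 1 = 0 := by rw [gPh1, one_rpow]; ring

lemma continuousOn_gPh3 (α : ℝ) : ContinuousOn (gPh3 α) (Set.Ioi 0) := fun _ hv =>
  ((continuousAt_rpow_const _ _ (Or.inl (ne_of_gt hv))).const_mul _).continuousWithinAt

lemma exists_gPh_bounds {α lo hi : ℝ} (hα : 1 < α) (hlo : 0 < lo) (h1 : (1 : ℝ) ∈ Set.Icc lo hi) :
    ∃ m G : ℝ, 0 < m ∧ 0 < G ∧ ∀ v ∈ Set.Icc lo hi, m * |v - 1| ≤ |gPh1 α v| ∧ 0 ≤ gPh α v ∧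
      gPh α v ≤ G * |v - 1| ^ 2 ∧ |gPh2 α v| ≤ G ∧ |gPh3 α v| ≤ G := by
  have hpos : ∀ v ∈ Set.Icc lo hi, 0 < v := fun v hv => hlo.trans_le hv.1
  have c2 : ContinuousOn (gPh2 α) (Set.Icc lo hi) := fun v hv => (hasDerivAt_gPh2 α (hpos v hv)).continuousAt.continuousWithinAt
  have c3 : ContinuousOn (gPh3 α) (Set.Icc lo hi) := (continuousOn_gPh3 α).mono hpos
  have p2 : ∀ v ∈ Set.Icc lo hi, 0 < gPh2 α v := fun v hv => by
    have := rpow_pos_of_pos (hpos v hv) (α - 2)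
    rw [gPh2]; have : 0 < α - 1 := by linarith
    positivity
  obtain ⟨v0, hv0, hmin⟩ := isCompact_Icc.exists_isMinOn ⟨1, h1⟩ c2
  obtain ⟨G2, hG2⟩ := isCompact_Icc.exists_bound_of_continuousOn c2
  obtain ⟨G3, hG3⟩ := isCompact_Icc.exists_bound_of_continuousOn c3
  obtain ⟨G, hG⟩ : ∃ G, G = max 1 (max G2 G3) := ⟨_, rfl⟩
  have q2 : ∀ v ∈ Set.Icc lo hi, |gPh2 α v| ≤ G := fun v hv => (hG2 v hv).trans (by rw [hG]; simp)
  refine ⟨gPh2 α v0, G, p2 v0 hv0, by rw [hG]; positivity, fun v hv => ?_⟩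
  have k1 : ∀ v ∈ Set.Icc lo hi, ∃ z ∈ Set.uIcc 1 v, gPh1 α v = gPh2 α z * (v - 1) := fun v hv => by
    obtain ⟨z, hz, h⟩ := exists_mvt (fun z hz => hasDerivAt_gPh1 α (hpos z hz)) h1 hv
    exact ⟨z, hz, by rw [← h, gPh1_one]; ring⟩
  refine ⟨?_, ?_⟩
  · obtain ⟨z, hz, h⟩ := k1 v hv
    have hz' := Set.uIcc_subset_Icc h1 hv hz
    rw [h, abs_mul, abs_of_pos (p2 z hz')]
    gcongr
    exact hmin hz'
  · obtain ⟨z, hz, h⟩ := exists_mvt (fun z hz => hasDerivAt_gPh α (hpos z hz)) h1 hv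
    have hz' := Set.uIcc_subset_Icc h1 hv hz
    obtain ⟨y, hy, h'⟩ := k1 z hz'
    have hy' := Set.uIcc_subset_Icc h1 hz' hy
    rw [gPh_one, sub_zero, h'] at h
    have e1 : 0 ≤ (z - 1) * (v - 1) := by
      rcases Set.mem_uIcc.1 hz with ⟨a, b⟩ | ⟨a, b⟩ <;> nlinarith
    have e2 : (z - 1) * (v - 1) ≤ |v - 1| ^ 2 := by
      rw [sq_abs]
      rcases Set.mem_uIcc.1 hz with ⟨a, b⟩ | ⟨a, b⟩ <;> nlinarith
    have e3 := p2 y hy'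
    have e4 := q2 y hy'
    rw [abs_of_pos e3] at e4
    refine ⟨by rw [h]; nlinarith, by rw [h]; nlinarith [mul_le_mul e4 e2 e1 (e3.le.trans e4)], q2 v hv, (hG3 v hv).trans (by rw [hG]; simp)⟩

lemma bdTerm_eq_oscBlock {α s v x : ℝ} (w0 w1 : ℝ → ℝ) (hs : 0 < s) (hx : 0 < x) (hg : gPh1 α v ≠ 0) :
    bdTerm (fun v => s * w0 (s * v)) (fun v => s ^ 2 * w1 (s * v)) (fun v => x * s ^ α * gPh α v)
      (fun v => x * s ^ α * gPh1 α v) (fun v => x * s ^ α * gPh2 α v) v =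
    (1 / (2 * π * Complex.I * (x * gPh1 α v : ℝ))) * oscBlock α 1 1 w0 x v (gPh α v) s +
    (((1 / (4 * π ^ 2 * (x * gPh1 α v) ^ 2) : ℝ) : ℂ) * oscBlock α 2 2 w1 x v (gPh α v) s -
      ((gPh2 α v * x / (4 * π ^ 2 * (x * gPh1 α v) ^ 3) : ℝ) : ℂ) * oscBlock α 1 2 w0 x v (gPh α v) s) := by
  have hA : (s ^ α : ℝ) ≠ 0 := (rpow_pos_of_pos hs α).ne'
  simp only [bdTerm, oscBlock]
  obtain ⟨A, hA'⟩ : ∃ A, A = s ^ α := ⟨_, rfl⟩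
  rw [← hA'] at hA ⊢
  have hA2 : (A : ℂ) ≠ 0 := by exact_mod_cast hA
  have hx2 : (x : ℂ) ≠ 0 := by exact_mod_cast hx.ne'
  have hg2 : (gPh1 α v : ℂ) ≠ 0 := by exact_mod_cast hg
  have hpi : (π : ℂ) ≠ 0 := by exact_mod_cast pi_ne_zero
  push_cast
  field_simp

lemma remTerm_eq_oscBlock {α s v x : ℝ} (w0 w1 w2 : ℝ → ℝ) (hs : 0 < s) (hx : 0 < x) (hg : gPh1 α v ≠ 0) :
    (remTerm (fun v => s * w0 (s * v)) (fun v => s ^ 2 * w1 (s * v)) (fun v => s ^ 3 * w2 (s * v))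
      (fun v => x * s ^ α * gPh1 α v) (fun v => x * s ^ α * gPh2 α v) (fun v => x * s ^ α * gPh3 α v) v : ℂ) * eC (x * s ^ α * gPh α v) =
    ((1 / (x ^ 2 * gPh1 α v ^ 2) : ℝ) : ℂ) * oscBlock α 3 2 w2 x v (gPh α v) s +
    (((-3 * gPh2 α v / (x ^ 2 * gPh1 α v ^ 3) : ℝ) : ℂ) * oscBlock α 2 2 w1 x v (gPh α v) s +
      ((-gPh3 α v / (x ^ 2 * gPh1 α v ^ 3) + 3 * gPh2 α v ^ 2 / (x ^ 2 * gPh1 α v ^ 4) : ℝ) : ℂ) * oscBlock α 1 2 w0 x v (gPh α v) s) := by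
  have hA : (s ^ α : ℝ) ≠ 0 := (rpow_pos_of_pos hs α).ne'
  simp only [remTerm, oscBlock]
  obtain ⟨A, hA'⟩ : ∃ A, A = s ^ α := ⟨_, rfl⟩
  rw [← hA'] at hA ⊢
  have hA2 : (A : ℂ) ≠ 0 := by exact_mod_cast hA
  have hx2 : (x : ℂ) ≠ 0 := by exact_mod_cast hx.ne'
  have hg2 : (gPh1 α v : ℂ) ≠ 0 := by exact_mod_cast hg
  push_cast
  field_simp
  ring

lemma integral_inv_sq_le {p q y : ℝ} (hpq : p ≤ q) (hy : 0 < y) (h : ∀ v ∈ Set.Icc p q, y ≤ |v - 1|) :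
    IntervalIntegrable (fun v : ℝ => 1 / |v - 1| ^ 2) volume p q ∧ ∫ v in p..q, 1 / |v - 1| ^ 2 ≤ 2 / y := by
  have hne : ∀ v ∈ Set.uIcc p q, v - 1 ≠ 0 := fun v hv => by
    rw [Set.uIcc_of_le hpq] at hv
    exact abs_pos.1 (hy.trans_le (h v hv))
  have hi : IntervalIntegrable (fun v : ℝ => 1 / |v - 1| ^ 2) volume p q := by
    apply ContinuousOn.intervalIntegrable
    refine continuousOn_const.div (by fun_prop) fun v hv => pow_ne_zero _ (abs_ne_zero.2 (hne v hv))
  have hd : ∀ v ∈ Set.uIcc p q, HasDerivAt (fun v : ℝ => -(v - 1)⁻¹) (1 / |v - 1| ^ 2) v := fun v hv => by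
    refine (((hasDerivAt_id' v).sub_const 1).fun_inv (hne v hv)).neg.congr_deriv ?_
    rw [sq_abs]; ring
  refine ⟨hi, ?_⟩
  rw [intervalIntegral.integral_eq_sub_of_hasDerivAt hd hi]
  have a : ∀ v ∈ Set.Icc p q, |(v - 1)⁻¹| ≤ 1 / y := fun v hv => by
    rw [abs_inv, ← one_div]; exact one_div_le_one_div_of_le hy (h v hv)
  have a1 := abs_le.1 (a p (Set.left_mem_Icc.2 hpq))
  have a2 := abs_le.1 (a q (Set.right_mem_Icc.2 hpq))
  rw [show 2 / y = 1 / y + 1 / y by ring]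
  linarith

set_option maxHeartbeats 1600000 in
lemma exists_far_isGood {α b B lo hi vlo vhi : ℝ} {w0 w1 w2 : ℝ → ℝ} (hα : 1 < α) (hlo : 0 < lo) (hB : 0 < B)
    (hw : IsBump w0 w1 w2 b B) (hvlo : 0 < vlo) (h1 : (1 : ℝ) ∈ Set.Icc vlo vhi) :
    ∃ C > 0, ∀ y p q : ℝ, 0 < y → y ≤ 1 → vlo ≤ p → p ≤ q → q ≤ vhi → (∀ v ∈ Set.Icc p q, y / 2 ≤ |v - 1|) →
      (∀ e, e = p ∨ e = q → |e - 1| = y / 2 ∨ ∀ s ∈ Set.Icc lo hi, s * e ≤ 1 / 2 ∨ b ≤ s * e) →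
      IsGood (Set.Icc lo hi) (C * y) (fun s => ∫ v in p..q, ((s * w0 (s * v) : ℝ) : ℂ) * eC ((y ^ 2)⁻¹ * s ^ α * gPh α v)) := by
  obtain ⟨m, G, hm, hG, hg⟩ := exists_gPh_bounds hα hvlo h1
  obtain ⟨C11, hC11, k11⟩ := exists_oscBlock_isGood hlo hi vhi α hB hw.b0 hw.l0 1 1
  obtain ⟨C12, hC12, k12⟩ := exists_oscBlock_isGood hlo hi vhi α hB hw.b0 hw.l0 1 2
  obtain ⟨C22, hC22, k22⟩ := exists_oscBlock_isGood hlo hi vhi α hB hw.b1 hw.l1 2 2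
  obtain ⟨C32, hC32, k32⟩ := exists_oscBlock_isGood hlo hi vhi α hB hw.b2 hw.l2 3 2
  obtain ⟨C, hC⟩ : ∃ C, C = max (max C11 C12) (max C22 C32) := ⟨_, rfl⟩
  have hC0 : 0 < C := by rw [hC]; positivity
  have l11 : C11 ≤ C := by rw [hC]; simp
  have l12 : C12 ≤ C := by rw [hC]; simp
  have l22 : C22 ≤ C := by rw [hC]; simp
  have l32 : C32 ≤ C := by rw [hC]; simp
  obtain ⟨D, hD⟩ : ∃ D, D = 1 + vhi := ⟨_, rfl⟩
  have hD0 : 1 ≤ D := by linarith [h1.2]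
  obtain ⟨E, hE⟩ : ∃ E, E = (D ^ 2 / m ^ 2 + 4 * G * D / m ^ 3 + 3 * G ^ 2 / m ^ 4) * (C * (4 + G)) := ⟨_, rfl⟩
  have hE0 : 0 < E := by rw [hE]; positivity
  obtain ⟨H, hH⟩ : ∃ H, H = (2 / m + (4 / m ^ 2 + 8 * G / m ^ 3)) * (C * (1 + G)) := ⟨_, rfl⟩
  have hH0 : 0 < H := by rw [hH]; positivity
  refine ⟨H + H + 4 * E, by positivity, fun y p q hy hy1 hp hpq hq hfar hend => ?_⟩
  obtain ⟨x, hx⟩ : ∃ x, x = (y ^ 2)⁻¹ := ⟨_, rfl⟩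
  have hx0 : 0 < x := by rw [hx]; positivity
  have hxy : x * y ^ 2 = 1 := by rw [hx]; field_simp
  rw [← hx]
  have hsub : Set.Icc p q ⊆ Set.Icc vlo vhi := Set.Icc_subset_Icc hp hq
  have hne : ∀ v ∈ Set.Icc p q, gPh1 α v ≠ 0 := fun v hv => by
    have := (hg v (hsub hv)).1
    have h2 := hfar v hv
    exact abs_pos.1 ((mul_pos hm (by linarith : 0 < |v - 1|)).trans_le this)
  have hvp : ∀ v ∈ Set.Icc p q, 0 < v := fun v hv => hvlo.trans_le (hsub hv).1
  have habs : ∀ v ∈ Set.Icc p q, |v - 1| ≤ D := fun v hv => by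
    have := hsub hv; rw [abs_le]; constructor <;> linarith [this.1, this.2]
  have kC : ∀ (ω : ℝ → ℝ) (k l : ℕ) (C' : ℝ), C' ≤ C → (∀ x v g : ℝ, 0 ≤ x → 0 ≤ v → v ≤ vhi → 0 ≤ g →
      IsGood (Set.Icc lo hi) (C' * (1 + x * g)) (oscBlock α k l ω x v g)) → ∀ v ∈ Set.Icc p q,
      IsGood (Set.Icc lo hi) (C * (1 + x * (G * |v - 1| ^ 2))) (oscBlock α k l ω x v (gPh α v)) := fun ω k l C' hC' hk v hv => by
    obtain ⟨-, q1, q2, -, -⟩ := hg v (hsub hv)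
    refine (hk x v _ hx0.le (hvp v hv).le ((hsub hv).2) q1).mono ?_
    have : 0 ≤ x * gPh α v := by positivity
    gcongr
  have j11 := kC w0 1 1 C11 l11 k11
  have j12 := kC w0 1 2 C12 l12 k12
  have j22 := kC w1 2 2 C22 l22 k22
  have j32 := kC w2 3 2 C32 l32 k32
  have hbd : ∀ e ∈ Set.Icc p q, (|e - 1| = y / 2 ∨ ∀ s ∈ Set.Icc lo hi, s * e ≤ 1 / 2 ∨ b ≤ s * e) →
      IsGood (Set.Icc lo hi) (H * y) (fun s => bdTerm (fun v => s * w0 (s * v)) (fun v => s ^ 2 * w1 (s * v)) (fun v => x * s ^ α * gPh α v)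
      (fun v => x * s ^ α * gPh1 α v) (fun v => x * s ^ α * gPh2 α v) e) := by
    intro e he hcase
    rcases hcase with h | h
    · obtain ⟨q1, -, -, q2, -⟩ := hg e (hsub he)
      rw [h] at q1
      have hK : C * (1 + x * (G * |e - 1| ^ 2)) ≤ C * (1 + G) := by
        rw [h]
        have : x * (G * (y / 2) ^ 2) = G / 4 := by linear_combination (G / 4) * hxy
        rw [this]; gcongr; linarith
      have hxg : 2 / m * y * (x * |gPh1 α e|) ≥ 1 := by
        calc 2 / m * y * (x * |gPh1 α e|) ≥ 2 / m * y * (x * (m * (y / 2))) := by gcongr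
          _ = 1 := by field_simp; linarith
      have hxg0 : 0 < x * |gPh1 α e| := mul_pos hx0 (abs_pos.2 (hne e he))
      obtain ⟨t, ht⟩ : ∃ t, t = x * |gPh1 α e| := ⟨_, rfl⟩
      rw [← ht] at hxg hxg0
      have hty : 1 / t ≤ 2 / m * y := by rw [div_le_iff₀ hxg0]; linarith
      have hpi := pi_gt_three
      have hte : |x * gPh1 α e| = t := by rw [ht, abs_mul, abs_of_pos hx0]
      have b1 : ‖(1 / (2 * π * Complex.I * (x * gPh1 α e : ℝ)) : ℂ)‖ ≤ 2 / m * y := by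
        have : ‖(1 / (2 * π * Complex.I * (x * gPh1 α e : ℝ)) : ℂ)‖ = 1 / (2 * π) * (1 / t) := by
          rw [norm_div, norm_mul, norm_mul, Complex.norm_real, Real.norm_eq_abs, hte]
          simp [abs_of_pos pi_pos]
          ring
        rw [this]
        refine le_trans ?_ hty
        apply mul_le_of_le_one_left (by positivity)
        rw [div_le_one (by positivity)]; linarith
      have b2 : ‖((1 / (4 * π ^ 2 * (x * gPh1 α e) ^ 2) : ℝ) : ℂ)‖ ≤ 4 / m ^ 2 * y := by
        have : ‖((1 / (4 * π ^ 2 * (x * gPh1 α e) ^ 2) : ℝ) : ℂ)‖ = 1 / (4 * π ^ 2) * (1 / t) ^ 2 := by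
          rw [Complex.norm_real, Real.norm_eq_abs, abs_of_nonneg (by positivity), ← sq_abs (x * gPh1 α e), hte]
          field_simp
        rw [this]
        calc _ ≤ 1 * (2 / m * y) ^ 2 := by
              gcongr
              rw [div_le_one (by positivity)]; nlinarith
          _ = 4 / m ^ 2 * (y * y) := by ring
          _ ≤ 4 / m ^ 2 * (y * 1) := by gcongr
          _ = _ := by ring
      have b3 : ‖((gPh2 α e * x / (4 * π ^ 2 * (x * gPh1 α e) ^ 3) : ℝ) : ℂ)‖ ≤ 8 * G / m ^ 3 * y := by
        have : ‖((gPh2 α e * x / (4 * π ^ 2 * (x * gPh1 α e) ^ 3) : ℝ) : ℂ)‖ = 1 / (4 * π ^ 2) * |gPh2 α e| * x * (1 / t) ^ 3 := by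
          rw [Complex.norm_real, Real.norm_eq_abs, abs_div, abs_mul, abs_mul, abs_pow, hte, abs_of_pos hx0, abs_of_pos (by positivity : 0 < 4 * π ^ 2)]
          field_simp
        rw [this]
        calc _ ≤ 1 * G * x * (2 / m * y) ^ 3 := by
              gcongr
              rw [div_le_one (by positivity)]; nlinarith
          _ = 8 * G / m ^ 3 * y * (x * y ^ 2) := by ring
          _ = _ := by rw [hxy, mul_one]
      have nn : 0 ≤ C * (1 + x * (G * |e - 1| ^ 2)) := by positivity
      refine ((((j11 e he).const_mul_le nn b1).add (((j22 e he).const_mul_le nn b2).sub ((j12 e he).const_mul_le nn b3))).mono ?_).congr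
        fun s hs => bdTerm_eq_oscBlock w0 w1 (hlo.trans_le hs.1) hx0 (hne e he)
      rw [← add_mul, ← add_mul, ← add_mul, ← add_mul, hH]
      calc _ ≤ (2 / m + (4 / m ^ 2 + 8 * G / m ^ 3)) * y * (C * (1 + G)) := by gcongr
        _ = _ := by ring
    · refine ⟨fun s hs => ?_, fun s hs t ht => ?_⟩
      · simp only [bdTerm, hw.z0 _ (h s hs), hw.z1 _ (h s hs)]
        simp; positivity
      · simp only [bdTerm, hw.z0 _ (h s hs), hw.z1 _ (h s hs), hw.z0 _ (h t ht), hw.z1 _ (h t ht)]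
        simp; positivity
  have hrem : ∀ v ∈ Set.Icc p q, IsGood (Set.Icc lo hi) (E * y ^ 2 * (1 / |v - 1| ^ 2)) (fun s =>
      (remTerm (fun v => s * w0 (s * v)) (fun v => s ^ 2 * w1 (s * v)) (fun v => s ^ 3 * w2 (s * v))
      (fun v => x * s ^ α * gPh1 α v) (fun v => x * s ^ α * gPh2 α v) (fun v => x * s ^ α * gPh3 α v) v : ℂ) * eC (x * s ^ α * gPh α v)) := by
    intro v hv
    obtain ⟨q1, -, -, q2, q3⟩ := hg v (hsub hv)
    have f1 := hfar v hv
    have f2 := habs v hv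
    obtain ⟨t, ht⟩ : ∃ t, t = |v - 1| := ⟨_, rfl⟩
    have nn : 0 ≤ C * (1 + x * (G * |v - 1| ^ 2)) := by positivity
    rw [← ht] at q1 f1 f2 nn ⊢
    have ht0 : 0 < t := by linarith
    have hmt : 0 < m * t := by positivity
    have b1 : ‖((1 / (x ^ 2 * gPh1 α v ^ 2) : ℝ) : ℂ)‖ ≤ 1 / (x ^ 2 * (m * t) ^ 2) := by
      rw [Complex.norm_real, Real.norm_eq_abs, abs_of_nonneg (by positivity), ← sq_abs (gPh1 α v)]
      gcongr
    have b2 : ‖((-3 * gPh2 α v / (x ^ 2 * gPh1 α v ^ 3) : ℝ) : ℂ)‖ ≤ 3 * G / (x ^ 2 * (m * t) ^ 3) := by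
      rw [Complex.norm_real, Real.norm_eq_abs, abs_div, abs_mul, abs_mul (x ^ 2), abs_pow, abs_pow, abs_of_pos hx0, abs_neg, abs_of_pos (by norm_num : (0 : ℝ) < 3)]
      gcongr
    have b3 : ‖((-gPh3 α v / (x ^ 2 * gPh1 α v ^ 3) + 3 * gPh2 α v ^ 2 / (x ^ 2 * gPh1 α v ^ 4) : ℝ) : ℂ)‖ ≤ G / (x ^ 2 * (m * t) ^ 3) + 3 * G ^ 2 / (x ^ 2 * (m * t) ^ 4) := by
      rw [Complex.norm_real, Real.norm_eq_abs]
      refine (abs_add_le _ _).trans (add_le_add ?_ ?_)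
      · rw [abs_div, abs_neg, abs_mul, abs_pow, abs_pow, abs_of_pos hx0]
        gcongr
      · rw [abs_div, abs_mul, abs_mul (x ^ 2), abs_pow, abs_pow, abs_pow, abs_of_pos hx0, abs_of_pos (by norm_num : (0 : ℝ) < 3)]
        gcongr
    have J32 := j32 v hv
    have J22 := j22 v hv
    have J12 := j12 v hv
    rw [← ht] at J32 J22 J12
    refine (((J32.const_mul_le nn b1).add ((J22.const_mul_le nn b2).add (J12.const_mul_le nn b3))).mono ?_).congr
        fun s hs => remTerm_eq_oscBlock w0 w1 w2 (hlo.trans_le hs.1) hx0 (hne v hv)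
    rw [← add_mul, ← add_mul]
    have e1 : 1 ≤ 4 * x * t ^ 2 := by
      have : x * y ^ 2 ≤ x * (2 * t) ^ 2 := by gcongr; linarith
      rw [hxy] at this; linarith
    have e2 : C * (1 + x * (G * t ^ 2)) ≤ C * (4 + G) * (x * t ^ 2) := by
      nlinarith
    have e3 : 1 / (x ^ 2 * (m * t) ^ 2) + (3 * G / (x ^ 2 * (m * t) ^ 3) + (G / (x ^ 2 * (m * t) ^ 3) + 3 * G ^ 2 / (x ^ 2 * (m * t) ^ 4)))
        = (t ^ 2 / m ^ 2 + 4 * G * t / m ^ 3 + 3 * G ^ 2 / m ^ 4) / (x ^ 2 * t ^ 4) := by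
      field_simp; ring
    rw [e3]
    calc _ ≤ (D ^ 2 / m ^ 2 + 4 * G * D / m ^ 3 + 3 * G ^ 2 / m ^ 4) / (x ^ 2 * t ^ 4) * (C * (4 + G) * (x * t ^ 2)) := by gcongr
      _ = E * (1 / x) * (1 / t ^ 2) := by rw [hE]; field_simp
      _ = _ := by
        have : 1 / x = y ^ 2 := by rw [eq_comm, eq_div_iff hx0.ne']; linarith
        rw [this]
  obtain ⟨ii, ib⟩ := integral_inv_sq_le hpq (by linarith : 0 < y / 2) hfar
  have hcg : ContinuousOn (gPh α) (Set.Icc p q) := fun v hv => (hasDerivAt_gPh α (hvp v hv)).continuousAt.continuousWithinAt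
  have hcg1 : ContinuousOn (gPh1 α) (Set.Icc p q) := fun v hv => (hasDerivAt_gPh1 α (hvp v hv)).continuousAt.continuousWithinAt
  have hcg2 : ContinuousOn (gPh2 α) (Set.Icc p q) := fun v hv => (hasDerivAt_gPh2 α (hvp v hv)).continuousAt.continuousWithinAt
  have hcg3 : ContinuousOn (gPh3 α) (Set.Icc p q) := (continuousOn_gPh3 α).mono hvp
  have cw0 : Continuous w0 := continuous_iff_continuousAt.2 fun u => (hw.d0 u).continuousAt
  have cw1 : Continuous w1 := continuous_iff_continuousAt.2 fun u => (hw.d1 u).continuousAt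
  have hJ := IsGood.integral (F := fun v s => (remTerm (fun v => s * w0 (s * v)) (fun v => s ^ 2 * w1 (s * v)) (fun v => s ^ 3 * w2 (s * v))
      (fun v => x * s ^ α * gPh1 α v) (fun v => x * s ^ α * gPh2 α v) (fun v => x * s ^ α * gPh3 α v) v : ℂ) * eC (x * s ^ α * gPh α v)) hpq (S := Set.Icc lo hi)
    (fun s hs => by
      apply ContinuousOn.intervalIntegrable
      rw [Set.uIcc_of_le hpq]
      have hA : (s ^ α : ℝ) ≠ 0 := (rpow_pos_of_pos (hlo.trans_le hs.1) α).ne'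
      refine (Complex.continuous_ofReal.comp_continuousOn ?_).mul (continuous_eC.comp_continuousOn (hcg.const_mul _))
      have d : ∀ v ∈ Set.Icc p q, x * s ^ α * gPh1 α v ≠ 0 := fun v hv => mul_ne_zero (mul_ne_zero hx0.ne' hA) (hne v hv)
      have z0 : ContinuousOn (fun v => s * w0 (s * v)) (Set.Icc p q) := by fun_prop
      have z1 : ContinuousOn (fun v => s ^ 2 * w1 (s * v)) (Set.Icc p q) := by fun_prop
      have z2 : ContinuousOn (fun v => s ^ 3 * w2 (s * v)) (Set.Icc p q) := by have := hw.c2; fun_prop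
      have y1 := hcg1.const_mul (x * s ^ α)
      have y2 := hcg2.const_mul (x * s ^ α)
      have y3 := hcg3.const_mul (x * s ^ α)
      unfold remTerm
      refine ContinuousOn.add (ContinuousOn.sub (ContinuousOn.sub ?_ ?_) ?_) ?_
      · exact z2.div (y1.pow 2) fun v hv => pow_ne_zero _ (d v hv)
      · exact ((z1.const_mul 3).mul y2).div (y1.pow 3) fun v hv => pow_ne_zero _ (d v hv)
      · exact (z0.mul y3).div (y1.pow 3) fun v hv => pow_ne_zero _ (d v hv)
      · exact ((z0.const_mul 3).mul (y2.pow 2)).div (y1.pow 4) fun v hv => pow_ne_zero _ (d v hv))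
    (ii.const_mul (E * y ^ 2)) hrem
  have hB1 := hbd q (Set.right_mem_Icc.2 hpq) (hend q (Or.inr rfl))
  have hB2 := hbd p (Set.left_mem_Icc.2 hpq) (hend p (Or.inl rfl))
  have hpi := pi_gt_three
  have nI : 0 ≤ ∫ v in p..q, E * y ^ 2 * (1 / |v - 1| ^ 2) := intervalIntegral.integral_nonneg hpq fun v hv => by positivity
  have hcoef : ‖(1 / (4 * π ^ 2) : ℂ)‖ ≤ 1 := by
    have : (1 / (4 * π ^ 2) : ℂ) = ((1 / (4 * π ^ 2) : ℝ) : ℂ) := by push_cast; rfl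
    rw [this, Complex.norm_real, Real.norm_eq_abs, abs_of_pos (by positivity), div_le_one (by positivity)]
    nlinarith
  refine (((hB1.sub hB2).sub (hJ.const_mul_le nI hcoef)).mono ?_).congr fun s hs => ?_
  · rw [intervalIntegral.integral_const_mul]
    have : E * y ^ 2 * ∫ v in p..q, 1 / |v - 1| ^ 2 ≤ E * y ^ 2 * (2 / (y / 2)) := by gcongr
    have e : E * y ^ 2 * (2 / (y / 2)) = 4 * E * y := by field_simp; ring
    linarith
  · have hs0 := hlo.trans_le hs.1
    have hA : (s ^ α : ℝ) ≠ 0 := (rpow_pos_of_pos hs0 α).ne'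
    have hu : ∀ v, HasDerivAt (fun v : ℝ => s * v) s v := fun v => by simpa using (hasDerivAt_id' v).const_mul s
    apply integral_by_parts_twice (w0 := fun v => s * w0 (s * v)) (f := fun v => x * s ^ α * gPh α v)
    · intro v _
      exact (((hw.d0 (s * v)).comp v (hu v)).const_mul s).congr_deriv (by ring)
    · intro v _
      exact (((hw.d1 (s * v)).comp v (hu v)).const_mul (s ^ 2)).congr_deriv (by ring)
    · have := hw.c2; fun_prop
    · rw [Set.uIcc_of_le hpq]; exact fun v hv => (hasDerivAt_gPh α (hvp v hv)).const_mul _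
    · rw [Set.uIcc_of_le hpq]; exact fun v hv => (hasDerivAt_gPh1 α (hvp v hv)).const_mul _
    · rw [Set.uIcc_of_le hpq]; exact fun v hv => (hasDerivAt_gPh2 α (hvp v hv)).const_mul _
    · rw [Set.uIcc_of_le hpq]; exact hcg3.const_mul _
    · rw [Set.uIcc_of_le hpq]; exact fun v hv => mul_ne_zero (mul_ne_zero hx0.ne' hA) (hne v hv)

lemma exists_stationary_isGood {α b B lo hi : ℝ} {w0 w1 w2 : ℝ → ℝ} (hα : 1 < α) (hlo : 0 < lo) (hhi : 0 < hi) (hB : 0 < B)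
    (hw : IsBump w0 w1 w2 b B) : ∃ vlo vhi C : ℝ, 0 < vlo ∧ vlo ≤ vhi ∧ 0 < C ∧ hi * vlo ≤ 1 / 2 ∧ b ≤ lo * vhi ∧ ∀ y : ℝ, 0 < y → y ≤ 1 →
      IsGood (Set.Icc lo hi) (C * y) (fun s => ∫ v in vlo..vhi, ((s * w0 (s * v) : ℝ) : ℂ) * eC ((y ^ 2)⁻¹ * s ^ α * gPh α v)) := by
  obtain ⟨vlo, hvlo⟩ : ∃ vlo, vlo = min (1 / 4) (1 / (2 * hi)) := ⟨_, rfl⟩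
  obtain ⟨vhi, hvhi⟩ : ∃ vhi, vhi = max 2 (b / lo) := ⟨_, rfl⟩
  have v0 : 0 < vlo := by rw [hvlo]; positivity
  have v1 : vlo ≤ 1 / 4 := by rw [hvlo]; exact min_le_left _ _
  have v2 : 2 ≤ vhi := by rw [hvhi]; exact le_max_left _ _
  have v3 : hi * vlo ≤ 1 / 2 := by
    calc hi * vlo ≤ hi * (1 / (2 * hi)) := by gcongr; rw [hvlo]; exact min_le_right _ _
      _ = _ := by field_simp
  have v4 : b ≤ lo * vhi := by
    calc b = lo * (b / lo) := by field_simp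
      _ ≤ _ := by gcongr; rw [hvhi]; exact le_max_right _ _
  have h1 : (1 : ℝ) ∈ Set.Icc vlo vhi := ⟨by linarith, by linarith⟩
  obtain ⟨C1, hC1, hfar⟩ := exists_far_isGood (lo := lo) (hi := hi) hα hlo hB hw v0 h1
  obtain ⟨m, G, hm, hG, hg⟩ := exists_gPh_bounds hα v0 h1
  obtain ⟨C2, hC2, hosc⟩ := exists_oscBlock_isGood hlo hi vhi α hB hw.b0 hw.l0 1 0
  refine ⟨vlo, vhi, C1 + C2 * (1 + G) + C1, v0, by linarith, by positivity, v3, v4, fun y hy hy1 => ?_⟩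
  have cw0 : Continuous w0 := continuous_iff_continuousAt.2 fun u => (hw.d0 u).continuousAt
  have hint : ∀ p q : ℝ, 0 < p → p ≤ q → ∀ s, IntervalIntegrable (fun v => ((s * w0 (s * v) : ℝ) : ℂ) * eC ((y ^ 2)⁻¹ * s ^ α * gPh α v)) volume p q := by
    intro p q hp hpq s
    apply ContinuousOn.intervalIntegrable
    rw [Set.uIcc_of_le hpq]
    have hcg : ContinuousOn (gPh α) (Set.Icc p q) := fun v hv => (hasDerivAt_gPh α (hp.trans_le hv.1)).continuousAt.continuousWithinAt
    refine (Complex.continuous_ofReal.comp_continuousOn ?_).mul (continuous_eC.comp_continuousOn (hcg.const_mul _))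
    fun_prop
  have f1 := hfar y vlo (1 - y / 2) hy hy1 le_rfl (by linarith) (by linarith)
    (fun v hv => by rw [abs_of_neg (by linarith [hv.2])]; linarith [hv.2]) (fun e he => by
      rcases he with rfl | rfl
      · right; intro s hs; left; exact (mul_le_mul_of_nonneg_right hs.2 v0.le).trans v3
      · left; rw [sub_sub_cancel_left, abs_neg, abs_of_pos (by positivity)])
  have f3 := hfar y (1 + y / 2) vhi hy hy1 (by linarith) (by linarith) le_rfl
    (fun v hv => by rw [abs_of_pos (by linarith [hv.1])]; linarith [hv.1]) (fun e he => by
      rcases he with rfl | rfl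
      · left; rw [add_sub_cancel_left, abs_of_pos (by positivity)]
      · right; intro s hs; right; exact v4.trans (mul_le_mul_of_nonneg_right hs.1 (by linarith)))
  have f2 : IsGood (Set.Icc lo hi) (C2 * (1 + G) * y) (fun s => ∫ v in (1 - y / 2)..(1 + y / 2), ((s * w0 (s * v) : ℝ) : ℂ) * eC ((y ^ 2)⁻¹ * s ^ α * gPh α v)) := by
    have := IsGood.integral (S := Set.Icc lo hi) (p := 1 - y / 2) (q := 1 + y / 2) (K := fun _ => C2 * (1 + G))
      (F := fun v s => ((s * w0 (s * v) : ℝ) : ℂ) * eC ((y ^ 2)⁻¹ * s ^ α * gPh α v)) (by linarith)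
      (fun s hs => hint _ _ (by linarith) (by linarith) s) intervalIntegrable_const (fun v hv => by
        have hv' : v ∈ Set.Icc vlo vhi := ⟨by linarith [hv.1], by linarith [hv.2]⟩
        obtain ⟨-, q1, q2, -⟩ := hg v hv'
        refine ((hosc (y ^ 2)⁻¹ v (gPh α v) (by positivity) (v0.le.trans hv'.1) hv'.2 q1).mono ?_).congr fun s hs => ?_
        · have a : |v - 1| ≤ y / 2 := by rw [abs_le]; constructor <;> linarith [hv.1, hv.2]
          have : (y ^ 2)⁻¹ * gPh α v ≤ G := by
            calc _ ≤ (y ^ 2)⁻¹ * (G * (y / 2) ^ 2) := by gcongr; exact q2.trans (by gcongr)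
              _ = G / 4 := by field_simp; ring
              _ ≤ G := by linarith
          gcongr
        · simp [oscBlock])
    refine this.mono (le_of_eq ?_)
    rw [intervalIntegral.integral_const, smul_eq_mul]; ring
  refine (((f1.add f2).add f3).mono (le_of_eq (by ring))).congr fun s _ => ?_
  rw [intervalIntegral.integral_add_adjacent_intervals (hint _ _ v0 (by linarith) s) (hint _ _ (by linarith) (by linarith) s),
    intervalIntegral.integral_add_adjacent_intervals (hint _ _ v0 (by linarith) s) (hint _ _ (by linarith) (by linarith) s)]

/-- The Fourier-type integral of the smoothed monomial phase. -/
noncomputable def smInt (w0 : ℝ → ℝ) (b α x ξ : ℝ) : ℂ := ∫ u in (1 / 2)..b, (w0 u : ℂ) * eC (x * u ^ α - ξ * u)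

lemma smInt_eq {α b B x s vlo vhi : ℝ} {w0 w1 w2 : ℝ → ℝ} (hs : 0 < s) (hb : 1 / 2 ≤ b)
    (hw : IsBump w0 w1 w2 b B) (hv0 : 0 < vlo) (hv1 : s * vlo ≤ 1 / 2) (hv2 : b ≤ s * vhi) :
    smInt w0 b α x (α * x * s ^ (α - 1)) = eC (-((α - 1) * x * s ^ α)) *
      ∫ v in vlo..vhi, ((s * w0 (s * v) : ℝ) : ℂ) * eC (x * s ^ α * gPh α v) := by
  have cw0 : Continuous w0 := continuous_iff_continuousAt.2 fun u => (hw.d0 u).continuousAt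
  have hF : ContinuousOn (fun u => (w0 u : ℂ) * eC (x * u ^ α - α * x * s ^ (α - 1) * u)) (Set.Ioi 0) := by
    refine (Complex.continuous_ofReal.comp_continuousOn cw0.continuousOn).mul (continuous_eC.comp_continuousOn ?_)
    have : ContinuousOn (fun u : ℝ => u ^ α) (Set.Ioi 0) := fun u hu => (continuousAt_rpow_const _ _ (Or.inl (ne_of_gt hu))).continuousWithinAt
    fun_prop
  have hsv : 0 < s * vlo := by positivity
  have ii : ∀ p q : ℝ, 0 < p → p ≤ q → IntervalIntegrable (fun u => (w0 u : ℂ) * eC (x * u ^ α - α * x * s ^ (α - 1) * u)) volume p q := by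
    intro p q hp hpq
    apply ContinuousOn.intervalIntegrable
    rw [Set.uIcc_of_le hpq]
    exact hF.mono fun u hu => hp.trans_le hu.1
  have e1 : smInt w0 b α x (α * x * s ^ (α - 1)) = ∫ u in (s * vlo)..(s * vhi), (w0 u : ℂ) * eC (x * u ^ α - α * x * s ^ (α - 1) * u) := by
    rw [← intervalIntegral.integral_add_adjacent_intervals (b := 1 / 2) (ii _ _ hsv hv1) (ii _ _ (by norm_num) (by linarith)),
      ← intervalIntegral.integral_add_adjacent_intervals (a := 1 / 2) (b := b) (c := s * vhi) (ii _ _ (by norm_num) hb) (ii _ _ (by linarith) hv2)]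
    have z1 : ∫ u in (s * vlo)..(1 / 2), (w0 u : ℂ) * eC (x * u ^ α - α * x * s ^ (α - 1) * u) = 0 := by
      rw [intervalIntegral.integral_congr (g := fun _ => 0), intervalIntegral.integral_zero]
      intro u hu
      rw [Set.uIcc_of_le hv1] at hu
      simp [hw.z0 u (Or.inl hu.2)]
    have z2 : ∫ u in b..(s * vhi), (w0 u : ℂ) * eC (x * u ^ α - α * x * s ^ (α - 1) * u) = 0 := by
      rw [intervalIntegral.integral_congr (g := fun _ => 0), intervalIntegral.integral_zero]
      intro u hu
      rw [Set.uIcc_of_le hv2] at hu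
      simp [hw.z0 u (Or.inr hu.1)]
    rw [z1, z2, zero_add, add_zero]; rfl
  have hv12 : vlo ≤ vhi := by
    by_contra h
    push Not at h
    nlinarith
  rw [e1, ← intervalIntegral.smul_integral_comp_mul_left, ← intervalIntegral.integral_smul, ← intervalIntegral.integral_const_mul]
  refine intervalIntegral.integral_congr fun v hv => ?_
  rw [Set.uIcc_of_le hv12] at hv
  have hv' : 0 < v := hv0.trans_le hv.1
  have e2 : x * (s * v) ^ α - α * x * s ^ (α - 1) * (s * v) = -((α - 1) * x * s ^ α) + x * s ^ α * gPh α v := by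
    rw [mul_rpow hs.le hv'.le, gPh]
    have : s ^ (α - 1) * s = s ^ α := by rw [← rpow_add_one hs.ne']; ring_nf
    linear_combination (-α * x * v) * this
  simp only [e2, eC_add, Complex.real_smul]
  push_cast; ring

lemma exists_rpow_bound {lo : ℝ} (hlo : 0 < lo) (hi p : ℝ) : ∃ C > 0, ∀ s, lo ≤ s → s ≤ hi → |s ^ p| ≤ C := by
  obtain ⟨C, hC, h⟩ := exists_rpow_lipschitz hlo hi p
  exact ⟨C, hC, fun s h1 h2 => (h s ⟨h1, h2⟩).1⟩

lemma abs_remTerm_le {B G κ w : ℝ} {w0 w1 w2 f1 f2 f3 : ℝ → ℝ} {v : ℝ} (hG : 0 ≤ G) (hκ : 0 < κ) (hw : 0 < w)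
    (h0 : |w0 v| ≤ B) (h1 : |w1 v| ≤ B) (h2 : |w2 v| ≤ B) (g1 : κ * w ≤ |f1 v|) (g2 : |f2 v| ≤ G * w) (g3 : |f3 v| ≤ G * w) :
    |remTerm w0 w1 w2 f1 f2 f3 v| ≤ B * (1 / κ ^ 2 + 4 * G / κ ^ 3 + 3 * G ^ 2 / κ ^ 4) / w ^ 2 := by
  have hB : 0 ≤ B := (abs_nonneg _).trans h0
  have hp : 0 < κ * w := by positivity
  unfold remTerm
  have a1 : |w2 v / f1 v ^ 2| ≤ B / (κ * w) ^ 2 := by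
    rw [abs_div, abs_pow]; gcongr
  have a2 : |3 * w1 v * f2 v / f1 v ^ 3| ≤ 3 * B * (G * w) / (κ * w) ^ 3 := by
    rw [abs_div, abs_pow, abs_mul, abs_mul, abs_of_pos (by norm_num : (0:ℝ) < 3)]; gcongr
  have a3 : |w0 v * f3 v / f1 v ^ 3| ≤ B * (G * w) / (κ * w) ^ 3 := by
    rw [abs_div, abs_pow, abs_mul]; gcongr
  have a4 : |3 * w0 v * f2 v ^ 2 / f1 v ^ 4| ≤ 3 * B * (G * w) ^ 2 / (κ * w) ^ 4 := by
    rw [abs_div, abs_pow, abs_mul, abs_mul, abs_pow, abs_of_pos (by norm_num : (0:ℝ) < 3)]; gcongr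
  have e : B * (1 / κ ^ 2 + 4 * G / κ ^ 3 + 3 * G ^ 2 / κ ^ 4) / w ^ 2 =
    B / (κ * w) ^ 2 + 3 * B * (G * w) / (κ * w) ^ 3 + B * (G * w) / (κ * w) ^ 3 + 3 * B * (G * w) ^ 2 / (κ * w) ^ 4 := by
    field_simp; ring
  rw [e]
  refine (abs_add_le _ _).trans (add_le_add ((abs_sub _ _).trans (add_le_add ((abs_sub _ _).trans (add_le_add a1 a2)) a3)) a4)

lemma exists_smInt_nonstationary {α b B : ℝ} {w0 w1 w2 : ℝ → ℝ} (hα : 1 < α) (hb : 1 ≤ b) (hw : IsBump w0 w1 w2 b B) :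
    ∃ C : ℝ, C > 0 ∧ ∀ x ξ : ℝ, 0 < x → (ξ ≤ α * (1 / 2) ^ (α - 1) / 2 * x ∨ 2 * α * b ^ (α - 1) * x ≤ ξ) →
      ‖smInt w0 b α x ξ‖ ≤ C / (x + |ξ|) ^ 2 := by
  obtain ⟨c1, hc1⟩ : ∃ c1, c1 = α * (1 / 2) ^ (α - 1) / 2 := ⟨_, rfl⟩
  obtain ⟨c2, hc2⟩ : ∃ c2, c2 = 2 * α * b ^ (α - 1) := ⟨_, rfl⟩
  have p1 : 0 < c1 := by rw [hc1]; positivity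
  have p2 : 0 < c2 := by rw [hc2]; positivity
  rw [← hc1, ← hc2]
  obtain ⟨κ, hκ⟩ : ∃ κ, κ = min 1 (min c1 c2) / 4 := ⟨_, rfl⟩
  have k0 : 0 < κ := by rw [hκ]; positivity
  have k1 : κ ≤ 1 / 4 := by rw [hκ]; linarith [min_le_left 1 (min c1 c2)]
  have k2 : κ ≤ c1 / 4 := by rw [hκ]; linarith [(min_le_right 1 (min c1 c2)).trans (min_le_left _ _)]
  have k3 : κ ≤ c2 / 4 := by rw [hκ]; linarith [(min_le_right 1 (min c1 c2)).trans (min_le_right _ _)]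
  obtain ⟨G2, hG2, h2⟩ := exists_rpow_bound (lo := 1 / 2) (by norm_num) b (α - 1 - 1)
  obtain ⟨G3, hG3, h3⟩ := exists_rpow_bound (lo := 1 / 2) (by norm_num) b (α - 1 - 1 - 1)
  obtain ⟨G, hG⟩ : ∃ G, G = |α * (α - 1)| * G2 + |α * (α - 1) * (α - 2)| * G3 := ⟨_, rfl⟩
  have hG0 : 0 ≤ G := by rw [hG]; positivity
  have hBn : 0 ≤ B := (abs_nonneg _).trans (hw.b0 0)
  obtain ⟨K, hK⟩ : ∃ K, K = B * (1 / κ ^ 2 + 4 * G / κ ^ 3 + 3 * G ^ 2 / κ ^ 4) := ⟨_, rfl⟩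
  have hK0 : 0 ≤ K := by rw [hK]; positivity
  refine ⟨K * b + 1, by positivity, fun x ξ hx hξ => ?_⟩
  have hwp : 0 < x + |ξ| := by positivity
  have hu : Set.uIcc (1 / 2) b = Set.Icc (1 / 2) b := Set.uIcc_of_le (by linarith)
  have pos : ∀ v ∈ Set.Icc (1 / 2) b, (0 : ℝ) < v := fun v hv => by linarith [hv.1]
  have hf1 : ∀ v ∈ Set.Icc (1 / 2) b, κ * (x + |ξ|) ≤ |α * x * v ^ (α - 1) - ξ| := by
    intro v hv
    have q1 : 2 * c1 * x ≤ α * x * v ^ (α - 1) := by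
      have : (1 / 2 : ℝ) ^ (α - 1) ≤ v ^ (α - 1) := rpow_le_rpow (by norm_num) hv.1 (by linarith)
      calc 2 * c1 * x = α * x * (1 / 2) ^ (α - 1) := by rw [hc1]; ring
        _ ≤ _ := by gcongr
    have q2 : α * x * v ^ (α - 1) ≤ c2 / 2 * x := by
      have : v ^ (α - 1) ≤ b ^ (α - 1) := rpow_le_rpow (pos v hv).le hv.2 (by linarith)
      calc α * x * v ^ (α - 1) ≤ α * x * b ^ (α - 1) := by gcongr
        _ = _ := by rw [hc2]; ring
    have m1 : κ * x ≤ c1 / 4 * x := by gcongr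
    have m2 : κ * x ≤ c2 / 4 * x := by gcongr
    have m3 : κ * |ξ| ≤ 1 / 4 * |ξ| := by gcongr
    rw [mul_add]
    rcases hξ with h | h
    · refine le_trans ?_ (le_abs_self _)
      rcases abs_cases ξ with ⟨e, h'⟩ | ⟨e, h'⟩ <;> rw [e] at m3 ⊢ <;> nlinarith
    · refine le_trans ?_ (neg_le_abs _)
      have : 0 < c2 * x := by positivity
      rw [abs_of_pos (by linarith)] at m3 ⊢
      nlinarith
  have hne : ∀ v ∈ Set.uIcc (1 / 2) b, α * x * v ^ (α - 1) - ξ ≠ 0 := fun v hv => by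
    rw [hu] at hv
    exact abs_pos.1 (lt_of_lt_of_le (by positivity) (hf1 v hv))
  have d0 : ∀ v ∈ Set.uIcc (1 / 2) b, HasDerivAt (fun u : ℝ => x * u ^ α - ξ * u) (α * x * v ^ (α - 1) - ξ) v := fun v hv => by
    rw [hu] at hv
    refine (((hasDerivAt_rpow_const (Or.inl (pos v hv).ne')).const_mul x).fun_sub ((hasDerivAt_id' v).const_mul ξ)).congr_deriv ?_
    ring
  have d1 : ∀ v ∈ Set.uIcc (1 / 2) b, HasDerivAt (fun u : ℝ => α * x * u ^ (α - 1) - ξ) (α * (α - 1) * x * v ^ (α - 1 - 1)) v := fun v hv => by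
    rw [hu] at hv
    refine (((hasDerivAt_rpow_const (Or.inl (pos v hv).ne')).const_mul (α * x)).sub_const ξ).congr_deriv ?_
    ring
  have d2 : ∀ v ∈ Set.uIcc (1 / 2) b, HasDerivAt (fun u : ℝ => α * (α - 1) * x * u ^ (α - 1 - 1)) (α * (α - 1) * (α - 2) * x * v ^ (α - 1 - 1 - 1)) v := fun v hv => by
    rw [hu] at hv
    refine ((hasDerivAt_rpow_const (Or.inl (pos v hv).ne')).const_mul (α * (α - 1) * x)).congr_deriv ?_
    ring
  have c3 : ContinuousOn (fun u : ℝ => α * (α - 1) * (α - 2) * x * u ^ (α - 1 - 1 - 1)) (Set.uIcc (1 / 2) b) := by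
    rw [hu]
    refine ContinuousOn.const_mul (fun v hv => (continuousAt_rpow_const _ _ (Or.inl (pos v hv).ne')).continuousWithinAt) _
  rw [smInt, integral_by_parts_twice (fun v _ => hw.d0 v) (fun v _ => hw.d1 v) hw.c2.continuousOn d0 d1 d2 c3 hne]
  simp only [bdTerm, hw.z0 b (Or.inr le_rfl), hw.z1 b (Or.inr le_rfl), hw.z0 (1 / 2) (Or.inl le_rfl), hw.z1 (1 / 2) (Or.inl le_rfl)]
  have hx' : x ≤ x + |ξ| := by linarith [abs_nonneg ξ]
  have key : ‖∫ v in (1 / 2)..b, (remTerm w0 w1 w2 (fun u : ℝ => α * x * u ^ (α - 1) - ξ) (fun u : ℝ => α * (α - 1) * x * u ^ (α - 1 - 1))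
      (fun u : ℝ => α * (α - 1) * (α - 2) * x * u ^ (α - 1 - 1 - 1)) v : ℂ) * eC (x * v ^ α - ξ * v)‖ ≤ K / (x + |ξ|) ^ 2 * |b - 1 / 2| := by
    apply intervalIntegral.norm_integral_le_of_norm_le_const
    intro v hv
    rw [Set.uIoc_of_le (by linarith)] at hv
    have hv' : v ∈ Set.Icc (1 / 2) b := ⟨hv.1.le, hv.2⟩
    rw [norm_mul, norm_eC, mul_one, Complex.norm_real, Real.norm_eq_abs, hK]
    refine abs_remTerm_le hG0 k0 hwp (hw.b0 v) (hw.b1 v) (hw.b2 v) (hf1 v hv') ?_ ?_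
    · rw [abs_mul, abs_mul, abs_of_pos hx]
      calc |α * (α - 1)| * x * |v ^ (α - 1 - 1)| ≤ |α * (α - 1)| * (x + |ξ|) * G2 := by gcongr; exact h2 v hv'.1 hv'.2
        _ = (|α * (α - 1)| * G2) * (x + |ξ|) := by ring
        _ ≤ _ := by gcongr; rw [hG]; linarith [show 0 ≤ |α * (α - 1) * (α - 2)| * G3 by positivity]
    · rw [abs_mul, abs_mul, abs_of_pos hx]
      calc |α * (α - 1) * (α - 2)| * x * |v ^ (α - 1 - 1 - 1)| ≤ |α * (α - 1) * (α - 2)| * (x + |ξ|) * G3 := by gcongr; exact h3 v hv'.1 hv'.2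
        _ = (|α * (α - 1) * (α - 2)| * G3) * (x + |ξ|) := by ring
        _ ≤ _ := by gcongr; rw [hG]; linarith [show 0 ≤ |α * (α - 1)| * G2 by positivity]
  have hpi : ‖(1 / (4 * (π : ℂ) ^ 2))‖ ≤ 1 := by
    rw [norm_div, norm_mul, norm_pow, Complex.norm_real, norm_one, Real.norm_eq_abs, abs_of_pos pi_pos]
    rw [div_le_one (by simp; positivity)]
    simp only [Complex.norm_ofNat]
    nlinarith [pi_gt_three]
  simp only [zero_div, zero_mul, sub_self, Complex.ofReal_zero, add_zero, mul_zero, zero_sub, norm_neg, norm_mul]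
  calc _ ≤ 1 * (K / (x + |ξ|) ^ 2 * |b - 1 / 2|) := by gcongr
    _ ≤ 1 * (K / (x + |ξ|) ^ 2 * b) := by gcongr; rw [abs_of_pos (by linarith)]; linarith
    _ = (K * b) / (x + |ξ|) ^ 2 := by ring
    _ ≤ _ := by gcongr; linarith

lemma fourier_smooth_monomial {α b B x M : ℝ} {w0 w1 w2 : ℝ → ℝ} (hb : 1 ≤ b) (hw : IsBump w0 w1 w2 b B) (hM : 0 < M) (ξ : ℝ) :
    FourierTransform.fourier (fun t : ℝ => (w0 (t / M) : ℂ) * eC (x * (t / M) ^ α)) ξ = M * smInt w0 b α x (ξ * M) := by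
  rw [Real.fourier_real_eq_integral_exp_smul]
  have e : ∀ v : ℝ, Complex.exp (↑(-2 * Real.pi * v * ξ) * Complex.I) • ((w0 (v / M) : ℂ) * eC (x * (v / M) ^ α)) =
      (fun u : ℝ => (w0 u : ℂ) * eC (x * u ^ α - ξ * M * u)) (v / M) := by
    intro v
    have h1 : Complex.exp (↑(-2 * Real.pi * v * ξ) * Complex.I) = eC (-(ξ * M * (v / M))) := by
      rw [eC]; congr 3; field_simp
    simp only [h1, smul_eq_mul]
    rw [sub_eq_add_neg, eC_add]; ring
  simp_rw [e]
  rw [Measure.integral_comp_div (fun u : ℝ => (w0 u : ℂ) * eC (x * u ^ α - ξ * M * u)), abs_of_pos hM, smInt, intervalIntegral.integral_of_le (by linarith)]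
  rw [Complex.real_smul]
  congr 1
  symm
  apply setIntegral_eq_integral_of_forall_compl_eq_zero
  intro u hu
  have : u ≤ 1 / 2 ∨ b ≤ u := by
    by_contra! h
    exact hu ⟨h.1, h.2.le⟩
  simp [hw.z0 u this]

lemma exists_poisson {α b B : ℝ} {w0 w1 w2 : ℝ → ℝ} (hα : 1 < α) (hb : 1 ≤ b) (hw : IsBump w0 w1 w2 b B) :
    ∃ C : ℝ, C > 0 ∧ ∀ x M T : ℝ, 0 < T → T ≤ x → x ≤ 2 * T → 0 < M → ∀ L : ℕ, b * M ≤ L →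
      ‖∑ n ∈ range L, (w0 (n / M) : ℂ) * eC (x * ((n : ℝ) / M) ^ α) -
        ∑ ν ∈ Finset.Icc ⌈α * (1 / 2) ^ (α - 1) / 2 * T / M⌉₊ ⌊2 * α * b ^ (α - 1) * (2 * T) / M⌋₊, (M : ℂ) * smInt w0 b α x (ν * M)‖
      ≤ C * (M / x ^ 2 + 1 / M) := by
  obtain ⟨C, hC, hns⟩ := exists_smInt_nonstationary hα hb hw
  obtain ⟨c1, hc1⟩ : ∃ c1, c1 = α * (1 / 2) ^ (α - 1) / 2 := ⟨_, rfl⟩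
  obtain ⟨c2, hc2⟩ : ∃ c2, c2 = 2 * α * b ^ (α - 1) := ⟨_, rfl⟩
  have p1 : 0 < c1 := by rw [hc1]; positivity
  have p2 : 0 < c2 := by rw [hc2]; positivity
  rw [← hc1, ← hc2] at hns ⊢
  have hsum : Summable (fun n : ℤ => 1 / (n : ℝ) ^ 2) := Real.summable_one_div_int_pow.2 (by norm_num)
  obtain ⟨Z2, hZ2⟩ : ∃ Z2, Z2 = ∑' n : ℤ, 1 / (n : ℝ) ^ 2 := ⟨_, rfl⟩
  have hZ0 : 0 ≤ Z2 := by rw [hZ2]; exact tsum_nonneg fun n => by positivity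
  refine ⟨C * (1 + Z2), by positivity, fun x M T hT hTx hxT hM L hL => ?_⟩
  have hx : 0 < x := by linarith
  obtain ⟨S, hS⟩ : ∃ S, S = Finset.Icc ⌈c1 * T / M⌉₊ ⌊c2 * (2 * T) / M⌋₊ := ⟨_, rfl⟩
  rw [← hS]
  obtain ⟨f, hf⟩ : ∃ f : ℝ → ℂ, f = fun t : ℝ => (w0 (t / M) : ℂ) * eC (x * (t / M) ^ α) := ⟨_, rfl⟩
  have cw0 : Continuous w0 := continuous_iff_continuousAt.2 fun u => (hw.d0 u).continuousAt
  have cf : Continuous f := by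
    rw [hf]
    have h1 : Continuous fun t : ℝ => (t / M) ^ α := (continuous_id.div_const M).rpow_const fun _ => Or.inr (by linarith)
    exact (Complex.continuous_ofReal.comp (cw0.comp (continuous_id.div_const M))).mul (continuous_eC.comp (h1.const_mul x))
  have fz : ∀ t, t ≤ 0 ∨ b * M ≤ t → f t = 0 := by
    intro t ht
    have : t / M ≤ 1 / 2 ∨ b ≤ t / M := by
      rcases ht with h | h
      · left; exact (div_nonpos_of_nonpos_of_nonneg h hM.le).trans (by norm_num)
      · right; rwa [le_div_iff₀ hM]
    simp [hf, hw.z0 _ this]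
  have hdec : f =O[Filter.cocompact ℝ] fun x => |x| ^ (-(2 : ℝ)) := by
    have : f =ᶠ[Filter.cocompact ℝ] fun _ => 0 := by
      filter_upwards [(isCompact_Icc (a := 0) (b := b * M)).compl_mem_cocompact] with t ht
      apply fz
      by_contra! h
      exact ht ⟨h.1.le, h.2.le⟩
    exact this.trans_isBigO (Asymptotics.isBigO_zero _ _)
  have hF : ∀ n : ℤ, FourierTransform.fourier f (n : ℝ) = M * smInt w0 b α x (n * M) := by
    intro n; rw [hf]; exact fourier_smooth_monomial hb hw hM n
  obtain ⟨S', hS'⟩ : ∃ S' : Finset ℤ, S' = S.map Nat.castEmbedding := ⟨_, rfl⟩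
  obtain ⟨g, hg⟩ : ∃ g : ℤ → ℝ, g = fun n : ℤ => C / M * (1 / (n : ℝ) ^ 2) + (if n = 0 then C * M / x ^ 2 else 0) := ⟨_, rfl⟩
  have hg1 : HasSum g (C / M * Z2 + C * M / x ^ 2) := by
    rw [hg, hZ2]
    exact (hsum.hasSum.mul_left _).add (hasSum_ite_eq 0 _)
  have hg0 : ∀ n, 0 ≤ g n := fun n => by rw [hg]; positivity
  have hout : ∀ n : ℤ, n ∉ S' → ‖FourierTransform.fourier f (n : ℝ)‖ ≤ g n := by
    intro n hn
    have h1 : (n : ℝ) * M ≤ c1 * x ∨ c2 * x ≤ n * M := by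
      by_contra! h
      apply hn
      have hn0 : 0 < (n : ℝ) := by
        have : 0 < (n : ℝ) * M := lt_trans (by positivity) h.1
        exact pos_of_mul_pos_left this hM.le
      obtain ⟨m, rfl⟩ := Int.eq_ofNat_of_zero_le (a := n) (by exact_mod_cast hn0.le)
      rw [hS', Finset.mem_map]
      refine ⟨m, ?_, rfl⟩
      push_cast at h
      rw [hS, Finset.mem_Icc, Nat.ceil_le, div_le_iff₀ hM]
      constructor
      · nlinarith
      · apply Nat.le_floor
        rw [le_div_iff₀ hM]
        nlinarith
    rw [hF, norm_mul, Complex.norm_real, Real.norm_eq_abs, abs_of_pos hM]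
    refine (mul_le_mul_of_nonneg_left (hns x _ hx h1) hM.le).trans ?_
    by_cases h0 : n = 0
    · subst h0; simp [hg]; apply le_of_eq; ring
    · have hn0 : 0 < |(n : ℝ)| := by positivity
      rw [abs_mul, abs_of_pos hM]
      simp only [hg, if_neg h0, add_zero]
      calc M * (C / (x + |(n : ℝ)| * M) ^ 2) ≤ M * (C / (|(n : ℝ)| * M) ^ 2) := by gcongr; linarith
        _ = C / M * (1 / |(n : ℝ)| ^ 2) := by field_simp
        _ = _ := by rw [sq_abs]
  have hsumF : Summable (fun n : ℤ => FourierTransform.fourier f (n : ℝ)) := by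
    refine Summable.of_norm_bounded_eventually hg1.summable ?_
    filter_upwards [S'.finite_toSet.compl_mem_cofinite] with n hn
    exact hout n (by simpa using hn)
  have hpo := Real.tsum_eq_tsum_fourier_of_rpow_decay_of_summable cf (by norm_num : (1 : ℝ) < 2) hdec hsumF 0
  have e1 : ∑' n : ℤ, f (0 + n) = ∑ n ∈ range L, (w0 (n / M) : ℂ) * eC (x * ((n : ℝ) / M) ^ α) := by
    rw [tsum_eq_sum (s := (range L).map Nat.castEmbedding)]
    · rw [Finset.sum_map]
      apply Finset.sum_congr rfl
      intro n _
      simp [hf]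
    · intro n hn
      rw [zero_add]
      apply fz
      by_contra! h
      have h0 : 0 < n := by exact_mod_cast h.1
      obtain ⟨m, rfl⟩ := Int.eq_ofNat_of_zero_le h0.le
      apply hn
      rw [Finset.mem_map]
      refine ⟨m, ?_, rfl⟩
      rw [Finset.mem_range]
      have := h.2.trans_le hL
      exact_mod_cast this
  have e2 : ∑' n : ℤ, FourierTransform.fourier f (n : ℝ) * (fourier n) ((0 : ℝ) : UnitAddCircle) = ∑' n : ℤ, FourierTransform.fourier f (n : ℝ) := by
    congr 1; ext n
    rw [show ((0 : ℝ) : UnitAddCircle) = 0 from rfl, fourier_eval_zero, mul_one]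
  rw [e1, e2, ← hsumF.sum_add_tsum_compl (s := S')] at hpo
  have e3 : ∑ n ∈ S', FourierTransform.fourier f (n : ℝ) = ∑ ν ∈ S, (M : ℂ) * smInt w0 b α x (ν * M) := by
    rw [hS', Finset.sum_map]
    apply Finset.sum_congr rfl
    intro n _
    rw [hF]; simp
  rw [hpo, e3, add_sub_cancel_left]
  have h2 : ‖∑' n : ↑(↑S' : Set ℤ)ᶜ, FourierTransform.fourier f ((n : ℤ) : ℝ)‖ ≤ ∑' n : ↑(↑S' : Set ℤ)ᶜ, g n :=
    tsum_of_norm_bounded (hg1.summable.subtype _).hasSum fun n => hout n (fun h => n.2 h)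
  have h3 : ∑' n : ↑(↑S' : Set ℤ)ᶜ, g n ≤ C / M * Z2 + C * M / x ^ 2 := by
    rw [← hg1.tsum_eq]
    exact Summable.tsum_subtype_le g _ hg0 hg1.summable
  calc _ ≤ C / M * Z2 + C * M / x ^ 2 := h2.trans h3
    _ ≤ _ := by
      have : 0 ≤ C / M := by positivity
      have : 0 ≤ C * M / x ^ 2 * Z2 := by positivity
      rw [show C * (1 + Z2) * (M / x ^ 2 + 1 / M) = C / M * Z2 + C * M / x ^ 2 + (C / M + C * M / x ^ 2 * Z2) by field_simp; ring]
      linarith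

lemma norm_sum_mul_le_of_lipschitz (F G : ℕ → ℂ) {a b : ℕ} {K D : ℝ}
    (hG : ∀ n, a ≤ n → n ≤ b → ‖G n‖ ≤ K) (hD : ∀ n, a ≤ n → n + 1 ≤ b → ‖G n - G (n + 1)‖ ≤ D) :
    ‖∑ n ∈ Finset.Icc a b, F n * G n‖ ≤ K * ‖∑ n ∈ Finset.Icc a b, F n‖ + D * ∑ y ∈ Finset.Ico a b, ‖∑ n ∈ Finset.Icc a y, F n‖ := by
  rcases lt_or_ge b a with h | h
  · rw [Finset.Icc_eq_empty (by omega), Finset.Ico_eq_empty (by omega)]; simp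
  have key : ∀ j, a ≤ j → ∑ n ∈ Finset.Icc a j, F n * G n = (∑ n ∈ Finset.Icc a j, F n) * G j +
      ∑ y ∈ Finset.Ico a j, (∑ n ∈ Finset.Icc a y, F n) * (G y - G (y + 1)) := by
    intro j hj
    induction j, hj using Nat.le_induction with
    | base => simp
    | succ j hj ih =>
      rw [← Finset.insert_Icc_right_eq_Icc_add_one (by omega), sum_insert (by simp), sum_insert (by simp), Finset.sum_Ico_succ_top hj, ih]
      ring
  rw [key b h]
  refine (norm_add_le _ _).trans (add_le_add ?_ ?_)
  · rw [norm_mul, mul_comm]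
    gcongr
    exact hG b h le_rfl
  · rw [mul_sum]
    refine (norm_sum_le _ _).trans (sum_le_sum fun y hy => ?_)
    rw [Finset.mem_Ico] at hy
    rw [norm_mul, mul_comm]
    gcongr
    exact hD y hy.1 hy.2

lemma exists_stationary_sum {α b B c1 c2 : ℝ} {w0 w1 w2 : ℝ → ℝ} (hα : 1 < α) (hb : 1 ≤ b) (hB : 0 < B) (hw : IsBump w0 w1 w2 b B)
    (p1 : 0 < c1) (p12 : c1 ≤ c2) :
    ∃ C : ℝ, C > 0 ∧ ∀ x M T : ℝ, 1 ≤ T → T ≤ x → x ≤ 2 * T → 0 < M →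
      ‖∑ ν ∈ Finset.Icc ⌈c1 * T / M⌉₊ ⌊c2 * (2 * T) / M⌋₊, (M : ℂ) * smInt w0 b α x (ν * M)‖ ≤
      C * (M / √T) * (‖∑ ν ∈ Finset.Icc ⌈c1 * T / M⌉₊ ⌊c2 * (2 * T) / M⌋₊,
          eC ((α - 1) * α ^ (-(α / (α - 1))) * M ^ (α / (α - 1)) * x ^ (1 - α / (α - 1)) * (ν : ℝ) ^ (α / (α - 1)))‖
        + M / T * ∑ y ∈ Finset.Icc ⌈c1 * T / M⌉₊ ⌊c2 * (2 * T) / M⌋₊, ‖∑ ν ∈ Finset.Icc ⌈c1 * T / M⌉₊ y,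
          eC ((α - 1) * α ^ (-(α / (α - 1))) * M ^ (α / (α - 1)) * x ^ (1 - α / (α - 1)) * (ν : ℝ) ^ (α / (α - 1)))‖) := by
  obtain ⟨p, hp⟩ : ∃ p, p = 1 / (α - 1) := ⟨_, rfl⟩
  have hα1 : 0 < α - 1 := by linarith
  have hp0 : 0 < p := by rw [hp]; positivity
  have p2 : 0 < c2 := p1.trans_le p12
  have hα0 : 0 < α := by linarith
  obtain ⟨u, hu⟩ : ∃ u, u = c1 / (2 * α) := ⟨_, rfl⟩
  obtain ⟨v, hv⟩ : ∃ v, v = 2 * c2 / α := ⟨_, rfl⟩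
  have hu0 : 0 < u := by rw [hu]; positivity
  have hv0 : 0 < v := by rw [hv]; positivity
  obtain ⟨Lp, hLp, hlip⟩ := exists_rpow_lipschitz hu0 v p
  obtain ⟨vlo, vhi, C, hvlo, hvv, hC, hv1, hv2, hgood⟩ := exists_stationary_isGood (lo := u ^ p) (hi := v ^ p) hα (by positivity) (by positivity) hB hw
  refine ⟨C * (1 + Lp / α), by positivity, fun x M T hT hTx hxT hM => ?_⟩
  have hx : 0 < x := by linarith
  have hT0 : 0 < T := by linarith
  obtain ⟨a, ha⟩ : ∃ a, a = ⌈c1 * T / M⌉₊ := ⟨_, rfl⟩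
  obtain ⟨e, he⟩ : ∃ e, e = ⌊c2 * (2 * T) / M⌋₊ := ⟨_, rfl⟩
  rw [← ha, ← he]
  obtain ⟨z, hz⟩ : ∃ z, z = (α - 1) * α ^ (-(α / (α - 1))) * M ^ (α / (α - 1)) * x ^ (1 - α / (α - 1)) := ⟨_, rfl⟩
  rw [← hz]
  obtain ⟨H, hH⟩ : ∃ H : ℝ → ℂ, H = fun s => ∫ v in vlo..vhi, ((s * w0 (s * v) : ℝ) : ℂ) * eC (x * s ^ α * gPh α v) := ⟨_, rfl⟩
  have hHg : IsGood (Set.Icc (u ^ p) (v ^ p)) (C * (√x)⁻¹) H := by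
    have := hgood (√x)⁻¹ (by positivity) (inv_le_one_of_one_le₀ (one_le_sqrt.2 (by linarith)))
    rwa [inv_pow, sq_sqrt hx.le, inv_inv, ← hH] at this
  obtain ⟨s, hs⟩ : ∃ s : ℕ → ℝ, s = fun ν : ℕ => ((ν : ℝ) * M / (α * x)) ^ p := ⟨_, rfl⟩
  have hbase : ∀ ν, a ≤ ν → ν ≤ e → ν * M / (α * x) ∈ Set.Icc u v := by
    intro ν h1 h2
    rw [ha, Nat.ceil_le, div_le_iff₀ hM] at h1
    have h2 : (ν : ℝ) * M ≤ c2 * (2 * T) := by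
      rw [← le_div_iff₀ hM]
      refine le_trans ?_ (Nat.floor_le (by positivity))
      rw [← he]; exact_mod_cast h2
    rw [hu, hv]
    constructor
    · rw [div_le_div_iff₀ (by positivity) (by positivity)]
      nlinarith [mul_pos p1 hα0]
    · rw [div_le_div_iff₀ (by positivity) (by positivity)]
      nlinarith [mul_pos p2 hα0]
  have hsmem : ∀ ν, a ≤ ν → ν ≤ e → s ν ∈ Set.Icc (u ^ p) (v ^ p) := by
    intro ν h1 h2
    obtain ⟨q1, q2⟩ := hbase ν h1 h2
    rw [hs]
    exact ⟨rpow_le_rpow hu0.le q1 hp0.le, rpow_le_rpow (hu0.le.trans q1) q2 hp0.le⟩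
  have hsm : ∀ ν, a ≤ ν → ν ≤ e → smInt w0 b α x (ν * M) = eC (-(z * (ν : ℝ) ^ (α / (α - 1)))) * H (s ν) := by
    intro ν h1 h2
    obtain ⟨q1, q2⟩ := hbase ν h1 h2
    have hq0 := hu0.trans_le q1
    obtain ⟨r1, r2⟩ := hsmem ν h1 h2
    have hs0 : 0 < s ν := lt_of_lt_of_le (by positivity) r1
    have hν : 0 < (ν : ℝ) := by
      by_contra! h
      have : ν * M / (α * x) ≤ 0 := div_nonpos_of_nonpos_of_nonneg (mul_nonpos_of_nonpos_of_nonneg h hM.le) (by positivity)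
      linarith
    have e1 : (ν : ℝ) * M = α * x * s ν ^ (α - 1) := by
      rw [hs]; simp only
      rw [← rpow_mul hq0.le, hp, one_div, inv_mul_cancel₀ hα1.ne', rpow_one]
      field_simp
    have e2 : (α - 1) * x * s ν ^ α = z * (ν : ℝ) ^ (α / (α - 1)) := by
      rw [hs]; simp only
      rw [← rpow_mul hq0.le, hp, one_div_mul_eq_div, div_rpow (by positivity) (by positivity), mul_rpow hν.le hM.le, mul_rpow hα0.le hx.le, hz,
        rpow_sub hx, rpow_one, rpow_neg hα0.le]
      field_simp
    rw [e1, smInt_eq hs0 (by linarith) hw hvlo, e2, hH]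
    · exact (mul_le_mul_of_nonneg_right r2 hvlo.le).trans hv1
    · exact hv2.trans (mul_le_mul_of_nonneg_right r1 (by linarith))
  have hsum : ∑ ν ∈ Finset.Icc a e, (M : ℂ) * smInt w0 b α x (ν * M) = M * ∑ ν ∈ Finset.Icc a e, eC (-(z * (ν : ℝ) ^ (α / (α - 1)))) * H (s ν) := by
    rw [mul_sum]
    refine sum_congr rfl fun ν hν => ?_
    rw [Finset.mem_Icc] at hν
    rw [hsm ν hν.1 hν.2]
  have hy : (√x)⁻¹ ≤ (√T)⁻¹ := by gcongr
  have hsT : 0 < √T := by positivity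
  have hab := norm_sum_mul_le_of_lipschitz (fun ν => eC (-(z * (ν : ℝ) ^ (α / (α - 1))))) (fun ν => H (s ν)) (a := a) (b := e)
    (K := C * (√T)⁻¹) (D := C * (√T)⁻¹ * (Lp / α * (M / T)))
    (fun n h1 h2 => (hHg.1 _ (hsmem n h1 h2)).trans (by gcongr))
    (fun n h1 h2 => by
      refine (hHg.2 _ (hsmem n h1 (by omega)) _ (hsmem (n + 1) (by omega) h2)).trans ?_
      have h3 := (hlip _ (hbase n h1 (by omega))).2 _ (hbase (n + 1) (by omega) h2)
      have h4 : |s n - s (n + 1)| ≤ Lp / α * (M / T) := by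
        rw [hs]; simp only
        refine h3.trans ?_
        have : n * M / (α * x) - ((n + 1 : ℕ) : ℝ) * M / (α * x) = -(M / (α * x)) := by push_cast; ring
        rw [this, abs_neg, abs_of_pos (by positivity)]
        calc Lp * (M / (α * x)) ≤ Lp * (M / (α * T)) := by gcongr
          _ = _ := by field_simp
      gcongr)
  simp only [norm_sum_eC_neg] at hab
  rw [hsum, norm_mul, Complex.norm_real, Real.norm_eq_abs, abs_of_pos hM]
  obtain ⟨A, hA⟩ : ∃ A : ℕ → ℝ, A = fun y => ‖∑ ν ∈ Finset.Icc a y, eC (z * (ν : ℝ) ^ (α / (α - 1)))‖ := ⟨_, rfl⟩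
  have hA0 : ∀ y, 0 ≤ A y := fun y => by rw [hA]; exact norm_nonneg _
  have hA' : ∀ y, ‖∑ ν ∈ Finset.Icc a y, eC (z * (ν : ℝ) ^ (α / (α - 1)))‖ = A y := fun y => by rw [hA]
  simp only [hA'] at hab ⊢
  have hsub : ∑ y ∈ Finset.Ico a e, A y ≤ ∑ y ∈ Finset.Icc a e, A y :=
    sum_le_sum_of_subset_of_nonneg Finset.Ico_subset_Icc_self fun y _ _ => hA0 y
  have hS0 : 0 ≤ ∑ y ∈ Finset.Icc a e, A y := sum_nonneg fun y _ => hA0 y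
  calc _ ≤ M * (C * (√T)⁻¹ * A e + C * (√T)⁻¹ * (Lp / α * (M / T)) * ∑ y ∈ Finset.Icc a e, A y) := by
        gcongr; refine hab.trans ?_; gcongr
    _ = C * (M / √T) * (A e + Lp / α * (M / T * ∑ y ∈ Finset.Icc a e, A y)) := by field_simp
    _ ≤ C * (M / √T) * ((1 + Lp / α) * (A e + M / T * ∑ y ∈ Finset.Icc a e, A y)) := by
        gcongr
        have q1 := hA0 e
        have q2 : 0 ≤ M / T * ∑ y ∈ Finset.Icc a e, A y := by positivity
        have q3 : 0 ≤ Lp / α := by positivity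
        nlinarith [mul_nonneg q3 q1]
    _ = _ := by ring

/-- The additive energy of `n ^ α`, `N ≤ n ≤ R N`, at tolerance `N ^ (α - 2)` is `O(N ^ (2 + γ))`. -/
def EnergyBound (α γ : ℝ) : Prop := ∀ R : ℝ, 1 ≤ R → ∃ C : ℝ, C > 0 ∧ ∀ N : ℝ, 1 ≤ N →
  (quadEnergy (Finset.Icc ⌈N⌉₊ ⌊R * N⌋₊) (fun n => (n : ℝ) ^ α) (N ^ (α - 2)) : ℝ) ≤ C * N ^ (2 + γ)

lemma quadEnergy_mono {s s' : Finset ℕ} {δ δ' : ℝ} (hs : s ⊆ s') (y : ℕ → ℝ) (hδ : δ ≤ δ') :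
    quadEnergy s y δ ≤ quadEnergy s' y δ' := by
  apply card_le_card
  intro p hp
  simp only [mem_filter, mem_product] at hp ⊢
  exact ⟨⟨⟨hs hp.1.1.1, hs hp.1.1.2⟩, hs hp.1.2.1, hs hp.1.2.2⟩, hp.2.trans hδ⟩

lemma integral_comp_rpow_le {β κ T Z : ℝ} {h : ℝ → ℝ} (hβ : 1 < β) (hκ : 0 < κ) (hT : 0 < T) (hc : Continuous h) (h0 : ∀ z, 0 ≤ h z)
    (hZ : κ * T ^ (1 - β) ≤ Z) : ∫ x in T..2 * T, h (κ * x ^ (1 - β)) ≤ (2 * T) ^ β / ((β - 1) * κ) * ∫ z in (0 : ℝ)..Z, h z := by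
  have hu : Set.uIcc T (2 * T) = Set.Icc T (2 * T) := Set.uIcc_of_le (by linarith)
  have pos : ∀ x ∈ Set.Icc T (2 * T), 0 < x := fun x hx => hT.trans_le hx.1
  have hβ1 : 0 < β - 1 := by linarith
  have hd : ∀ x ∈ Set.uIcc T (2 * T), HasDerivAt (fun x : ℝ => κ * x ^ (1 - β)) (κ * ((1 - β) * x ^ (1 - β - 1))) x := fun x hx => by
    rw [hu] at hx
    exact (hasDerivAt_rpow_const (Or.inl (pos x hx).ne')).const_mul κ
  have cr : ∀ p : ℝ, ContinuousOn (fun x : ℝ => x ^ p) (Set.uIcc T (2 * T)) := fun p x hx => by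
    rw [hu] at hx
    exact (continuousAt_rpow_const _ _ (Or.inl (pos x hx).ne')).continuousWithinAt
  have hd' : ContinuousOn (fun x : ℝ => κ * ((1 - β) * x ^ (1 - β - 1))) (Set.uIcc T (2 * T)) :=
    ((cr _).const_mul _).const_mul _
  have hcz : ContinuousOn (fun x : ℝ => h (κ * x ^ (1 - β))) (Set.uIcc T (2 * T)) := hc.comp_continuousOn ((cr _).const_mul _)
  have hcv := intervalIntegral.integral_comp_mul_deriv hd hd' hc
  simp only [Function.comp_def] at hcv
  obtain ⟨D, hD⟩ : ∃ D, D = (2 * T) ^ β / ((β - 1) * κ) := ⟨_, rfl⟩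
  have hD0 : 0 < D := by rw [hD]; positivity
  rw [← hD]
  have h1 : ∫ x in T..2 * T, h (κ * x ^ (1 - β)) ≤ ∫ x in T..2 * T, (-D) * (h (κ * x ^ (1 - β)) * (κ * ((1 - β) * x ^ (1 - β - 1)))) := by
    apply intervalIntegral.integral_mono_on (by linarith) hcz.intervalIntegrable ((hcz.mul hd').const_mul _ |>.intervalIntegrable)
    intro x hx
    have hx0 := pos x hx
    have e : 1 ≤ D * (κ * ((β - 1) * x ^ (-β))) := by
      have : x ^ β ≤ (2 * T) ^ β := rpow_le_rpow hx0.le hx.2 (by linarith)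
      rw [hD, rpow_neg hx0.le]
      have hxp : 0 < x ^ β := by positivity
      calc 1 ≤ (2 * T) ^ β / x ^ β := by rwa [one_le_div hxp]
        _ = _ := by field_simp
    rw [show 1 - β - 1 = -β by ring]
    simp only [Pi.mul_apply]
    have := mul_le_mul_of_nonneg_left e (h0 (κ * x ^ (1 - β)))
    nlinarith
  refine h1.trans ?_
  rw [intervalIntegral.integral_const_mul, hcv, neg_mul, ← mul_neg, ← intervalIntegral.integral_symm]
  gcongr
  have z1 : 0 ≤ κ * (2 * T) ^ (1 - β) := by positivity
  have z2 : κ * (2 * T) ^ (1 - β) ≤ κ * T ^ (1 - β) := by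
    gcongr κ * ?_
    exact rpow_le_rpow_of_nonpos hT (by linarith) (by linarith)
  exact intervalIntegral.integral_mono_interval z1 z2 hZ (Filter.Eventually.of_forall fun z => h0 z) (hc.intervalIntegrable _ _)

lemma exists_dual_energy {β γ c1 c2 κ : ℝ} (hβ : 1 < β) (hγ : 0 < γ) (hE : EnergyBound β γ) (p1 : 0 < c1) (p12 : c1 ≤ c2) (hκ : 0 < κ) :
    ∃ C : ℝ, C > 0 ∧ ∀ M T : ℝ, 1 ≤ T → T ≤ M ^ 2 → 0 < M → ∀ y ∈ Finset.Icc ⌈c1 * T / M⌉₊ ⌊c2 * (2 * T) / M⌋₊,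
      ∫ x in T..2 * T, ‖∑ ν ∈ Finset.Icc ⌈c1 * T / M⌉₊ y, eC (κ * M ^ β * x ^ (1 - β) * (ν : ℝ) ^ β)‖ ^ 4 ≤ C * T * (T / M) ^ (2 + γ) := by
  have p2 : 0 < c2 := p1.trans_le p12
  obtain ⟨C1, hC1, h1⟩ := exists_integral_le_energy
  obtain ⟨C2, hC2, h2⟩ := hE (2 * c2 / c1) (by rw [one_le_div p1]; linarith)
  obtain ⟨G, hG, h3⟩ := exists_rpow_bound p1 (2 * c2) (2 - β)
  have hβ1 : 0 < β - 1 := by linarith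
  refine ⟨2 ^ β / ((β - 1) * κ) * C1 * (κ + G / 2) * (C2 * (2 * c2) ^ (2 + γ)), by positivity, fun M T hT hTM hM y hy => ?_⟩
  have hT0 : 0 < T := by linarith
  obtain ⟨N, hN⟩ : ∃ N, N = T / M := ⟨_, rfl⟩
  have hN0 : 0 < N := by rw [hN]; positivity
  have hTN : T = N * M := by rw [hN]; field_simp
  rw [show c1 * T / M = c1 * N by rw [hN]; ring, show c2 * (2 * T) / M = 2 * c2 * N by rw [hN]; ring, Finset.mem_Icc] at hy
  rw [show c1 * T / M = c1 * N by rw [hN]; ring, ← hN]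
  have hy2 : (y : ℝ) ≤ 2 * c2 * N := (Nat.le_floor_iff (by positivity)).1 hy.2
  have hN1 : 1 ≤ 2 * c2 * N := by
    refine le_trans ?_ hy2
    have : 1 ≤ ⌈c1 * N⌉₊ := Nat.one_le_ceil_iff.2 (by positivity)
    exact_mod_cast this.trans hy.1
  obtain ⟨N0, hN0'⟩ : ∃ N0, N0 = max 1 (c1 * N) := ⟨_, rfl⟩
  have n1 : 1 ≤ N0 := by rw [hN0']; exact le_max_left _ _
  have n2 : c1 * N ≤ N0 := by rw [hN0']; exact le_max_right _ _
  have n3 : N0 ≤ 2 * c2 * N := by rw [hN0']; exact max_le hN1 (by nlinarith)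
  have nG : N0 ^ (2 - β) ≤ G * N ^ (2 - β) := by
    have := h3 (N0 / N) (by rwa [le_div_iff₀ hN0]) (by rwa [div_le_iff₀ hN0])
    rw [div_rpow (by linarith) hN0.le] at this
    have := (le_abs_self _).trans this
    rwa [div_le_iff₀ (by positivity)] at this
  have hN2 : N ^ (2 : ℝ) ≤ T := by
    rw [rpow_two, hN, div_pow, div_le_iff₀ (by positivity)]; nlinarith
  obtain ⟨Z, hZ⟩ : ∃ Z, Z = κ * M ^ β * T ^ (1 - β) + N0 ^ (2 - β) / 2 := ⟨_, rfl⟩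
  have hZ0 : 0 < Z := by rw [hZ]; positivity
  have hcont : Continuous fun t : ℝ => ‖∑ ν ∈ Finset.Icc ⌈c1 * N⌉₊ y, eC (t * (ν : ℝ) ^ β)‖ ^ 4 := by
    refine (continuous_norm.comp (continuous_finsetSum _ fun ν _ => ?_)).pow 4
    exact continuous_eC.comp (continuous_id.mul continuous_const)
  have s1 := integral_comp_rpow_le (Z := Z) hβ (show 0 < κ * M ^ β by positivity) hT0 hcont (fun z => by positivity)
    (by rw [hZ]; linarith [show 0 ≤ N0 ^ (2 - β) by positivity])
  refine s1.trans ?_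
  have s2 := h1 (Finset.Icc ⌈c1 * N⌉₊ y) (fun ν => (ν : ℝ) ^ β) Z hZ0
  have s3 : quadEnergy (Finset.Icc ⌈c1 * N⌉₊ y) (fun ν => (ν : ℝ) ^ β) (1 / (2 * Z)) ≤
      quadEnergy (Finset.Icc ⌈N0⌉₊ ⌊2 * c2 / c1 * N0⌋₊) (fun ν => (ν : ℝ) ^ β) (N0 ^ (β - 2)) := by
    apply quadEnergy_mono
    · intro ν hν
      rw [Finset.mem_Icc] at hν ⊢
      have a1 : 1 ≤ ⌈c1 * N⌉₊ := Nat.one_le_ceil_iff.2 (by positivity)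
      constructor
      · rw [Nat.ceil_le, hN0']
        apply max_le
        · exact_mod_cast a1.trans hν.1
        · exact Nat.ceil_le.1 hν.1
      · apply Nat.le_floor
        calc (ν : ℝ) ≤ y := by exact_mod_cast hν.2
          _ ≤ 2 * c2 / c1 * (c1 * N) := hy2.trans_eq (by field_simp)
          _ ≤ _ := by gcongr
    · rw [show β - 2 = -(2 - β) by ring, rpow_neg (by linarith), one_div]
      apply inv_anti₀ (by positivity)
      rw [hZ]
      linarith [show 0 ≤ κ * M ^ β * T ^ (1 - β) by positivity]
  have s4 := h2 N0 n1
  have s3' : (quadEnergy (Finset.Icc ⌈c1 * N⌉₊ y) (fun ν => (ν : ℝ) ^ β) (1 / (2 * Z)) : ℝ) ≤ C2 * ((2 * c2) ^ (2 + γ) * N ^ (2 + γ)) := by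
    refine (Nat.cast_le.2 s3).trans (s4.trans ?_)
    gcongr
    rw [← mul_rpow (by positivity) hN0.le]
    exact rpow_le_rpow (by linarith) n3 (by linarith)
  have s5 : (2 * T) ^ β / ((β - 1) * (κ * M ^ β)) * Z ≤ 2 ^ β / ((β - 1) * κ) * ((κ + G / 2) * T) := by
    have hMN : T ^ β = N ^ β * M ^ β := by rw [hTN, mul_rpow hN0.le hM.le]
    have e1 : (2 * T) ^ β / ((β - 1) * (κ * M ^ β)) = 2 ^ β / ((β - 1) * κ) * N ^ β := by
      rw [mul_rpow (by norm_num) hT0.le, hMN]; field_simp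
    rw [e1, mul_assoc]
    refine mul_le_mul_of_nonneg_left ?_ (by positivity)
    have e2 : N ^ β * (κ * M ^ β * T ^ (1 - β)) = κ * T := by
      rw [rpow_sub hT0, rpow_one, hMN]; field_simp
    have e3 : N ^ β * N ^ (2 - β) = N ^ (2 : ℝ) := by rw [← rpow_add hN0]; congr 1; ring
    calc N ^ β * Z = κ * T + N ^ β * N0 ^ (2 - β) / 2 := by rw [hZ, mul_add, e2]; ring
      _ ≤ κ * T + N ^ β * (G * N ^ (2 - β)) / 2 := by gcongr
      _ = κ * T + G * N ^ (2 : ℝ) / 2 := by rw [← e3]; ring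
      _ ≤ κ * T + G * T / 2 := by gcongr
      _ = _ := by ring
  calc _ ≤ (2 * T) ^ β / ((β - 1) * (κ * M ^ β)) * (C1 * Z * (C2 * ((2 * c2) ^ (2 + γ) * N ^ (2 + γ)))) := by
        gcongr; exact s2.trans (by gcongr)
    _ = ((2 * T) ^ β / ((β - 1) * (κ * M ^ β)) * Z) * (C1 * (C2 * ((2 * c2) ^ (2 + γ) * N ^ (2 + γ)))) := by ring
    _ ≤ (2 ^ β / ((β - 1) * κ) * ((κ + G / 2) * T)) * (C1 * (C2 * ((2 * c2) ^ (2 + γ) * N ^ (2 + γ)))) := by gcongr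
    _ = _ := by ring

lemma sum_pow_four_le (s : Finset ℕ) (f : ℕ → ℝ) : (∑ i ∈ s, f i) ^ 4 ≤ (#s : ℝ) ^ 3 * ∑ i ∈ s, f i ^ 4 := by
  have h1 : (∑ i ∈ s, f i) ^ 2 ≤ #s * ∑ i ∈ s, f i ^ 2 := sq_sum_le_card_mul_sum_sq
  have h2 : (∑ i ∈ s, f i ^ 2) ^ 2 ≤ #s * ∑ i ∈ s, (f i ^ 2) ^ 2 := sq_sum_le_card_mul_sum_sq
  calc (∑ i ∈ s, f i) ^ 4 = ((∑ i ∈ s, f i) ^ 2) ^ 2 := by ring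
    _ ≤ (#s * ∑ i ∈ s, f i ^ 2) ^ 2 := by gcongr
    _ = (#s : ℝ) ^ 2 * (∑ i ∈ s, f i ^ 2) ^ 2 := by ring
    _ ≤ (#s : ℝ) ^ 2 * (#s * ∑ i ∈ s, (f i ^ 2) ^ 2) := by gcongr
    _ = (#s : ℝ) ^ 3 * ∑ i ∈ s, (f i ^ 2) ^ 2 := by ring
    _ = _ := by simp_rw [← pow_mul]

lemma add_pow_four_le (a b : ℝ) : (a + b) ^ 4 ≤ 8 * (a ^ 4 + b ^ 4) := by
  nlinarith [sq_nonneg (a - b), sq_nonneg (a ^ 2 - b ^ 2), sq_nonneg (a * (a - b)), sq_nonneg (b * (a - b)), sq_nonneg ((a - b) ^ 2)]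

lemma exists_dyadic_moment {α γ b B : ℝ} {w0 w1 w2 : ℝ → ℝ} (hα : 1 < α) (hγ : 0 < γ) (hE : EnergyBound (α / (α - 1)) γ)
    (hb : 1 ≤ b) (hB : 0 < B) (hw : IsBump w0 w1 w2 b B) :
    ∃ C : ℝ, C > 0 ∧ ∀ M T : ℝ, 1 ≤ M → 1 ≤ T → T ≤ M ^ 2 → ∀ L : ℕ, b * M ≤ L →
      ∫ x in T..2 * T, ‖∑ n ∈ range L, (w0 (n / M) : ℂ) * eC (x * ((n : ℝ) / M) ^ α)‖ ^ 4 ≤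
        C * (M ^ 4 / T + M ^ (2 - γ) * T ^ (1 + γ)) := by
  have hα1 : 0 < α - 1 := by linarith
  have hβ : 1 < α / (α - 1) := by rw [one_lt_div hα1]; linarith
  obtain ⟨β, hβe⟩ : ∃ β, β = α / (α - 1) := ⟨_, rfl⟩
  obtain ⟨κ, hκe⟩ : ∃ κ, κ = (α - 1) * α ^ (-β) := ⟨_, rfl⟩
  have hκ : 0 < κ := by rw [hκe]; positivity
  obtain ⟨c1, hc1⟩ : ∃ c1, c1 = α * (1 / 2) ^ (α - 1) / 2 := ⟨_, rfl⟩
  obtain ⟨c2, hc2⟩ : ∃ c2, c2 = 2 * α * b ^ (α - 1) := ⟨_, rfl⟩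
  have p1 : 0 < c1 := by rw [hc1]; positivity
  have p2 : 0 < c2 := by rw [hc2]; positivity
  have p12 : c1 ≤ c2 := by
    have h1 : (1 / 2 : ℝ) ^ (α - 1) ≤ 1 := rpow_le_one (by norm_num) (by norm_num) hα1.le
    have h2 : 1 ≤ b ^ (α - 1) := one_le_rpow hb hα1.le
    rw [hc1, hc2]; nlinarith
  obtain ⟨C1, hC1, h1⟩ := exists_poisson hα hb hw
  obtain ⟨C2, hC2, h2⟩ := exists_stationary_sum hα hb hB hw p1 p12
  obtain ⟨C3, hC3, h3⟩ := exists_dual_energy hβ hγ hE p1 p12 hκ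
  rw [← hc1, ← hc2] at h1
  rw [← hβe, ← hκe] at h2
  rw [← hβe] at h3
  obtain ⟨K, hK⟩ : ∃ K, K = 64 * C2 ^ 4 * (C3 * (1 + (2 * c2) ^ 4)) := ⟨_, rfl⟩
  have hK0 : 0 < K := by rw [hK]; positivity
  refine ⟨128 * C1 ^ 4 + K, by positivity, fun M T hM hT hTM L hL => ?_⟩
  have hM0 : 0 < M := by linarith
  have hT0 : 0 < T := by linarith
  obtain ⟨a, ha⟩ : ∃ a, a = ⌈c1 * T / M⌉₊ := ⟨_, rfl⟩
  obtain ⟨e, he⟩ : ∃ e, e = ⌊c2 * (2 * T) / M⌋₊ := ⟨_, rfl⟩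
  obtain ⟨A, hA⟩ : ∃ A : ℕ → ℝ → ℝ, A = fun y x => ‖∑ ν ∈ Finset.Icc a y, eC (κ * M ^ β * x ^ (1 - β) * (ν : ℝ) ^ β)‖ := ⟨_, rfl⟩
  have h1' := fun x q1 q2 => h1 x M T hT0 q1 q2 hM0 L hL
  have h2' := fun x q1 q2 => h2 x M T hT q1 q2 hM0
  have h3' := h3 M T hT hTM hM0
  simp only [← ha, ← he] at h1' h2' h3'
  have hAe : ∀ y x, ‖∑ ν ∈ Finset.Icc a y, eC (κ * M ^ β * x ^ (1 - β) * (ν : ℝ) ^ β)‖ = A y x := fun y x => by rw [hA]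
  simp only [hAe] at h2' h3'
  have hA0 : ∀ y x, 0 ≤ A y x := fun y x => by rw [hA]; exact norm_nonneg _
  have hcA : ∀ y, ContinuousOn (fun x => A y x ^ 4) (Set.uIcc T (2 * T)) := by
    intro y
    rw [hA]
    refine (continuous_norm.comp_continuousOn (continuousOn_finsetSum _ fun ν _ => continuous_eC.comp_continuousOn ?_)).pow 4
    refine (ContinuousOn.const_mul (fun x hx => ?_) _).mul_const _
    rw [Set.uIcc_of_le (by linarith)] at hx
    exact (continuousAt_rpow_const _ _ (Or.inl (by linarith [hx.1]))).continuousWithinAt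
  obtain ⟨Q, hQ⟩ : ∃ Q, Q = C3 * T * (T / M) ^ (2 + γ) := ⟨_, rfl⟩
  have hQ0 : 0 ≤ Q := by rw [hQ]; positivity
  rw [← hQ] at h3'
  have hAend : ∫ x in T..2 * T, A e x ^ 4 ≤ Q := by
    by_cases hae : a ≤ e
    · exact h3' e (Finset.mem_Icc.2 ⟨hae, le_rfl⟩)
    · have : ∀ x, A e x = 0 := fun x => by rw [hA]; simp only; rw [Finset.Icc_eq_empty hae]; simp
      simp [this, hQ0]
  have hcard : (#(Finset.Icc a e) : ℝ) ≤ 2 * c2 * (T / M) := by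
    have : #(Finset.Icc a e) ≤ e := by
      have : 1 ≤ a := by rw [ha]; exact Nat.one_le_ceil_iff.2 (by positivity)
      rw [Nat.card_Icc]; omega
    calc (#(Finset.Icc a e) : ℝ) ≤ e := by exact_mod_cast this
      _ ≤ c2 * (2 * T) / M := by rw [he]; exact Nat.floor_le (by positivity)
      _ = _ := by ring
  have hpt : ∀ x ∈ Set.Icc T (2 * T), ‖∑ n ∈ range L, (w0 (n / M) : ℂ) * eC (x * ((n : ℝ) / M) ^ α)‖ ^ 4 ≤
      8 * C1 ^ 4 * (M / T ^ 2 + 1 / M) ^ 4 + 64 * C2 ^ 4 * (M ^ 4 / T ^ 2) *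
        (A e x ^ 4 + (2 * c2) ^ 3 * (M / T) * ∑ y ∈ Finset.Icc a e, A y x ^ 4) := by
    intro x hx
    have q1 := h1' x hx.1 hx.2
    have q2 := h2' x hx.1 hx.2
    obtain ⟨W, hW⟩ : ∃ W : ℂ, W = ∑ ν ∈ Finset.Icc a e, (M : ℂ) * smInt w0 b α x (ν * M) := ⟨_, rfl⟩
    obtain ⟨V, hV⟩ : ∃ V : ℂ, V = ∑ n ∈ range L, (w0 (n / M) : ℂ) * eC (x * ((n : ℝ) / M) ^ α) := ⟨_, rfl⟩
    obtain ⟨σ, hσ⟩ : ∃ σ, σ = ∑ y ∈ Finset.Icc a e, A y x := ⟨_, rfl⟩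
    rw [← hV]
    rw [← hV, ← hW] at q1
    rw [← hW, ← hσ] at q2
    have hσ0 : 0 ≤ σ := by rw [hσ]; exact sum_nonneg fun y _ => hA0 y x
    have q3 : ‖V - W‖ ≤ C1 * (M / T ^ 2 + 1 / M) := q1.trans (by gcongr; exact hx.1)
    have q4 : ‖V‖ ≤ ‖V - W‖ + ‖W‖ := by simpa using norm_add_le (V - W) W
    have q5 : ‖W‖ ^ 4 ≤ 8 * C2 ^ 4 * (M ^ 4 / T ^ 2) * (A e x ^ 4 + (2 * c2) ^ 3 * (M / T) * ∑ y ∈ Finset.Icc a e, A y x ^ 4) := by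
      have r1 : (M / T * σ) ^ 4 ≤ (2 * c2) ^ 3 * (M / T) * ∑ y ∈ Finset.Icc a e, A y x ^ 4 := by
        have : σ ^ 4 ≤ (2 * c2 * (T / M)) ^ 3 * ∑ y ∈ Finset.Icc a e, A y x ^ 4 := by
          rw [hσ]
          refine (sum_pow_four_le _ _).trans (mul_le_mul_of_nonneg_right (pow_le_pow_left₀ (Nat.cast_nonneg _) hcard 3) ?_)
          exact sum_nonneg fun y _ => by positivity
        calc (M / T * σ) ^ 4 = (M / T) ^ 4 * σ ^ 4 := by ring
          _ ≤ (M / T) ^ 4 * ((2 * c2 * (T / M)) ^ 3 * ∑ y ∈ Finset.Icc a e, A y x ^ 4) := by gcongr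
          _ = _ := by field_simp
      have r2 : (√T) ^ 4 = T ^ 2 := by rw [show 4 = 2 * 2 by norm_num, pow_mul, sq_sqrt hT0.le]
      calc ‖W‖ ^ 4 ≤ (C2 * (M / √T) * (A e x + M / T * σ)) ^ 4 := by gcongr
        _ = C2 ^ 4 * (M ^ 4 / T ^ 2) * (A e x + M / T * σ) ^ 4 := by rw [← r2]; ring
        _ ≤ C2 ^ 4 * (M ^ 4 / T ^ 2) * (8 * (A e x ^ 4 + (M / T * σ) ^ 4)) := by gcongr; exact add_pow_four_le _ _
        _ ≤ C2 ^ 4 * (M ^ 4 / T ^ 2) * (8 * (A e x ^ 4 + (2 * c2) ^ 3 * (M / T) * ∑ y ∈ Finset.Icc a e, A y x ^ 4)) := by gcongr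
        _ = _ := by ring
    calc ‖V‖ ^ 4 ≤ (‖V - W‖ + ‖W‖) ^ 4 := by gcongr
      _ ≤ 8 * (‖V - W‖ ^ 4 + ‖W‖ ^ 4) := add_pow_four_le _ _
      _ ≤ 8 * ((C1 * (M / T ^ 2 + 1 / M)) ^ 4 + 8 * C2 ^ 4 * (M ^ 4 / T ^ 2) * (A e x ^ 4 + (2 * c2) ^ 3 * (M / T) * ∑ y ∈ Finset.Icc a e, A y x ^ 4)) := by
        gcongr
      _ = _ := by ring
  have hcS : ContinuousOn (fun x => ∑ y ∈ Finset.Icc a e, A y x ^ 4) (Set.uIcc T (2 * T)) := continuousOn_finsetSum _ fun y _ => hcA y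
  have hi1 : IntervalIntegrable (fun x => A e x ^ 4) volume T (2 * T) := (hcA e).intervalIntegrable
  have hi2 : IntervalIntegrable (fun x => (2 * c2) ^ 3 * (M / T) * ∑ y ∈ Finset.Icc a e, A y x ^ 4) volume T (2 * T) :=
    (hcS.const_mul _).intervalIntegrable
  have hcZ : Continuous fun x : ℝ => ‖∑ n ∈ range L, (w0 (n / M) : ℂ) * eC (x * ((n : ℝ) / M) ^ α)‖ ^ 4 := by
    refine (continuous_norm.comp (continuous_finsetSum _ fun ν _ => ?_)).pow 4
    exact continuous_const.mul (continuous_eC.comp (continuous_id.mul continuous_const))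
  have hint := intervalIntegral.integral_mono_on (by linarith) (hcZ.intervalIntegrable T (2 * T))
    (intervalIntegrable_const.add ((hi1.add hi2).const_mul (64 * C2 ^ 4 * (M ^ 4 / T ^ 2)))) hpt
  refine hint.trans ?_
  rw [intervalIntegral.integral_add intervalIntegrable_const ((hi1.add hi2).const_mul _), intervalIntegral.integral_const,
    intervalIntegral.integral_const_mul, intervalIntegral.integral_add hi1 hi2, intervalIntegral.integral_const_mul,
    intervalIntegral.integral_finsetSum fun y _ => (hcA y).intervalIntegrable, smul_eq_mul]
  have t1 : ∑ y ∈ Finset.Icc a e, ∫ x in T..2 * T, A y x ^ 4 ≤ 2 * c2 * (T / M) * Q := by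
    refine (sum_le_card_nsmul _ _ Q h3').trans ?_
    rw [nsmul_eq_mul]; gcongr
  have t2 : (2 * T - T) * (8 * C1 ^ 4 * (M / T ^ 2 + 1 / M) ^ 4) ≤ 128 * C1 ^ 4 * (M ^ 4 / T) := by
    have u1 : T * (M / T ^ 2) ^ 4 ≤ M ^ 4 / T := by
      rw [show T * (M / T ^ 2) ^ 4 = M ^ 4 / T ^ 7 by field_simp]
      gcongr
      exact le_self_pow₀ hT (by norm_num)
    have u2 : T * (1 / M) ^ 4 ≤ M ^ 4 / T := by
      rw [show T * (1 / M) ^ 4 = T / M ^ 4 by field_simp, div_le_div_iff₀ (by positivity) hT0]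
      calc T * T ≤ M ^ 2 * M ^ 2 := by gcongr
        _ = M ^ 4 := by ring
        _ ≤ M ^ 4 * M ^ 4 := le_mul_of_one_le_left (by positivity) (one_le_pow₀ hM)
    calc _ = 8 * C1 ^ 4 * (T * (M / T ^ 2 + 1 / M) ^ 4) := by ring
      _ ≤ 8 * C1 ^ 4 * (T * (8 * ((M / T ^ 2) ^ 4 + (1 / M) ^ 4))) := by gcongr; exact add_pow_four_le _ _
      _ = 64 * C1 ^ 4 * (T * (M / T ^ 2) ^ 4 + T * (1 / M) ^ 4) := by ring
      _ ≤ 64 * C1 ^ 4 * (M ^ 4 / T + M ^ 4 / T) := by gcongr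
      _ = _ := by ring
  have t3 : M ^ 4 / T ^ 2 * Q = C3 * (M ^ (2 - γ) * T ^ (1 + γ)) := by
    rw [hQ, div_rpow hT0.le hM0.le, rpow_sub hM0, rpow_add hT0, rpow_add hT0, rpow_add hM0, rpow_two, rpow_two, rpow_one]
    field_simp
  calc _ ≤ 128 * C1 ^ 4 * (M ^ 4 / T) + 64 * C2 ^ 4 * (M ^ 4 / T ^ 2) * (Q + (2 * c2) ^ 3 * (M / T) * (2 * c2 * (T / M) * Q)) := by gcongr
    _ = 128 * C1 ^ 4 * (M ^ 4 / T) + 64 * C2 ^ 4 * (1 + (2 * c2) ^ 4) * (M ^ 4 / T ^ 2 * Q) := by field_simp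
    _ = 128 * C1 ^ 4 * (M ^ 4 / T) + K * (M ^ (2 - γ) * T ^ (1 + γ)) := by rw [t3, hK]; ring
    _ ≤ _ := by
      have v1 : 0 ≤ M ^ 4 / T := by positivity
      have v2 : 0 ≤ M ^ (2 - γ) * T ^ (1 + γ) := by positivity
      nlinarith [mul_nonneg hK0.le v1, mul_nonneg (by positivity : 0 ≤ 128 * C1 ^ 4) v2]

lemma exists_full_moment {α γ b B : ℝ} {w0 w1 w2 : ℝ → ℝ} (hα : 1 < α) (hγ : 0 < γ) (hE : EnergyBound (α / (α - 1)) γ)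
    (hb : 1 ≤ b) (hB : 0 < B) (hw : IsBump w0 w1 w2 b B) :
    ∃ C : ℝ, C > 0 ∧ ∀ M : ℝ, 1 ≤ M → ∀ j : ℕ, (2 : ℝ) ^ j ≤ M ^ 2 →
      ∫ x in (0 : ℝ)..2 ^ j, ‖∑ n ∈ range ⌈b * M⌉₊, (w0 (n / M) : ℂ) * eC (x * ((n : ℝ) / M) ^ α)‖ ^ 4 ≤
        C * (M ^ 4 + M ^ (2 - γ) * (2 ^ j) ^ (1 + γ)) := by
  obtain ⟨C, hC, h⟩ := exists_dyadic_moment hα hγ hE hb hB hw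
  refine ⟨(2 * b * B) ^ 4 + 2 * C, by positivity, fun M hM j hj => ?_⟩
  have hM0 : 0 < M := by linarith
  obtain ⟨L, hL⟩ : ∃ L, L = ⌈b * M⌉₊ := ⟨_, rfl⟩
  have hL1 : b * M ≤ L := by rw [hL]; exact Nat.le_ceil _
  have hL2 : (L : ℝ) ≤ 2 * b * M := by
    have : (L : ℝ) < b * M + 1 := by rw [hL]; exact Nat.ceil_lt_add_one (by positivity)
    nlinarith
  rw [← hL]
  obtain ⟨F, hF⟩ : ∃ F : ℝ → ℝ, F = fun x => ‖∑ n ∈ range L, (w0 (n / M) : ℂ) * eC (x * ((n : ℝ) / M) ^ α)‖ ^ 4 := ⟨_, rfl⟩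
  have hcF : Continuous F := by
    rw [hF]
    refine (continuous_norm.comp (continuous_finsetSum _ fun ν _ => ?_)).pow 4
    exact continuous_const.mul (continuous_eC.comp (continuous_id.mul continuous_const))
  have hFb : ∀ x, F x ≤ (2 * b * B * M) ^ 4 := by
    intro x
    rw [hF]; simp only
    gcongr
    refine (norm_sum_le _ _).trans ((sum_le_card_nsmul _ _ B fun n _ => ?_).trans ?_)
    · rw [norm_mul, norm_eC, mul_one, Complex.norm_real]; exact hw.b0 _
    · rw [card_range, nsmul_eq_mul]
      calc (L : ℝ) * B ≤ 2 * b * M * B := by gcongr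
        _ = _ := by ring
  have key : ∀ j : ℕ, (2 : ℝ) ^ j ≤ M ^ 2 → ∫ x in (0 : ℝ)..2 ^ j, F x ≤
      (2 * b * B) ^ 4 * M ^ 4 + C * (M ^ 4 * (2 - 2 / 2 ^ j) + M ^ (2 - γ) * (2 ^ j) ^ (1 + γ)) := by
    intro j
    induction j with
    | zero =>
      intro _
      have h1 : ∫ x in (0 : ℝ)..1, F x ≤ ∫ x in (0 : ℝ)..1, (2 * b * B * M) ^ 4 :=
        intervalIntegral.integral_mono_on (by norm_num) (hcF.intervalIntegrable _ _) intervalIntegrable_const fun x _ => hFb x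
      rw [intervalIntegral.integral_const, smul_eq_mul] at h1
      have : 0 ≤ C * M ^ (2 - γ) := by positivity
      norm_num at h1 ⊢
      nlinarith
    | succ j ih =>
      intro hj
      have hj2 : (2 : ℝ) ^ (j + 1) = 2 * 2 ^ j := by rw [pow_succ]; ring
      have hp : 0 < (2 : ℝ) ^ j := by positivity
      have hj' : (2 : ℝ) ^ j ≤ M ^ 2 := by rw [hj2] at hj; linarith
      have i1 := ih hj'
      have i2 := h M (2 ^ j) hM (one_le_pow₀ (by norm_num)) hj' L hL1
      have i3 := intervalIntegral.integral_add_adjacent_intervals (hcF.intervalIntegrable (μ := volume) 0 (2 ^ j)) (hcF.intervalIntegrable (μ := volume) (2 ^ j) (2 * 2 ^ j))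
      rw [hj2, ← i3]
      have i4 : ∫ x in (2 : ℝ) ^ j..2 * 2 ^ j, F x ≤ C * (M ^ 4 / 2 ^ j + M ^ (2 - γ) * (2 ^ j) ^ (1 + γ)) := by rw [hF]; exact i2
      have i5 : 2 * ((2 : ℝ) ^ j) ^ (1 + γ) ≤ (2 * 2 ^ j) ^ (1 + γ) := by
        rw [mul_rpow (by norm_num) hp.le]
        gcongr
        calc (2 : ℝ) = 2 ^ (1 : ℝ) := by norm_num
          _ ≤ _ := rpow_le_rpow_of_exponent_le (by norm_num) (by linarith)
      have i6 : M ^ (2 - γ) * (2 * ((2 : ℝ) ^ j) ^ (1 + γ)) ≤ M ^ (2 - γ) * (2 * 2 ^ j) ^ (1 + γ) := by gcongr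
      have i7 : M ^ 4 * (2 - 2 / (2 * 2 ^ j)) = M ^ 4 * (2 - 2 / 2 ^ j) + M ^ 4 / 2 ^ j := by field_simp; ring
      rw [i7]
      calc _ ≤ _ := add_le_add i1 i4
        _ = (2 * b * B) ^ 4 * M ^ 4 + C * ((M ^ 4 * (2 - 2 / 2 ^ j) + M ^ 4 / 2 ^ j) + M ^ (2 - γ) * (2 * (2 ^ j) ^ (1 + γ))) := by ring
        _ ≤ _ := by gcongr
  have := key j hj
  rw [hF] at this
  refine this.trans ?_
  have v1 : 0 ≤ M ^ 4 := by positivity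
  have v2 : 0 ≤ M ^ (2 - γ) * ((2 : ℝ) ^ j) ^ (1 + γ) := by positivity
  have v3 : M ^ 4 * (2 - 2 / 2 ^ j) ≤ 2 * M ^ 4 := by
    have : 0 ≤ M ^ 4 * (2 / 2 ^ j) := by positivity
    linarith
  have v4 : 0 ≤ (2 * b * B) ^ 4 := by positivity
  nlinarith [mul_le_mul_of_nonneg_left v3 hC.le, mul_nonneg v4 v2, mul_nonneg hC.le v2]

lemma quadEnergy_div_rpow (s : Finset ℕ) {M α δ : ℝ} (hM : 0 < M) :
    quadEnergy s (fun n => ((n : ℝ) / M) ^ α) δ = quadEnergy s (fun n => (n : ℝ) ^ α) (M ^ α * δ) := by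
  unfold quadEnergy
  congr 1
  ext p
  simp only [mem_filter, and_congr_right_iff]
  intro _
  have hp : 0 < M ^ α := by positivity
  have : quadDiff (fun n => (n : ℝ) ^ α) p = M ^ α * quadDiff (fun n => ((n : ℝ) / M) ^ α) p := by
    simp only [quadDiff, div_rpow (Nat.cast_nonneg _) hM.le]
    field_simp
  rw [this, abs_mul, abs_of_pos hp, mul_le_mul_iff_right₀ hp]

lemma exists_energy_le {α γ R : ℝ} (hα : 1 < α) (hγ : 0 < γ) (hE : EnergyBound (α / (α - 1)) γ) (hR : 1 ≤ R) :
    ∃ C : ℝ, C > 0 ∧ ∀ M : ℝ, 1 ≤ M → ∀ j : ℕ, (2 : ℝ) ^ j ≤ M ^ 2 →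
      (quadEnergy (Finset.Icc ⌈M⌉₊ ⌊R * M⌋₊) (fun n => (n : ℝ) ^ α) (M ^ α * (1 / (2 * 2 ^ j))) : ℝ) ≤
        C * (M ^ 4 / 2 ^ j + M ^ (2 - γ) * (2 ^ j) ^ γ) := by
  obtain ⟨w0, w1, w2, B, hB, hw, hw0, hw1⟩ := exists_isBump hR
  obtain ⟨C, hC, h⟩ := exists_full_moment hα hγ hE (b := R + 1) (by linarith) hB hw
  refine ⟨C * π ^ 2 / 2, by positivity, fun M hM j hj => ?_⟩
  have hM0 : 0 < M := by linarith
  have h1 := h M hM j hj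
  have hp : 0 < (2 : ℝ) ^ j := by positivity
  have h2 := quadEnergy_le_integral (range ⌈(R + 1) * M⌉₊) (fun n => w0 (n / M)) (fun n => ((n : ℝ) / M) ^ α) (fun n => hw0 _)
    (Finset.Icc ⌈M⌉₊ ⌊R * M⌋₊) (fun n hn => by
      rw [Finset.mem_Icc] at hn
      rw [Finset.mem_range, Nat.lt_ceil]
      have := (Nat.le_floor_iff (by positivity)).1 hn.2
      nlinarith) (fun n hn => by
      rw [Finset.mem_Icc] at hn
      apply hw1
      · rw [one_le_div hM0]; exact Nat.ceil_le.1 hn.1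
      · rw [div_le_iff₀ hM0]; exact (Nat.le_floor_iff (by positivity)).1 hn.2) hp
  have h3 := h2.trans h1
  rw [quadEnergy_div_rpow _ hM0, ← le_div_iff₀ (by positivity)] at h3
  refine h3.trans (le_of_eq ?_)
  rw [rpow_add hp, rpow_one]
  field_simp

lemma quadEnergy_le_card (s : Finset ℕ) (y : ℕ → ℝ) (δ : ℝ) : (quadEnergy s y δ : ℝ) ≤ (#s : ℝ) ^ 4 := by
  have : quadEnergy s y δ ≤ #s ^ 4 := by
    refine (card_filter_le _ _).trans (le_of_eq ?_)
    simp only [card_product]; ring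
  exact_mod_cast this

lemma card_Icc_ceil_floor_le {N R : ℝ} (hN : 1 ≤ N) (hR : 1 ≤ R) : (#(Finset.Icc ⌈N⌉₊ ⌊R * N⌋₊) : ℝ) ≤ R * N := by
  have h1 : 1 ≤ ⌈N⌉₊ := Nat.one_le_ceil_iff.2 (by linarith)
  have : #(Finset.Icc ⌈N⌉₊ ⌊R * N⌋₊) ≤ ⌊R * N⌋₊ := by rw [Nat.card_Icc]; omega
  calc _ ≤ (⌊R * N⌋₊ : ℝ) := by exact_mod_cast this
    _ ≤ _ := Nat.floor_le (by nlinarith)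

lemma energyBound_two (α : ℝ) : EnergyBound α 2 := by
  intro R hR
  refine ⟨R ^ 4, by positivity, fun N hN => (quadEnergy_le_card _ _ _).trans ?_⟩
  have := card_Icc_ceil_floor_le hN hR
  calc _ ≤ (R * N) ^ 4 := by gcongr
    _ = R ^ 4 * N ^ (2 + 2 : ℝ) := by rw [mul_pow]; norm_num

lemma EnergyBound.dual {α γ : ℝ} (hα : 1 < α) (hγ : 0 < γ) (hE : EnergyBound (α / (α - 1)) γ) : EnergyBound α (γ / (1 + γ)) := by
  intro R hR
  obtain ⟨C, hC, h⟩ := exists_energy_le hα hγ hE hR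
  obtain ⟨η, hη⟩ : ∃ η, η = γ / (1 + γ) := ⟨_, rfl⟩
  have hη0 : 0 < η := by rw [hη]; positivity
  have hη1 : η < 1 := by rw [hη, div_lt_one (by positivity)]; linarith
  rw [← hη]
  refine ⟨5 * C + (2 * R) ^ 4, by positivity, fun N hN => ?_⟩
  have hN0 : 0 < N := by linarith
  have hNp : 1 ≤ N ^ (2 + η) := one_le_rpow hN (by linarith)
  by_cases hN2 : 2 ≤ N ^ (2 - η)
  · obtain ⟨j, hj1, hj2⟩ := exists_nat_pow_near (x := N ^ (2 - η) / 2) (y := (2 : ℝ)) (by linarith) (by norm_num)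
    have hle : N ^ (2 - η) ≤ N ^ (2 : ℝ) := rpow_le_rpow_of_exponent_le hN (by linarith)
    have hjp : 0 < (2 : ℝ) ^ j := by positivity
    have hj3 : (2 : ℝ) ^ j ≤ N ^ 2 := by rw [← rpow_two]; linarith [show 0 < N ^ (2 - η) by positivity]
    have h1 := h N hN j hj3
    have h2 : quadEnergy (Finset.Icc ⌈N⌉₊ ⌊R * N⌋₊) (fun n => (n : ℝ) ^ α) (N ^ (α - 2)) ≤
        quadEnergy (Finset.Icc ⌈N⌉₊ ⌊R * N⌋₊) (fun n => (n : ℝ) ^ α) (N ^ α * (1 / (2 * 2 ^ j))) := by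
      apply quadEnergy_mono _ _ _
      · exact subset_rfl
      · rw [rpow_sub hN0, div_eq_mul_one_div]
        gcongr
        linarith
    have h3 : N ^ 4 / 2 ^ j ≤ 4 * N ^ (2 + η) := by
      rw [div_le_iff₀ hjp]
      have e : N ^ (2 + η) * N ^ (2 - η) = N ^ 4 := by
        rw [← rpow_add hN0, show 2 + η + (2 - η) = (4 : ℕ) by norm_num, rpow_natCast]
      rw [pow_succ] at hj2
      have : 0 < N ^ (2 + η) := by positivity
      nlinarith
    have h4 : N ^ (2 - γ) * (2 ^ j) ^ γ ≤ N ^ (2 + η) := by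
      calc N ^ (2 - γ) * (2 ^ j) ^ γ ≤ N ^ (2 - γ) * (N ^ (2 - η)) ^ γ := by
            gcongr; linarith [show 0 < N ^ (2 - η) by positivity]
        _ = N ^ (2 + η) := by
          rw [← rpow_mul hN0.le, ← rpow_add hN0]
          congr 1
          rw [hη]; field_simp; ring
    calc _ ≤ _ := Nat.cast_le.2 h2
      _ ≤ _ := h1
      _ ≤ C * (4 * N ^ (2 + η) + N ^ (2 + η)) := by gcongr
      _ ≤ _ := by nlinarith [show 0 ≤ (2 * R) ^ 4 by positivity]
  · have : N ≤ N ^ (2 - η) := by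
      nth_rw 1 [← rpow_one N]; exact rpow_le_rpow_of_exponent_le hN (by linarith)
    have h1 := card_Icc_ceil_floor_le hN hR
    calc _ ≤ _ := quadEnergy_le_card _ _ _
      _ ≤ (2 * R) ^ 4 := by gcongr; nlinarith
      _ ≤ (5 * C + (2 * R) ^ 4) * 1 := by linarith
      _ ≤ _ := by gcongr

lemma energyBound_of_nat (k : ℕ) : ∀ α : ℝ, 1 < α → EnergyBound α (2 / (2 * k + 1)) := by
  induction k with
  | zero => intro α _; simpa using energyBound_two α
  | succ k ih =>
    intro α hα
    have hα1 : 0 < α - 1 := by linarith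
    have := EnergyBound.dual hα (by positivity) (ih (α / (α - 1)) (by rw [one_lt_div hα1]; linarith))
    convert this using 1
    push_cast
    field_simp
    ring

lemma exists_energy_two {c : ℝ} (hc : 1 < c) : ∃ C : ℝ, C > 0 ∧ ∀ M : ℝ, 1 ≤ M →
    (quadEnergy (Finset.Icc ⌈M⌉₊ ⌊2 * M⌋₊) (fun n => (n : ℝ) ^ c) 2 : ℝ) ≤ C * M ^ (max 2 (4 - c) + 0.02) := by
  have hc1 : 0 < c - 1 := by linarith
  have hE := energyBound_of_nat 50 (c / (c - 1)) (by rw [one_lt_div hc1]; linarith)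
  obtain ⟨C, hC, h⟩ := exists_energy_le (R := 2) hc (by positivity) hE (by norm_num)
  obtain ⟨γ, hγ⟩ : ∃ γ : ℝ, γ = 2 / (2 * (50 : ℕ) + 1) := ⟨_, rfl⟩
  rw [← hγ] at h
  have hγ0 : 0 < γ := by rw [hγ]; norm_num
  have hγ1 : γ ≤ 0.02 := by rw [hγ]; norm_num
  refine ⟨9 * C + 8 ^ 4, by positivity, fun M hM => ?_⟩
  have hM0 : 0 < M := by linarith
  have hmx : 2 ≤ max 2 (4 - c) := le_max_left _ _
  have hMp : 1 ≤ M ^ (max 2 (4 - c) + 0.02) := one_le_rpow hM (by linarith)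
  obtain ⟨m, hm⟩ : ∃ m, m = min (M ^ c) (M ^ (2 : ℝ)) / 4 := ⟨_, rfl⟩
  have m1 : m ≤ M ^ c / 4 := by rw [hm]; gcongr; exact min_le_left _ _
  have m2 : m ≤ M ^ (2 : ℝ) / 4 := by rw [hm]; gcongr; exact min_le_right _ _
  by_cases hm1 : 1 ≤ m
  · obtain ⟨j, hj1, hj2⟩ := exists_nat_pow_near hm1 (by norm_num : (1 : ℝ) < 2)
    have hjp : 0 < (2 : ℝ) ^ j := by positivity
    have hj3 : (2 : ℝ) ^ j ≤ M ^ 2 := by rw [← rpow_two]; linarith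
    have h1 := h M hM j hj3
    have h2 : quadEnergy (Finset.Icc ⌈M⌉₊ ⌊2 * M⌋₊) (fun n => (n : ℝ) ^ c) 2 ≤
        quadEnergy (Finset.Icc ⌈M⌉₊ ⌊2 * M⌋₊) (fun n => (n : ℝ) ^ c) (M ^ c * (1 / (2 * 2 ^ j))) := by
      apply quadEnergy_mono _ _ _
      · exact subset_rfl
      · rw [mul_one_div, le_div_iff₀ (by positivity)]; linarith
    have h3 : M ^ 4 / 2 ^ j ≤ 8 * M ^ (max 2 (4 - c) + 0.02) := by
      rw [div_le_iff₀ hjp]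
      have e4 : M ^ 4 = M ^ (4 : ℝ) := by norm_cast
      have e : M ^ 4 ≤ M ^ (max 2 (4 - c) + 0.02) * min (M ^ c) (M ^ (2 : ℝ)) := by
        rcases min_choice (M ^ c) (M ^ (2 : ℝ)) with h' | h' <;> rw [h', ← rpow_add hM0, e4]
        · exact rpow_le_rpow_of_exponent_le hM (by linarith [le_max_right 2 (4 - c)])
        · exact rpow_le_rpow_of_exponent_le hM (by linarith)
      rw [pow_succ, hm] at hj2
      nlinarith
    have h4 : M ^ (2 - γ) * (2 ^ j) ^ γ ≤ M ^ (max 2 (4 - c) + 0.02) := by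
      calc M ^ (2 - γ) * (2 ^ j) ^ γ ≤ M ^ (2 - γ) * (M ^ (2 : ℝ)) ^ γ := by
            gcongr; rwa [rpow_two]
        _ = M ^ (2 + γ) := by
          rw [← rpow_mul hM0.le, ← rpow_add hM0]
          congr 1; ring
        _ ≤ _ := rpow_le_rpow_of_exponent_le hM (by linarith)
    calc _ ≤ _ := Nat.cast_le.2 h2
      _ ≤ _ := h1
      _ ≤ C * (8 * M ^ (max 2 (4 - c) + 0.02) + M ^ (max 2 (4 - c) + 0.02)) := by gcongr
      _ ≤ _ := by nlinarith
  · have hM4 : M ≤ 4 := by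
      push Not at hm1
      have : min (M ^ c) (M ^ (2 : ℝ)) < 4 := by rw [hm] at hm1; linarith
      have e : M ≤ min (M ^ c) (M ^ (2 : ℝ)) := by
        refine le_min ?_ ?_ <;> nth_rw 1 [← rpow_one M] <;> exact rpow_le_rpow_of_exponent_le hM (by linarith)
      linarith
    have h1 := card_Icc_ceil_floor_le (R := 2) hM (by norm_num)
    calc _ ≤ _ := quadEnergy_le_card _ _ _
      _ ≤ (8 : ℝ) ^ 4 := by gcongr; linarith
      _ ≤ (9 * C + 8 ^ 4) * 1 := by linarith
      _ ≤ _ := by gcongr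

lemma integral_cos_int (m : ℤ) : ∫ x in (0 : ℝ)..1, cos (2 * π * x * m) = if m = 0 then 1 else 0 := by
  split_ifs with h
  · simp [h]
  · have hk : 2 * π * (m : ℝ) ≠ 0 := by
      have : (m : ℝ) ≠ 0 := by exact_mod_cast h
      positivity
    have e : ∀ x : ℝ, 2 * π * x * m = (2 * π * m) * x := fun x => by ring
    simp_rw [e]
    rw [intervalIntegral.integral_comp_mul_left (fun x => cos x) hk, integral_cos]
    have : sin (2 * π * (m : ℝ) * 1) = 0 := by
      rw [show 2 * π * (m : ℝ) * 1 = ((2 * m : ℤ) : ℝ) * π by push_cast; ring, sin_int_mul_pi]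
    rw [this]; simp

/-- The fourth moment over a period counts additive quadruples of the integer parts. -/
lemma integral_floor_le_quadEnergy (s : Finset ℕ) (w y : ℕ → ℝ) {W : ℝ} (hw0 : ∀ n ∈ s, 0 ≤ w n) (hw : ∀ n ∈ s, w n ≤ W) :
    ∫ x in (0 : ℝ)..1, ‖∑ n ∈ s, (w n : ℂ) * eC (⌊y n⌋ * x)‖ ^ 4 ≤ W ^ 4 * quadEnergy s y 2 := by
  have h1 : ∀ x : ℝ, ‖∑ n ∈ s, (w n : ℂ) * eC (⌊y n⌋ * x)‖ ^ 4 = ∑ p ∈ (s ×ˢ s) ×ˢ (s ×ˢ s),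
      w p.1.1 * w p.1.2 * (w p.2.1 * w p.2.2) *
        cos (2 * π * x * ((⌊y p.1.1⌋ + ⌊y p.1.2⌋ - (⌊y p.2.1⌋ + ⌊y p.2.2⌋) : ℤ) : ℝ)) := by
    intro x
    have h := norm_sum_eC_pow_four s w (fun n => (⌊y n⌋ : ℝ)) x
    simp only [quadDiff] at h
    push_cast
    rw [← h]
    simp only [mul_comm x]
  simp_rw [h1]
  rw [intervalIntegral.integral_finsetSum (fun p _ => by apply Continuous.intervalIntegrable; fun_prop)]
  simp_rw [intervalIntegral.integral_const_mul, integral_cos_int]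
  rw [quadEnergy, card_filter]
  push_cast
  rw [mul_sum]
  refine sum_le_sum fun p hp => ?_
  simp only [mem_product] at hp
  obtain ⟨⟨p1, p2⟩, p3, p4⟩ := hp
  have a1 := hw0 _ p1
  have a2 := hw0 _ p2
  have a3 := hw0 _ p3
  have a4 := hw0 _ p4
  have b1 := hw _ p1
  have b2 := hw _ p2
  have b3 := hw _ p3
  have b4 := hw _ p4
  have hW : 0 ≤ W := a1.trans b1
  split_ifs with h h' h'
  · simp only [mul_one]
    calc _ ≤ W * W * (W * W) := by gcongr
      _ = _ := by ring
  · refine absurd ?_ h'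
    have hz : (⌊y p.1.1⌋ : ℝ) + ⌊y p.1.2⌋ - (⌊y p.2.1⌋ + ⌊y p.2.2⌋) = 0 := by exact_mod_cast h
    have f1 := Int.floor_le (y p.1.1)
    have f2 := Int.floor_le (y p.1.2)
    have f3 := Int.floor_le (y p.2.1)
    have f4 := Int.floor_le (y p.2.2)
    have g1 := Int.lt_floor_add_one (y p.1.1)
    have g2 := Int.lt_floor_add_one (y p.1.2)
    have g3 := Int.lt_floor_add_one (y p.2.1)
    have g4 := Int.lt_floor_add_one (y p.2.2)
    rw [quadDiff, abs_le]
    constructor <;> linarith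
  · simp only [mul_zero, mul_one]; positivity
  · simp

lemma exists_fourth_moment {c : ℝ} (hc : 1 < c) : ∃ C : ℝ, C > 0 ∧ ∀ P : ℝ, 1 ≤ P →
    ∫ α in (0 : ℝ)..1, ‖SS c P α‖ ^ 4 ≤ C * P ^ (max 2 (4 - c) + 0.0201) := by
  obtain ⟨C, hC, hE⟩ := exists_energy_two hc
  obtain ⟨E, hEd⟩ : ∃ E, E = max 2 (4 - c) + 0.02 := ⟨_, rfl⟩
  have hE0 : 0 ≤ E := by rw [hEd]; have := le_max_left 2 (4 - c); linarith
  rw [← hEd] at hE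
  obtain ⟨δ, hδ⟩ : ∃ δ : ℝ, δ = 0.0001 / 8 := ⟨_, rfl⟩
  have hδ0 : 0 < δ := by rw [hδ]; norm_num
  refine ⟨C * (1 + 2 / δ) ^ 8, by positivity, fun P hP => ?_⟩
  have hP0 : 0 < P := by linarith
  have hx1 : 1 ≤ ⌊P⌋₊ := Nat.one_le_floor_iff _ |>.2 hP
  obtain ⟨k, hk1, hk2⟩ : ∃ k, 2 ^ k ≤ ⌊P⌋₊ ∧ ⌊P⌋₊ < 2 ^ (k + 1) := exists_nat_pow_near hx1 (by norm_num)
  have hkP : (2 : ℝ) ^ k ≤ P := by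
    calc (2 : ℝ) ^ k = ((2 ^ k : ℕ) : ℝ) := by push_cast; rfl
      _ ≤ (⌊P⌋₊ : ℝ) := by exact_mod_cast hk1
      _ ≤ P := Nat.floor_le hP0.le
  have hL : ((k + 1 : ℕ) : ℝ) ≤ (1 + 2 / δ) * P ^ δ := by
    have l1 := Real.log_le_log (by positivity) hkP
    rw [Real.log_pow] at l1
    have l2 := exists_log_le_rpow hδ0 P hP
    have l3 := Real.log_two_gt_d9
    have l4 : (1 : ℝ) ≤ P ^ δ := one_le_rpow hP hδ0.le
    have l5 : (k : ℝ) * (1 / 2) ≤ k * Real.log 2 := by gcongr; linarith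
    have l6 : (1 + 2 / δ) * P ^ δ = P ^ δ + 2 * (1 / δ * P ^ δ) := by ring
    push_cast
    linarith
  obtain ⟨s, hs⟩ : ∃ s : ℕ → Finset ℕ, s = fun i : ℕ => (Finset.Ioc (2 ^ i) (2 * 2 ^ i)).filter (fun n => n.Prime ∧ n ≤ ⌊P⌋₊) := ⟨_, rfl⟩
  have hS : ∀ α, SS c P α = ∑ i ∈ range (k + 1), ∑ n ∈ s i, (Real.log n : ℂ) * eC (⌊(n : ℝ) ^ c⌋ * α) := by
    intro α
    have d := sum_dyadic (fun n => if n.Prime ∧ n ≤ ⌊P⌋₊ then (Real.log n : ℂ) * eC (⌊(n : ℝ) ^ c⌋ * α) else 0) hk2.le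
      (by simp [Nat.not_prime_one]) (fun a ha => by simp [ha])
    simp only [← sum_filter] at d
    rw [hs, ← d, SS]
    refine sum_congr ?_ fun _ _ => rfl
    ext n
    simp only [mem_filter, mem_range, mem_Ioc]
    constructor
    · rintro ⟨h1, h2⟩; exact ⟨⟨h2.pos, by omega⟩, h2, by omega⟩
    · rintro ⟨h1, h2, h3⟩; exact ⟨by omega, h2⟩
  have hcont : ∀ i, Continuous fun α : ℝ => ‖∑ n ∈ s i, (Real.log n : ℂ) * eC (⌊(n : ℝ) ^ c⌋ * α)‖ ^ 4 := by
    have := continuous_eC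
    intro i; fun_prop
  have hcS : Continuous fun α : ℝ => ‖SS c P α‖ ^ 4 := by
    have := continuous_eC
    unfold SS; fun_prop
  have hblock : ∀ i ∈ range (k + 1), ∫ α in (0 : ℝ)..1, ‖∑ n ∈ s i, (Real.log n : ℂ) * eC (⌊(n : ℝ) ^ c⌋ * α)‖ ^ 4 ≤
      ((k + 1 : ℕ) : ℝ) ^ 4 * (C * P ^ E) := by
    intro i hi
    have hik : i ≤ k := by rw [mem_range] at hi; omega
    have b1 := integral_floor_le_quadEnergy (s i) (fun n => Real.log n) (fun n => (n : ℝ) ^ c) (W := ((k + 1 : ℕ) : ℝ))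
      (fun n _ => Real.log_natCast_nonneg n) (fun n hn => by
        rw [hs] at hn
        simp only [mem_filter, mem_Ioc] at hn
        have hn2 : n ≤ 2 ^ (k + 1) := hn.2.2.trans hk2.le
        have hn0 : (0 : ℝ) < n := by exact_mod_cast hn.2.1.pos
        calc Real.log n ≤ Real.log (2 ^ (k + 1)) := Real.log_le_log hn0 (by exact_mod_cast hn2)
          _ = ((k + 1 : ℕ) : ℝ) * Real.log 2 := by rw [Real.log_pow]
          _ ≤ ((k + 1 : ℕ) : ℝ) * 1 := by gcongr; linarith [Real.log_two_lt_d9]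
          _ = _ := mul_one _)
    refine b1.trans ?_
    have b2 := hE (2 ^ i) (one_le_pow₀ (by norm_num))
    have b3 : quadEnergy (s i) (fun n => (n : ℝ) ^ c) 2 ≤ quadEnergy (Finset.Icc ⌈(2 : ℝ) ^ i⌉₊ ⌊2 * (2 : ℝ) ^ i⌋₊) (fun n => (n : ℝ) ^ c) 2 := by
      refine quadEnergy_mono (fun n hn => ?_) _ le_rfl
      rw [hs] at hn
      simp only [mem_filter, mem_Ioc] at hn
      rw [Finset.mem_Icc, Nat.ceil_le, Nat.le_floor_iff (by positivity)]
      exact ⟨by exact_mod_cast hn.1.1.le, by exact_mod_cast hn.1.2⟩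
    have b4 : ((2 : ℝ) ^ i) ^ E ≤ P ^ E :=
      rpow_le_rpow (by positivity) ((pow_le_pow_right₀ (by norm_num) hik).trans hkP) hE0
    gcongr
    calc _ ≤ _ := Nat.cast_le.2 b3
      _ ≤ _ := b2
      _ ≤ _ := by gcongr
  calc ∫ α in (0 : ℝ)..1, ‖SS c P α‖ ^ 4
      ≤ ∫ α in (0 : ℝ)..1, ((k + 1 : ℕ) : ℝ) ^ 3 * ∑ i ∈ range (k + 1), ‖∑ n ∈ s i, (Real.log n : ℂ) * eC (⌊(n : ℝ) ^ c⌋ * α)‖ ^ 4 := by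
        refine intervalIntegral.integral_mono_on (by norm_num) (hcS.intervalIntegrable _ _)
          (Continuous.intervalIntegrable (by fun_prop) _ _) fun α _ => ?_
        have q := sum_pow_four_le (range (k + 1)) (fun i => ‖∑ n ∈ s i, (Real.log n : ℂ) * eC (⌊(n : ℝ) ^ c⌋ * α)‖)
        rw [card_range] at q
        refine le_trans ?_ q
        rw [hS]
        gcongr
        exact norm_sum_le _ _
    _ = ((k + 1 : ℕ) : ℝ) ^ 3 * ∑ i ∈ range (k + 1), ∫ α in (0 : ℝ)..1, ‖∑ n ∈ s i, (Real.log n : ℂ) * eC (⌊(n : ℝ) ^ c⌋ * α)‖ ^ 4 := by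
        rw [intervalIntegral.integral_const_mul, intervalIntegral.integral_finsetSum fun i _ => (hcont i).intervalIntegrable _ _]
    _ ≤ ((k + 1 : ℕ) : ℝ) ^ 3 * ∑ i ∈ range (k + 1), ((k + 1 : ℕ) : ℝ) ^ 4 * (C * P ^ E) := by
        gcongr with i hi
        exact hblock i hi
    _ = ((k + 1 : ℕ) : ℝ) ^ 8 * (C * P ^ E) := by
        rw [sum_const, card_range, nsmul_eq_mul]; ring
    _ ≤ ((1 + 2 / δ) * P ^ δ) ^ 8 * (C * P ^ E) := by gcongr
    _ = C * (1 + 2 / δ) ^ 8 * ((P ^ δ) ^ 8 * P ^ E) := by ring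
    _ = _ := by
        congr 1
        rw [← rpow_natCast, ← rpow_mul hP0.le, ← rpow_add hP0, hEd, hδ]
        congr 1; push_cast; ring

lemma card_Ioc_floor_two_le {X : ℝ} (hX : 1 ≤ X) : (#(Finset.Ioc ⌊X⌋₊ ⌊2 * X⌋₊) : ℝ) ≤ 2 * X := by
  rw [Nat.card_Ioc]
  calc ((⌊2 * X⌋₊ - ⌊X⌋₊ : ℕ) : ℝ) ≤ (⌊2 * X⌋₊ : ℝ) := by exact_mod_cast Nat.sub_le _ _
    _ ≤ _ := Nat.floor_le (by linarith)

lemma norm_TT_le {c X : ℝ} (hX : 1 ≤ X) (γ : ℝ) : ‖TT c X γ‖ ≤ 2 * X :=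
  (norm_sum_eC_le _ _).trans (card_Ioc_floor_two_le hX)

/-- A majorant for `T` without singularities. -/
lemma exists_TT_kernel {c : ℝ} (hc1 : 1 < c) (hc2 : c < 2.0551) (hc3 : c ≠ 2) :
    ∃ C : ℝ, C > 0 ∧ ∀ X : ℝ, 1 ≤ X → ∀ γ : ℝ,
      ‖TT c X γ‖ ≤ C * (X ^ (0.866 : ℝ) + X ^ (1 - c) * (1 / (X ^ (-c) + Int.fract γ) + 1 / (X ^ (-c) + (1 - Int.fract γ)))) := by
  obtain ⟨C, hC, H⟩ := TT_bound hc1 hc2 hc3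
  refine ⟨2 * C + 4, by positivity, fun X hX γ => ?_⟩
  have hX0 : 0 < X := by linarith
  obtain ⟨ρ, hρ⟩ : ∃ ρ, ρ = X ^ (-c) := ⟨_, rfl⟩
  have hρ0 : 0 < ρ := by rw [hρ]; positivity
  have hY : X ^ (1 - c) = X * ρ := by rw [hρ, sub_eq_add_neg, rpow_add hX0, rpow_one]
  rw [TT_fract, ← hρ]
  obtain ⟨f, hf⟩ : ∃ f, f = Int.fract γ := ⟨_, rfl⟩
  have hf0 : 0 ≤ f := hf ▸ Int.fract_nonneg γ
  have hf1 : f < 1 := hf ▸ Int.fract_lt_one γ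
  rw [← hf]
  have hg0 : 0 < 1 - f := by linarith
  have hn := norm_TT_le (c := c) hX f
  have hXp : 0 < X ^ (0.866 : ℝ) := by positivity
  have trivial_bound : ∀ u v : ℝ, 0 ≤ u → u ≤ ρ → 0 ≤ v →
      2 * X ≤ (2 * C + 4) * (X ^ (0.866 : ℝ) + X ^ (1 - c) * (1 / (ρ + u) + 1 / (ρ + v))) := by
    intro u v hu hu' hv
    have h1 : 1 / (2 * ρ) ≤ 1 / (ρ + u) := one_div_le_one_div_of_le (by positivity) (by linarith)
    have h2 : 0 < 1 / (ρ + v) := by positivity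
    calc 2 * X = 4 * (0 + X ^ (1 - c) * (1 / (2 * ρ) + 0)) := by rw [hY]; field_simp; norm_num
      _ ≤ (2 * C + 4) * (X ^ (0.866 : ℝ) + X ^ (1 - c) * (1 / (ρ + u) + 1 / (ρ + v))) := by
        gcongr; linarith
  have hdiv : ∀ u : ℝ, ρ < u → X ^ (1 - c) / u ≤ 2 * (X ^ (1 - c) * (1 / (ρ + u))) := by
    intro u hu
    have : 0 < u := by linarith
    rw [div_eq_mul_one_div, mul_left_comm]
    gcongr
    rw [mul_one_div, div_le_div_iff₀ this (by positivity)]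
    linarith
  rcases le_or_gt f ρ with h | h
  · exact hn.trans (trivial_bound f (1 - f) hf0 h hg0.le)
  rcases le_or_gt (1 - f) ρ with h' | h'
  · rw [add_comm (1 / (ρ + f))]
    exact hn.trans (trivial_bound (1 - f) f hg0.le h' hf0)
  have d1 := hdiv f h
  have d2 := hdiv (1 - f) h'
  have hK : 0 < X ^ (0.866 : ℝ) + X ^ (1 - c) * (1 / (ρ + f) + 1 / (ρ + (1 - f))) := by positivity
  calc _ ≤ _ := H X hX f (by linarith) hf1
    _ ≤ C * (2 * (X ^ (0.866 : ℝ) + X ^ (1 - c) * (1 / (ρ + f) + 1 / (ρ + (1 - f))))) := by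
      gcongr
      linarith
    _ ≤ _ := by nlinarith

lemma integral_inv_add_fract {ρ : ℝ} (hρ : 0 < ρ) (β : ℝ) :
    ∫ α in (0 : ℝ)..1, (1 / (ρ + Int.fract (α - β)) + 1 / (ρ + (1 - Int.fract (α - β)))) = 2 * Real.log ((ρ + 1) / ρ) := by
  obtain ⟨g, hg⟩ : ∃ g : ℝ → ℝ, g = fun x => 1 / (ρ + Int.fract x) + 1 / (ρ + (1 - Int.fract x)) := ⟨_, rfl⟩
  have hper : Function.Periodic g 1 := fun x => by simp [hg]
  have e1 : ∫ α in (0 : ℝ)..1, g (α - β) = ∫ x in (0 : ℝ)..1, g x := by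
    rw [intervalIntegral.integral_comp_sub_right g β, show (1 : ℝ) - β = (0 - β) + 1 by ring, hper.intervalIntegral_add_eq (0 - β) 0, zero_add]
  have e2 : ∫ x in (0 : ℝ)..1, g x = ∫ x in (0 : ℝ)..1, (1 / (ρ + x) + 1 / (ρ + (1 - x))) := by
    refine intervalIntegral.integral_congr_ae ?_
    have hne : ∀ᵐ x : ℝ, x ≠ 1 := by simp [ae_iff]
    filter_upwards [hne] with x hx hx2
    rw [Set.uIoc_of_le (by norm_num)] at hx2
    have : Int.fract x = x := Int.fract_eq_self.2 ⟨hx2.1.le, lt_of_le_of_ne hx2.2 hx⟩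
    simp [hg, this]
  have e3 : ∫ x in (0 : ℝ)..1, 1 / (ρ + x) = Real.log ((ρ + 1) / ρ) := by
    rw [intervalIntegral.integral_comp_add_left (fun x => 1 / x) ρ, integral_one_div_of_pos (by linarith) (by linarith), add_zero]
  have e4 : ∫ x in (0 : ℝ)..1, 1 / (ρ + (1 - x)) = Real.log ((ρ + 1) / ρ) := by
    rw [intervalIntegral.integral_comp_sub_left (fun x => 1 / (ρ + x)) 1, sub_self, sub_zero, e3]
  have c1 : IntervalIntegrable (fun x : ℝ => 1 / (ρ + x)) volume 0 1 := by
    refine ContinuousOn.intervalIntegrable (continuousOn_const.div (by fun_prop) fun x hx => ?_)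
    rw [Set.uIcc_of_le (by norm_num)] at hx
    have := hx.1; positivity
  have c2 : IntervalIntegrable (fun x : ℝ => 1 / (ρ + (1 - x))) volume 0 1 := by
    refine ContinuousOn.intervalIntegrable (continuousOn_const.div (by fun_prop) fun x hx => ?_)
    rw [Set.uIcc_of_le (by norm_num)] at hx
    have := hx.2; linarith
  calc _ = ∫ α in (0 : ℝ)..1, g (α - β) := by rw [hg]
    _ = _ := by rw [e1, e2, intervalIntegral.integral_add c1 c2, e3, e4]; ring

lemma exists_integral_mul_TT_le {c : ℝ} (hc1 : 1 < c) (hc2 : c < 2.0551) (hc3 : c ≠ 2) :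
    ∃ C : ℝ, C > 0 ∧ ∀ X : ℝ, 1 ≤ X → ∀ β : ℝ, ∀ F : ℝ → ℝ, Continuous F → (∀ α, 0 ≤ F α) →
      ∀ τ B : ℝ, 0 ≤ τ → τ ≤ 1 - τ → (∀ α, τ ≤ α → α ≤ 1 - τ → F α ≤ B) →
      ∫ α in τ..(1 - τ), F α * ‖TT c X (α - β)‖ ≤
        C * (X ^ (0.866 : ℝ) * (∫ α in (0 : ℝ)..1, F α) + B * (X ^ (1 - c) * X ^ (0.00021 : ℝ))) := by
  obtain ⟨C, hC, H⟩ := exists_TT_kernel hc1 hc2 hc3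
  refine ⟨C * 40000, by positivity, fun X hX β F hF hF0 τ B hτ hτ' hB => ?_⟩
  have hX0 : 0 < X := by linarith
  obtain ⟨ρ, hρ⟩ : ∃ ρ, ρ = X ^ (-c) := ⟨_, rfl⟩
  have hρ0 : 0 < ρ := by rw [hρ]; positivity
  obtain ⟨k, hk⟩ : ∃ k : ℝ → ℝ, k = fun x => 1 / (ρ + Int.fract x) + 1 / (ρ + (1 - Int.fract x)) := ⟨_, rfl⟩
  have hpos : ∀ x : ℝ, 0 ≤ 1 - Int.fract x := fun x => by linarith [Int.fract_lt_one x]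
  have hk0 : ∀ x, 0 ≤ k x := fun x => by
    have := hpos x
    have := Int.fract_nonneg x
    rw [hk]; positivity
  have hkI : ∀ a b, IntervalIntegrable (fun α => k (α - β)) volume a b := by
    intro a b
    have hm : Measurable fun α => k (α - β) := by
      have := measurable_fract (R := ℝ)
      rw [hk]; fun_prop
    refine (intervalIntegrable_const (c := 1 / ρ + 1 / ρ)).mono_fun hm.aestronglyMeasurable ?_
    filter_upwards with x
    rw [norm_of_nonneg (hk0 _), norm_of_nonneg (by positivity), hk]
    have := hpos (x - β)
    have := Int.fract_nonneg (x - β)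
    exact add_le_add (one_div_le_one_div_of_le hρ0 (by linarith)) (one_div_le_one_div_of_le hρ0 (by linarith))
  have hB0 : 0 ≤ B := (hF0 τ).trans (hB τ le_rfl hτ')
  have hkint : ∫ α in τ..(1 - τ), k (α - β) ≤ 40000 * X ^ (0.00021 : ℝ) := by
    have m := intervalIntegral.integral_mono_interval (μ := volume) hτ hτ' (by linarith : 1 - τ ≤ 1)
      (Filter.Eventually.of_forall fun α => hk0 (α - β)) (hkI 0 1)
    refine m.trans ?_
    have := integral_inv_add_fract hρ0 β
    rw [hk]
    simp only [this]
    have hXc : 1 ≤ X ^ c := one_le_rpow hX (by linarith)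
    have e : (ρ + 1) / ρ = 1 + X ^ c := by
      rw [hρ, rpow_neg hX0.le]; field_simp
    have l := exists_log_le_rpow (by norm_num : (0 : ℝ) < 0.0001) (1 + X ^ c) (by linarith)
    have l2 : (1 + X ^ c) ^ (0.0001 : ℝ) ≤ 2 * X ^ (0.00021 : ℝ) := by
      calc (1 + X ^ c) ^ (0.0001 : ℝ) ≤ (2 * X ^ c) ^ (0.0001 : ℝ) := by gcongr; linarith
        _ = 2 ^ (0.0001 : ℝ) * X ^ (c * 0.0001) := by rw [mul_rpow (by norm_num) (by positivity), ← rpow_mul hX0.le]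
        _ ≤ 2 ^ (1 : ℝ) * X ^ (0.00021 : ℝ) := by
          gcongr
          · norm_num
          · norm_num
          · linarith
        _ = _ := by rw [rpow_one]
    rw [e]
    norm_num at l l2 ⊢
    linarith
  have hTc : Continuous fun α : ℝ => ‖TT c X (α - β)‖ := by
    have := continuous_eC
    unfold TT; fun_prop
  have hFint : ∫ α in τ..(1 - τ), F α ≤ ∫ α in (0 : ℝ)..1, F α :=
    intervalIntegral.integral_mono_interval hτ hτ' (by linarith) (Filter.Eventually.of_forall hF0) (hF.intervalIntegrable _ _)
  have hF1 : 0 ≤ ∫ α in (0 : ℝ)..1, F α := intervalIntegral.integral_nonneg (by norm_num) fun α _ => hF0 α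
  have i1 : IntervalIntegrable (fun α => C * X ^ (0.866 : ℝ) * F α) volume τ (1 - τ) := (hF.const_mul _).intervalIntegrable _ _
  have i2 : IntervalIntegrable (fun α => C * B * X ^ (1 - c) * k (α - β)) volume τ (1 - τ) := (hkI _ _).const_mul _
  calc ∫ α in τ..(1 - τ), F α * ‖TT c X (α - β)‖
      ≤ ∫ α in τ..(1 - τ), (C * X ^ (0.866 : ℝ) * F α + C * B * X ^ (1 - c) * k (α - β)) := by
        refine intervalIntegral.integral_mono_on hτ' ((hF.mul hTc).intervalIntegrable _ _) (i1.add i2) fun α hα => ?_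
        have h1 := H X hX (α - β)
        have h2 : F α * (X ^ (1 - c) * k (α - β)) ≤ B * (X ^ (1 - c) * k (α - β)) := by
          have := hk0 (α - β)
          have := hB α hα.1 hα.2
          gcongr
        calc F α * ‖TT c X (α - β)‖ ≤ F α * (C * (X ^ (0.866 : ℝ) + X ^ (1 - c) * k (α - β))) := by
              refine mul_le_mul_of_nonneg_left ?_ (hF0 α)
              rw [hk, hρ]; exact h1
          _ = C * X ^ (0.866 : ℝ) * F α + C * (F α * (X ^ (1 - c) * k (α - β))) := by ring
          _ ≤ C * X ^ (0.866 : ℝ) * F α + C * (B * (X ^ (1 - c) * k (α - β))) := by gcongr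
          _ = _ := by ring
    _ = C * X ^ (0.866 : ℝ) * (∫ α in τ..(1 - τ), F α) + C * B * X ^ (1 - c) * ∫ α in τ..(1 - τ), k (α - β) := by
        rw [intervalIntegral.integral_add i1 i2, intervalIntegral.integral_const_mul, intervalIntegral.integral_const_mul]
    _ ≤ C * X ^ (0.866 : ℝ) * (40000 * ∫ α in (0 : ℝ)..1, F α) + C * B * X ^ (1 - c) * (40000 * X ^ (0.00021 : ℝ)) := by
        gcongr
        linarith
    _ = _ := by ring

theorem stmt_18 (c : ℝ) (hc1 : 1 < c) (hc2 : c < 4109054 / 1999527) (hc3 : c ≠ 2) :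
    ∃ ε₀ > 0, ∀ ε : ℝ, 0 < ε → ε ≤ ε₀ → ∀ A : ℝ, 0 < A →
      ∃ C > 0, ∃ P₀ : ℝ, ∀ P : ℝ, P₀ ≤ P →
        ∀ τ : ℝ, τ = P ^ (1 - c - ε) →
          ∀ X : ℝ, A⁻¹ * P ^ ((9449 : ℝ) / 10000) ≤ X → X ≤ A * P →
            ∀ β : ℝ,
              (∫ α in τ..(1 - τ), ‖SS c P α‖ ^ 4 * ‖TT c X (α - β)‖)
                ≤ C * (X ^ ((c + 4) / 7 + ε) * (P ^ (4 - c) + P ^ 2) * P ^ ε +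
                    P ^ ((2627349 : ℝ) / 666509 + ε) * X ^ (1 - c)) := by
  have hc2' : c < 2.0551 := hc2.trans (by norm_num)
  obtain ⟨C₁, hC₁, h1⟩ := SS_sup_bound c hc1 hc2' hc3
  obtain ⟨C₂, hC₂, h2⟩ := exists_fourth_moment hc1
  obtain ⟨C₃, hC₃, h3⟩ := exists_integral_mul_TT_le hc1 hc2' hc3
  refine ⟨0.001, by norm_num, fun ε hε hε1 A hA => ?_⟩
  refine ⟨C₃ * (C₂ * A ^ (c - 0.134) + C₁ ^ 4 * A ^ (0.00021 : ℝ)), by positivity, max (2 ^ 200) (A ^ 2), fun P hP τ hτ X hX1 hX2 β => ?_⟩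
  have hP200 : 2 ^ 200 ≤ P := (le_max_left _ _).trans hP
  have hPA : A ^ 2 ≤ P := (le_max_right _ _).trans hP
  have hP1 : 1 ≤ P := le_trans (by norm_num) hP200
  have hP0 : 0 < P := by linarith
  have hX : 1 ≤ X := by
    refine le_trans ?_ hX1
    rw [le_inv_mul_iff₀ hA, mul_one]
    calc A = (A ^ 2) ^ ((1 : ℝ) / 2) := by rw [← Real.sqrt_eq_rpow, Real.sqrt_sq hA.le]
      _ ≤ P ^ ((1 : ℝ) / 2) := rpow_le_rpow (by positivity) hPA (by norm_num)
      _ ≤ _ := rpow_le_rpow_of_exponent_le hP1 (by norm_num)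
  have hX0 : 0 < X := by linarith
  obtain ⟨R, hR⟩ : ∃ R, R = X ^ ((c + 4) / 7 + ε) * (P ^ (4 - c) + P ^ 2) * P ^ ε := ⟨_, rfl⟩
  have hR0 : 0 ≤ R := by rw [hR]; positivity
  rw [← hR]
  have hτ0 : 0 < τ := by rw [hτ]; positivity
  rcases lt_or_ge (1 - τ) τ with hlt | hle
  · rw [intervalIntegral.integral_symm]
    have : 0 ≤ ∫ α in (1 - τ)..τ, ‖SS c P α‖ ^ 4 * ‖TT c X (α - β)‖ :=
      intervalIntegral.integral_nonneg hlt.le fun α _ => by positivity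
    refine (neg_nonpos.2 this).trans (by positivity)
  have hτ3 : P ^ (1 - c - 0.003) ≤ τ := by
    rw [hτ]; exact rpow_le_rpow_of_exponent_le hP1 (by linarith)
  have hcont : Continuous fun α => ‖SS c P α‖ ^ 4 := by
    have := continuous_eC
    unfold SS; fun_prop
  have key := h3 X hX β (fun α => ‖SS c P α‖ ^ 4) hcont (fun α => by positivity) τ ((C₁ * P ^ (1 - 0.0146 : ℝ)) ^ 4) hτ0.le hle
    (fun α ha hb => by
      have := h1 P α hP200 (hτ3.trans ha) (hb.trans (by linarith))
      gcongr)
  refine key.trans ?_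
  obtain ⟨Q, hQ⟩ : ∃ Q, Q = P ^ ((2627349 : ℝ) / 666509 + ε) * X ^ (1 - c) := ⟨_, rfl⟩
  have hQ0 : 0 ≤ Q := by rw [hQ]; positivity
  have b1 : X ^ (0.866 : ℝ) * (∫ α in (0 : ℝ)..1, ‖SS c P α‖ ^ 4) ≤ C₂ * A ^ (c - 0.134) * Q := by
    calc X ^ (0.866 : ℝ) * (∫ α in (0 : ℝ)..1, ‖SS c P α‖ ^ 4)
        ≤ X ^ (0.866 : ℝ) * (C₂ * P ^ (max 2 (4 - c) + 0.0201)) := by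
          have := h2 P hP1
          gcongr
      _ = X ^ (c - 0.134) * X ^ (1 - c) * (C₂ * P ^ (max 2 (4 - c) + 0.0201)) := by
          rw [← rpow_add hX0]; ring_nf
      _ ≤ (A * P) ^ (c - 0.134) * X ^ (1 - c) * (C₂ * P ^ (max 2 (4 - c) + 0.0201)) := by
          gcongr
          linarith
      _ = C₂ * A ^ (c - 0.134) * (P ^ ((c - 0.134) + (max 2 (4 - c) + 0.0201)) * X ^ (1 - c)) := by
          rw [mul_rpow hA.le hP0.le, rpow_add hP0 (c - 0.134)]; ring
      _ ≤ C₂ * A ^ (c - 0.134) * Q := by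
          have hm : max 2 (4 - c) ≤ 3.9418 + 0.134 - 0.0201 - c := max_le (by linarith) (by linarith)
          have := rpow_le_rpow_of_exponent_le hP1 (by linarith :
            (c - 0.134) + (max 2 (4 - c) + 0.0201) ≤ (2627349 : ℝ) / 666509 + ε)
          rw [hQ]
          gcongr _ * (?_ * _)
  have b2 : (C₁ * P ^ (1 - 0.0146 : ℝ)) ^ 4 * (X ^ (1 - c) * X ^ (0.00021 : ℝ)) ≤ C₁ ^ 4 * A ^ (0.00021 : ℝ) * Q := by
    calc (C₁ * P ^ (1 - 0.0146 : ℝ)) ^ 4 * (X ^ (1 - c) * X ^ (0.00021 : ℝ))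
        ≤ (C₁ * P ^ (1 - 0.0146 : ℝ)) ^ 4 * (X ^ (1 - c) * (A * P) ^ (0.00021 : ℝ)) := by gcongr
      _ = C₁ ^ 4 * A ^ (0.00021 : ℝ) * (P ^ ((1 - 0.0146) * (4 : ℕ) + 0.00021 : ℝ) * X ^ (1 - c)) := by
          rw [mul_rpow hA.le hP0.le, rpow_add hP0, rpow_mul hP0.le, rpow_natCast]; ring
      _ ≤ C₁ ^ 4 * A ^ (0.00021 : ℝ) * Q := by
          have := rpow_le_rpow_of_exponent_le hP1 (by push_cast; linarith :
            (1 - 0.0146) * (4 : ℕ) + 0.00021 ≤ (2627349 : ℝ) / 666509 + ε)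
          rw [hQ]
          gcongr _ * (?_ * _)
  rw [← hQ]
  calc _ ≤ C₃ * (C₂ * A ^ (c - 0.134) * Q + C₁ ^ 4 * A ^ (0.00021 : ℝ) * Q) := by gcongr
    _ = C₃ * (C₂ * A ^ (c - 0.134) + C₁ ^ 4 * A ^ (0.00021 : ℝ)) * Q := by ring
    _ ≤ _ := by gcongr; linarith
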